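/- Let K/ℚ be a finite Galois extension of number fields, and let h: ℕ → ℝ be the characteristic function of the set of positive integers all of whose prime factors are rational primes that split completely in K (with h(1) = 1). Then h ∈ 𝓜; that is, h is multiplicative and satisfies all four conditions (i)–(iv) defining the class 𝓜. -/

import Mathlib

open Filter Finset MeasureTheory
open scoped Classical Pointwise

noncomputable section

/-- The set of primes in `[1, x]`. -/
def primesUpTo (x : ℝ) : Finset ℕ := (Finset.Icc 1 ⌊x⌋₊).filter Nat.Prime

/-- The mean value `S_h(x) = (1/x) ∑_{1 ≤ n ≤ x} h(n)`. -/
def Sm (h : ℕ → ℝ) (x : ℝ) : ℝ := (1 / x) * ∑ n ∈ Finset.Icc 1 ⌊x⌋₊, h n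

/-- The mean value `S_h(x; q, a) = (q/x) ∑_{1 ≤ n ≤ x, n ≡ a (q)} h(n)`. -/
def SmAP (h : ℕ → ℝ) (x : ℝ) (q : ℕ) (a : ℤ) : ℝ :=
  ((q : ℝ) / x) * ∑ n ∈ Finset.Icc 1 ⌊x⌋₊,
    if ((n : ℤ) : ZMod q) = (a : ZMod q) then h n else 0

/-- `∏_{p ≤ x, p ∤ q} (1 + |h(p)|/p)`. -/
def ppProd (h : ℕ → ℝ) (x : ℝ) (q : ℕ) : ℝ :=
  ∏ p ∈ (primesUpTo x).filter (fun p => ¬ p ∣ q), (1 + |h p| / p)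

/-- `h` is multiplicative. -/
def MultFn (h : ℕ → ℝ) : Prop :=
  h 1 = 1 ∧ ∀ m n : ℕ, Nat.Coprime m n → h (m * n) = h m * h n

/-- Condition (i) of the class `𝓜`, with explicit constant `H`. -/
def CondI (h : ℕ → ℝ) (H : ℝ) : Prop :=
  1 ≤ H ∧ ∀ p k : ℕ, p.Prime → 1 ≤ k → |h (p ^ k)| ≤ H ^ k

/-- Condition (ii) of the class `𝓜`: `|h(n)| ≪_ε n^ε`. -/
def CondII (h : ℕ → ℝ) : Prop :=
  ∀ ε : ℝ, 0 < ε → ∃ C : ℝ, 0 < C ∧ ∀ n : ℕ, 1 ≤ n → |h n| ≤ C * (n : ℝ) ^ ε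

/-- Condition (iii) of the class `𝓜`, with explicit constant `α`. -/
def CondIII (h : ℕ → ℝ) (α : ℝ) : Prop :=
  0 < α ∧ ∃ x₀ : ℝ, ∀ x ≥ x₀, α ≤ (1 / x) * ∑ p ∈ primesUpTo x, |h p| * Real.log p

/-- Condition (iv) of the class `𝓜`: stability of mean values in progressions. -/
def CondIV (h : ℕ → ℝ) : Prop :=
  ∀ C : ℝ, 0 < C → ∃ φ : ℝ → ℝ, Tendsto φ atTop (nhds 0) ∧
    ∃ K : ℝ, 0 < K ∧ ∃ x₀ : ℝ, ∀ x ≥ x₀, ∀ x' : ℝ, ∀ q : ℕ, ∀ A : ℤ,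
      x * (Real.log x) ^ (-C) < x' → x' < x →
      1 ≤ q → (q : ℝ) < (Real.log x) ^ C → Int.gcd (q : ℤ) A = 1 →
      |SmAP h x' q A - SmAP h x q A| ≤
        K * φ x * ((q : ℝ) / (Nat.totient q : ℝ)) * (1 / Real.log x) * ppProd h x q

/-- The class `𝓜` of multiplicative functions. -/
def MemM (h : ℕ → ℝ) : Prop :=
  MultFn h ∧ (∃ H, CondI h H) ∧ CondII h ∧ (∃ α, CondIII h α) ∧ CondIV h

/-- An admissible choice of the function `w`:
`log log x / log log log x < w(x) ≤ log log x` for all large `x`. -/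
def GoodW (w : ℝ → ℝ) : Prop :=
  ∃ x₀ : ℝ, ∀ x ≥ x₀,
    Real.log (Real.log x) / Real.log (Real.log (Real.log x)) < w x ∧
    w x ≤ Real.log (Real.log x)

/-- `W(x) = ∏_{p ≤ w(x)} p`. -/
def Wprod (w : ℝ → ℝ) (x : ℝ) : ℕ := ∏ p ∈ primesUpTo (w x), p

/-- A rational prime `p` splits completely in `K` if `pO_K` factors into
`[K:ℚ]` distinct prime ideals of the ring of integers `O_K`. -/
def SplitsCompletely (K : Type*) [Field K] [NumberField K] (p : ℕ) : Prop :=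
  ∃ S : Finset (Ideal (NumberField.RingOfIntegers K)),
    S.card = Module.finrank ℚ K ∧ (∀ P ∈ S, P.IsPrime ∧ P ≠ ⊥) ∧
    Ideal.span {((p : ℕ) : NumberField.RingOfIntegers K)} = ∏ P ∈ S, P

namespace S18

lemma factorial_dvd_ap (q a M : ℕ) :
    M.factorial ∣ q ^ M * ∏ m ∈ Finset.Icc 1 M, (a + q * m) := by
  rcases Nat.eq_zero_or_pos q with rfl | hq
  · rcases Nat.eq_zero_or_pos M with rfl | hM
    · simp
    · simp [zero_pow hM.ne']
  rcases Nat.eq_zero_or_pos (∏ m ∈ Finset.Icc 1 M, (a + q * m)) with h0 | hpos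
  · rw [h0]; simp
  rw [← Nat.factorization_prime_le_iff_dvd (Nat.factorial_ne_zero M) (by positivity)]
  intro p hp
  rw [← hp.pow_dvd_iff_le_factorization (by positivity)]
  set v := M.factorial.factorization p with hv
  have hvd : p ^ v ∣ M.factorial := Nat.ordProj_dvd _ _
  by_cases hpq : p ∣ q
  · have : v ≤ M := by
      have h1 := Nat.factorization_factorial_le_div_pred hp M
      exact h1.trans (Nat.div_le_self _ _)
    exact ((pow_dvd_pow p this).trans (pow_dvd_pow_of_dvd hpq M)).mul_right _
  · have hcop : Nat.Coprime q (p ^ v) := ((Nat.Prime.coprime_iff_not_dvd hp).2 hpq).symm.pow_right v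
    apply Dvd.dvd.mul_left
    obtain ⟨c, hc⟩ : ∃ c : ℕ, ((q * c : ℕ) : ZMod (p ^ v)) = 1 := by
      have : NeZero (p ^ v) := ⟨pow_ne_zero _ hp.ne_zero⟩
      refine ⟨((q : ZMod (p ^ v))⁻¹).val, ?_⟩
      rw [Nat.cast_mul, ZMod.natCast_zmod_val, ZMod.coe_mul_inv_eq_one q hcop]
    rw [← ZMod.natCast_eq_zero_iff]
    have h2 : ((∏ m ∈ Finset.Icc 1 M, (a + q * m) : ℕ) : ZMod (p ^ v))
        = (q : ZMod (p ^ v)) ^ M * ((∏ m ∈ Finset.Icc 1 M, (c * a + m) : ℕ) : ZMod (p ^ v)) := by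
      push_cast
      have : (q : ZMod (p ^ v)) ^ M = ∏ m ∈ Finset.Icc 1 M, (q : ZMod (p ^ v)) := by simp
      rw [this, ← Finset.prod_mul_distrib]
      apply Finset.prod_congr rfl
      intro m _
      push_cast at hc
      linear_combination (-(a : ZMod (p ^ v))) * hc
    rw [h2]
    have h3 : ∏ m ∈ Finset.Icc 1 M, (c * a + m) = (c * a + 1).ascFactorial M := by
      have hI : Finset.Icc 1 M = Finset.Ico 1 (M + 1) := by ext; simp
      rw [Nat.ascFactorial_eq_prod_range, hI, Finset.prod_Ico_eq_prod_range]
      simp only [Nat.add_sub_cancel]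
      apply Finset.prod_congr rfl; intros; ring
    have h4 : ((∏ m ∈ Finset.Icc 1 M, (c * a + m) : ℕ) : ZMod (p ^ v)) = 0 := by
      rw [ZMod.natCast_eq_zero_iff, h3]
      exact hvd.trans (Nat.factorial_dvd_ascFactorial _ _)
    rw [h4, mul_zero]

/-- elementary Brun--Titchmarsh substitute -/
lemma bt_basic (q a M : ℕ) (hq : 1 ≤ q) (hM : 1 ≤ M) (S : Finset ℕ)
    (hS : ∀ p ∈ S, p.Prime ∧ M < p ∧ ∃ m ∈ Finset.Icc 1 M, p = a + q * m) :
    ∑ p ∈ S, Real.log p ≤ M * (1 + Real.log (q * (a + q * M : ℕ) / M)) := by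
  obtain ⟨Z, hZ⟩ := factorial_dvd_ap q a M
  set Pi := ∏ m ∈ Finset.Icc 1 M, (a + q * m) with hPi
  have hPipos : 0 < Pi := Finset.prod_pos (by
    intro m hm; have := (Finset.mem_Icc.1 hm).1; positivity)
  have hZpos : 0 < Z := by
    rcases Nat.eq_zero_or_pos Z with rfl | h
    · rw [mul_zero] at hZ
      have : 0 < q ^ M * Pi := by positivity
      omega
    · exact h
  have hdvd : ∏ p ∈ S, p ∣ Z := by
    apply Finset.prod_primes_dvd
    · intro p hp; exact (hS p hp).1.prime
    · intro p hp
      obtain ⟨h1, h2, m, hm, h3⟩ := hS p hp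
      have hd : p ∣ Pi := by
        rw [h3]; exact Finset.dvd_prod_of_mem _ hm
      have hd2 : p ∣ M.factorial * Z := hZ ▸ hd.mul_left _
      rcases (h1.dvd_mul).1 hd2 with h | h
      · rw [h1.dvd_factorial] at h; omega
      · exact h
  have hle : ∏ p ∈ S, p ≤ Z := Nat.le_of_dvd hZpos hdvd
  have hPile : Pi ≤ (a + q * M) ^ M := by
    calc Pi ≤ ∏ m ∈ Finset.Icc 1 M, (a + q * M) := by
          apply Finset.prod_le_prod' ; intro m hm
          have := (Finset.mem_Icc.1 hm).2
          gcongr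
      _ = _ := by simp
  have hX : (0 : ℝ) < (a + q * M : ℕ) := by
    have : 0 < a + q * M := by positivity
    exact_mod_cast this
  have hfac : ((M : ℝ)) ^ M / M.factorial ≤ Real.exp M := Real.pow_div_factorial_le_exp _ (by positivity) M
  have hMpos : (0 : ℝ) < M := by exact_mod_cast hM
  have hqpos : (0 : ℝ) < q := by exact_mod_cast hq
  have hsum : ∑ p ∈ S, Real.log p = Real.log ((∏ p ∈ S, p : ℕ) : ℝ) := by
    push_cast
    rw [Real.log_prod]
    intro p hp; exact_mod_cast (hS p hp).1.ne_zero
  have hprodpos : (0 : ℝ) < ((∏ p ∈ S, p : ℕ) : ℝ) := by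
    have : 0 < ∏ p ∈ S, p := Finset.prod_pos fun p hp => (hS p hp).1.pos
    exact_mod_cast this
  rw [hsum]
  have hZr : (M.factorial : ℝ) * Z ≤ (q : ℝ) ^ M * ((a + q * M : ℕ) : ℝ) ^ M := by
    have : M.factorial * Z ≤ q ^ M * (a + q * M) ^ M := by
      rw [← hZ]; gcongr
    exact_mod_cast this
  have hfp : (0 : ℝ) < M.factorial := by exact_mod_cast Nat.factorial_pos M
  have key : ((∏ p ∈ S, p : ℕ) : ℝ) ≤ Real.exp M * ((q * (a + q * M : ℕ) / M : ℝ)) ^ M := by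
    have h1 : ((∏ p ∈ S, p : ℕ) : ℝ) ≤ Z := by exact_mod_cast hle
    have h2 : (Z : ℝ) ≤ (q : ℝ) ^ M * ((a + q * M : ℕ) : ℝ) ^ M / M.factorial := by
      rw [le_div_iff₀ hfp]; linarith
    refine h1.trans (h2.trans ?_)
    rw [div_pow, mul_pow]
    calc (q : ℝ) ^ M * ((a + q * M : ℕ) : ℝ) ^ M / M.factorial
        = ((M : ℝ) ^ M / M.factorial) * ((q : ℝ) ^ M * ((a + q * M : ℕ) : ℝ) ^ M / (M : ℝ) ^ M) := by
          field_simp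
      _ ≤ _ := by gcongr
  calc Real.log ((∏ p ∈ S, p : ℕ) : ℝ) ≤ Real.log (Real.exp M * ((q * (a + q * M : ℕ) / M : ℝ)) ^ M) :=
        Real.log_le_log hprodpos key
    _ = _ := by
        rw [Real.log_mul (Real.exp_ne_zero _) (by positivity), Real.log_exp, Real.log_pow]
        ring


/-- primes in a short window in a residue class -/
lemma bt_window (q : ℕ) (hq : 1 ≤ q) (b : ZMod q) (y η : ℝ) (hη : 0 < η) (hη' : η ≤ 1 / 4)
    (hy : 4 * q ≤ y) (S : Finset ℕ)
    (hS : ∀ p ∈ S, p.Prime ∧ (p : ZMod q) = b ∧ y * Real.exp (-η) < p ∧ (p : ℝ) ≤ y) :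
    ∑ p ∈ S, Real.log p ≤ (η * y / q + 1) * (1 + Real.log (4 * q ^ 2 / η)) := by
  have hq0 : (1 : ℝ) ≤ q := by exact_mod_cast hq
  have hqp : (0 : ℝ) < q := by linarith
  have : NeZero q := ⟨by omega⟩
  set z := y * Real.exp (-η) with hz
  have hy4 : 4 ≤ y := by linarith
  have he1 : 1 - η ≤ Real.exp (-η) := by
    have := Real.add_one_le_exp (-η); linarith
  have he2 : Real.exp (-η) ≤ 1 - η / 2 := by
    have := Real.exp_bound_div_one_sub_of_interval hη.le (by linarith : η < 1)
    have h1 := Real.add_one_le_exp η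
    rw [Real.exp_neg, inv_le_comm₀ (Real.exp_pos _) (by linarith)]
    refine le_trans ?_ h1
    rw [inv_le_iff_one_le_mul₀ (by linarith)]
    nlinarith
  have hzle : z ≤ y - η * y / 2 := by rw [hz]; nlinarith
  have hzge : y - η * y ≤ z := by rw [hz]; nlinarith
  have hzq : q ≤ z := by nlinarith
  set Nz := ⌊z⌋₊ with hNz
  have hNz1 : (Nz : ℝ) ≤ z := Nat.floor_le (by linarith)
  have hNz2 : z < Nz + 1 := Nat.lt_floor_add_one z
  have hNq : q ≤ Nz := Nat.le_floor hzq
  set r := ((Nz : ZMod q) - b).val with hr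
  have hrq : r < q := ZMod.val_lt _
  set a := Nz - r with ha
  have har : a + r = Nz := by omega
  set M := ⌈(y - z) / q⌉₊ with hM
  have hMpos : 0 < (y - z) / q := div_pos (by nlinarith) hqp
  have hM1 : 1 ≤ M := Nat.ceil_pos.2 hMpos
  have hMge : (y - z) / q ≤ M := Nat.le_ceil _
  have hMle : (M : ℝ) < (y - z) / q + 1 := Nat.ceil_lt_add_one hMpos.le
  have hMle2 : (M : ℝ) ≤ η * y / q + 1 := by
    have : (y - z) / q ≤ η * y / q := by gcongr; linarith
    linarith
  have hbM := bt_basic q a M hq hM1 S ?_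
  · refine hbM.trans ?_
    have hX : ((a + q * M : ℕ) : ℝ) ≤ 2 * y := by
      push_cast
      have h1 : (a : ℝ) ≤ z := by
        have : (a : ℝ) ≤ Nz := by exact_mod_cast (by omega : a ≤ Nz)
        linarith
      have h2 : (q : ℝ) * M ≤ (y - z) + q := by
        have := mul_le_mul_of_nonneg_left hMle.le hqp.le
        rw [mul_add, mul_div_cancel₀ _ hqp.ne'] at this
        linarith
      linarith
    have hMp : (0 : ℝ) < M := by exact_mod_cast hM1
    have hXp : (0 : ℝ) < ((a + q * M : ℕ) : ℝ) := by
      push_cast; positivity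
    have hratio : (q * (a + q * M : ℕ) / M : ℝ) ≤ 4 * q ^ 2 / η := by
      rw [div_le_div_iff₀ hMp hη]
      have h1 : η * y / 2 ≤ M * q := by
        rw [div_le_iff₀ hqp] at hMge; linarith
      have h2 : (q : ℝ) * ((a + q * M : ℕ) : ℝ) * η ≤ q * (2 * y) * η := by gcongr
      nlinarith
    have hlog : Real.log (q * (a + q * M : ℕ) / M : ℝ) ≤ Real.log (4 * q ^ 2 / η) :=
      Real.log_le_log (by positivity) hratio
    have hlog0 : 0 ≤ Real.log (4 * q ^ 2 / η) := by
      apply Real.log_nonneg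
      rw [le_div_iff₀ hη]; nlinarith
    have h3 : 0 ≤ 1 + Real.log (4 * q ^ 2 / η) := by linarith
    calc (M : ℝ) * (1 + Real.log (q * (a + q * M : ℕ) / M : ℝ))
        ≤ M * (1 + Real.log (4 * q ^ 2 / η)) := by gcongr
      _ ≤ _ := by gcongr
  · intro p hp
    obtain ⟨h1, h2, h3, h4⟩ := hS p hp
    have hpN : Nz + 1 ≤ p := by
      have : (Nz : ℝ) < p := lt_of_le_of_lt hNz1 h3
      exact_mod_cast this
    refine ⟨h1, ?_, ?_⟩
    · have : (M : ℝ) < p := by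
        have : η * y / q ≤ y / 4 := by
          rw [div_le_iff₀ hqp]
          nlinarith
        have : η * y ≤ y / 4 := by nlinarith
        linarith
      exact_mod_cast this
    · have hmod : ((p - a : ℕ) : ZMod q) = 0 := by
        rw [Nat.cast_sub (by omega), h2]
        have : ((a + r : ℕ) : ZMod q) = Nz := by rw [har]
        rw [Nat.cast_add, hr, ZMod.natCast_zmod_val] at this
        linear_combination -this
      rw [ZMod.natCast_eq_zero_iff] at hmod
      obtain ⟨m, hm⟩ := hmod
      have hpa : p = a + q * m := by omega
      refine ⟨m, Finset.mem_Icc.2 ⟨?_, ?_⟩, hpa⟩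
      · by_contra hcon
        have : m = 0 := by omega
        subst this; omega
      · have h5 : (Nz : ℝ) < a + q := by exact_mod_cast (by omega : Nz < a + q)
        have h6 : (Nz : ℝ) + 1 ≤ a + q := by exact_mod_cast (by omega : Nz + 1 ≤ a + q)
        have h7 : (p : ℝ) = a + q * m := by exact_mod_cast hpa
        have h8 : (m : ℝ) < M + 1 := by
          have : (q : ℝ) * m < y - z + q := by linarith
          have h9 : (m : ℝ) < (y - z) / q + 1 := by
            rw [← sub_lt_iff_lt_add, lt_div_iff₀ hqp]; linarith
          linarith
        have : m < M + 1 := by exact_mod_cast h8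
        omega

/-- primes up to `u` in a residue class -/
lemma bt_theta (q : ℕ) (hq : 1 ≤ q) (b : ZMod q) (u : ℝ) (hu : q ≤ u) (S : Finset ℕ)
    (hS : ∀ p ∈ S, p.Prime ∧ (p : ZMod q) = b ∧ q < p ∧ (p : ℝ) ≤ u) :
    ∑ p ∈ S, Real.log p ≤ 2 * (u / q) * (4 + 2 * Real.log q) := by
  have hq0 : (1 : ℝ) ≤ q := by exact_mod_cast hq
  have hqp : (0 : ℝ) < q := by linarith
  have : NeZero q := ⟨by omega⟩
  set a := b.val with ha
  have haq : a < q := ZMod.val_lt _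
  set M := ⌈u / q⌉₊ with hM
  have hup : 0 < u := by linarith
  have hMge : u / q ≤ M := Nat.le_ceil _
  have hMle : (M : ℝ) < u / q + 1 := Nat.ceil_lt_add_one (by positivity)
  have huq : 1 ≤ u / q := by rw [le_div_iff₀ hqp]; linarith
  have hM1 : 1 ≤ M := Nat.ceil_pos.2 (by positivity)
  have hMp : (0 : ℝ) < M := by exact_mod_cast hM1
  rw [← Finset.sum_filter_add_sum_filter_not S (fun p => p ≤ M)]
  have hsmall : ∑ p ∈ S.filter (fun p => p ≤ M), Real.log p ≤ Real.log 4 * M := by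
    have h1 := Chebyshev.theta_le_log4_mul_x (x := (M : ℝ)) hMp.le
    refine le_trans ?_ h1
    rw [Chebyshev.theta, Nat.floor_natCast]
    apply Finset.sum_le_sum_of_subset_of_nonneg
    · intro p hp
      rw [Finset.mem_filter] at hp
      have := (hS p hp.1).1
      simp [this, this.pos, hp.2]
    · intro p _ _
      exact Real.log_natCast_nonneg p
  have hbig := bt_basic q a M hq hM1 (S.filter (fun p => ¬ p ≤ M)) ?_
  · have hX : ((a + q * M : ℕ) : ℝ) ≤ 3 * u := by
      push_cast
      have h1 : (a : ℝ) ≤ q := by exact_mod_cast haq.le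
      have h2 : (q : ℝ) * M ≤ u + q := by
        have := mul_le_mul_of_nonneg_left hMle.le hqp.le
        rw [mul_add, mul_div_cancel₀ _ hqp.ne'] at this
        linarith
      linarith
    have hratio : (q * (a + q * M : ℕ) / M : ℝ) ≤ 3 * q ^ 2 := by
      rw [div_le_iff₀ hMp]
      rw [div_le_iff₀ hqp] at hMge
      have h2 : (q : ℝ) * ((a + q * M : ℕ) : ℝ) ≤ q * (3 * u) := by gcongr
      nlinarith
    have hXp : (0 : ℝ) < ((a + q * M : ℕ) : ℝ) := by push_cast; positivity
    have hlog : Real.log (q * (a + q * M : ℕ) / M : ℝ) ≤ Real.log 3 + 2 * Real.log q := by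
      have := Real.log_le_log (by positivity) hratio
      rw [Real.log_mul (by norm_num) (by positivity), Real.log_pow] at this
      exact_mod_cast this
    have h3 : Real.log 3 ≤ 1.2 := by
      rw [Real.log_le_iff_le_exp (by norm_num)]
      have h := Real.exp_one_gt_d9
      have h' := Real.add_one_le_exp (0.2 : ℝ)
      have : Real.exp 1.2 = Real.exp 1 * Real.exp 0.2 := by rw [← Real.exp_add]; norm_num
      nlinarith [Real.exp_pos 1]
    have h4 : Real.log 4 ≤ 1.4 := by
      have : Real.log 4 = 2 * Real.log 2 := by
        rw [show (4 : ℝ) = 2 ^ 2 by norm_num, Real.log_pow]; norm_num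
      rw [this]; have := Real.log_two_lt_d9; linarith
    have hlq : 0 ≤ Real.log q := Real.log_nonneg hq0
    have hM2 : (M : ℝ) ≤ 2 * (u / q) := by linarith
    calc _ ≤ Real.log 4 * M + M * (1 + Real.log (q * (a + q * M : ℕ) / M : ℝ)) := add_le_add hsmall hbig
      _ ≤ 1.4 * M + M * (1 + (1.2 + 2 * Real.log q)) := by gcongr; linarith
      _ = M * (3.6 + 2 * Real.log q) := by ring
      _ ≤ (2 * (u / q)) * (4 + 2 * Real.log q) := by gcongr; norm_num
  · intro p hp
    rw [Finset.mem_filter] at hp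
    obtain ⟨h1, h2, h3, h4⟩ := hS p hp.1
    refine ⟨h1, by omega, ?_⟩
    have hmod : ((p - a : ℕ) : ZMod q) = 0 := by
      rw [Nat.cast_sub (by omega), h2, ha, ZMod.natCast_zmod_val, sub_self]
    rw [ZMod.natCast_eq_zero_iff] at hmod
    obtain ⟨m, hm⟩ := hmod
    have hpa : p = a + q * m := by omega
    refine ⟨m, Finset.mem_Icc.2 ⟨?_, ?_⟩, hpa⟩
    · by_contra hcon
      have : m = 0 := by omega
      subst this; omega
    · have h7 : (p : ℝ) = a + q * m := by exact_mod_cast hpa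
      have : (m : ℝ) ≤ M := by
        refine le_trans ?_ hMge
        rw [le_div_iff₀ hqp]
        have : (0 : ℝ) ≤ a := by positivity
        linarith
      exact_mod_cast this

end S18

namespace S18
open Complex in
lemma integrable_exp_neg_abs (c : ℝ) (hc : 0 < c) (w : ℝ) :
    Integrable (fun v : ℝ => cexp ((w * I : ℂ) * v) * (Real.exp (-c * |v|) : ℂ)) := by
  rw [← integrableOn_univ, ← Set.Iic_union_Ioi (a := (0 : ℝ))]
  apply IntegrableOn.union
  · have := integrableOn_exp_mul_complex_Iic (a := (w * I + c : ℂ)) (by simpa using hc) 0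
    refine this.congr_fun ?_ measurableSet_Iic
    intro v hv
    simp only [Set.mem_Iic] at hv
    simp only [abs_of_nonpos hv, ofReal_exp, ← Complex.exp_add]
    congr 1; push_cast; ring
  · have := integrableOn_exp_mul_complex_Ioi (a := (w * I - c : ℂ)) (by simpa using hc) 0
    refine this.congr_fun ?_ measurableSet_Ioi
    intro v hv
    simp only [Set.mem_Ioi] at hv
    simp only [abs_of_pos hv, ofReal_exp, ← Complex.exp_add]
    congr 1; push_cast; ring

open Complex in
lemma integral_exp_neg_abs (c : ℝ) (hc : 0 < c) (w : ℝ) :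
    ∫ v : ℝ, cexp ((w * I : ℂ) * v) * (Real.exp (-c * |v|) : ℂ) = ((2 * c / (c ^ 2 + w ^ 2) : ℝ) : ℂ) := by
  have hIntg := integrable_exp_neg_abs c hc w
  rw [← intervalIntegral.integral_Iic_add_Ioi (b := 0) hIntg.integrableOn hIntg.integrableOn]
  have h1 : ∫ v : ℝ in Set.Iic 0, cexp ((w * I : ℂ) * v) * (Real.exp (-c * |v|) : ℂ)
      = ∫ v : ℝ in Set.Iic 0, cexp ((w * I + c : ℂ) * v) := by
    apply setIntegral_congr_fun measurableSet_Iic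
    intro v hv
    simp only [Set.mem_Iic] at hv
    simp only [abs_of_nonpos hv, ofReal_exp, ← Complex.exp_add]
    congr 1; push_cast; ring
  have h2 : ∫ v : ℝ in Set.Ioi 0, cexp ((w * I : ℂ) * v) * (Real.exp (-c * |v|) : ℂ)
      = ∫ v : ℝ in Set.Ioi 0, cexp ((w * I - c : ℂ) * v) := by
    apply setIntegral_congr_fun measurableSet_Ioi
    intro v hv
    simp only [Set.mem_Ioi] at hv
    simp only [abs_of_pos hv, ofReal_exp, ← Complex.exp_add]
    congr 1; push_cast; ring
  rw [h1, h2, integral_exp_mul_complex_Iic (by simpa using hc), integral_exp_mul_complex_Ioi (by simpa using hc)]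
  have hn1 : (w * I + c : ℂ) ≠ 0 := by
    intro h; have := congrArg re h; simp at this; exact hc.ne' this
  have hn2 : (w * I - c : ℂ) ≠ 0 := by
    intro h; have := congrArg re h; simp at this; exact hc.ne' this
  have hn3 : ((c : ℂ) ^ 2 + (w : ℂ) ^ 2) ≠ 0 := by
    have : c ^ 2 + w ^ 2 ≠ 0 := by positivity
    exact_mod_cast this
  push_cast
  simp only [mul_zero, Complex.exp_zero]
  field_simp
  linear_combination (-2 * c * w ^ 2 : ℂ) * I_sq

lemma integrable_lorentz (c : ℝ) (hc : 0 < c) : Integrable (fun t : ℝ => 1 / (c ^ 2 + t ^ 2)) := by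
  have h := integrable_inv_one_add_sq.comp_div hc.ne'
  have h2 := h.const_mul (1 / c ^ 2)
  refine h2.congr (ae_of_all _ fun t => ?_)
  simp only
  field_simp

open Complex in
lemma lorentz_kernel (c : ℝ) (hc : 0 < c) (d : ℝ) :
    ∫ t : ℝ, cexp ((d * I : ℂ) * t) * ((1 / (c ^ 2 + t ^ 2) : ℝ) : ℂ)
      = ((2 * Real.pi) * (Real.exp (-c * |d|) / (2 * c)) : ℝ) := by
  set f : ℝ → ℂ := fun v => (Real.exp (-c * |v|) : ℂ) with hf
  have hfc : Continuous f := by fun_prop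
  have hfi : Integrable f := by
    have := integrable_exp_neg_abs c hc 0
    refine this.congr (ae_of_all _ fun v => ?_)
    simp [hf]
  have hF : FourierTransform.fourier f = fun w : ℝ => ((2 * c / (c ^ 2 + (-2 * Real.pi * w) ^ 2) : ℝ) : ℂ) := by
    funext w
    rw [Real.fourier_eq', ← integral_exp_neg_abs c hc]
    apply integral_congr_ae (ae_of_all _ fun v => ?_)
    simp only [smul_eq_mul, hf]
    congr 2
    simp only [RCLike.inner_apply, conj_trivial]
    push_cast; ring
  have hFi : Integrable (FourierTransform.fourier f) := by
    rw [hF]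
    have h := (integrable_lorentz c hc).comp_mul_left' (R := -2 * Real.pi) (by simp [Real.pi_ne_zero])
    have h2 := (h.const_mul (2 * c)).ofReal (𝕜 := ℂ)
    refine h2.congr (ae_of_all _ fun t => ?_)
    simp only [mul_one_div]
    rfl
  have hinv := congrFun (hfc.fourierInv_fourier_eq hfi hFi) d
  rw [Real.fourierInv_eq', hF] at hinv
  have hcv := Measure.integral_comp_mul_left (fun t : ℝ => cexp ((d * I : ℂ) * t) * ((1 / (c ^ 2 + t ^ 2) : ℝ) : ℂ)) (2 * Real.pi)
  have h3 : ∫ x : ℝ, (fun t : ℝ => cexp ((d * I : ℂ) * t) * ((1 / (c ^ 2 + t ^ 2) : ℝ) : ℂ)) (2 * Real.pi * x)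
      = (1 / (2 * c) : ℂ) * f d := by
    rw [← hinv, ← integral_const_mul]
    apply integral_congr_ae (ae_of_all _ fun v => ?_)
    have hc' : (c : ℂ) ≠ 0 := by exact_mod_cast hc.ne'
    simp only [smul_eq_mul, RCLike.inner_apply, conj_trivial]
    have : ((d * I : ℂ) * (2 * Real.pi * v : ℝ)) = ((2 * Real.pi * (d * v) : ℝ) : ℂ) * I := by
      push_cast; ring
    rw [this]
    push_cast
    field_simp
  have hpi := Real.pi_pos
  rw [h3, abs_of_pos (by positivity), real_smul] at hcv
  have : ∫ t : ℝ, cexp ((d * I : ℂ) * t) * ((1 / (c ^ 2 + t ^ 2) : ℝ) : ℂ) = (2 * Real.pi : ℝ) * ((1 / (2 * c) : ℂ) * f d) := by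
    rw [hcv]
    push_cast
    have : (Real.pi : ℂ) ≠ 0 := by exact_mod_cast hpi.ne'
    field_simp
  rw [this, hf]
  push_cast
  ring

lemma integrable_tsum_aux {ι : Type*} [Countable ι] {F : ι → ℝ → ℂ}
    (hF_int : ∀ i : ι, Integrable (F i)) (hF_sum : Summable fun i ↦ ∫ a, ‖F i a‖)
    (hp : ∀ t, Summable (fun i => F i t)) :
    Integrable (fun t => ∑' i, F i t) := by
  refine ⟨?_, ?_⟩
  · apply aestronglyMeasurable_of_tendsto_ae (u := (atTop : Filter (Finset ι)))
      (f := fun s t => ∑ i ∈ s, F i t)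
    · intro s
      exact (integrable_finsetSum s fun i _ => hF_int i).1
    · exact ae_of_all _ fun t => (hp t).hasSum
  · have h1 : ∫⁻ t, ‖∑' i, F i t‖ₑ ≤ ∫⁻ t, ∑' i, ‖F i t‖ₑ :=
      lintegral_mono fun t => enorm_tsum_le_tsum_enorm
    refine lt_of_le_of_lt h1 ?_
    rw [lintegral_tsum fun i => (hF_int i).1.enorm]
    have h2 : ∀ i, ∫⁻ t, ‖F i t‖ₑ = ENNReal.ofReal (∫ a, ‖F i a‖) := fun i =>
      (ofReal_integral_norm_eq_lintegral_enorm (hF_int i)).symm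
    simp_rw [h2]
    exact hF_sum.tsum_ofReal_lt_top

set_option maxHeartbeats 1000000 in
open Complex in
/-- Plancherel for step functions (sums over countable sets) -/
lemma plancherel_step {ι : Type*} [Countable ι] (a : ι → ℂ) (μ : ι → ℝ) (c : ℝ) (hc : 0 < c)
    (hs : Summable (fun i => ‖a i‖ * Real.exp (-c * μ i))) :
    Integrable (fun v : ℝ => ‖∑' i, (if μ i ≤ v then a i else 0)‖ ^ 2 * Real.exp (-2 * c * v)) ∧
    Integrable (fun t : ℝ => ‖∑' i, a i * cexp (-(c + t * I) * μ i)‖ ^ 2 * (1 / (c ^ 2 + t ^ 2))) ∧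
    (2 * Real.pi) * ∫ v : ℝ, ‖∑' i, (if μ i ≤ v then a i else 0)‖ ^ 2 * Real.exp (-2 * c * v)
      = ∫ t : ℝ, ‖∑' i, a i * cexp (-(c + t * I) * μ i)‖ ^ 2 * (1 / (c ^ 2 + t ^ 2)) := by
  set α : ι → ℂ := fun i => a i * Real.exp (-c * μ i) with hα
  have hαn : ∀ i, ‖α i‖ = ‖a i‖ * Real.exp (-c * μ i) := fun i => by
    rw [hα]; simp only [norm_mul, norm_real, Real.norm_eq_abs, Real.abs_exp]
  have hsα : Summable (fun i => ‖α i‖) := by simpa only [hαn] using hs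
  have hsprod : Summable (fun z : ι × ι => ‖α z.1‖ * ‖α z.2‖) :=
    hsα.mul_of_nonneg hsα (fun _ => norm_nonneg _) (fun _ => norm_nonneg _)
  -- right side
  set R : ι × ι → ℝ → ℂ := fun z t => (α z.1 * (starRingEnd ℂ) (α z.2)) *
    (cexp (((μ z.2 - μ z.1 : ℝ) * I : ℂ) * t) * ((1 / (c ^ 2 + t ^ 2) : ℝ) : ℂ)) with hR
  have hexpn : ∀ (d t : ℝ), ‖cexp ((d * I : ℂ) * t)‖ = 1 := fun d t => by
    rw [show (d * I : ℂ) * t = ((d * t : ℝ) : ℂ) * I by push_cast; ring, norm_exp_ofReal_mul_I]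
  have hRint : ∀ z, Integrable (R z) := by
    intro z
    apply Integrable.const_mul
    refine (integrable_lorentz c hc).mono ?_ (ae_of_all _ fun t => ?_)
    · apply Continuous.aestronglyMeasurable
      have : ∀ t : ℝ, c ^ 2 + t ^ 2 ≠ 0 := fun t => by positivity
      fun_prop (disch := assumption)
    · rw [norm_mul, hexpn, one_mul, norm_real]
  have hRn : ∀ z t, ‖R z t‖ = (‖α z.1‖ * ‖α z.2‖) * (1 / (c ^ 2 + t ^ 2)) := by
    intro z t
    rw [hR]
    simp only [norm_mul, hexpn, one_mul, RCLike.norm_conj, norm_real, Real.norm_eq_abs]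
    rw [abs_of_pos (by positivity)]
  have hRsum : Summable (fun z => ∫ t, ‖R z t‖) := by
    simp_rw [hRn, integral_const_mul]
    exact hsprod.mul_right _
  have hRp : ∀ t, Summable (fun z => R z t) := by
    intro t
    apply Summable.of_norm
    simp_rw [hRn]
    exact hsprod.mul_right _
  have hRt : ∀ t : ℝ, ((‖∑' i, a i * cexp (-(c + t * I) * μ i)‖ ^ 2 * (1 / (c ^ 2 + t ^ 2)) : ℝ) : ℂ)
      = ∑' z, R z t := by
    intro t
    have e1 : ∀ i, a i * cexp (-(c + t * I) * μ i) = α i * cexp (((-μ i : ℝ) * I : ℂ) * t) := by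
      intro i
      rw [hα]; simp only [ofReal_exp]
      rw [mul_assoc, ← Complex.exp_add]
      congr 2; push_cast; ring
    have hs1 : Summable (fun i => ‖α i * cexp (((-μ i : ℝ) * I : ℂ) * t)‖) := by
      simpa only [norm_mul, hexpn, mul_one] using hsα
    simp_rw [e1]
    rw [ofReal_mul, ofReal_pow, ← mul_conj', conj_tsum,
      tsum_mul_tsum_of_summable_norm hs1 (by simpa only [RCLike.norm_conj] using hs1), ← tsum_mul_right]
    congr 1; funext z
    rw [hR]
    simp only [map_mul, ← Complex.exp_conj, conj_ofReal, conj_I]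
    have : cexp (((μ z.2 - μ z.1 : ℝ) * I : ℂ) * t) = cexp (((-μ z.1 : ℝ) * I : ℂ) * t) * cexp (((-μ z.2 : ℝ) * -I : ℂ) * t) := by
      rw [← Complex.exp_add]; congr 1; push_cast; ring
    rw [this]; ring
  -- left side
  set Lf : ι × ι → ℝ → ℂ := fun z => Set.indicator (Set.Ici (max (μ z.1) (μ z.2)))
    (fun v : ℝ => (a z.1 * (starRingEnd ℂ) (a z.2)) * (Real.exp ((-2 * c) * v) : ℂ)) with hL
  have hExpInt : ∀ m : ℝ, IntegrableOn (fun v => Real.exp ((-2 * c) * v)) (Set.Ici m) := fun m =>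
by
    rw [integrableOn_Ici_iff_integrableOn_Ioi]
    exact integrableOn_exp_mul_Ioi (by linarith) m
  have hExpVal : ∀ m : ℝ, ∫ v in Set.Ici m, Real.exp ((-2 * c) * v) = Real.exp (-2 * c * m) / (2 * c) := fun m => by
    rw [integral_Ici_eq_integral_Ioi, integral_exp_mul_Ioi (by linarith)]
    rw [neg_mul, div_neg, neg_div, neg_neg]
  have hLint : ∀ z, Integrable (Lf z) := by
    intro z
    rw [hL, integrable_indicator_iff measurableSet_Ici]
    exact ((hExpInt _).ofReal (𝕜 := ℂ)).const_mul _
  have hLn : ∀ z v, ‖Lf z v‖ = (‖a z.1‖ * ‖a z.2‖) *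
      (Set.indicator (Set.Ici (max (μ z.1) (μ z.2))) (fun v => Real.exp ((-2 * c) * v)) v) := by
    intro z v
    rw [hL]
    simp only [Set.indicator]
    split_ifs
    · simp only [norm_mul, RCLike.norm_conj, norm_real, Real.norm_eq_abs, Real.abs_exp]
    · simp
  have hmax : ∀ z : ι × ι, Real.exp (-2 * c * max (μ z.1) (μ z.2)) =
      Real.exp (-c * μ z.1) * Real.exp (-c * μ z.2) * Real.exp (-c * |μ z.2 - μ z.1|) := by
    intro z
    rw [← Real.exp_add, ← Real.exp_add]
    congr 1
    rcases le_total (μ z.1) (μ z.2) with h | h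
    · rw [max_eq_right h, abs_of_nonneg (by linarith)]; ring
    · rw [max_eq_left h, abs_of_nonpos (by linarith)]; ring
  have hLnI : ∀ z, ∫ v, ‖Lf z v‖ = (‖a z.1‖ * ‖a z.2‖) * (Real.exp (-2 * c * max (μ z.1) (μ z.2)) / (2 * c)) := by
    intro z
    simp_rw [hLn]
    rw [integral_const_mul, integral_indicator measurableSet_Ici, hExpVal]
  have hLsum : Summable (fun z => ∫ v, ‖Lf z v‖) := by
    simp_rw [hLnI]
    refine Summable.of_nonneg_of_le (fun z => by positivity) (fun z => ?_) (hsprod.mul_right (1 / (2 * c)))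
    rw [hαn, hαn, hmax]
    have : Real.exp (-c * |μ z.2 - μ z.1|) ≤ 1 := by
      rw [Real.exp_le_one_iff]; nlinarith [abs_nonneg (μ z.2 - μ z.1)]
    calc ‖a z.1‖ * ‖a z.2‖ * (Real.exp (-c * μ z.1) * Real.exp (-c * μ z.2) * Real.exp (-c * |μ z.2 - μ z.1|) / (2 * c))
        ≤ ‖a z.1‖ * ‖a z.2‖ * (Real.exp (-c * μ z.1) * Real.exp (-c * μ z.2) * 1 / (2 * c)) := by gcongr
      _ = _ := by ring
  have hS : ∀ v, Summable (fun i => ‖if μ i ≤ v then a i else 0‖) := by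
    intro v
    refine Summable.of_nonneg_of_le (fun i => norm_nonneg _) (fun i => ?_) (hs.mul_right (Real.exp (c * v)))
    split_ifs with h
    · rw [mul_assoc, ← Real.exp_add]
      have : 1 ≤ Real.exp (-c * μ i + c * v) := Real.one_le_exp (by nlinarith)
      nlinarith [norm_nonneg (a i)]
    · simp only [norm_zero]; positivity
  have hLe : ∀ z v, Lf z v = (if μ z.1 ≤ v then a z.1 else 0) * (starRingEnd ℂ) (if μ z.2 ≤ v then a z.2 else 0)
      * (Real.exp ((-2 * c) * v) : ℂ) := by
    intro z v
    rw [hL]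
    simp only [Set.indicator, Set.mem_Ici, max_le_iff]
    by_cases h1 : μ z.1 ≤ v <;> by_cases h2 : μ z.2 ≤ v <;> simp [h1, h2]
  have hSS : ∀ v, Summable (fun z : ι × ι => (if μ z.1 ≤ v then a z.1 else 0) * (starRingEnd ℂ) (if μ z.2 ≤ v then a z.2 else 0)) := by
    intro v
    have h2 : Summable (fun i => ‖(starRingEnd ℂ) (if μ i ≤ v then a i else 0)‖) := by
      simpa only [RCLike.norm_conj] using hS v
    exact summable_mul_of_summable_norm (f := fun i => (if μ i ≤ v then a i else 0))
      (g := fun i => (starRingEnd ℂ) (if μ i ≤ v then a i else 0)) (hS v) h2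
  have hLp : ∀ v, Summable (fun z => Lf z v) := by
    intro v
    simp_rw [hLe]
    exact (hSS v).mul_right _
  have hLt : ∀ v : ℝ, ((‖∑' i, (if μ i ≤ v then a i else 0)‖ ^ 2 * Real.exp (-2 * c * v) : ℝ) : ℂ) = ∑' z, Lf z v := by
    intro v
    simp_rw [hLe]
    rw [ofReal_mul, ofReal_pow, ← mul_conj', conj_tsum, tsum_mul_right,
      tsum_mul_tsum_of_summable_norm (hS v) (by simpa only [RCLike.norm_conj] using hS v)]
  have hI1 : Integrable (fun v => ∑' z, Lf z v) := integrable_tsum_aux hLint hLsum hLp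
  have hI2 : Integrable (fun v => ∑' z, R z v) := integrable_tsum_aux hRint hRsum hRp
  refine ⟨?_, ?_, ?_⟩
  · rw [← integrable_norm_iff hI1.1] at hI1
    refine hI1.congr (ae_of_all _ fun v => ?_)
    simp only
    rw [← hLt, norm_real, Real.norm_eq_abs, abs_of_nonneg (by positivity)]
  · rw [← integrable_norm_iff hI2.1] at hI2
    refine hI2.congr (ae_of_all _ fun v => ?_)
    simp only
    rw [← hRt, norm_real, Real.norm_eq_abs, abs_of_nonneg (by positivity)]
  · have h1 := hasSum_integral_of_summable_integral_norm hLint hLsum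
    have h2 := hasSum_integral_of_summable_integral_norm hRint hRsum
    simp_rw [← hLt] at h1
    simp_rw [← hRt] at h2
    rw [integral_complex_ofReal] at h1 h2
    have h3 := h1.mul_left (2 * Real.pi : ℂ)
    have : ∀ z, (2 * Real.pi : ℂ) * ∫ v, Lf z v = ∫ t, R z t := by
      intro z
      rw [hL, hR]
      simp only
      rw [integral_const_mul, lorentz_kernel c hc, integral_indicator measurableSet_Ici, integral_const_mul,
        integral_complex_ofReal, hExpVal, hmax, hα]
      simp only [map_mul, conj_ofReal]
      push_cast
      ring
    simp_rw [this] at h3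
    have h4 := h3.unique h2
    exact_mod_cast h4
end S18

namespace S18

open Complex in
lemma parseval_chars (q : ℕ) [NeZero q] (f : ZMod q → ℂ) :
    ∑ χ : DirichletCharacter ℂ q, ‖∑ b : ZMod q, χ b * f b‖ ^ 2
      = q.totient * ∑ b ∈ (Finset.univ : Finset (ZMod q)).filter IsUnit, ‖f b‖ ^ 2 := by
  have key : ∀ χ : DirichletCharacter ℂ q, ((‖∑ b : ZMod q, χ b * f b‖ ^ 2 : ℝ) : ℂ)
      = ∑ a ∈ (Finset.univ : Finset (ZMod q)).filter IsUnit, ∑ b : ZMod q,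
        (χ a⁻¹ * χ b) * ((starRingEnd ℂ) (f a) * f b) := by
    intro χ
    rw [ofReal_pow, ← conj_mul', map_sum, Finset.sum_mul_sum, Finset.sum_filter]
    apply Finset.sum_congr rfl
    intro a _
    split_ifs with ha
    · apply Finset.sum_congr rfl
      intro b _
      have : (starRingEnd ℂ) (χ a) = χ a⁻¹ := by
        have h1 := MulChar.star_apply' χ a
        rw [MulChar.inv_apply] at h1
        obtain ⟨u, rfl⟩ := ha
        rw [Ring.inverse_unit] at h1
        rw [ZMod.inv_coe_unit]
        exact h1
      rw [map_mul, this]; ring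
    · simp [MulChar.map_nonunit χ ha]
  have : ((∑ χ : DirichletCharacter ℂ q, ‖∑ b : ZMod q, χ b * f b‖ ^ 2 : ℝ) : ℂ)
      = ((q.totient * ∑ b ∈ (Finset.univ : Finset (ZMod q)).filter IsUnit, ‖f b‖ ^ 2 : ℝ) : ℂ) := by
    rw [ofReal_sum]
    simp_rw [key]
    rw [Finset.sum_comm, ofReal_mul, ofReal_sum, Finset.mul_sum]
    apply Finset.sum_congr rfl
    intro a ha
    rw [Finset.sum_comm]
    simp_rw [← Finset.sum_mul]
    simp_rw [DirichletCharacter.sum_char_inv_mul_char_eq ℂ (Finset.mem_filter.1 ha).2]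
    simp only [ite_mul, zero_mul, Finset.sum_ite_eq, Finset.mem_univ, if_true]
    rw [conj_mul']; push_cast; ring
  exact_mod_cast this

lemma count_ap (q : ℕ) (hq : 1 ≤ q) (b : ZMod q) (z u : ℝ) (hz : 0 ≤ z) (hzu : z ≤ u) :
    (((Finset.Ioc ⌊z⌋₊ ⌊u⌋₊).filter (fun n : ℕ => (n : ZMod q) = b)).card : ℝ) ≤ (u - z) / q + 2 := by
  have : NeZero q := ⟨by omega⟩
  have hq0 : (1 : ℝ) ≤ q := by exact_mod_cast hq
  have hqp : (0 : ℝ) < q := by linarith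
  have e : (Finset.Ioc ⌊z⌋₊ ⌊u⌋₊).filter (fun n : ℕ => (n : ZMod q) = b)
      = (Finset.Ioc ⌊z⌋₊ ⌊u⌋₊).filter (fun n : ℕ => n ≡ b.val [MOD q]) := by
    apply Finset.filter_congr
    intro n _
    rw [← ZMod.natCast_eq_natCast_iff, ZMod.natCast_zmod_val]
  rw [e]
  have h := Nat.Ioc_filter_modEq_card ⌊z⌋₊ ⌊u⌋₊ (show 0 < q by omega) b.val
  have hR : (((Finset.Ioc ⌊z⌋₊ ⌊u⌋₊).filter (fun n : ℕ => n ≡ b.val [MOD q])).card : ℝ)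
      = ((max (⌊((⌊u⌋₊ : ℚ) - b.val) / q⌋ - ⌊((⌊z⌋₊ : ℚ) - b.val) / q⌋) 0 : ℤ) : ℝ) := by
    exact_mod_cast h
  rw [hR, Int.cast_max, Int.cast_sub, Int.cast_zero]
  have h1 : ((⌊((⌊u⌋₊ : ℚ) - b.val) / q⌋ : ℤ) : ℝ) ≤ ((⌊u⌋₊ : ℝ) - b.val) / q := by
    have := Int.floor_le (((⌊u⌋₊ : ℚ) - b.val) / q)
    exact_mod_cast (by exact_mod_cast this : (((⌊((⌊u⌋₊ : ℚ) - b.val) / q⌋ : ℤ) : ℚ) : ℝ) ≤ ((((⌊u⌋₊ : ℚ) - b.val) / q : ℚ) : ℝ))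
  have h2 : ((⌊z⌋₊ : ℝ) - b.val) / q < ((⌊((⌊z⌋₊ : ℚ) - b.val) / q⌋ : ℤ) : ℝ) + 1 := by
    have := Int.lt_floor_add_one (((⌊z⌋₊ : ℚ) - b.val) / q)
    exact_mod_cast (by exact_mod_cast this : ((((⌊z⌋₊ : ℚ) - b.val) / q : ℚ) : ℝ) < (((⌊((⌊z⌋₊ : ℚ) - b.val) / q⌋ : ℤ) : ℚ) : ℝ) + 1)
  have h3 : (⌊u⌋₊ : ℝ) ≤ u := Nat.floor_le (by linarith)
  have h4 : z < ⌊z⌋₊ + 1 := Nat.lt_floor_add_one z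
  apply max_le
  · have h5 : ((⌊u⌋₊ : ℝ) - b.val) / q - ((⌊z⌋₊ : ℝ) - b.val) / q ≤ (u - z) / q + 1 := by
      rw [← sub_div, div_add_one hqp.ne']
      gcongr; linarith
    linarith
  · have : 0 ≤ (u - z) / q := div_nonneg (by linarith) hqp.le
    linarith

/-- residue class mod `q` and divisible by `d`. -/
lemma count_ap_dvd (q : ℕ) (hq : 1 ≤ q) (b : ZMod q) (hb : IsUnit b) (d : ℕ) (hd : 1 ≤ d) (u : ℝ) (hu : 0 ≤ u) :
    (((Finset.Icc 1 ⌊u⌋₊).filter (fun n : ℕ => (n : ZMod q) = b ∧ d ∣ n)).card : ℝ) ≤ u / (d * q) + 2 := by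
  have hdp : (0 : ℝ) < d := by exact_mod_cast hd
  have hqp : (0 : ℝ) < q := by exact_mod_cast hq
  rcases Finset.eq_empty_or_nonempty ((Finset.Icc 1 ⌊u⌋₊).filter (fun n : ℕ => (n : ZMod q) = b ∧ d ∣ n)) with h | h
  · rw [h]; simp; positivity
  · obtain ⟨n0, hn0⟩ := h
    simp only [Finset.mem_filter] at hn0
    obtain ⟨_, h1, m0, rfl⟩ := hn0
    have hdu : IsUnit (d : ZMod q) := by
      rw [← h1] at hb
      push_cast at hb
      exact isUnit_of_mul_isUnit_left hb
    have hle := count_ap q hq (m0 : ZMod q) 0 (u / d) le_rfl (by positivity)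
    rw [Nat.floor_zero, sub_zero, div_div] at hle
    refine le_trans ?_ hle
    norm_cast
    apply Finset.card_le_card_of_injOn (fun n => n / d)
    · intro n hn
      simp only [Finset.coe_filter, Finset.mem_Icc, Set.mem_setOf_eq] at hn
      obtain ⟨⟨h2, h3⟩, h4, m, rfl⟩ := hn
      simp only [Finset.coe_filter, Finset.mem_Ioc, Set.mem_setOf_eq]
      rw [Nat.mul_div_cancel_left _ (by omega)]
      refine ⟨⟨Nat.pos_of_ne_zero (by rintro rfl; simp at h2), ?_⟩, ?_⟩
      · rw [Nat.le_floor_iff (by positivity), le_div_iff₀ hdp]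
        rw [Nat.le_floor_iff hu] at h3
        push_cast at h3; linarith
      · rw [← h1] at h4; push_cast at h4
        exact hdu.mul_left_cancel h4
    · intro n hn n' hn' hnn
      simp only [Finset.coe_filter, Set.mem_setOf_eq] at hn hn'
      obtain ⟨_, _, m, rfl⟩ := hn
      obtain ⟨_, _, m', rfl⟩ := hn'
      simp only [Nat.mul_div_cancel_left _ (show 0 < d by omega)] at hnn
      rw [hnn]
end S18

namespace S18

/-- Sum of `log p` over prime factors `p > Q`. -/
def ell (Q : ℝ) (n : ℕ) : ℝ := ∑ p ∈ n.primeFactors.filter (fun p : ℕ => Q < p), Real.log p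

lemma ell_nonneg (Q : ℝ) (n : ℕ) : 0 ≤ ell Q n :=
  Finset.sum_nonneg fun p _ => Real.log_natCast_nonneg p

lemma log_sub_ell (Q : ℝ) (n : ℕ) (_ : n ≠ 0) :
    Real.log n - ell Q n =
      ∑ d ∈ n.divisors.filter (fun d : ℕ => ¬ (d.Prime ∧ Q < d)), ArithmeticFunction.vonMangoldt d := by
  have h1 := ArithmeticFunction.vonMangoldt_sum (n := n)
  rw [← h1, ← Finset.sum_filter_add_sum_filter_not n.divisors (fun d : ℕ => (d.Prime ∧ Q < d))]
  have h2 : ell Q n = ∑ d ∈ n.divisors.filter (fun d : ℕ => (d.Prime ∧ Q < d)), ArithmeticFunction.vonMangoldt d := by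
    unfold ell
    have : n.divisors.filter (fun d : ℕ => (d.Prime ∧ Q < d)) = n.primeFactors.filter (fun p : ℕ => Q < p) := by
      ext d
      simp only [Finset.mem_filter, Nat.mem_divisors, Nat.mem_primeFactors]
      tauto
    rw [this]
    refine Finset.sum_congr rfl fun p hp => ?_
    simp only [Finset.mem_filter, Nat.mem_primeFactors] at hp
    rw [ArithmeticFunction.vonMangoldt_apply_prime hp.1.1]
  rw [h2]; ring

lemma ell_le_log (Q : ℝ) (n : ℕ) (hn : n ≠ 0) : ell Q n ≤ Real.log n := by
  have := log_sub_ell Q n hn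
  have h2 : 0 ≤ ∑ d ∈ n.divisors.filter (fun d : ℕ => ¬ (d.Prime ∧ Q < d)), ArithmeticFunction.vonMangoldt d :=
    Finset.sum_nonneg fun d _ => ArithmeticFunction.vonMangoldt_nonneg
  linarith

lemma np_sum : ∃ C : ℝ, 0 < C ∧ ∀ N : ℕ, ∑ d ∈ (Icc 1 N).filter (fun d : ℕ => ¬ d.Prime), ArithmeticFunction.vonMangoldt d / d ≤ C := by
  have h := ArithmeticFunction.vonMangoldt.summable_residueClass_non_primes_div (q := 1) 0
  refine ⟨(∑' n : ℕ, (if n.Prime then 0 else ArithmeticFunction.vonMangoldt.residueClass (0 : ZMod 1) n) / n) + 1, ?_, fun N => ?_⟩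
  · have : 0 ≤ (∑' n : ℕ, (if n.Prime then 0 else ArithmeticFunction.vonMangoldt.residueClass (0 : ZMod 1) n) / n) := by
      refine tsum_nonneg fun n => ?_
      split_ifs
      · simp
      · exact div_nonneg (ArithmeticFunction.vonMangoldt.residueClass_nonneg _ _) (Nat.cast_nonneg _)
    linarith
  · have h2 := h.sum_le_tsum ((Icc 1 N).filter (fun d : ℕ => ¬ d.Prime)) (fun n _ => by
      split_ifs
      · simp
      · exact div_nonneg (ArithmeticFunction.vonMangoldt.residueClass_nonneg _ _) (Nat.cast_nonneg _))
    have h3 : ∑ d ∈ (Icc 1 N).filter (fun d : ℕ => ¬ d.Prime), ArithmeticFunction.vonMangoldt d / d =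
      ∑ n ∈ (Icc 1 N).filter (fun d : ℕ => ¬ d.Prime), (if n.Prime then 0 else ArithmeticFunction.vonMangoldt.residueClass (0 : ZMod 1) n) / n := by
      refine Finset.sum_congr rfl fun d hd => ?_
      simp only [Finset.mem_filter] at hd
      rw [if_neg hd.2, ArithmeticFunction.vonMangoldt.residueClass]
      rw [Set.indicator_of_mem]
      exact Subsingleton.elim _ _
    rw [h3]; linarith

lemma harm_le (N : ℕ) : ∑ d ∈ Icc 1 N, (1 : ℝ) / d ≤ 1 + Real.log N := by
  have := harmonic_le_one_add_log N
  rw [harmonic_eq_sum_Icc] at this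
  push_cast at this
  simpa [one_div] using this


lemma err_log (R : ℝ) (hR : 1 ≤ R) (q : ℕ) (hq : 1 ≤ q) (hqR : (q : ℝ) ≤ Real.exp R) (b : ZMod q)
    (u : ℝ) (hu : Real.exp (5 * R) ≤ u) (hlu : Real.log u ≤ Real.exp R) :
    ∑ n ∈ (Icc 1 ⌊u⌋₊).filter (fun n : ℕ => (n : ZMod q) = b), (Real.log u - Real.log n) ≤ 6 * (u / q) * R ^ 2 := by
  have hu0 : 0 < u := lt_of_lt_of_le (Real.exp_pos _) hu
  have hq0 : (0 : ℝ) < q := by exact_mod_cast hq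
  have he1 : 1 ≤ Real.exp R := Real.one_le_exp (by linarith)
  set z := u * Real.exp (-R) with hz
  have hz0 : 0 ≤ z := by positivity
  have hzu : z ≤ u := by
    have : Real.exp (-R) ≤ 1 := Real.exp_le_one_iff.mpr (by linarith)
    nlinarith
  have hc1 := count_ap q hq b 0 z le_rfl hz0
  have hc2 := count_ap q hq b 0 u le_rfl hu0.le
  have huq : Real.exp R ≤ u / q := by
    rw [le_div_iff₀ hq0]
    calc Real.exp R * q ≤ Real.exp R * Real.exp R := by gcongr
      _ = Real.exp (2 * R) := by rw [← Real.exp_add]; ring_nf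
      _ ≤ Real.exp (5 * R) := Real.exp_le_exp.mpr (by linarith)
      _ ≤ u := hu
  have hlu0 : 0 ≤ Real.log u := Real.log_nonneg (by
    have := Real.one_le_exp (show 0 ≤ 5 * R by linarith); linarith)
  -- termwise
  have hterm : ∀ n ∈ (Icc 1 ⌊u⌋₊).filter (fun n : ℕ => (n : ZMod q) = b),
      Real.log u - Real.log n ≤ R + (if n ≤ ⌊z⌋₊ then Real.log u else 0) := by
    intro n hn
    simp only [Finset.mem_filter, Finset.mem_Icc] at hn
    have hn1 : (1 : ℝ) ≤ n := by exact_mod_cast hn.1.1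
    split_ifs with hnz
    · have := Real.log_nonneg hn1
      linarith
    · have : z < n := by
        by_contra hcon
        exact hnz (Nat.le_floor (not_lt.mp hcon))
      have h3 : Real.log z ≤ Real.log n := Real.log_le_log (by positivity) this.le
      rw [hz, Real.log_mul hu0.ne' (Real.exp_pos _).ne', Real.log_exp] at h3
      linarith
  refine (Finset.sum_le_sum hterm).trans ?_
  rw [Finset.sum_add_distrib, ← Finset.sum_filter, Finset.sum_const, Finset.sum_const, nsmul_eq_mul, nsmul_eq_mul]
  have e0 : Ioc ⌊(0:ℝ)⌋₊ ⌊u⌋₊ = Icc 1 ⌊u⌋₊ := by ext; simp [Nat.succ_le_iff, Finset.mem_Ioc]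
  rw [e0] at hc2
  have e1 : (((Icc 1 ⌊u⌋₊).filter (fun n : ℕ => (n : ZMod q) = b)).filter (fun n => n ≤ ⌊z⌋₊)) ⊆
      (Ioc ⌊(0:ℝ)⌋₊ ⌊z⌋₊).filter (fun n : ℕ => (n : ZMod q) = b) := by
    intro n hn
    simp only [Finset.mem_filter, Finset.mem_Icc, Finset.mem_Ioc, Nat.floor_zero] at hn ⊢
    exact ⟨⟨by omega, hn.2⟩, hn.1.2⟩
  have hc3 : (((((Icc 1 ⌊u⌋₊).filter (fun n : ℕ => (n : ZMod q) = b)).filter (fun n => n ≤ ⌊z⌋₊)).card : ℕ) : ℝ) ≤ (z - 0) / q + 2 :=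
    le_trans (by exact_mod_cast Finset.card_le_card e1) hc1
  have h5 : (z - 0) / q * Real.log u ≤ u / q := by
    calc (z - 0) / q * Real.log u ≤ (z - 0) / q * Real.exp R := by gcongr
      _ = u / q * (Real.exp (-R) * Real.exp R) := by rw [hz]; ring
      _ = u / q := by rw [← Real.exp_add]; simp
  have hR2 : R ≤ R ^ 2 := by nlinarith
  have h6 : (((((Icc 1 ⌊u⌋₊).filter (fun n : ℕ => (n : ZMod q) = b)).filter (fun n => n ≤ ⌊z⌋₊)).card : ℕ) : ℝ) * Real.log u ≤ 3 * (u / q) := by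
    calc _ ≤ ((z - 0) / q + 2) * Real.log u := by gcongr
      _ = (z - 0) / q * Real.log u + 2 * Real.log u := by ring
      _ ≤ u / q + 2 * (u / q) := by linarith
      _ = _ := by ring
  have h7 : (((Icc 1 ⌊u⌋₊).filter (fun n : ℕ => (n : ZMod q) = b)).card : ℝ) * R ≤ 3 * (u / q) * R := by
    have h71 : (((Icc 1 ⌊u⌋₊).filter (fun n : ℕ => (n : ZMod q) = b)).card : ℝ) ≤ 3 * (u / q) := by
      simp only [sub_zero] at hc2
      linarith
    gcongr
  have huq0 : 0 ≤ u / q := by positivity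
  nlinarith

lemma err_main : ∃ C : ℝ, 0 < C ∧ ∀ (R : ℝ) (_ : 1 ≤ R) (q : ℕ) (_ : 1 ≤ q) (_ : (q : ℝ) ≤ Real.exp R) (b : ZMod q)
    (_ : IsUnit b) (u : ℝ) (_ : Real.exp (5 * R) ≤ u) (_ : Real.log u ≤ Real.exp R),
    ∑ n ∈ (Icc 1 ⌊u⌋₊).filter (fun n : ℕ => (n : ZMod q) = b), (Real.log u - ell (Real.exp (4 * R)) n) ≤ C * (u / q) * R ^ 2 := by
  obtain ⟨C0, hC0, hnp⟩ := np_sum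
  refine ⟨6 + (20 + C0 + 12 + 4), by positivity, fun R hR q hq hqR b hb u hu hlu => ?_⟩
  have hu0 : 0 < u := lt_of_lt_of_le (Real.exp_pos _) hu
  have hq0 : (0 : ℝ) < q := by exact_mod_cast hq
  have hu1 : 1 ≤ u := by
    have := Real.one_le_exp (show 0 ≤ 5 * R by linarith); linarith
  set Q := Real.exp (4 * R) with hQ
  have h1 : ∑ n ∈ (Icc 1 ⌊u⌋₊).filter (fun n : ℕ => (n : ZMod q) = b), (Real.log u - ell Q n) =
      ∑ n ∈ (Icc 1 ⌊u⌋₊).filter (fun n : ℕ => (n : ZMod q) = b), (Real.log u - Real.log n) +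
      ∑ n ∈ (Icc 1 ⌊u⌋₊).filter (fun n : ℕ => (n : ZMod q) = b),
        ∑ d ∈ n.divisors.filter (fun d : ℕ => ¬ (d.Prime ∧ Q < d)), ArithmeticFunction.vonMangoldt d := by
    rw [← Finset.sum_add_distrib]
    refine Finset.sum_congr rfl fun n hn => ?_
    simp only [Finset.mem_filter, Finset.mem_Icc] at hn
    rw [← log_sub_ell Q n (by omega)]; ring
  have h2 : ∑ n ∈ (Icc 1 ⌊u⌋₊).filter (fun n : ℕ => (n : ZMod q) = b),
        ∑ d ∈ n.divisors.filter (fun d : ℕ => ¬ (d.Prime ∧ Q < d)), ArithmeticFunction.vonMangoldt d =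
      ∑ d ∈ (Icc 1 ⌊u⌋₊).filter (fun d : ℕ => ¬ (d.Prime ∧ Q < d)),
        ((((Icc 1 ⌊u⌋₊).filter (fun n : ℕ => (n : ZMod q) = b ∧ d ∣ n)).card : ℕ) : ℝ) * ArithmeticFunction.vonMangoldt d := by
    have : ∀ d ∈ (Icc 1 ⌊u⌋₊).filter (fun d : ℕ => ¬ (d.Prime ∧ Q < d)), ((((Icc 1 ⌊u⌋₊).filter (fun n : ℕ => (n : ZMod q) = b ∧ d ∣ n)).card : ℕ) : ℝ) * ArithmeticFunction.vonMangoldt d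
       = ∑ n ∈ (Icc 1 ⌊u⌋₊).filter (fun n : ℕ => (n : ZMod q) = b ∧ d ∣ n), ArithmeticFunction.vonMangoldt d := by
      intro d _
      rw [Finset.sum_const, nsmul_eq_mul]
    rw [Finset.sum_congr rfl this]
    refine Finset.sum_comm' fun n d => ?_
    simp only [Finset.mem_filter, Finset.mem_Icc, Nat.mem_divisors]
    constructor
    · rintro ⟨⟨⟨a1, a2⟩, a3⟩, ⟨a4, a5⟩, a6⟩
      exact ⟨⟨⟨a1, a2⟩, a3, a4⟩, ⟨Nat.pos_of_dvd_of_pos a4 (by omega), (Nat.le_of_dvd (by omega) a4).trans a2⟩, a6⟩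
    · rintro ⟨⟨⟨a1, a2⟩, a3, a4⟩, _, a6⟩
      exact ⟨⟨⟨a1, a2⟩, a3⟩, ⟨a4, by omega⟩, a6⟩
  -- bound each
  have hL0 : ∀ d : ℕ, 0 ≤ ArithmeticFunction.vonMangoldt d := fun d => ArithmeticFunction.vonMangoldt_nonneg
  set W : ℕ → ℝ := fun d => (u / (d * q) + 2) * ArithmeticFunction.vonMangoldt d with hW
  have hW0 : ∀ d, 0 ≤ W d := fun d => mul_nonneg (by positivity) (hL0 d)
  have h3 : ∑ d ∈ (Icc 1 ⌊u⌋₊).filter (fun d : ℕ => ¬ (d.Prime ∧ Q < d)),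
        ((((Icc 1 ⌊u⌋₊).filter (fun n : ℕ => (n : ZMod q) = b ∧ d ∣ n)).card : ℕ) : ℝ) * ArithmeticFunction.vonMangoldt d
      ≤ ∑ d ∈ Icc 1 ⌊Q⌋₊, W d + ∑ d ∈ (Icc 1 ⌊u⌋₊).filter (fun d : ℕ => ¬ d.Prime), W d := by
    calc _ ≤ ∑ d ∈ (Icc 1 ⌊u⌋₊).filter (fun d : ℕ => ¬ (d.Prime ∧ Q < d)), W d := by
          refine Finset.sum_le_sum fun d hd => ?_
          simp only [Finset.mem_filter, Finset.mem_Icc] at hd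
          exact mul_le_mul_of_nonneg_right (count_ap_dvd q hq b hb d hd.1.1 u hu0.le) (hL0 d)
      _ ≤ ∑ d ∈ Icc 1 ⌊Q⌋₊ ∪ (Icc 1 ⌊u⌋₊).filter (fun d : ℕ => ¬ d.Prime), W d := by
          refine Finset.sum_le_sum_of_subset_of_nonneg (fun d hd => ?_) fun d _ _ => hW0 d
          simp only [Finset.mem_filter, Finset.mem_Icc, Finset.mem_union] at hd ⊢
          by_cases hp : d.Prime
          · left
            exact ⟨hd.1.1, Nat.le_floor (not_lt.mp fun h => hd.2 ⟨hp, h⟩)⟩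
          · right; exact ⟨hd.1, hp⟩
      _ ≤ _ := by
          rw [← Finset.sum_union_inter]
          have := Finset.sum_nonneg (s := Icc 1 ⌊Q⌋₊ ∩ (Icc 1 ⌊u⌋₊).filter (fun d : ℕ => ¬ d.Prime)) fun d _ => hW0 d
          linarith
  have hWe : ∀ d : ℕ, W d = u / q * (ArithmeticFunction.vonMangoldt d / d) + 2 * ArithmeticFunction.vonMangoldt d := by
    intro d; rw [hW]; simp only [div_mul_eq_div_div]
    ring
  have huq : Real.exp (4 * R) ≤ u / q := by
    rw [le_div_iff₀ hq0]
    calc Real.exp (4 * R) * q ≤ Real.exp (4 * R) * Real.exp R := by gcongr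
      _ = Real.exp (5 * R) := by rw [← Real.exp_add]; ring_nf
      _ ≤ u := hu
  have huq0 : 0 < u / q := by positivity
  have hl4 : Real.log 4 ≤ 2 := by
    have : Real.log 4 = 2 * Real.log 2 := by
      rw [show (4:ℝ) = 2 ^ 2 by norm_num, Real.log_pow]; norm_num
    have := Real.log_two_lt_d9; linarith
  have h4 : ∑ d ∈ Icc 1 ⌊Q⌋₊, W d ≤ (20 + 12) * (u / q) * R ^ 2 := by
    simp only [hWe]
    rw [Finset.sum_add_distrib, ← Finset.mul_sum, ← Finset.mul_sum]
    have a1 : ∑ d ∈ Icc 1 ⌊Q⌋₊, ArithmeticFunction.vonMangoldt d / d ≤ 20 * R ^ 2 := by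
      calc _ ≤ ∑ d ∈ Icc 1 ⌊Q⌋₊, (4 * R) * (1 / d : ℝ) := by
            refine Finset.sum_le_sum fun d hd => ?_
            simp only [Finset.mem_Icc] at hd
            have hd0 : (0 : ℝ) < d := by exact_mod_cast hd.1
            have : ArithmeticFunction.vonMangoldt d ≤ 4 * R := by
              refine ArithmeticFunction.vonMangoldt_le_log.trans ?_
              rw [← Real.log_exp (4 * R), ← hQ]
              exact Real.log_le_log hd0 ((Nat.cast_le.mpr hd.2).trans (Nat.floor_le (Real.exp_pos _).le))
            rw [mul_one_div]
            gcongr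
        _ ≤ (4 * R) * (1 + Real.log ⌊Q⌋₊) := by
            rw [← Finset.mul_sum]
            gcongr
            exact harm_le _
        _ ≤ (4 * R) * (1 + 4 * R) := by
            gcongr
            rw [← Real.log_exp (4 * R), ← hQ]
            refine Real.log_le_log ?_ (Nat.floor_le (Real.exp_pos _).le)
            exact_mod_cast Nat.floor_pos.mpr (Real.one_le_exp (by linarith))
        _ ≤ _ := by nlinarith
    have a2 : ∑ d ∈ Icc 1 ⌊Q⌋₊, ArithmeticFunction.vonMangoldt d ≤ 6 * (u / q) := by
      have := Chebyshev.psi_le_const_mul_self (x := Q) (Real.exp_pos _).le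
      rw [Chebyshev.psi] at this
      have e : Ioc 0 ⌊Q⌋₊ = Icc 1 ⌊Q⌋₊ := by ext; simp [Nat.succ_le_iff, Finset.mem_Ioc]
      rw [e] at this
      refine this.trans ?_
      have hQp : 0 < Q := Real.exp_pos _
      nlinarith
    have : u / q * ∑ d ∈ Icc 1 ⌊Q⌋₊, ArithmeticFunction.vonMangoldt d / d ≤ u / q * (20 * R ^ 2) := by gcongr
    have hh : u / q * 1 ≤ u / q * R ^ 2 := by gcongr; nlinarith
    linarith
  have h5 : ∑ d ∈ (Icc 1 ⌊u⌋₊).filter (fun d : ℕ => ¬ d.Prime), W d ≤ (C0 + 4) * (u / q) * R ^ 2 := by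
    simp only [hWe]
    rw [Finset.sum_add_distrib, ← Finset.mul_sum, ← Finset.mul_sum]
    have a1 := hnp ⌊u⌋₊
    have a2 := Chebyshev.psi_sub_theta_le hu1
    rw [Chebyshev.psi_sub_theta_eq_sum_not_prime] at a2
    have e : Ioc 0 ⌊u⌋₊ = Icc 1 ⌊u⌋₊ := by ext; simp [Nat.succ_le_iff, Finset.mem_Ioc]
    rw [e] at a2
    have a3 : 2 * √u * Real.log u ≤ 2 * (u / q) := by
      have hs : √u * Real.log u ≤ u / q := by
        rw [le_div_iff₀ hq0]
        have hs2 : Real.exp (2 * R) ≤ √u := by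
          refine Real.le_sqrt_of_sq_le ?_
          rw [← Real.exp_nat_mul]
          refine le_trans (Real.exp_le_exp.mpr ?_) hu
          push_cast; linarith
        calc √u * Real.log u * q ≤ √u * Real.exp R * Real.exp R := by gcongr
          _ = √u * Real.exp (2 * R) := by rw [mul_assoc, ← Real.exp_add]; ring_nf
          _ ≤ √u * √u := by gcongr
          _ = u := Real.mul_self_sqrt hu0.le
      linarith
    have a4 : u / q * ∑ d ∈ (Icc 1 ⌊u⌋₊).filter (fun d : ℕ => ¬ d.Prime), ArithmeticFunction.vonMangoldt d / d ≤ u / q * C0 := by gcongr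
    have : (u / q) * (C0 + 4) * 1 ≤ (u / q) * (C0 + 4) * R ^ 2 := by
      gcongr
      nlinarith
    nlinarith
  have h6 := err_log R hR q hq hqR b u hu hlu
  rw [h1, h2]
  nlinarith

end S18

namespace S18

/-- Completely multiplicative zero-one functions. -/
structure CM (h : ℕ → ℝ) : Prop where
  zero : h 0 = 0
  one : h 1 = 1
  mul : ∀ m n, h (m * n) = h m * h n
  val : ∀ n, h n = 0 ∨ h n = 1

lemma CM.nonneg {h : ℕ → ℝ} (hh : CM h) (n : ℕ) : 0 ≤ h n := by
  rcases hh.val n with h | h <;> rw [h] <;> norm_num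

lemma CM.le_one {h : ℕ → ℝ} (hh : CM h) (n : ℕ) : h n ≤ 1 := by
  rcases hh.val n with h | h <;> rw [h] <;> norm_num

/-- The integers up to `u` in a residue class. -/
def cls (q : ℕ) (b : ZMod q) (u : ℝ) : Finset ℕ := (Icc 1 ⌊u⌋₊).filter (fun n : ℕ => (n : ZMod q) = b)

def MM (h : ℕ → ℝ) (q : ℕ) (b : ZMod q) (u : ℝ) : ℝ := ∑ n ∈ cls q b u, h n

def EE (h : ℕ → ℝ) (q : ℕ) (lam : ℝ) (b : ZMod q) (u : ℝ) : ℝ := MM h q b u - lam * MM h q b (u / lam)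

def TT (h : ℕ → ℝ) (Q : ℝ) (q : ℕ) (b : ZMod q) (u : ℝ) : ℝ := ∑ n ∈ cls q b u, h n * ell Q n

def ET (h : ℕ → ℝ) (Q : ℝ) (q : ℕ) (lam : ℝ) (b : ZMod q) (u : ℝ) : ℝ :=
  TT h Q q b u - lam * TT h Q q b (u / lam)

lemma card_cls (q : ℕ) (hq : 1 ≤ q) (b : ZMod q) (u : ℝ) (hu : 0 ≤ u) : ((cls q b u).card : ℝ) ≤ u / q + 2 := by
  have hc2 := count_ap q hq b 0 u le_rfl hu
  have e0 : Ioc ⌊(0:ℝ)⌋₊ ⌊u⌋₊ = Icc 1 ⌊u⌋₊ := by ext; simp [Nat.succ_le_iff, Finset.mem_Ioc]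
  rw [e0] at hc2
  simpa [cls] using hc2

lemma MM_nonneg {h : ℕ → ℝ} (hh : CM h) (q : ℕ) (b : ZMod q) (u : ℝ) : 0 ≤ MM h q b u :=
  Finset.sum_nonneg fun n _ => hh.nonneg n

lemma MM_le_card {h : ℕ → ℝ} (hh : CM h) (q : ℕ) (b : ZMod q) (u : ℝ) : MM h q b u ≤ (cls q b u).card := by
  have := Finset.sum_le_sum (s := cls q b u) fun n _ => hh.le_one n
  simpa [MM] using this

lemma err_h : ∃ C : ℝ, 0 < C ∧ ∀ {h : ℕ → ℝ} (_ : CM h) (R : ℝ) (_ : 1 ≤ R) (q : ℕ) (_ : 1 ≤ q) (_ : (q : ℝ) ≤ Real.exp R) (b : ZMod q)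
    (_ : IsUnit b) (u : ℝ) (_ : Real.exp (5 * R) ≤ u) (_ : Real.log u ≤ Real.exp R),
    |MM h q b u * Real.log u - TT h (Real.exp (4 * R)) q b u| ≤ C * (u / q) * R ^ 2 := by
  obtain ⟨C, hC, H⟩ := err_main
  refine ⟨C, hC, fun {h} hh R hR q hq hqR b hb u hu hlu => ?_⟩
  have h1 := H R hR q hq hqR b hb u hu hlu
  have hu0 : 0 < u := lt_of_lt_of_le (Real.exp_pos _) hu
  have e : MM h q b u * Real.log u - TT h (Real.exp (4 * R)) q b u =
      ∑ n ∈ cls q b u, h n * (Real.log u - ell (Real.exp (4 * R)) n) := by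
    rw [MM, TT, Finset.sum_mul, ← Finset.sum_sub_distrib]
    exact Finset.sum_congr rfl fun n _ => by ring
  have hpos : ∀ n ∈ cls q b u, 0 ≤ Real.log u - ell (Real.exp (4 * R)) n := by
    intro n hn
    simp only [cls, Finset.mem_filter, Finset.mem_Icc] at hn
    have h2 := ell_le_log (Real.exp (4 * R)) n (by omega)
    have h3 : Real.log n ≤ Real.log u := Real.log_le_log (by exact_mod_cast hn.1.1)
      ((Nat.cast_le.mpr hn.1.2).trans (Nat.floor_le hu0.le))
    linarith
  rw [e, abs_of_nonneg (Finset.sum_nonneg fun n hn => mul_nonneg (hh.nonneg n) (hpos n hn))]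
  refine le_trans (Finset.sum_le_sum fun n hn => ?_) h1
  exact mul_le_of_le_one_left (hpos n hn) (hh.le_one n)

lemma E_log : ∃ C : ℝ, 0 < C ∧ ∀ {h : ℕ → ℝ} (_ : CM h) (R : ℝ) (_ : 1 ≤ R) (q : ℕ) (_ : 1 ≤ q) (_ : (q : ℝ) ≤ Real.exp R) (b : ZMod q)
    (_ : IsUnit b) (lam : ℝ) (_ : 1 ≤ lam) (_ : lam ≤ Real.exp R)
    (u : ℝ) (_ : Real.exp (6 * R) ≤ u) (_ : Real.log u ≤ Real.exp R),
    |EE h q lam b u * Real.log u - ET h (Real.exp (4 * R)) q lam b u| ≤ C * (u / q) * R ^ 2 := by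
  obtain ⟨C, hC, H⟩ := err_h
  refine ⟨2 * C + 3, by positivity, fun {h} hh R hR q hq hqR b hb lam hl hlR u hu hlu => ?_⟩
  have hu0 : 0 < u := lt_of_lt_of_le (Real.exp_pos _) hu
  have hq0 : (0 : ℝ) < q := by exact_mod_cast hq
  have hl0 : 0 < lam := by linarith
  have hul : Real.exp (5 * R) ≤ u / lam := by
    rw [le_div_iff₀ hl0]
    calc Real.exp (5 * R) * lam ≤ Real.exp (5 * R) * Real.exp R := by gcongr
      _ = Real.exp (6 * R) := by rw [← Real.exp_add]; ring_nf
      _ ≤ u := hu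
  have hlog : Real.log (u / lam) = Real.log u - Real.log lam := Real.log_div hu0.ne' hl0.ne'
  have hll : 0 ≤ Real.log lam := Real.log_nonneg hl
  have hllR : Real.log lam ≤ R := by
    rw [← Real.log_exp R]; exact Real.log_le_log hl0 hlR
  have h1 := H hh R hR q hq hqR b hb u (le_trans (Real.exp_le_exp.mpr (by linarith)) hu) hlu
  have h2 := H hh R hR q hq hqR b hb (u / lam) hul (by linarith)
  have h3 : MM h q b (u / lam) ≤ u / lam / q + 2 := (MM_le_card hh q b _).trans (card_cls q hq b _ (by positivity))
  have huq : lam ≤ u / q := by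
    rw [le_div_iff₀ hq0]
    calc lam * q ≤ Real.exp R * Real.exp R := by gcongr
      _ = Real.exp (2 * R) := by rw [← Real.exp_add]; ring_nf
      _ ≤ Real.exp (6 * R) := Real.exp_le_exp.mpr (by linarith)
      _ ≤ u := hu
  have h4 : lam * MM h q b (u / lam) * Real.log lam ≤ 3 * (u / q) * R := by
    have : lam * MM h q b (u / lam) ≤ 3 * (u / q) := by
      calc lam * MM h q b (u / lam) ≤ lam * (u / lam / q + 2) := by gcongr
        _ = u / q + 2 * lam := by field_simp
        _ ≤ _ := by linarith
    have h0 := mul_nonneg hl0.le (MM_nonneg hh q b (u / lam))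
    gcongr
  have h4' : 0 ≤ lam * MM h q b (u / lam) * Real.log lam := mul_nonneg (mul_nonneg hl0.le (MM_nonneg hh q b (u / lam))) hll
  have e : EE h q lam b u * Real.log u - ET h (Real.exp (4 * R)) q lam b u =
     (MM h q b u * Real.log u - TT h (Real.exp (4 * R)) q b u) - lam * (MM h q b (u / lam) * Real.log (u / lam) - TT h (Real.exp (4 * R)) q b (u / lam))
      - lam * MM h q b (u / lam) * Real.log lam := by
    rw [hlog, EE, ET]; ring
  rw [e]
  have h5 : |lam * (MM h q b (u / lam) * Real.log (u / lam) - TT h (Real.exp (4 * R)) q b (u / lam))| ≤ C * (u / q) * R ^ 2 := by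
    rw [abs_mul, abs_of_pos hl0]
    calc _ ≤ lam * (C * (u / lam / q) * R ^ 2) := by gcongr
      _ = _ := by field_simp
  have h6 : 3 * (u / q) * R ≤ 3 * (u / q) * R ^ 2 := by
    gcongr; nlinarith
  rw [abs_le] at h1 h5 ⊢
  constructor <;> linarith [h1.1, h1.2, h5.1, h5.2]

lemma T_conv {h : ℕ → ℝ} (hh : CM h) (Q : ℝ) (q : ℕ) (hq : 1 ≤ q) (hQ : (q : ℝ) ≤ Q) (b : ZMod q) (u x : ℝ)
    (_ : 0 ≤ u) (hux : u ≤ x) :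
    TT h Q q b u = ∑ p ∈ (Icc 1 ⌊x⌋₊).filter (fun p : ℕ => p.Prime ∧ Q < p),
      h p * Real.log p * MM h q (b * (p : ZMod q)⁻¹) (u / p) := by
  have h1 : TT h Q q b u = ∑ n ∈ cls q b u, ∑ p ∈ n.primeFactors.filter (fun p : ℕ => Q < p), h n * Real.log p := by
    unfold TT ell
    exact Finset.sum_congr rfl fun n _ => by rw [Finset.mul_sum]
  have h2 : ∑ n ∈ cls q b u, ∑ p ∈ n.primeFactors.filter (fun p : ℕ => Q < p), h n * Real.log p =
      ∑ p ∈ (Icc 1 ⌊x⌋₊).filter (fun p : ℕ => p.Prime ∧ Q < p), ∑ n ∈ (cls q b u).filter (fun n => p ∣ n), h n * Real.log p := by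
    refine Finset.sum_comm' fun n p => ?_
    simp only [cls, Finset.mem_filter, Finset.mem_Icc, Nat.mem_primeFactors]
    constructor
    · rintro ⟨⟨⟨a1, a2⟩, a3⟩, ⟨a4, a5, a6⟩, a7⟩
      exact ⟨⟨⟨⟨a1, a2⟩, a3⟩, a5⟩, ⟨a4.one_lt.le, ((Nat.le_of_dvd (by omega) a5).trans a2).trans (Nat.floor_mono hux)⟩, a4, a7⟩
    · rintro ⟨⟨⟨⟨a1, a2⟩, a3⟩, a5⟩, _, a4, a7⟩
      exact ⟨⟨⟨a1, a2⟩, a3⟩, ⟨a4, a5, by omega⟩, a7⟩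
  rw [h1, h2]
  refine Finset.sum_congr rfl fun p hp => ?_
  simp only [Finset.mem_filter, Finset.mem_Icc] at hp
  have hp0 : 0 < p := hp.2.1.pos
  have hqp : q < p := by exact_mod_cast lt_of_le_of_lt hQ hp.2.2
  have hcop : Nat.Coprime p q := (Nat.Prime.coprime_iff_not_dvd hp.2.1).mpr fun hd => by
    have := Nat.le_of_dvd (by omega) hd; omega
  have hinv : (p : ZMod q) * (p : ZMod q)⁻¹ = 1 := ZMod.coe_mul_inv_eq_one p hcop
  rw [MM, Finset.mul_sum]
  symm
  refine Finset.sum_nbij' (fun m => p * m) (fun n => n / p) ?_ ?_ ?_ ?_ ?_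
  · intro m hm
    simp only [cls, Finset.mem_filter, Finset.mem_Icc, Nat.floor_div_natCast] at hm ⊢
    refine ⟨⟨⟨Nat.mul_pos hp0 hm.1.1, ?_⟩, ?_⟩, Dvd.intro m rfl⟩
    · rw [mul_comm]; exact (Nat.le_div_iff_mul_le hp0).mp hm.1.2
    · push_cast; rw [hm.2, mul_comm b, ← mul_assoc, hinv, one_mul]
  · intro n hn
    simp only [cls, Finset.mem_filter, Finset.mem_Icc, Nat.floor_div_natCast] at hn ⊢
    obtain ⟨⟨⟨a1, a2⟩, a3⟩, m, rfl⟩ := hn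
    rw [Nat.mul_div_cancel_left _ hp0]
    refine ⟨⟨Nat.pos_of_ne_zero (by rintro rfl; simp at a1), (Nat.le_div_iff_mul_le hp0).mpr (by rw [mul_comm]; exact a2)⟩, ?_⟩
    rw [← a3]; push_cast
    rw [mul_comm (p : ZMod q), mul_assoc, hinv, mul_one]
  · intro m _; exact Nat.mul_div_cancel_left _ hp0
  · intro n hn
    simp only [Finset.mem_filter] at hn
    exact Nat.mul_div_cancel' hn.2
  · intro m _
    rw [hh.mul]; ring

lemma ET_conv {h : ℕ → ℝ} (hh : CM h) (Q : ℝ) (q : ℕ) (hq : 1 ≤ q) (hQ : (q : ℝ) ≤ Q) (lam : ℝ) (hl : 1 ≤ lam) (b : ZMod q) (u : ℝ)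
    (hu : 0 ≤ u) :
    ET h Q q lam b u = ∑ p ∈ (Icc 1 ⌊u⌋₊).filter (fun p : ℕ => p.Prime ∧ Q < p),
      h p * Real.log p * EE h q lam (b * (p : ZMod q)⁻¹) (u / p) := by
  rw [ET, T_conv hh Q q hq hQ b u u hu le_rfl, T_conv hh Q q hq hQ b (u / lam) u (by positivity) (div_le_self hu hl),
    Finset.mul_sum, ← Finset.sum_sub_distrib]
  refine Finset.sum_congr rfl fun p _ => ?_
  rw [EE, div_right_comm]; ring

end S18

namespace S18

lemma big_p (Q : ℝ) (q : ℕ) (hq : 1 ≤ q) (hQ : (q : ℝ) ≤ Q) (A : ZMod q) (hA : IsUnit A) (y V : ℝ) (hy : 0 < y) (hV : 1 ≤ V) :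
    ∑ p ∈ (Icc 1 ⌊y⌋₊).filter (fun p : ℕ => (p.Prime ∧ Q < p) ∧ y / V < p),
      Real.log p * (cls q (A * (p : ZMod q)⁻¹) (y / p)).card ≤
      (1 + Real.log V) * (2 * (y / q) * (4 + 2 * Real.log q)) := by
  have hq0 : (0 : ℝ) < q := by exact_mod_cast hq
  have hlq : 0 ≤ Real.log q := Real.log_natCast_nonneg q
  have h1 : ∑ p ∈ (Icc 1 ⌊y⌋₊).filter (fun p : ℕ => (p.Prime ∧ Q < p) ∧ y / V < p),
      Real.log p * (cls q (A * (p : ZMod q)⁻¹) (y / p)).card =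
      ∑ p ∈ (Icc 1 ⌊y⌋₊).filter (fun p : ℕ => (p.Prime ∧ Q < p) ∧ y / V < p),
        ∑ m ∈ cls q (A * (p : ZMod q)⁻¹) (y / p), Real.log p := by
    refine Finset.sum_congr rfl fun p _ => ?_
    rw [Finset.sum_const, nsmul_eq_mul]; ring
  have h2 : ∑ p ∈ (Icc 1 ⌊y⌋₊).filter (fun p : ℕ => (p.Prime ∧ Q < p) ∧ y / V < p),
        ∑ m ∈ cls q (A * (p : ZMod q)⁻¹) (y / p), Real.log p =
      ∑ m ∈ Icc 1 ⌊V⌋₊, ∑ p ∈ ((Icc 1 ⌊y⌋₊).filter (fun p : ℕ => (p.Prime ∧ Q < p) ∧ y / V < p)).filter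
        (fun p : ℕ => m ∈ cls q (A * (p : ZMod q)⁻¹) (y / p)), Real.log p := by
    refine Finset.sum_comm' fun p m => ?_
    constructor
    · rintro ⟨a1, a2⟩
      refine ⟨Finset.mem_filter.mpr ⟨a1, a2⟩, ?_⟩
      simp only [Finset.mem_filter, Finset.mem_Icc, cls] at a1 a2 ⊢
      refine ⟨a2.1.1, Nat.le_floor ?_⟩
      have hp0 : (0 : ℝ) < p := by exact_mod_cast a1.2.1.1.pos
      have b1 : (m : ℝ) ≤ y / p := (Nat.cast_le.mpr a2.1.2).trans (Nat.floor_le (by positivity))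
      have b2 := a1.2.2
      rw [div_lt_iff₀ (by linarith)] at b2
      rw [le_div_iff₀ hp0] at b1
      nlinarith
    · rintro ⟨a1, a2⟩
      exact Finset.mem_filter.mp a1
  rw [h1, h2]
  have h3 : ∀ m ∈ Icc 1 ⌊V⌋₊, ∑ p ∈ ((Icc 1 ⌊y⌋₊).filter (fun p : ℕ => (p.Prime ∧ Q < p) ∧ y / V < p)).filter
        (fun p : ℕ => m ∈ cls q (A * (p : ZMod q)⁻¹) (y / p)), Real.log p ≤ (2 * (y / q) * (4 + 2 * Real.log q)) * (1 / m) := by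
    intro m hm
    set S := ((Icc 1 ⌊y⌋₊).filter (fun p : ℕ => (p.Prime ∧ Q < p) ∧ y / V < p)).filter
        (fun p : ℕ => m ∈ cls q (A * (p : ZMod q)⁻¹) (y / p)) with hS
    rw [Finset.mem_Icc] at hm
    have hm0 : (0 : ℝ) < m := by exact_mod_cast hm.1
    rcases S.eq_empty_or_nonempty with he | ⟨p0, hp0⟩
    · rw [he, Finset.sum_empty]; positivity
    · have key : ∀ p ∈ S, p.Prime ∧ (p : ZMod q) * m = A ∧ (q : ℝ) < p ∧ (p : ℝ) ≤ y / m := by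
        intro p hp
        simp only [hS, Finset.mem_filter, Finset.mem_Icc, cls] at hp
        obtain ⟨⟨_, ⟨a1, a2⟩, _⟩, ⟨_, a3⟩, a4⟩ := hp
        have hqp : (q : ℝ) < p := lt_of_le_of_lt hQ a2
        have hqp' : q < p := by exact_mod_cast hqp
        have hcop : Nat.Coprime p q := (Nat.Prime.coprime_iff_not_dvd a1).mpr fun hd => by
          have := Nat.le_of_dvd (by omega) hd; omega
        have hinv : (p : ZMod q) * (p : ZMod q)⁻¹ = 1 := ZMod.coe_mul_inv_eq_one p hcop
        have hp0 : (0 : ℝ) < p := by exact_mod_cast a1.pos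
        have b1 : (m : ℝ) ≤ y / p := (Nat.cast_le.mpr a3).trans (Nat.floor_le (by positivity))
        refine ⟨a1, ?_, hqp, ?_⟩
        · rw [a4, mul_comm A, ← mul_assoc, hinv, one_mul]
        · rw [le_div_iff₀ hp0] at b1
          rw [le_div_iff₀ hm0]; linarith
      have hmu : IsUnit (m : ZMod q) := by
        have := (key p0 hp0).2.1
        rw [← this] at hA
        exact isUnit_of_mul_isUnit_right hA
      have := bt_theta q hq (A * (m : ZMod q)⁻¹) (y / m) ((key p0 hp0).2.2.1.le.trans (key p0 hp0).2.2.2) S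
        (fun p hp => ⟨(key p hp).1, by
          rw [← (key p hp).2.1, mul_assoc, ZMod.mul_inv_of_unit _ hmu, mul_one], by exact_mod_cast (key p hp).2.2.1, (key p hp).2.2.2⟩)
      refine this.trans (le_of_eq ?_)
      field_simp
  refine (Finset.sum_le_sum h3).trans ?_
  rw [← Finset.mul_sum, mul_comm]
  gcongr
  refine (harm_le _).trans ?_
  gcongr
  · exact_mod_cast Nat.floor_pos.mpr hV
  · exact Nat.floor_le (by linarith)

lemma EE_abs_le {h : ℕ → ℝ} (hh : CM h) (q : ℕ) (lam : ℝ) (hl : 0 ≤ lam) (b : ZMod q) (u : ℝ) :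
    |EE h q lam b u| ≤ (cls q b u).card + lam * (cls q b (u / lam)).card := by
  have h1 := MM_nonneg hh q b u
  have h2 := MM_le_card hh q b u
  have h3 := mul_nonneg hl (MM_nonneg hh q b (u / lam))
  have h4 := mul_le_mul_of_nonneg_left (MM_le_card hh q b (u / lam)) hl
  rw [EE, abs_le]
  constructor <;> linarith

lemma MM_diff {h : ℕ → ℝ} (hh : CM h) (q : ℕ) (hq : 1 ≤ q) (b : ZMod q) (w u : ℝ) (hw : 0 ≤ w) (hwu : w ≤ u) :
    0 ≤ MM h q b u - MM h q b w ∧ MM h q b u - MM h q b w ≤ (u - w) / q + 2 := by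
  have hsub : cls q b w ⊆ cls q b u := by
    intro n hn
    simp only [cls, Finset.mem_filter, Finset.mem_Icc] at hn ⊢
    exact ⟨⟨hn.1.1, hn.1.2.trans (Nat.floor_mono hwu)⟩, hn.2⟩
  have e : MM h q b u - MM h q b w = ∑ n ∈ cls q b u \ cls q b w, h n := by
    rw [MM, MM, ← Finset.sum_sdiff hsub]; ring
  have hc := count_ap q hq b w u hw hwu
  rw [e]
  refine ⟨Finset.sum_nonneg fun n _ => hh.nonneg n, ?_⟩
  have h1 : ∑ n ∈ cls q b u \ cls q b w, h n ≤ ∑ n ∈ cls q b u \ cls q b w, (1 : ℝ) :=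
    Finset.sum_le_sum fun n _ => hh.le_one n
  refine h1.trans (le_trans ?_ hc)
  rw [Finset.sum_const, nsmul_eq_mul, mul_one]
  exact_mod_cast Finset.card_le_card (by
    intro n hn
    simp only [cls, Finset.mem_sdiff, Finset.mem_filter, Finset.mem_Icc, Finset.mem_Ioc] at hn ⊢
    refine ⟨⟨?_, hn.1.1.2⟩, hn.1.2⟩
    by_contra hcon
    exact hn.2 ⟨⟨hn.1.1.1, not_lt.mp hcon⟩, hn.1.2⟩)

lemma EE_diff {h : ℕ → ℝ} (hh : CM h) (q : ℕ) (hq : 1 ≤ q) (lam : ℝ) (hl : 1 ≤ lam) (b : ZMod q) (u η v : ℝ) (hu : 0 < u)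
    (hη : 0 ≤ η) (hv1 : Real.log u - η < v) (hv2 : v ≤ Real.log u) :
    |EE h q lam b u| ≤ |EE h q lam b (Real.exp v)| + (2 * η * u / q + 2 + 2 * lam) := by
  have hq0 : (0 : ℝ) < q := by exact_mod_cast hq
  have hl0 : 0 < lam := by linarith
  set w := Real.exp v with hw
  have hw0 : 0 < w := Real.exp_pos _
  have hwu : w ≤ u := by rw [hw, ← Real.exp_log hu]; exact Real.exp_le_exp.mpr hv2
  have hwu2 : u - w ≤ η * u := by
    have : u * Real.exp (-η) ≤ w := by
      rw [hw]; nth_rw 1 [← Real.exp_log hu]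
      rw [← Real.exp_add]; exact Real.exp_le_exp.mpr (by linarith)
    have h2 := Real.add_one_le_exp (-η)
    nlinarith
  have d1 := MM_diff hh q hq b w u hw0.le hwu
  have d2 := MM_diff hh q hq b (w / lam) (u / lam) (by positivity) (by gcongr)
  have d3 : (u - w) / q ≤ η * u / q := by gcongr
  have d4 : lam * ((u / lam - w / lam) / q + 2) = (u - w) / q + 2 * lam := by field_simp
  have d5 : lam * (MM h q b (u / lam) - MM h q b (w / lam)) ≤ (u - w) / q + 2 * lam := by
    rw [← d4]; exact mul_le_mul_of_nonneg_left d2.2 hl0.le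
  have d6 : 0 ≤ lam * (MM h q b (u / lam) - MM h q b (w / lam)) := mul_nonneg hl0.le d2.1
  have : |EE h q lam b u - EE h q lam b w| ≤ 2 * η * u / q + 2 + 2 * lam := by
    have e : EE h q lam b u - EE h q lam b w = (MM h q b u - MM h q b w) - lam * (MM h q b (u / lam) - MM h q b (w / lam)) := by
      rw [EE, EE]; ring
    have d7 : 2 * η * u / q = 2 * (η * u / q) := by ring
    have d8 : 0 ≤ η * u / q := by positivity
    rw [e, abs_le, d7]
    constructor <;> linarith [d1.1, d1.2]
  have h2 := abs_sub_abs_le_abs_sub (EE h q lam b u) (EE h q lam b w)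
  linarith

lemma MM_meas {h : ℕ → ℝ} (hh : CM h) (q : ℕ) (hq : 1 ≤ q) (b : ZMod q) (c : ℝ) (hc : 0 < c) :
    Measurable (fun v : ℝ => MM h q b (Real.exp v / c)) := by
  apply Monotone.measurable
  intro v w hvw
  have := (MM_diff hh q hq b (Real.exp v / c) (Real.exp w / c) (by positivity) (by gcongr)).1
  linarith

lemma EE_meas {h : ℕ → ℝ} (hh : CM h) (q : ℕ) (hq : 1 ≤ q) (lam : ℝ) (hl : 1 ≤ lam) (b : ZMod q) :
    Measurable (fun v : ℝ => EE h q lam b (Real.exp v)) := by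
  have h1 := MM_meas hh q hq b 1 one_pos
  simp only [div_one] at h1
  exact h1.sub ((MM_meas hh q hq b lam (by linarith)).const_mul lam)

lemma EE_bd {h : ℕ → ℝ} (hh : CM h) (q : ℕ) (hq : 1 ≤ q) (lam : ℝ) (hl : 1 ≤ lam) (b : ZMod q) (v : ℝ) :
    |EE h q lam b (Real.exp v)| ≤ 2 * Real.exp v + 2 + 2 * lam := by
  have hl0 : 0 < lam := by linarith
  have hq0 : (0 : ℝ) < q := by exact_mod_cast hq
  have hq1 : (1 : ℝ) ≤ q := by exact_mod_cast hq
  have h1 := EE_abs_le hh q lam hl0.le b (Real.exp v)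
  have h2 := card_cls q hq b (Real.exp v) (Real.exp_pos v).le
  have h3 := mul_le_mul_of_nonneg_left (card_cls q hq b (Real.exp v / lam) (by positivity)) hl0.le
  have h4 : lam * (Real.exp v / lam / q + 2) = Real.exp v / q + 2 * lam := by field_simp
  have h5 : Real.exp v / q ≤ Real.exp v := div_le_self (Real.exp_pos v).le hq1
  linarith

lemma EE_int {h : ℕ → ℝ} (hh : CM h) (q : ℕ) (hq : 1 ≤ q) (lam : ℝ) (hl : 1 ≤ lam) (b : ZMod q) (s t : ℝ) :
    IntegrableOn (fun v : ℝ => |EE h q lam b (Real.exp v)|) (Set.Ioc s t) := by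
  refine Measure.integrableOn_of_bounded (M := 2 * Real.exp t + 2 + 2 * lam) (by simp) ?_ ?_
  · exact ((EE_meas hh q hq lam hl b).abs).aestronglyMeasurable
  · refine (ae_restrict_iff' measurableSet_Ioc).mpr (ae_of_all _ fun v hv => ?_)
    rw [Real.norm_eq_abs, abs_abs]
    refine (EE_bd hh q hq lam hl b v).trans ?_
    have := Real.exp_le_exp.mpr hv.2
    linarith

lemma smooth_one {h : ℕ → ℝ} (hh : CM h) (q : ℕ) (hq : 1 ≤ q) (lam : ℝ) (hl : 1 ≤ lam) (b : ZMod q) (u η : ℝ) (hu : 0 < u)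
    (hη : 0 < η) :
    |EE h q lam b u| ≤ (1 / η) * (∫ v in Set.Ioc (Real.log u - η) (Real.log u), |EE h q lam b (Real.exp v)|)
       + (2 * η * u / q + 2 + 2 * lam) := by
  have h1 : ∫ v in Set.Ioc (Real.log u - η) (Real.log u), (|EE h q lam b u| - (2 * η * u / q + 2 + 2 * lam)) ≤
      ∫ v in Set.Ioc (Real.log u - η) (Real.log u), |EE h q lam b (Real.exp v)| := by
    refine setIntegral_mono_on ?_ (EE_int hh q hq lam hl b _ _) measurableSet_Ioc fun v hv => ?_
    · exact integrableOn_const (by simp)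
    · have := EE_diff hh q hq lam hl b u η v hu hη.le hv.1 hv.2
      linarith
  rw [setIntegral_const] at h1
  simp only [Measure.real, Real.volume_Ioc, smul_eq_mul] at h1
  rw [show Real.log u - (Real.log u - η) = η by ring, ENNReal.toReal_ofReal hη.le] at h1
  have h2 : |EE h q lam b u| - (2 * η * u / q + 2 + 2 * lam) ≤ (1 / η) * (∫ v in Set.Ioc (Real.log u - η) (Real.log u), |EE h q lam b (Real.exp v)|) := by
    rw [one_div, inv_mul_eq_div, le_div_iff₀ hη]; linarith
  linarith

end S18

namespace S18

/-- The mean over the unit residue classes. -/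
def II (h : ℕ → ℝ) (q : ℕ) [NeZero q] (lam : ℝ) (s t : ℝ) : ℝ :=
  ∫ v in Set.Ioc s t, ∑ b ∈ univ.filter (fun b : ZMod q => IsUnit b), |EE h q lam b (Real.exp v)| * Real.exp (-v)

lemma II_int {h : ℕ → ℝ} (hh : CM h) (q : ℕ) [NeZero q] (lam : ℝ) (hl : 1 ≤ lam) (s t : ℝ) :
    IntegrableOn (fun v => ∑ b ∈ univ.filter (fun b : ZMod q => IsUnit b), |EE h q lam b (Real.exp v)| * Real.exp (-v)) (Set.Ioc s t) := by
  have hq : 1 ≤ q := NeZero.one_le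
  refine integrable_finsetSum _ fun b _ => ?_
  refine Measure.integrableOn_of_bounded (M := (2 * Real.exp t + 2 + 2 * lam) * Real.exp (-s)) (by simp) ?_ ?_
  · exact (((EE_meas hh q hq lam hl b).abs).mul (by fun_prop)).aestronglyMeasurable
  · refine (ae_restrict_iff' measurableSet_Ioc).mpr (ae_of_all _ fun v hv => ?_)
    rw [Real.norm_eq_abs, abs_mul, abs_abs, abs_of_pos (Real.exp_pos _)]
    have h1 := (EE_bd hh q hq lam hl b v)
    have := Real.exp_le_exp.mpr hv.2
    have := Real.exp_le_exp.mpr (neg_le_neg hv.1.le)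
    gcongr
    linarith

lemma window_pt {q : ℕ} (f : ZMod q → ℝ) (hf : ∀ b, 0 ≤ f b) (R : ℝ) (hR : 1 ≤ R) [NeZero q] (hqR : (q : ℝ) ≤ Real.exp R) (A : ZMod q)
    (hA : IsUnit A) (x : ℝ) (hx : 0 ≤ x) (v : ℝ) (S : Finset ℕ)
    (hS : ∀ p ∈ S, (p.Prime ∧ Real.exp (4 * R) < p) ∧ (x * Real.exp (-v)) * Real.exp (-(Real.exp (-2 * R) / 4)) < p ∧ (p : ℝ) ≤ x * Real.exp (-v)) :
    ∑ p ∈ S, Real.log p * f (A * (p : ZMod q)⁻¹) ≤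
      ∑ b ∈ univ.filter (fun b : ZMod q => IsUnit b), (24 * R * (Real.exp (-2 * R) / 4) * (x * Real.exp (-v)) / q) * f b := by
  have hq : 1 ≤ q := NeZero.one_le
  have hq0 : (0 : ℝ) < q := by exact_mod_cast hq
  rcases S.eq_empty_or_nonempty with he | ⟨p0, hp0⟩
  · rw [he, Finset.sum_empty]
    exact Finset.sum_nonneg fun b _ => mul_nonneg (by positivity) (hf b)
  set η := Real.exp (-2 * R) / 4 with hη
  have hη0 : 0 < η := by positivity
  set y := x * Real.exp (-v) with hy
  have he3 : (4:ℝ) ≤ Real.exp (3 * R) := by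
    have := Real.add_one_le_exp (3 * R); linarith
  have hyQ : Real.exp (4 * R) < y := lt_of_lt_of_le (hS p0 hp0).1.2 (hS p0 hp0).2.2
  have hQq : 4 * (q : ℝ) ≤ Real.exp (4 * R) := by
    calc 4 * (q : ℝ) ≤ Real.exp (3 * R) * Real.exp R := by gcongr
      _ = _ := by rw [← Real.exp_add]; ring_nf
  have hcop : ∀ p ∈ S, (p : ZMod q) * (p : ZMod q)⁻¹ = 1 := by
    intro p hp
    have h1 := (hS p hp).1
    have hqp : q < p := by
      have : (q : ℝ) < p := by linarith
      exact_mod_cast this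
    have hc : Nat.Coprime p q := (Nat.Prime.coprime_iff_not_dvd h1.1).mpr fun hd => by
      have := Nat.le_of_dvd (by omega) hd; omega
    exact ZMod.coe_mul_inv_eq_one p hc
  rw [← Finset.sum_fiberwise_of_maps_to (s := S) (t := univ.filter (fun b : ZMod q => IsUnit b)) (g := fun p : ℕ => A * (p : ZMod q)⁻¹)]
  swap
  · intro p hp
    simp only [Finset.mem_filter, Finset.mem_univ, true_and]
    have hu : IsUnit (p : ZMod q)⁻¹ := .of_mul_eq_one_right _ (hcop p hp)
    exact hA.mul hu
  refine Finset.sum_le_sum fun b hb => ?_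
  simp only [Finset.mem_filter, Finset.mem_univ, true_and] at hb
  have e : ∑ p ∈ S.filter (fun p : ℕ => A * (p : ZMod q)⁻¹ = b), Real.log p * f (A * (p : ZMod q)⁻¹) =
      (∑ p ∈ S.filter (fun p : ℕ => A * (p : ZMod q)⁻¹ = b), Real.log p) * f b := by
    rw [Finset.sum_mul]
    refine Finset.sum_congr rfl fun p hp => ?_
    rw [Finset.mem_filter] at hp
    rw [hp.2]
  rw [e]
  refine mul_le_mul_of_nonneg_right ?_ (hf b)
  have hη4 : η ≤ 1 / 4 := by
    have : Real.exp (-2 * R) ≤ 1 := Real.exp_le_one_iff.mpr (by linarith)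
    rw [hη]; linarith
  have hw := bt_window q hq (A * b⁻¹) y η hη0 hη4 (by linarith) (S.filter (fun p : ℕ => A * (p : ZMod q)⁻¹ = b)) (by
    intro p hp
    rw [Finset.mem_filter] at hp
    have h1 := hS p hp.1
    refine ⟨h1.1.1, ?_, h1.2.1, h1.2.2⟩
    have hbb := ZMod.mul_inv_of_unit b hb
    have h2 : A = b * p := by rw [← hp.2, mul_assoc, mul_comm _ (p : ZMod q), hcop p hp.1, mul_one]
    rw [h2, mul_comm b, mul_assoc, hbb, mul_one])
  refine hw.trans ?_
  have h1 : Real.log (4 * q ^ 2 / η) ≤ 3 + 4 * R := by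
    have : (4 : ℝ) * q ^ 2 / η ≤ Real.exp (3 + 4 * R) := by
      have e1 : (4 : ℝ) * q ^ 2 / η = 16 * Real.exp (2 * R) * q ^ 2 := by
        rw [hη, show -2 * R = -(2 * R) by ring, Real.exp_neg]; field_simp; norm_num
      rw [e1]
      have h16 : (16 : ℝ) ≤ Real.exp 3 := by
        have : Real.exp 3 = Real.exp 1 ^ 3 := by rw [← Real.exp_nat_mul]; norm_num
        rw [this]
        have h27 := Real.exp_one_gt_d9
        calc (16 : ℝ) ≤ 2.6 ^ 3 := by norm_num
          _ ≤ _ := by gcongr; linarith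
      calc 16 * Real.exp (2 * R) * (q : ℝ) ^ 2 ≤ Real.exp 3 * Real.exp (2 * R) * (Real.exp R) ^ 2 := by gcongr
        _ = _ := by rw [← Real.exp_nat_mul, ← Real.exp_add, ← Real.exp_add]; push_cast; ring_nf
    rw [← Real.log_exp (3 + 4 * R)]
    exact Real.log_le_log (by positivity) this
  have h2 : 1 ≤ 2 * (η * y / q) := by
    have : Real.exp R / 4 ≤ η * y / q := by
      rw [le_div_iff₀ hq0]
      calc Real.exp R / 4 * q ≤ Real.exp R / 4 * Real.exp R := by gcongr
        _ = Real.exp (-2 * R) / 4 * Real.exp (4 * R) := by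
          rw [div_mul_eq_mul_div, div_mul_eq_mul_div, ← Real.exp_add, ← Real.exp_add]; ring_nf
        _ ≤ η * y := by gcongr
    have := Real.add_one_le_exp R
    linarith
  have h0 : 0 < η * y / q := by
    have : 0 < y := (Real.exp_pos _).trans hyQ
    positivity
  calc (η * y / q + 1) * (1 + Real.log (4 * q ^ 2 / η)) ≤ (η * y / q + 2 * (η * y / q)) * (1 + (3 + 4 * R)) := by
        have : 0 ≤ Real.log (4 * (q : ℝ) ^ 2 / η) := by
          refine Real.log_nonneg ?_
          rw [le_div_iff₀ hη0]
          have : (1:ℝ) ≤ q := by exact_mod_cast hq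
          nlinarith
        gcongr
    _ ≤ (3 * (η * y / q)) * (8 * R) := by
        have : η * y / q + 2 * (η * y / q) = 3 * (η * y / q) := by ring
        rw [this]; gcongr; linarith
    _ = _ := by ring

lemma small_p {h : ℕ → ℝ} (hh : CM h) (R : ℝ) (hR : 1 ≤ R) (q : ℕ) [NeZero q] (hqR : (q : ℝ) ≤ Real.exp R) (A : ZMod q)
    (hA : IsUnit A) (lam : ℝ) (hl : 1 ≤ lam) (hlR : lam ≤ Real.exp R) (x : ℝ) (hx : Real.exp (20 * R) ≤ x)
    (hxR : Real.log x ≤ Real.exp R) (S : Finset ℕ)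
    (hS : ∀ p ∈ S, (p.Prime ∧ Real.exp (4 * R) < p) ∧ (p : ℝ) ≤ x / Real.exp (20 * R)) :
    ∑ p ∈ S, Real.log p * |EE h q lam (A * (p : ZMod q)⁻¹) (x / p)| ≤
      (x / q) * (24 * R * II h q lam (19 * R) (Real.log x) + 9) := by
  have hq : 1 ≤ q := NeZero.one_le
  have hq0 : (0 : ℝ) < q := by exact_mod_cast hq
  have hx0 : 0 < x := lt_of_lt_of_le (Real.exp_pos _) hx
  set η := Real.exp (-2 * R) / 4 with hη
  have hη0 : 0 < η := by positivity
  have hη4 : η ≤ 1 / 4 := by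
    have : Real.exp (-2 * R) ≤ 1 := Real.exp_le_one_iff.mpr (by linarith)
    rw [hη]; linarith
  set L := Real.log x with hL
  have hL20 : 20 * R ≤ L := by
    rw [hL, ← Real.log_exp (20 * R)]; exact Real.log_le_log (Real.exp_pos _) hx
  have hp0 : ∀ p ∈ S, (0 : ℝ) < p := fun p hp => by exact_mod_cast (hS p hp).1.1.pos
  have hp1 : ∀ p ∈ S, (1 : ℝ) ≤ p := fun p hp => by exact_mod_cast (hS p hp).1.1.one_lt.le
  have hpx : ∀ p ∈ S, (p : ℝ) ≤ x := fun p hp => (hS p hp).2.trans (div_le_self hx0.le (Real.one_le_exp (by linarith)))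
  have hlogp : ∀ p ∈ S, 0 ≤ Real.log p := fun p hp => Real.log_nonneg (hp1 p hp)
  -- smoothing
  have step1 : ∀ p ∈ S, Real.log p * |EE h q lam (A * (p : ZMod q)⁻¹) (x / p)| ≤
      (1 / η) * (∫ v in Set.Ioc (19 * R) L, (Set.Ioc (Real.log (x / p) - η) (Real.log (x / p))).indicator
        (fun v => Real.log p * |EE h q lam (A * (p : ZMod q)⁻¹) (Real.exp v)|) v)
       + (2 * η * (x / q) * (Real.log p / p) + (2 + 2 * lam) * Real.log p) := by
    intro p hp
    have h1 := smooth_one hh q hq lam hl (A * (p : ZMod q)⁻¹) (x / p) η (div_pos hx0 (hp0 p hp)) hη0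
    have hlog : Real.log (x / p) = L - Real.log p := Real.log_div hx0.ne' (hp0 p hp).ne'
    have hsub : Set.Ioc (Real.log (x / p) - η) (Real.log (x / p)) ⊆ Set.Ioc (19 * R) L := by
      apply Set.Ioc_subset_Ioc
      · have : Real.log p ≤ L - 20 * R := by
          rw [hL, ← Real.log_exp (20 * R), ← Real.log_div hx0.ne' (Real.exp_pos _).ne']
          exact Real.log_le_log (hp0 p hp) (hS p hp).2
        linarith
      · have := hlogp p hp; linarith
    rw [setIntegral_indicator measurableSet_Ioc, Set.inter_eq_self_of_subset_right hsub, integral_const_mul]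
    calc _ ≤ Real.log p * _ := mul_le_mul_of_nonneg_left h1 (hlogp p hp)
      _ = _ := by field_simp; ring
  refine (Finset.sum_le_sum step1).trans ?_
  rw [Finset.sum_add_distrib, Finset.sum_add_distrib, ← Finset.mul_sum, ← Finset.mul_sum, ← Finset.mul_sum]
  have hIntg : ∀ p ∈ S, IntegrableOn ((Set.Ioc (Real.log (x / p) - η) (Real.log (x / p))).indicator
        (fun v => Real.log p * |EE h q lam (A * (p : ZMod q)⁻¹) (Real.exp v)|)) (Set.Ioc (19 * R) L) := by
    intro p _
    exact Integrable.indicator ((EE_int hh q hq lam hl _ _ _).const_mul _) measurableSet_Ioc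
  rw [← integral_finsetSum _ hIntg]
  have step2 : ∫ v in Set.Ioc (19 * R) L, ∑ p ∈ S, (Set.Ioc (Real.log (x / p) - η) (Real.log (x / p))).indicator
        (fun v => Real.log p * |EE h q lam (A * (p : ZMod q)⁻¹) (Real.exp v)|) v ≤
      (24 * R * η * (x / q)) * II h q lam (19 * R) L := by
    rw [II, ← integral_const_mul]
    refine setIntegral_mono_on (integrable_finsetSum _ hIntg) ((II_int hh q lam hl _ _).const_mul _) measurableSet_Ioc fun v hv => ?_
    have h1 := window_pt (fun b : ZMod q => |EE h q lam b (Real.exp v)|) (fun b => abs_nonneg _) R hR hqR A hA x hx0.le v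
      (S.filter (fun p : ℕ => v ∈ Set.Ioc (Real.log (x / p) - η) (Real.log (x / p)))) (by
        intro p hp
        rw [Finset.mem_filter, Set.mem_Ioc] at hp
        have hlog : Real.log (x / p) = L - Real.log p := Real.log_div hx0.ne' (hp0 p hp.1).ne'
        rw [hlog] at hp
        have ex : x = Real.exp L := (Real.exp_log hx0).symm
        have ep : (p : ℝ) = Real.exp (Real.log p) := (Real.exp_log (hp0 p hp.1)).symm
        refine ⟨(hS p hp.1).1, ?_, ?_⟩
        · rw [ex, ← Real.exp_add, ← Real.exp_add, ep]
          exact Real.exp_lt_exp.mpr (by rw [← hη]; linarith [hp.2.1])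
        · rw [ex, ← Real.exp_add, ep]
          exact Real.exp_le_exp.mpr (by linarith [hp.2.2]))
    have e1 : ∑ p ∈ S, (Set.Ioc (Real.log (x / p) - η) (Real.log (x / p))).indicator
        (fun v => Real.log p * |EE h q lam (A * (p : ZMod q)⁻¹) (Real.exp v)|) v = 
        ∑ p ∈ S.filter (fun p : ℕ => v ∈ Set.Ioc (Real.log (x / p) - η) (Real.log (x / p))), Real.log p * |EE h q lam (A * (p : ZMod q)⁻¹) (Real.exp v)| := by
      rw [Finset.sum_filter]
      exact Finset.sum_congr rfl fun p _ => by rw [Set.indicator_apply]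
    rw [e1]
    refine h1.trans (le_of_eq ?_)
    rw [Finset.mul_sum]
    refine Finset.sum_congr rfl fun b _ => ?_
    rw [← hη]; ring
  have hSsub : S ⊆ Icc 1 ⌊x⌋₊ := by
    intro p hp
    rw [Finset.mem_Icc]
    exact ⟨(hS p hp).1.1.one_lt.le, Nat.le_floor (hpx p hp)⟩
  have hL0 : 0 ≤ L := by linarith
  have step3 : ∑ p ∈ S, Real.log p / p ≤ 2 * Real.exp (2 * R) := by
    calc ∑ p ∈ S, Real.log p / p ≤ ∑ p ∈ S, L * (1 / p : ℝ) := by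
          refine Finset.sum_le_sum fun p hp => ?_
          rw [mul_one_div]
          have := hp0 p hp
          gcongr
          exact Real.log_le_log this (hpx p hp)
      _ ≤ ∑ p ∈ Icc 1 ⌊x⌋₊, L * (1 / p : ℝ) :=
          Finset.sum_le_sum_of_subset_of_nonneg hSsub fun p _ _ => by positivity
      _ ≤ L * (1 + L) := by
          rw [← Finset.mul_sum]
          gcongr
          refine (harm_le _).trans ?_
          gcongr
          rw [hL]
          refine Real.log_le_log ?_ (Nat.floor_le hx0.le)
          exact_mod_cast Nat.floor_pos.mpr ((Real.one_le_exp (by linarith)).trans hx)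
      _ ≤ Real.exp R * (Real.exp R + Real.exp R) := by
          have := Real.one_le_exp (show 0 ≤ R by linarith)
          gcongr
      _ = _ := by rw [← two_mul, mul_left_comm, ← Real.exp_add]; ring_nf
  have step4 : ∑ p ∈ S, Real.log p ≤ 2 * (x / Real.exp (20 * R)) := by
    have h1 := Chebyshev.theta_le_log4_mul_x (x := x / Real.exp (20 * R)) (by positivity)
    have hl4 : Real.log 4 ≤ 2 := by
      have : Real.log 4 = 2 * Real.log 2 := by
        rw [show (4:ℝ) = 2 ^ 2 by norm_num, Real.log_pow]; norm_num
      have := Real.log_two_lt_d9; linarith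
    have h2 : ∑ p ∈ S, Real.log p ≤ Chebyshev.theta (x / Real.exp (20 * R)) := by
      rw [Chebyshev.theta]
      refine Finset.sum_le_sum_of_subset_of_nonneg (fun p hp => ?_) fun p _ _ => Real.log_natCast_nonneg p
      simp only [Finset.mem_filter, Finset.mem_Ioc]
      exact ⟨⟨(hS p hp).1.1.pos, Nat.le_floor (hS p hp).2⟩, (hS p hp).1.1⟩
    have : 0 ≤ x / Real.exp (20 * R) := by positivity
    nlinarith
  have t1 : (1 / η) * ((24 * R * η * (x / q)) * II h q lam (19 * R) L) = (x / q) * (24 * R * II h q lam (19 * R) L) := by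
    field_simp
  have t2 : 2 * η * (x / q) * (2 * Real.exp (2 * R)) = x / q := by
    rw [hη, show -2 * R = -(2 * R) by ring, Real.exp_neg]; field_simp; norm_num
  have t3 : (2 + 2 * lam) * (2 * (x / Real.exp (20 * R))) ≤ 8 * (x / q) := by
    have : lam * (x / Real.exp (20 * R)) ≤ x / q := by
      rw [le_div_iff₀ hq0]
      calc lam * (x / Real.exp (20 * R)) * q ≤ Real.exp R * (x / Real.exp (20 * R)) * Real.exp R := by gcongr
        _ = x * (Real.exp (2 * R) / Real.exp (20 * R)) := by
          rw [show 2 * R = R + R by ring, Real.exp_add]; ring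
        _ ≤ x * 1 := by
          gcongr
          rw [div_le_one (Real.exp_pos _)]
          exact Real.exp_le_exp.mpr (by linarith)
        _ = x := mul_one x
    have h0 : 0 ≤ x / Real.exp (20 * R) := by positivity
    nlinarith
  have s2 := mul_le_mul_of_nonneg_left step2 (show 0 ≤ 1 / η by positivity)
  have s3 := mul_le_mul_of_nonneg_left step3 (show 0 ≤ 2 * η * (x / q) by positivity)
  have s4 := mul_le_mul_of_nonneg_left step4 (show 0 ≤ 2 + 2 * lam by linarith)
  rw [t1] at s2
  rw [t2] at s3
  linarith

lemma pointwise_stage : ∃ C : ℝ, 0 < C ∧ ∀ {h : ℕ → ℝ} (_ : CM h) (R : ℝ) (_ : 1 ≤ R) (q : ℕ) [NeZero q] (_ : (q : ℝ) ≤ Real.exp R) (A : ZMod q)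
    (_ : IsUnit A) (lam : ℝ) (_ : 1 ≤ lam) (_ : lam ≤ Real.exp R) (x : ℝ) (_ : Real.exp (20 * R) ≤ x)
    (_ : Real.log x ≤ Real.exp R),
    |EE h q lam A x| * Real.log x ≤ C * (x / q) * (R ^ 2 + R * II h q lam (19 * R) (Real.log x)) := by
  obtain ⟨C, hC, H⟩ := E_log
  refine ⟨C + 600, by positivity, fun {h} hh R hR q _ hqR A hA lam hl hlR x hx hxR => ?_⟩
  have hq : 1 ≤ q := NeZero.one_le
  have hq0 : (0 : ℝ) < q := by exact_mod_cast hq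
  have hl0 : 0 < lam := by linarith
  have hx0 : 0 < x := lt_of_lt_of_le (Real.exp_pos _) hx
  have hx1 : 1 ≤ x := (Real.one_le_exp (by linarith)).trans hx
  have h1 := H hh R hR q hq hqR A hA lam hl hlR x (le_trans (Real.exp_le_exp.mpr (by linarith)) hx) hxR
  set Q := Real.exp (4 * R) with hQ
  have hqQ : (q : ℝ) ≤ Q := hqR.trans (Real.exp_le_exp.mpr (by linarith))
  set P := (Icc 1 ⌊x⌋₊).filter (fun p : ℕ => p.Prime ∧ Q < p) with hP
  have h2 : |ET h Q q lam A x| ≤ ∑ p ∈ P, Real.log p * |EE h q lam (A * (p : ZMod q)⁻¹) (x / p)| := by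
    rw [ET_conv hh Q q hq hqQ lam hl A x hx0.le]
    refine (Finset.abs_sum_le_sum_abs _ _).trans (Finset.sum_le_sum fun p _ => ?_)
    rw [abs_mul, abs_mul, abs_of_nonneg (hh.nonneg p), abs_of_nonneg (Real.log_natCast_nonneg p)]
    gcongr
    exact mul_le_of_le_one_left (Real.log_natCast_nonneg p) (hh.le_one p)
  rw [← Finset.sum_filter_add_sum_filter_not P (fun p : ℕ => x / Real.exp (20 * R) < p)] at h2
  have h3 := small_p hh R hR q hqR A hA lam hl hlR x hx hxR (P.filter (fun p : ℕ => ¬ x / Real.exp (20 * R) < p)) (by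
    intro p hp
    simp only [hP, Finset.mem_filter] at hp
    exact ⟨hp.1.2, not_lt.mp hp.2⟩)
  have hlogq : Real.log q ≤ R := by
    rw [← Real.log_exp R]; exact Real.log_le_log hq0 hqR
  have h4 : ∑ p ∈ P.filter (fun p : ℕ => x / Real.exp (20 * R) < p), Real.log p * |EE h q lam (A * (p : ZMod q)⁻¹) (x / p)| ≤
      2 * ((1 + 20 * R) * (2 * (x / q) * (4 + 2 * R))) := by
    have b1 := big_p Q q hq hqQ A hA x (Real.exp (20 * R)) hx0 (Real.one_le_exp (by linarith))
    have b2 := big_p Q q hq hqQ A hA (x / lam) (Real.exp (20 * R)) (by positivity) (Real.one_le_exp (by linarith))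
    rw [Real.log_exp] at b1 b2
    have c1 : ∑ p ∈ P.filter (fun p : ℕ => x / Real.exp (20 * R) < p), Real.log p * |EE h q lam (A * (p : ZMod q)⁻¹) (x / p)| ≤
       ∑ p ∈ P.filter (fun p : ℕ => x / Real.exp (20 * R) < p), Real.log p * (cls q (A * (p : ZMod q)⁻¹) (x / p)).card +
       lam * ∑ p ∈ P.filter (fun p : ℕ => x / Real.exp (20 * R) < p), Real.log p * (cls q (A * (p : ZMod q)⁻¹) (x / lam / p)).card := by
      rw [Finset.mul_sum, ← Finset.sum_add_distrib]
      refine Finset.sum_le_sum fun p _ => ?_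
      have := mul_le_mul_of_nonneg_left (EE_abs_le hh q lam hl0.le (A * (p : ZMod q)⁻¹) (x / p)) (Real.log_natCast_nonneg p)
      rw [div_right_comm x lam]
      linarith
    have c2 : P.filter (fun p : ℕ => x / Real.exp (20 * R) < p) = (Icc 1 ⌊x⌋₊).filter (fun p : ℕ => (p.Prime ∧ Q < p) ∧ x / Real.exp (20 * R) < p) := by
      rw [hP, Finset.filter_filter]
    have c3 : ∑ p ∈ P.filter (fun p : ℕ => x / Real.exp (20 * R) < p), Real.log p * ((cls q (A * (p : ZMod q)⁻¹) (x / lam / p)).card : ℝ) ≤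
       ∑ p ∈ (Icc 1 ⌊x / lam⌋₊).filter (fun p : ℕ => (p.Prime ∧ Q < p) ∧ x / lam / Real.exp (20 * R) < p), Real.log p * ((cls q (A * (p : ZMod q)⁻¹) (x / lam / p)).card : ℝ) := by
      rw [← Finset.sum_filter_ne_zero]
      refine Finset.sum_le_sum_of_subset_of_nonneg (fun p hp' => ?_) fun p _ _ => mul_nonneg (Real.log_natCast_nonneg p) (Nat.cast_nonneg _)
      obtain ⟨hp, hne⟩ := Finset.mem_filter.mp hp'
      simp only [hP, Finset.mem_filter, Finset.mem_Icc] at hp ⊢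
      have hp0 : (0 : ℝ) < p := by exact_mod_cast hp.1.1.1
      refine ⟨⟨hp.1.1.1, ?_⟩, hp.1.2, ?_⟩
      · by_contra hcon
        apply hne
        have : cls q (A * (p : ZMod q)⁻¹) (x / lam / p) = ∅ := by
          have hlt : x / lam < p := by
            by_contra hc
            exact hcon (Nat.le_floor (not_lt.mp hc))
          have : ⌊x / lam / p⌋₊ = 0 := Nat.floor_eq_zero.mpr (by rw [div_lt_one hp0]; exact hlt)
          rw [cls, this]; rfl
        rw [this]; simp
      · refine lt_of_le_of_lt ?_ hp.2
        gcongr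
        exact div_le_self hx0.le hl
    rw [c2] at c1 c3
    rw [c2]
    have c4 : lam * ((1 + 20 * R) * (2 * (x / lam / q) * (4 + 2 * Real.log q))) = (1 + 20 * R) * (2 * (x / q) * (4 + 2 * Real.log q)) := by
      field_simp
    have c5 := mul_le_mul_of_nonneg_left (c3.trans b2) hl0.le
    rw [c4] at c5
    have c6 : (1 + 20 * R) * (2 * (x / q) * (4 + 2 * Real.log q)) ≤ (1 + 20 * R) * (2 * (x / q) * (4 + 2 * R)) := by gcongr
    linarith
  have h5 : |EE h q lam A x| * Real.log x ≤ |ET h Q q lam A x| + C * (x / q) * R ^ 2 := by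
    have := abs_sub_abs_le_abs_sub (EE h q lam A x * Real.log x) (ET h Q q lam A x)
    rw [abs_mul, abs_of_nonneg (Real.log_nonneg hx1)] at this
    linarith
  have hII : 0 ≤ II h q lam (19 * R) (Real.log x) := by
    refine setIntegral_nonneg measurableSet_Ioc fun v _ => Finset.sum_nonneg fun b _ => by positivity
  have hxq : 0 < x / q := by positivity
  have e2 : 2 * ((1 + 20 * R) * (2 * (x / q) * (4 + 2 * R))) ≤ (x / q) * (504 * R ^ 2) := by
    have : 2 * ((1 + 20 * R) * (2 * (x / q) * (4 + 2 * R))) = (x / q) * (4 * ((1 + 20 * R) * (4 + 2 * R))) := by ring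
    rw [this]
    exact mul_le_mul_of_nonneg_left (by nlinarith) hxq.le
  have e3 : (x / q) * 9 ≤ (x / q) * (9 * R ^ 2) := by gcongr; nlinarith
  have e4 : 0 ≤ (x / q) * (R * II h q lam (19 * R) (Real.log x)) := by positivity
  have e5 : 0 ≤ C * ((x / q) * (R * II h q lam (19 * R) (Real.log x))) := by positivity
  have e6 : 0 ≤ (x / q) * R ^ 2 := by positivity
  nlinarith

end S18

namespace S18

/-- Dirichlet series twisted by a character. -/
def Dser (f : ℕ → ℝ) {q : ℕ} (χ : DirichletCharacter ℂ q) (s : ℂ) : ℂ :=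
  ∑' n : ℕ, (χ n * f n) * Complex.exp (-s * (Real.log n : ℝ))

/-- summatory function in residue classes -/
def Tf (f : ℕ → ℝ) (q : ℕ) (b : ZMod q) (u : ℝ) : ℝ := ∑ n ∈ cls q b u, f n

lemma Tf_char (f : ℕ → ℝ) (hf0 : f 0 = 0) (q : ℕ) [NeZero q] (χ : DirichletCharacter ℂ q) (m v : ℝ) :
    HasSum (fun n : ℕ => if Real.log n + m ≤ v then χ n * f n else 0)
      (∑ b : ZMod q, χ b * (Tf f q b (Real.exp (v - m)) : ℝ)) := by
  have h1 : ∑ b : ZMod q, χ b * (Tf f q b (Real.exp (v - m)) : ℝ) =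
      ∑ n ∈ Icc 1 ⌊Real.exp (v - m)⌋₊, (if Real.log n + m ≤ v then χ n * f n else 0) := by
    have : ∀ b : ZMod q, χ b * (Tf f q b (Real.exp (v - m)) : ℝ) =
        ∑ n ∈ (Icc 1 ⌊Real.exp (v - m)⌋₊).filter (fun n : ℕ => (n : ZMod q) = b), (if Real.log n + m ≤ v then χ n * f n else 0) := by
      intro b
      rw [Tf, cls]
      push_cast
      rw [Finset.mul_sum]
      refine Finset.sum_congr rfl fun n hn => ?_
      simp only [Finset.mem_filter, Finset.mem_Icc] at hn
      have hn0 : (0 : ℝ) < n := by exact_mod_cast hn.1.1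
      have : Real.log n + m ≤ v := by
        have h2 : (n : ℝ) ≤ Real.exp (v - m) := (Nat.cast_le.mpr hn.1.2).trans (Nat.floor_le (Real.exp_pos _).le)
        have h3 := Real.log_le_log hn0 h2
        rw [Real.log_exp] at h3
        linarith
      rw [if_pos this, hn.2]
    rw [Finset.sum_congr rfl fun b _ => this b, Finset.sum_fiberwise]
  rw [h1]
  refine hasSum_sum_of_ne_finset_zero fun n hn => ?_
  rcases Nat.eq_zero_or_pos n with rfl | hn0
  · simp [hf0]
  · rw [if_neg]
    intro hle
    apply hn
    rw [Finset.mem_Icc]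
    refine ⟨hn0, Nat.le_floor ?_⟩
    have hn0' : (0 : ℝ) < n := by exact_mod_cast hn0
    rw [← Real.log_le_iff_le_exp hn0']
    linarith

lemma P1_char (f : ℕ → ℝ) (hf0 : f 0 = 0) (q : ℕ) [NeZero q] (χ : DirichletCharacter ℂ q) (m κ c : ℝ) (hc : 0 < c)
    (hs : Summable fun n : ℕ => |f n| * Real.exp (-c * Real.log n)) :
    Integrable (fun v : ℝ => ‖∑ b : ZMod q, χ b * ((Tf f q b (Real.exp v) - κ * Tf f q b (Real.exp (v - m)) : ℝ) : ℂ)‖ ^ 2 * Real.exp (-2 * c * v)) ∧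
    Integrable (fun t : ℝ => ‖Dser f χ (c + t * Complex.I) * (1 - κ * Complex.exp (-(c + t * Complex.I) * m))‖ ^ 2 * (1 / (c ^ 2 + t ^ 2))) ∧
    (2 * Real.pi) * ∫ v : ℝ, ‖∑ b : ZMod q, χ b * ((Tf f q b (Real.exp v) - κ * Tf f q b (Real.exp (v - m)) : ℝ) : ℂ)‖ ^ 2 * Real.exp (-2 * c * v)
      = ∫ t : ℝ, ‖Dser f χ (c + t * Complex.I) * (1 - κ * Complex.exp (-(c + t * Complex.I) * m))‖ ^ 2 * (1 / (c ^ 2 + t ^ 2)) := by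
  set a : ℕ ⊕ ℕ → ℂ := Sum.elim (fun n : ℕ => χ n * f n) (fun n : ℕ => -κ * (χ n * f n)) with ha
  set μ : ℕ ⊕ ℕ → ℝ := Sum.elim (fun n : ℕ => Real.log n) (fun n : ℕ => Real.log n + m) with hμ
  have hsχ : Summable fun n : ℕ => ‖χ n * (f n : ℂ)‖ * Real.exp (-c * Real.log n) := by
    refine Summable.of_nonneg_of_le (fun n => by positivity) (fun n => ?_) hs
    gcongr
    rw [norm_mul, Complex.norm_real, Real.norm_eq_abs]
    exact mul_le_of_le_one_left (abs_nonneg _) (χ.norm_le_one _)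
  have hsum : Summable (fun i => ‖a i‖ * Real.exp (-c * μ i)) := by
    refine Summable.sum _ ?_ ?_
    · exact hsχ
    · have h2 := hsχ.mul_left (|κ| * Real.exp (-c * m))
      refine h2.congr fun n => ?_
      simp only [ha, hμ, Function.comp, Sum.elim_inr, norm_mul, norm_neg, Complex.norm_real, Real.norm_eq_abs, mul_add, Real.exp_add]
      ring
  have key := plancherel_step a μ c hc hsum
  have e1 : ∀ v : ℝ, ∑' i, (if μ i ≤ v then a i else 0) = ∑ b : ZMod q, χ b * ((Tf f q b (Real.exp v) - κ * Tf f q b (Real.exp (v - m)) : ℝ) : ℂ) := by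
    intro v
    have h1 := Tf_char f hf0 q χ 0 v
    have h2 := (Tf_char f hf0 q χ m v).mul_left (-(κ : ℂ))
    simp only [sub_zero, add_zero] at h1
    have h3 : HasSum (fun i => (if μ i ≤ v then a i else 0)) (_ + _) := HasSum.sum (f := (fun i => (if μ i ≤ v then a i else 0))) h1 (by
      refine h2.congr_fun ?_
      intro n
      simp only [ha, hμ, Function.comp, Sum.elim_inr]
      split_ifs <;> simp)
    rw [h3.tsum_eq, Finset.mul_sum, ← Finset.sum_add_distrib]
    refine Finset.sum_congr rfl fun b _ => ?_
    push_cast; ring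
  have e2 : ∀ t : ℝ, ∑' i, a i * Complex.exp (-(c + t * Complex.I) * μ i) = Dser f χ (c + t * Complex.I) * (1 - κ * Complex.exp (-(c + t * Complex.I) * m)) := by
    intro t
    have hsD : Summable fun n : ℕ => (χ n * f n) * Complex.exp (-(c + t * Complex.I) * (Real.log n : ℝ)) := by
      refine Summable.of_norm (hsχ.congr fun n => ?_)
      generalize Real.log (n : ℝ) = L
      rw [norm_mul (χ n * (f n : ℂ)), Complex.norm_exp]
      simp
    have h1 := hsD.hasSum
    have h2 := h1.mul_left (-(κ : ℂ) * Complex.exp (-(c + t * Complex.I) * m))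
    have h3 : HasSum (fun i => a i * Complex.exp (-(c + t * Complex.I) * μ i)) (_ + _) := HasSum.sum (f := (fun i => a i * Complex.exp (-(c + t * Complex.I) * μ i))) h1 (by
      refine h2.congr_fun ?_
      intro n
      simp only [ha, hμ, Function.comp, Sum.elim_inr]
      push_cast
      rw [mul_add, Complex.exp_add]; ring)
    rw [h3.tsum_eq, Dser]; ring
  simp only [e1, e2] at key
  exact key

lemma P2_sum (f : ℕ → ℝ) (hf0 : f 0 = 0) (q : ℕ) [NeZero q] (m κ c : ℝ) (hc : 0 < c)
    (hs : Summable fun n : ℕ => |f n| * Real.exp (-c * Real.log n)) :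
    Integrable (fun v : ℝ => (q.totient : ℝ) * ∑ b ∈ (univ : Finset (ZMod q)).filter IsUnit, (Tf f q b (Real.exp v) - κ * Tf f q b (Real.exp (v - m))) ^ 2 * Real.exp (-2 * c * v)) ∧
    (2 * Real.pi) * ∫ v : ℝ, (q.totient : ℝ) * ∑ b ∈ (univ : Finset (ZMod q)).filter IsUnit, (Tf f q b (Real.exp v) - κ * Tf f q b (Real.exp (v - m))) ^ 2 * Real.exp (-2 * c * v)
      = ∫ t : ℝ, ∑ χ : DirichletCharacter ℂ q, ‖Dser f χ (c + t * Complex.I) * (1 - κ * Complex.exp (-(c + t * Complex.I) * m))‖ ^ 2 * (1 / (c ^ 2 + t ^ 2)) := by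
  have key := fun χ : DirichletCharacter ℂ q => P1_char f hf0 q χ m κ c hc hs
  have e : (fun v : ℝ => (q.totient : ℝ) * ∑ b ∈ (univ : Finset (ZMod q)).filter IsUnit, (Tf f q b (Real.exp v) - κ * Tf f q b (Real.exp (v - m))) ^ 2 * Real.exp (-2 * c * v))
      = fun v : ℝ => ∑ χ : DirichletCharacter ℂ q, ‖∑ b : ZMod q, χ b * ((Tf f q b (Real.exp v) - κ * Tf f q b (Real.exp (v - m)) : ℝ) : ℂ)‖ ^ 2 * Real.exp (-2 * c * v) := by
    funext v
    have := parseval_chars q (fun b => ((Tf f q b (Real.exp v) - κ * Tf f q b (Real.exp (v - m)) : ℝ) : ℂ))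
    rw [← Finset.sum_mul, ← Finset.sum_mul, this]
    simp only [Complex.norm_real, Real.norm_eq_abs, sq_abs]
    ring
  rw [e]
  refine ⟨integrable_finsetSum _ fun χ _ => (key χ).1, ?_⟩
  rw [integral_finsetSum _ fun χ _ => (key χ).1, integral_finsetSum _ fun χ _ => (key χ).2.1, Finset.mul_sum]
  exact Finset.sum_congr rfl fun χ _ => (key χ).2.2

end S18

namespace S18

lemma zeta_part (σ : ℝ) (hσ : 0 < σ) (N : ℕ) :
    ∑ n ∈ Icc 1 N, Real.exp (-(1 + σ) * Real.log n) ≤ 1 + 1 / σ := by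
  have key : ∀ N : ℕ, 1 ≤ N → ∑ n ∈ Icc 1 N, Real.exp (-(1 + σ) * Real.log n) ≤ 1 + 1 / σ - (1 / σ) * Real.exp (-σ * Real.log N) := by
    intro N hN
    induction N, hN using Nat.le_induction with
    | base => simp
    | succ n hn ih =>
      rw [Finset.sum_Icc_succ_top (by omega)]
      have hn0 : (0 : ℝ) < n := by exact_mod_cast hn
      have h1 : Real.log ((n + 1 : ℕ) : ℝ) - Real.log n ≥ 1 / (n + 1) := by
        have h2 := Real.log_le_sub_one_of_pos (show (0 : ℝ) < n / (n + 1) by positivity)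
        rw [Real.log_div (by positivity) (by positivity)] at h2
        have h3 : (n : ℝ) / (n + 1) - 1 = - (1 / (n + 1)) := by field_simp; ring
        push_cast
        linarith
      have h4 : Real.exp (-σ * Real.log n) = Real.exp (-σ * Real.log ((n + 1 : ℕ) : ℝ)) * Real.exp (σ * (Real.log ((n + 1 : ℕ) : ℝ) - Real.log n)) := by
        rw [← Real.exp_add]; ring_nf
      have h5 : Real.exp (-(1 + σ) * Real.log ((n + 1 : ℕ) : ℝ)) = Real.exp (-σ * Real.log ((n + 1 : ℕ) : ℝ)) * (1 / (n + 1)) := by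
        rw [show -(1 + σ) * Real.log ((n + 1 : ℕ) : ℝ) = -σ * Real.log ((n + 1 : ℕ) : ℝ) - Real.log ((n + 1 : ℕ) : ℝ) by ring, Real.exp_sub, Real.exp_log (by positivity)]
        push_cast; ring
      have h6 : 1 + σ * (1 / (n + 1)) ≤ Real.exp (σ * (Real.log ((n + 1 : ℕ) : ℝ) - Real.log n)) := by
        have := Real.add_one_le_exp (σ * (Real.log ((n + 1 : ℕ) : ℝ) - Real.log n))
        have h7 : σ * (1 / (n + 1)) ≤ σ * (Real.log ((n + 1 : ℕ) : ℝ) - Real.log n) := by gcongr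
        linarith
      have h8 : Real.exp (-σ * Real.log ((n + 1 : ℕ) : ℝ)) * (1 + σ * (1 / (n + 1))) ≤ Real.exp (-σ * Real.log n) := by
        rw [h4]; gcongr
      have h9 : (1 / σ) * (Real.exp (-σ * Real.log ((n + 1 : ℕ) : ℝ)) * (1 + σ * (1 / (n + 1)))) ≤ (1 / σ) * Real.exp (-σ * Real.log n) := by gcongr
      have h10 : (1 / σ) * (Real.exp (-σ * Real.log ((n + 1 : ℕ) : ℝ)) * (1 + σ * (1 / (n + 1)))) = (1 / σ) * Real.exp (-σ * Real.log ((n + 1 : ℕ) : ℝ)) + Real.exp (-σ * Real.log ((n + 1 : ℕ) : ℝ)) * (1 / (n + 1)) := by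
        field_simp
      rw [h5]
      linarith
  rcases Nat.eq_zero_or_pos N with rfl | hN
  · simp; positivity
  · have := key N hN
    have h2 : 0 ≤ (1 / σ) * Real.exp (-σ * Real.log N) := by positivity
    linarith

lemma dser_bd (f : ℕ → ℝ) (hf0 : f 0 = 0) (K τ σ : ℝ) (hσ : 0 < σ) (hK : 0 ≤ K)
    (hf : ∀ n : ℕ, 1 ≤ n → |f n| ≤ K * Real.exp (τ * Real.log n)) :
    (Summable fun n : ℕ => |f n| * Real.exp (-(1 + τ + σ) * Real.log n)) ∧
    ∑' n : ℕ, |f n| * Real.exp (-(1 + τ + σ) * Real.log n) ≤ K * (1 + 1 / σ) := by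
  have hnn : ∀ n : ℕ, 0 ≤ |f n| * Real.exp (-(1 + τ + σ) * Real.log n) := fun n => by positivity
  have hb : ∀ N : ℕ, ∑ n ∈ range N, |f n| * Real.exp (-(1 + τ + σ) * Real.log n) ≤ K * (1 + 1 / σ) := by
    intro N
    calc ∑ n ∈ range N, |f n| * Real.exp (-(1 + τ + σ) * Real.log n)
        ≤ ∑ n ∈ Icc 1 N, |f n| * Real.exp (-(1 + τ + σ) * Real.log n) := by
          have : ∑ n ∈ Icc 0 N, |f n| * Real.exp (-(1 + τ + σ) * Real.log n) = ∑ n ∈ Icc 1 N, |f n| * Real.exp (-(1 + τ + σ) * Real.log n) := by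
            symm
            refine Finset.sum_subset (Finset.Icc_subset_Icc_left (by omega)) fun n hn hn' => ?_
            have : n = 0 := by simp at hn hn'; omega
            rw [this, hf0]; simp
          rw [← this]
          refine Finset.sum_le_sum_of_subset_of_nonneg (fun n hn => ?_) fun n _ _ => hnn n
          simp at hn ⊢; omega
      _ ≤ ∑ n ∈ Icc 1 N, K * Real.exp (-(1 + σ) * Real.log n) := by
          refine Finset.sum_le_sum fun n hn => ?_
          have h1 := hf n (Finset.mem_Icc.mp hn).1
          calc |f n| * Real.exp (-(1 + τ + σ) * Real.log n) ≤ K * Real.exp (τ * Real.log n) * Real.exp (-(1 + τ + σ) * Real.log n) := by gcongr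
            _ = K * Real.exp (-(1 + σ) * Real.log n) := by
              rw [mul_assoc, ← Real.exp_add]; ring_nf
      _ ≤ K * (1 + 1 / σ) := by
          rw [← Finset.mul_sum]
          gcongr
          exact zeta_part σ hσ N
  exact ⟨summable_of_sum_range_le hnn hb, Real.tsum_le_of_sum_range_le hnn hb⟩

lemma norm_Dser_term (f : ℕ → ℝ) {q : ℕ} (χ : DirichletCharacter ℂ q) (c t : ℝ) (n : ℕ) :
    ‖(χ n * f n) * Complex.exp (-(c + t * Complex.I) * (Real.log n : ℝ))‖ ≤ |f n| * Real.exp (-c * Real.log n) := by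
  generalize Real.log (n : ℝ) = L
  rw [norm_mul (χ n * (f n : ℂ)), Complex.norm_exp, norm_mul, Complex.norm_real, Real.norm_eq_abs]
  have : ((-(c + t * Complex.I) * (L : ℂ))).re = -c * L := by simp
  rw [this]
  gcongr
  exact mul_le_of_le_one_left (abs_nonneg _) (χ.norm_le_one _)

lemma Dser_summable (f : ℕ → ℝ) {q : ℕ} (χ : DirichletCharacter ℂ q) (c t : ℝ)
    (hs : Summable fun n : ℕ => |f n| * Real.exp (-c * Real.log n)) :
    Summable fun n : ℕ => (χ n * f n) * Complex.exp (-(c + t * Complex.I) * (Real.log n : ℝ)) :=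
  Summable.of_norm_bounded hs fun n => norm_Dser_term f χ c t n

lemma Dser_norm_le (f : ℕ → ℝ) {q : ℕ} (χ : DirichletCharacter ℂ q) (c t : ℝ)
    (hs : Summable fun n : ℕ => |f n| * Real.exp (-c * Real.log n)) :
    ‖Dser f χ (c + t * Complex.I)‖ ≤ ∑' n : ℕ, |f n| * Real.exp (-c * Real.log n) :=
  tsum_of_norm_bounded hs.hasSum fun n => norm_Dser_term f χ c t n

lemma Dser_term_eq (f : ℕ → ℝ) (hf0 : f 0 = 0) {q : ℕ} (χ : DirichletCharacter ℂ q) (s : ℂ) :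
    (fun n : ℕ => (χ n * f n) * Complex.exp (-s * (Real.log n : ℝ))) = LSeries.term (fun n : ℕ => χ n * f n) s := by
  funext n
  rcases Nat.eq_zero_or_pos n with rfl | hn
  · simp [hf0]
  · rw [LSeries.term_of_ne_zero (by omega), Complex.cpow_def_of_ne_zero (by exact_mod_cast (by omega : n ≠ 0)),
      Complex.natCast_log, div_eq_mul_inv, ← Complex.exp_neg]
    ring_nf

/-- prime part -/
def gg (h : ℕ → ℝ) (Q : ℝ) (n : ℕ) : ℝ := if n.Prime ∧ Q < n then h n * Real.log n else 0

lemma Dser_conv {h : ℕ → ℝ} (hh : CM h) (Q : ℝ) {q : ℕ} (χ : DirichletCharacter ℂ q) (c t : ℝ)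
    (hs : Summable fun n : ℕ => |h n| * Real.exp (-c * Real.log n))
    (hg : Summable fun n : ℕ => |gg h Q n| * Real.exp (-c * Real.log n)) :
    Dser (fun n => h n * ell Q n) χ (c + t * Complex.I) = Dser h χ (c + t * Complex.I) * Dser (gg h Q) χ (c + t * Complex.I) := by
  have hg0 : gg h Q 0 = 0 := by simp [gg]
  have h1 : LSeriesSummable (fun n : ℕ => χ n * (h n : ℂ)) (c + t * Complex.I) := by
    rw [LSeriesSummable, ← Dser_term_eq h hh.zero]
    exact Dser_summable h χ c t hs
  have h2 : LSeriesSummable (fun n : ℕ => χ n * (gg h Q n : ℂ)) (c + t * Complex.I) := by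
    rw [LSeriesSummable, ← Dser_term_eq _ hg0]
    exact Dser_summable _ χ c t hg
  have h3 := LSeries_convolution' h1 h2
  rw [Dser, Dser_term_eq _ (by simp [hh.zero]), Dser, Dser_term_eq _ hh.zero, Dser, Dser_term_eq _ hg0]
  rw [LSeries, LSeries, LSeries] at h3
  rw [← h3]
  congr 2
  funext n
  rw [LSeries.convolution_def]
  beta_reduce
  rw [Nat.sum_divisorsAntidiagonal' (f := fun d e : ℕ => χ d * (h d : ℂ) * (χ e * (gg h Q e : ℂ)))]
  have h4 : ∀ e ∈ n.divisors, χ ((n / e : ℕ) : ZMod q) * (h (n / e) : ℂ) * (χ e * (gg h Q e : ℂ)) =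
      χ n * (h n : ℂ) * ((if e.Prime ∧ Q < e then Real.log e else 0 : ℝ) : ℂ) := by
    intro e he
    have hd : n / e * e = n := Nat.div_mul_cancel (Nat.dvd_of_mem_divisors he)
    have e1 : χ (n : ZMod q) = χ ((n / e : ℕ) : ZMod q) * χ (e : ZMod q) := by
      rw [← map_mul, ← Nat.cast_mul, hd]
    have e2 : h n = h (n / e) * h e := by rw [← hh.mul, hd]
    rw [gg, e1, e2]
    split_ifs <;> push_cast <;> ring
  rw [Finset.sum_congr rfl h4, ← Finset.mul_sum, ← Complex.ofReal_sum]
  push_cast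
  rw [mul_assoc]
  congr 2
  norm_cast
  rw [ell, ← Finset.sum_filter]
  refine Finset.sum_congr ?_ fun _ _ => rfl
  ext p
  simp [Nat.mem_primeFactors]
  tauto

end S18

namespace S18

lemma card_units_filter (q : ℕ) [NeZero q] : (((univ : Finset (ZMod q)).filter IsUnit).card : ℝ) = q.totient := by
  have : ((univ : Finset (ZMod q)).filter IsUnit).card = q.totient := by
    rw [← ZMod.card_units_eq_totient, ← Finset.card_univ (α := (ZMod q)ˣ)]
    symm
    refine Finset.card_bij (fun u _ => (u : ZMod q)) ?_ ?_ ?_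
    · intro u _; simp
    · intro u _ v _ huv; exact Units.ext huv
    · intro b hb
      obtain ⟨u, hu⟩ := (Finset.mem_filter.mp hb).2
      exact ⟨u, Finset.mem_univ _, hu⟩
  rw [this]

lemma theta_pt {h : ℕ → ℝ} (hh : CM h) (R : ℝ) (hR : 1 ≤ R) (q : ℕ) (hq : 1 ≤ q) (hqR : (q : ℝ) ≤ Real.exp R) (b : ZMod q) (u : ℝ) (hu : 0 < u) :
    0 ≤ Tf (gg h (Real.exp (4 * R))) q b u ∧ Tf (gg h (Real.exp (4 * R))) q b u ≤ 12 * R * (u / q) := by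
  have hq0 : (0 : ℝ) < q := by exact_mod_cast hq
  have hgn : ∀ n, 0 ≤ gg h (Real.exp (4 * R)) n := by
    intro n
    rw [gg]
    split_ifs
    · exact mul_nonneg (hh.nonneg n) (Real.log_natCast_nonneg n)
    · exact le_rfl
  refine ⟨Finset.sum_nonneg fun n _ => hgn n, ?_⟩
  set S := (cls q b u).filter (fun p : ℕ => p.Prime ∧ Real.exp (4 * R) < p) with hS
  have h1 : Tf (gg h (Real.exp (4 * R))) q b u ≤ ∑ p ∈ S, Real.log p := by
    rw [Tf, hS, Finset.sum_filter]
    refine Finset.sum_le_sum fun n _ => ?_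
    rw [gg]
    split_ifs
    · exact mul_le_of_le_one_left (Real.log_natCast_nonneg n) (hh.le_one n)
    · exact le_rfl
  have hS' : ∀ p ∈ S, p.Prime ∧ (p : ZMod q) = b ∧ q < p ∧ (p : ℝ) ≤ u := by
    intro p hp
    simp only [hS, cls, Finset.mem_filter, Finset.mem_Icc] at hp
    refine ⟨hp.2.1, hp.1.2, ?_, ?_⟩
    · have : (q : ℝ) < p := lt_of_le_of_lt (hqR.trans (Real.exp_le_exp.mpr (by linarith))) hp.2.2
      exact_mod_cast this
    · exact (Nat.cast_le.mpr hp.1.1.2).trans (Nat.floor_le hu.le)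
  by_cases hqu : (q : ℝ) ≤ u
  · refine h1.trans ((bt_theta q hq b u hqu S hS').trans ?_)
    have h2 : Real.log q ≤ R := by
      rw [Real.log_le_iff_le_exp hq0]; exact hqR
    have h3 : 0 ≤ u / q := by positivity
    nlinarith
  · have : S = ∅ := by
      rw [Finset.eq_empty_iff_forall_notMem]
      intro p hp
      obtain ⟨_, _, h3, h4⟩ := hS' p hp
      have : (q : ℝ) < p := by exact_mod_cast h3
      linarith
    rw [this] at h1
    simp at h1
    exact h1.trans (by positivity)

lemma gg_bd {h : ℕ → ℝ} (hh : CM h) (Q : ℝ) (τ : ℝ) (hτ : 0 < τ) (n : ℕ) : |gg h Q n| ≤ (1 / τ) * Real.exp (τ * Real.log n) := by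
  have h1 : Real.log n ≤ (1 / τ) * Real.exp (τ * Real.log n) := by
    have := Real.add_one_le_exp (τ * Real.log n)
    rw [one_div, le_inv_mul_iff₀ hτ]; linarith
  rw [gg]
  split_ifs
  · rw [abs_of_nonneg (mul_nonneg (hh.nonneg n) (Real.log_natCast_nonneg n))]
    exact (mul_le_of_le_one_left (Real.log_natCast_nonneg n) (hh.le_one n)).trans h1
  · simp; positivity

lemma hell_bd {h : ℕ → ℝ} (hh : CM h) (Q : ℝ) (τ : ℝ) (hτ : 0 < τ) (n : ℕ) (hn : 1 ≤ n) : |h n * ell Q n| ≤ (1 / τ) * Real.exp (τ * Real.log n) := by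
  have h1 : Real.log n ≤ (1 / τ) * Real.exp (τ * Real.log n) := by
    have := Real.add_one_le_exp (τ * Real.log n)
    rw [one_div, le_inv_mul_iff₀ hτ]; linarith
  rw [abs_of_nonneg (mul_nonneg (hh.nonneg n) (ell_nonneg Q n))]
  exact (mul_le_of_le_one_left (ell_nonneg Q n) (hh.le_one n)).trans ((ell_le_log Q n (by omega)).trans h1)

lemma gg_summ {h : ℕ → ℝ} (hh : CM h) (Q a : ℝ) (ha : 0 < a) :
    (Summable fun n : ℕ => |gg h Q n| * Real.exp (-(1 + 1 / a) * Real.log n)) ∧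
    ∑' n : ℕ, |gg h Q n| * Real.exp (-(1 + 1 / a) * Real.log n) ≤ 2 * a * (1 + 2 * a) := by
  have := dser_bd (gg h Q) (by simp [gg]) (2 * a) (1 / (2 * a)) (1 / (2 * a)) (by positivity) (by positivity)
    (fun n _ => by simpa using gg_bd hh Q (1 / (2 * a)) (by positivity) n)
  have e : 1 + 1 / (2 * a) + 1 / (2 * a) = 1 + 1 / a := by field_simp; ring
  rw [e] at this
  simpa using this

lemma hell_summ {h : ℕ → ℝ} (hh : CM h) (Q a : ℝ) (ha : 0 < a) :
    (Summable fun n : ℕ => |h n * ell Q n| * Real.exp (-(1 + 1 / a) * Real.log n)) := by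
  have := dser_bd (fun n => h n * ell Q n) (by simp [hh.zero]) (2 * a) (1 / (2 * a)) (1 / (2 * a)) (by positivity) (by positivity)
    (fun n hn => by simpa using hell_bd hh Q (1 / (2 * a)) (by positivity) n hn)
  have e : 1 + 1 / (2 * a) + 1 / (2 * a) = 1 + 1 / a := by field_simp; ring
  rw [e] at this
  exact this.1

lemma h_summ {h : ℕ → ℝ} (hh : CM h) (a : ℝ) (ha : 0 < a) :
    (Summable fun n : ℕ => |h n| * Real.exp (-(1 + 1 / a) * Real.log n)) ∧
    ∑' n : ℕ, |h n| * Real.exp (-(1 + 1 / a) * Real.log n) ≤ 1 + a := by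
  have := dser_bd h hh.zero 1 0 (1 / a) (by positivity) (by positivity)
    (fun n hn => by simpa [abs_of_nonneg (hh.nonneg n)] using hh.le_one n)
  simpa using this

lemma theta_mean {h : ℕ → ℝ} (hh : CM h) (R : ℝ) (hR : 1 ≤ R) (q : ℕ) [NeZero q] (hqR : (q : ℝ) ≤ Real.exp R) (a : ℝ) (ha : 0 < a) :
    ∫ t : ℝ, ∑ χ : DirichletCharacter ℂ q, ‖Dser (gg h (Real.exp (4 * R))) χ ((1 + 1 / a : ℝ) + t * Complex.I)‖ ^ 2 * (1 / ((1 + 1 / a) ^ 2 + t ^ 2))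
      ≤ 2 * Real.pi * (72 * R ^ 2 * a) := by
  set c : ℝ := 1 + 1 / a with hc
  set Q := Real.exp (4 * R) with hQ
  have hq : 1 ≤ q := NeZero.one_le
  have hq0 : (0 : ℝ) < q := by exact_mod_cast hq
  have hc0 : 0 < c := by positivity
  have key := P2_sum (gg h Q) (by simp [gg]) q 0 0 c hc0 (gg_summ hh Q a ha).1
  simp only [Complex.ofReal_zero, zero_mul, sub_zero, mul_one] at key
  rw [← key.2]
  gcongr
  have hIntg : IntegrableOn (fun v : ℝ => 144 * R ^ 2 * Real.exp ((-2 / a) * v)) (Set.Ioi 0) :=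
    (integrableOn_exp_mul_Ioi (by rw [div_lt_iff₀ ha]; linarith) 0).const_mul _
  have hval : ∫ v : ℝ in Set.Ioi 0, 144 * R ^ 2 * Real.exp ((-2 / a) * v) = 72 * R ^ 2 * a := by
    rw [integral_const_mul, integral_exp_mul_Ioi (by rw [div_lt_iff₀ ha]; linarith) 0]
    simp; field_simp; norm_num
  rw [← hval, ← integral_indicator measurableSet_Ioi]
  refine integral_mono key.1 ((integrable_indicator_iff measurableSet_Ioi).mpr hIntg) fun v => ?_
  beta_reduce
  rw [Set.indicator_apply]
  split_ifs with hv
  · have hb : ∀ b ∈ (univ : Finset (ZMod q)).filter IsUnit, Tf (gg h Q) q b (Real.exp v) ^ 2 * Real.exp (-2 * c * v) ≤ 144 * R ^ 2 * Real.exp ((-2 / a) * v) / q ^ 2 := by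
      intro b _
      obtain ⟨h1, h2⟩ := theta_pt hh R hR q hq hqR b (Real.exp v) (Real.exp_pos v)
      calc Tf (gg h Q) q b (Real.exp v) ^ 2 * Real.exp (-2 * c * v) ≤ (12 * R * (Real.exp v / q)) ^ 2 * Real.exp (-2 * c * v) := by gcongr
        _ = 144 * R ^ 2 / q ^ 2 * (Real.exp v ^ 2 * Real.exp (-2 * c * v)) := by ring
        _ = 144 * R ^ 2 / q ^ 2 * Real.exp ((-2 / a) * v) := by
          congr 1
          rw [← Real.exp_nat_mul, ← Real.exp_add]
          congr 1
          rw [hc]; push_cast; field_simp; ring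
        _ = _ := by ring
    have h3 := Finset.sum_le_sum hb
    rw [Finset.sum_const, nsmul_eq_mul, card_units_filter] at h3
    have hφ : (q.totient : ℝ) ≤ q := by exact_mod_cast Nat.totient_le q
    calc _ ≤ (q.totient : ℝ) * (q.totient * (144 * R ^ 2 * Real.exp ((-2 / a) * v) / q ^ 2)) := by gcongr
      _ ≤ (q : ℝ) * (q * (144 * R ^ 2 * Real.exp ((-2 / a) * v) / q ^ 2)) := by gcongr
      _ = _ := by field_simp
  · have : ∀ b ∈ (univ : Finset (ZMod q)).filter IsUnit, Tf (gg h Q) q b (Real.exp v) ^ 2 * Real.exp (-2 * c * v) = 0 := by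
      intro b _
      have h0 : Tf (gg h Q) q b (Real.exp v) = 0 := by
        rw [Tf]
        refine Finset.sum_eq_zero fun n hn => ?_
        rw [gg, if_neg]
        rintro ⟨hp, hQn⟩
        have h1 : (n : ℝ) ≤ Real.exp v := (Nat.cast_le.mpr (Finset.mem_Icc.mp (Finset.mem_filter.mp hn).1).2).trans (Nat.floor_le (Real.exp_pos v).le)
        simp only [Set.mem_Ioi, not_lt] at hv
        have h2 : Real.exp v ≤ 1 := by rwa [Real.exp_le_one_iff]
        have h3 : (2 : ℝ) ≤ n := by exact_mod_cast hp.two_le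
        linarith
      rw [h0]; ring
    rw [Finset.sum_eq_zero this, mul_zero]

end S18

namespace S18

lemma lam_factor (lam : ℝ) (hl : 1 ≤ lam) (c t : ℝ) (hc : 1 ≤ c) :
    ‖(1 : ℂ) - lam * Complex.exp (-(c + t * Complex.I) * (Real.log lam : ℝ))‖ ≤ 2 := by
  have h1 : ‖(lam : ℂ) * Complex.exp (-(c + t * Complex.I) * (Real.log lam : ℝ))‖ ≤ 1 := by
    rw [norm_mul, Complex.norm_exp, Complex.norm_real, Real.norm_eq_abs, abs_of_pos (by linarith)]
    have h2 : (-(c + t * Complex.I) * (Real.log lam : ℝ)).re = - c * Real.log lam := by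
      generalize Real.log lam = L
      simp
    rw [h2]
    have h3 : 0 ≤ Real.log lam := Real.log_nonneg hl
    calc lam * Real.exp (-c * Real.log lam) ≤ lam * Real.exp (- Real.log lam) := by
          gcongr; nlinarith
      _ = 1 := by rw [Real.exp_neg, Real.exp_log (by linarith)]; field_simp
  calc _ ≤ ‖(1 : ℂ)‖ + ‖(lam : ℂ) * Complex.exp (-(c + t * Complex.I) * (Real.log lam : ℝ))‖ := norm_sub_le _ _
    _ ≤ 2 := by simp at *; linarith

lemma integral_lorentz (T : ℝ) (hT : 0 < T) : ∫ t : ℝ, 1 / (T ^ 2 + t ^ 2) = Real.pi / T := by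
  have h1 : ∀ t : ℝ, 1 / (T ^ 2 + t ^ 2) = (1 / T ^ 2) * (1 + (t / T) ^ 2)⁻¹ := by
    intro t; field_simp
  simp only [h1]
  rw [integral_const_mul, Measure.integral_comp_div (fun t : ℝ => (1 + t ^ 2)⁻¹) T, integral_univ_inv_one_add_sq, abs_of_pos hT, smul_eq_mul]
  field_simp

lemma card_chars (q : ℕ) [NeZero q] : (Fintype.card (DirichletCharacter ℂ q) : ℝ) ≤ q := by
  have := DirichletCharacter.card_eq_totient_of_hasEnoughRootsOfUnity ℂ q
  rw [← Nat.card_eq_fintype_card, this]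
  exact_mod_cast Nat.totient_le q

lemma ET_mean {h : ℕ → ℝ} (hh : CM h) (R : ℝ) (hR : 1 ≤ R) (q : ℕ) [NeZero q] (hqR : (q : ℝ) ≤ Real.exp R)
    (lam : ℝ) (hl : 1 ≤ lam) (a : ℝ) (ha : 1 ≤ a) (haR : 2 * a ≤ Real.exp R) (B : ℝ) (hB : 1 ≤ B)
    (HB : ∀ (χ : DirichletCharacter ℂ q) (t : ℝ), |t| ≤ Real.exp (7 * R) →
      ‖Dser h χ ((1 + 1 / a : ℝ) + t * Complex.I) * (1 - lam * Complex.exp (-((1 + 1 / a : ℝ) + t * Complex.I) * (Real.log lam : ℝ)))‖ ≤ B) :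
    Integrable (fun v : ℝ => (q.totient : ℝ) * ∑ b ∈ (univ : Finset (ZMod q)).filter IsUnit, (ET h (Real.exp (4 * R)) q lam b (Real.exp v)) ^ 2 * Real.exp (-2 * (1 + 1 / a) * v)) ∧
    ∫ v : ℝ, (q.totient : ℝ) * ∑ b ∈ (univ : Finset (ZMod q)).filter IsUnit, (ET h (Real.exp (4 * R)) q lam b (Real.exp v)) ^ 2 * Real.exp (-2 * (1 + 1 / a) * v)
      ≤ 88 * R ^ 2 * B ^ 2 * a := by
  have ha0 : 0 < a := by linarith
  set Q := Real.exp (4 * R) with hQ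
  have hQq : (q : ℝ) ≤ Real.exp R := hqR
  set T := Real.exp (7 * R) with hT
  have hT0 : 0 < T := Real.exp_pos _
  have hq : 1 ≤ q := NeZero.one_le
  have hq0 : (0 : ℝ) < q := by exact_mod_cast hq
  have hc1 : 1 ≤ 1 + 1 / a := by have : 0 < 1 / a := by positivity
                                 linarith
  have hc2 : 1 + 1 / a ≤ 2 := by have : 1 / a ≤ 1 := by rw [div_le_one ha0]; exact ha
                                 linarith
  have hhs := h_summ hh a ha0
  have hgs := gg_summ hh Q a ha0
  have hes := hell_summ hh Q a ha0
  set c : ℝ := 1 + 1 / a with hc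
  have hc0 : 0 < c := by positivity
  have key := P2_sum (fun n => h n * ell Q n) (by simp [hh.zero]) q (Real.log lam) lam c hc0 hes
  have eET : ∀ (b : ZMod q) (v : ℝ), Tf (fun n => h n * ell Q n) q b (Real.exp v) - lam * Tf (fun n => h n * ell Q n) q b (Real.exp (v - Real.log lam)) = ET h Q q lam b (Real.exp v) := by
    intro b v
    rw [Real.exp_sub, Real.exp_log (by linarith)]
    rfl
  simp only [eET] at key
  refine ⟨key.1, ?_⟩
  have hθ := theta_mean hh R hR q hqR a ha0
  have hgP := P2_sum (gg h Q) (by simp [gg]) q 0 0 c hc0 hgs.1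
  -- pointwise
  have hpt : ∀ t : ℝ, ∑ χ : DirichletCharacter ℂ q, ‖Dser (fun n => h n * ell Q n) χ (c + t * Complex.I) * (1 - lam * Complex.exp (-(c + t * Complex.I) * (Real.log lam : ℝ)))‖ ^ 2 * (1 / (c ^ 2 + t ^ 2))
      ≤ B ^ 2 * (∑ χ : DirichletCharacter ℂ q, ‖Dser (gg h Q) χ (c + t * Complex.I)‖ ^ 2 * (1 / (c ^ 2 + t ^ 2))) + 32 * T * (1 / (T ^ 2 + t ^ 2)) := by
    intro t
    have hone : ∀ χ : DirichletCharacter ℂ q, ‖Dser (fun n => h n * ell Q n) χ (c + t * Complex.I) * (1 - lam * Complex.exp (-(c + t * Complex.I) * (Real.log lam : ℝ)))‖ ^ 2 * (1 / (c ^ 2 + t ^ 2))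
        ≤ B ^ 2 * (‖Dser (gg h Q) χ (c + t * Complex.I)‖ ^ 2 * (1 / (c ^ 2 + t ^ 2))) + 32 * Real.exp (6 * R) * (1 / (T ^ 2 + t ^ 2)) := by
      intro χ
      rw [Dser_conv hh Q χ c t hhs.1 hgs.1]
      by_cases ht : |t| ≤ T
      · have h1 := HB χ t ht
        have e : Dser h χ (c + t * Complex.I) * Dser (gg h Q) χ (c + t * Complex.I) * (1 - lam * Complex.exp (-(c + t * Complex.I) * (Real.log lam : ℝ)))
          = (Dser h χ (c + t * Complex.I) * (1 - lam * Complex.exp (-(c + t * Complex.I) * (Real.log lam : ℝ)))) * Dser (gg h Q) χ (c + t * Complex.I) := by ring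
        rw [e, norm_mul, mul_pow]
        have h2 : ‖Dser h χ (c + t * Complex.I) * (1 - lam * Complex.exp (-(c + t * Complex.I) * (Real.log lam : ℝ)))‖ ^ 2 ≤ B ^ 2 := by gcongr
        have h3 : 0 ≤ 32 * Real.exp (6 * R) * (1 / (T ^ 2 + t ^ 2)) := by positivity
        rw [mul_assoc]
        have := mul_le_mul_of_nonneg_right h2 (show 0 ≤ ‖Dser (gg h Q) χ (c + t * Complex.I)‖ ^ 2 * (1 / (c ^ 2 + t ^ 2)) by positivity)
        linarith
      · push Not at ht
        have h1 := (Dser_norm_le h χ c t hhs.1).trans hhs.2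
        have h2 := (Dser_norm_le (gg h Q) χ c t hgs.1).trans hgs.2
        have h3 := lam_factor lam hl c t hc1
        have hE1 : 1 ≤ Real.exp R := Real.one_le_exp (by linarith)
        have h1' : ‖Dser h χ (c + t * Complex.I)‖ ≤ Real.exp R := h1.trans (by linarith)
        have h2' : ‖Dser (gg h Q) χ (c + t * Complex.I)‖ ≤ 2 * Real.exp R ^ 2 := h2.trans (by nlinarith)
        have h4 : ‖Dser h χ (c + t * Complex.I) * Dser (gg h Q) χ (c + t * Complex.I) * (1 - lam * Complex.exp (-(c + t * Complex.I) * (Real.log lam : ℝ)))‖ ≤ Real.exp R * (2 * Real.exp R ^ 2) * 2 := by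
          rw [norm_mul, norm_mul]
          gcongr
        have h5 : (Real.exp R * (2 * Real.exp R ^ 2) * 2) ^ 2 = 16 * Real.exp (6 * R) := by
          rw [show (6 : ℝ) * R = ((6 : ℕ) : ℝ) * R by norm_num, Real.exp_nat_mul]; ring
        have h6 : 1 / (c ^ 2 + t ^ 2) ≤ 2 * (1 / (T ^ 2 + t ^ 2)) := by
          have h7 : T ^ 2 ≤ t ^ 2 := by rw [← sq_abs t]; gcongr
          rw [mul_one_div, div_le_div_iff₀ (by positivity) (by positivity)]
          nlinarith [sq_nonneg c]
        have h8 : 0 ≤ B ^ 2 * (‖Dser (gg h Q) χ (c + t * Complex.I)‖ ^ 2 * (1 / (c ^ 2 + t ^ 2))) := by positivity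
        calc _ ≤ (Real.exp R * (2 * Real.exp R ^ 2) * 2) ^ 2 * (2 * (1 / (T ^ 2 + t ^ 2))) := by gcongr
          _ = 32 * Real.exp (6 * R) * (1 / (T ^ 2 + t ^ 2)) := by rw [h5]; ring
          _ ≤ _ := by linarith
    refine (Finset.sum_le_sum fun χ _ => hone χ).trans ?_
    rw [Finset.sum_add_distrib, ← Finset.mul_sum, Finset.sum_const, nsmul_eq_mul, Finset.card_univ]
    refine add_le_add le_rfl ?_
    have h9 : (Fintype.card (DirichletCharacter ℂ q) : ℝ) * Real.exp (6 * R) ≤ T := by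
      calc _ ≤ Real.exp R * Real.exp (6 * R) := by
            gcongr
            exact (card_chars q).trans hqR
        _ = T := by rw [← Real.exp_add, hT]; ring_nf
    have h10 : 0 ≤ 1 / (T ^ 2 + t ^ 2) := by positivity
    calc _ = 32 * ((Fintype.card (DirichletCharacter ℂ q) : ℝ) * Real.exp (6 * R)) * (1 / (T ^ 2 + t ^ 2)) := by ring
      _ ≤ _ := by gcongr
  have hI1 : Integrable (fun t : ℝ => ∑ χ : DirichletCharacter ℂ q, ‖Dser (fun n => h n * ell Q n) χ (c + t * Complex.I) * (1 - lam * Complex.exp (-(c + t * Complex.I) * (Real.log lam : ℝ)))‖ ^ 2 * (1 / (c ^ 2 + t ^ 2))) :=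
    integrable_finsetSum _ fun χ _ => (P1_char (fun n => h n * ell Q n) (by simp [hh.zero]) q χ (Real.log lam) lam c hc0 hes).2.1
  have hI2 : Integrable (fun t : ℝ => ∑ χ : DirichletCharacter ℂ q, ‖Dser (gg h Q) χ (c + t * Complex.I)‖ ^ 2 * (1 / (c ^ 2 + t ^ 2))) := by
    refine integrable_finsetSum _ fun χ _ => ?_
    have := (P1_char (gg h Q) (by simp [gg]) q χ 0 0 c hc0 hgs.1).2.1
    simpa using this
  have hI3 := integrable_lorentz T hT0
  have hfin := integral_mono hI1 ((hI2.const_mul (B ^ 2)).add (hI3.const_mul (32 * T))) hpt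
  rw [← key.2] at hfin
  simp only [Pi.add_apply] at hfin
  rw [integral_add (hI2.const_mul _) (hI3.const_mul _), integral_const_mul (B ^ 2), integral_const_mul (32 * T), integral_lorentz T hT0] at hfin
  have hpi := Real.pi_pos
  have h11 : 32 * T * (Real.pi / T) = 2 * Real.pi * 16 := by field_simp; norm_num
  rw [h11] at hfin
  have h12 : 2 * Real.pi * (∫ v : ℝ, (q.totient : ℝ) * ∑ b ∈ (univ : Finset (ZMod q)).filter IsUnit, (ET h Q q lam b (Real.exp v)) ^ 2 * Real.exp (-2 * c * v)) ≤ 2 * Real.pi * (B ^ 2 * (72 * R ^ 2 * a) + 16) := by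
    have := mul_le_mul_of_nonneg_left hθ (show 0 ≤ B ^ 2 by positivity)
    linarith
  have h13 := le_of_mul_le_mul_left h12 (by positivity)
  have h14 : 1 ≤ R ^ 2 * B ^ 2 * a := by
    have h15 : 1 ≤ R ^ 2 := by nlinarith
    have h16 : 1 ≤ B ^ 2 := by nlinarith
    calc (1 : ℝ) = 1 * 1 * 1 := by ring
      _ ≤ _ := by gcongr
  linarith

lemma block : ∃ C : ℝ, 0 < C ∧ ∀ {h : ℕ → ℝ} (_ : CM h) (R : ℝ) (_ : 1 ≤ R) (q : ℕ) [NeZero q] (_ : (q : ℝ) ≤ Real.exp R)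
    (lam : ℝ) (_ : 1 ≤ lam) (_ : lam ≤ Real.exp R) (a : ℝ) (_ : 19 * R ≤ a) (_ : 2 * a ≤ Real.exp R) (B : ℝ) (_ : 1 ≤ B)
    (_ : ∀ (χ : DirichletCharacter ℂ q) (t : ℝ), |t| ≤ Real.exp (7 * R) →
      ‖Dser h χ ((1 + 1 / a : ℝ) + t * Complex.I) * (1 - lam * Complex.exp (-((1 + 1 / a : ℝ) + t * Complex.I) * (Real.log lam : ℝ)))‖ ≤ B),
    II h q lam a (2 * a) ≤ C * (R * B + R ^ 2) := by
  obtain ⟨C, hC, HE⟩ := E_log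
  refine ⟨44 * Real.exp 4 + 1 + C, by positivity, fun {h} hh R hR q _ hqR lam hl hlR a ha haR B hB HB => ?_⟩
  have ha0 : 0 < a := by linarith
  have hq : 1 ≤ q := NeZero.one_le
  have hq0 : (0 : ℝ) < q := by exact_mod_cast hq
  obtain ⟨hIntg, hmean⟩ := ET_mean hh R hR q hqR lam hl a (by linarith) haR B hB HB
  set Q := Real.exp (4 * R) with hQ
  set κ := R * B with hκ
  have hκ0 : 0 < κ := by positivity
  have hφ0 : (0 : ℝ) < q.totient := by exact_mod_cast Nat.totient_pos.mpr hq
  have hφ : (q.totient : ℝ) ≤ q := by exact_mod_cast Nat.totient_le q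
  set G : ℝ → ℝ := fun v => (q.totient : ℝ) * ∑ b ∈ (univ : Finset (ZMod q)).filter IsUnit, (ET h Q q lam b (Real.exp v)) ^ 2 * Real.exp (-2 * (1 + 1 / a) * v) with hG
  have hG0 : ∀ v, 0 ≤ G v := fun v => by
    simp only [hG]
    exact mul_nonneg hφ0.le (Finset.sum_nonneg fun b _ => by positivity)
  have hpt : ∀ v ∈ Set.Ioc a (2 * a), ∑ b ∈ univ.filter (fun b : ZMod q => IsUnit b), |EE h q lam b (Real.exp v)| * Real.exp (-v)
      ≤ (Real.exp 4 / (2 * κ * a)) * G v + (κ / 2 + C * R ^ 2) / a := by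
    intro v hv
    have hv0 : 0 < v := ha0.trans hv.1
    have h1 : ∀ b ∈ univ.filter (fun b : ZMod q => IsUnit b), |EE h q lam b (Real.exp v)| * Real.exp (-v)
        ≤ (1 / a) * (((Real.exp 4 / (2 * κ)) * (q.totient * ((ET h Q q lam b (Real.exp v)) ^ 2 * Real.exp (-2 * (1 + 1 / a) * v))) + κ / 2 / q.totient) + C * R ^ 2 / q) := by
      intro b hb
      have hb' := (Finset.mem_filter.mp hb).2
      have h2 := HE hh R hR q hq hqR b hb' lam hl hlR (Real.exp v) (Real.exp_le_exp.mpr (by linarith [hv.1])) (by rw [Real.log_exp]; linarith [hv.2])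
      rw [Real.log_exp] at h2
      have h3 : |EE h q lam b (Real.exp v)| * v ≤ |ET h Q q lam b (Real.exp v)| + C * (Real.exp v / q) * R ^ 2 := by
        have h4 := abs_add_le (EE h q lam b (Real.exp v) * v - ET h Q q lam b (Real.exp v)) (ET h Q q lam b (Real.exp v))
        rw [sub_add_cancel, abs_mul, abs_of_pos hv0] at h4
        linarith
      have h5 : |EE h q lam b (Real.exp v)| * Real.exp (-v) * a ≤ |ET h Q q lam b (Real.exp v)| * Real.exp (-v) + C * R ^ 2 / q := by
        have h6 : |EE h q lam b (Real.exp v)| * a ≤ |EE h q lam b (Real.exp v)| * v := by gcongr; exact hv.1.le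
        have h7 := mul_le_mul_of_nonneg_right (h6.trans h3) (Real.exp_pos (-v)).le
        have h8 : Real.exp v * Real.exp (-v) = 1 := by rw [← Real.exp_add]; simp
        calc _ = |EE h q lam b (Real.exp v)| * a * Real.exp (-v) := by ring
          _ ≤ _ := h7
          _ = |ET h Q q lam b (Real.exp v)| * Real.exp (-v) + C * R ^ 2 / q * (Real.exp v * Real.exp (-v)) := by ring
          _ = _ := by rw [h8, mul_one]
      have h9 : |ET h Q q lam b (Real.exp v)| * Real.exp (-v) ≤ (Real.exp 4 / (2 * κ)) * (q.totient * ((ET h Q q lam b (Real.exp v)) ^ 2 * Real.exp (-2 * (1 + 1 / a) * v))) + κ / 2 / q.totient := by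
        set y := |ET h Q q lam b (Real.exp v)| * Real.exp (-v) with hy
        have h10 : y ≤ (q.totient * y ^ 2 / (2 * κ)) + κ / 2 / q.totient := by
          have : (q.totient * y ^ 2 / (2 * κ)) + κ / 2 / q.totient - y = (q.totient * y - κ) ^ 2 / (2 * κ * q.totient) := by
            field_simp; ring
          have h11 : 0 ≤ (q.totient * y - κ) ^ 2 / (2 * κ * q.totient) := by positivity
          linarith
        have h12 : y ^ 2 ≤ Real.exp 4 * ((ET h Q q lam b (Real.exp v)) ^ 2 * Real.exp (-2 * (1 + 1 / a) * v)) := by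
          have : Real.exp (-v) ^ 2 ≤ Real.exp 4 * Real.exp (-2 * (1 + 1 / a) * v) := by
            rw [← Real.exp_nat_mul, ← Real.exp_add, Real.exp_le_exp]
            have h13 : 1 / a * v ≤ 2 := by
              rw [one_div, inv_mul_le_iff₀ ha0]; linarith [hv.2]
            push_cast
            nlinarith
          rw [hy, mul_pow, sq_abs]
          calc _ ≤ (ET h Q q lam b (Real.exp v)) ^ 2 * (Real.exp 4 * Real.exp (-2 * (1 + 1 / a) * v)) := by gcongr
            _ = _ := by ring
        refine h10.trans ?_
        gcongr
        calc q.totient * y ^ 2 / (2 * κ) ≤ q.totient * (Real.exp 4 * ((ET h Q q lam b (Real.exp v)) ^ 2 * Real.exp (-2 * (1 + 1 / a) * v))) / (2 * κ) := by gcongr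
          _ = _ := by ring
      rw [one_div_mul_eq_div, le_div_iff₀ ha0]
      linarith
    refine (Finset.sum_le_sum h1).trans ?_
    rw [← Finset.mul_sum, Finset.sum_add_distrib, Finset.sum_add_distrib, Finset.sum_const, Finset.sum_const, ← Finset.mul_sum, ← Finset.mul_sum, nsmul_eq_mul, nsmul_eq_mul]
    have hcu := card_units_filter q
    rw [hcu]
    have h20 : (q.totient : ℝ) * (C * R ^ 2 / q) ≤ C * R ^ 2 := by
      rw [mul_div_assoc', div_le_iff₀ hq0, mul_comm]; gcongr
    have h21 : (q.totient : ℝ) * (κ / 2 / q.totient) = κ / 2 := by field_simp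
    rw [h21]
    calc _ ≤ 1 / a * (Real.exp 4 / (2 * κ) * G v + κ / 2 + C * R ^ 2) := by gcongr
      _ = _ := by ring
  have hGi : IntegrableOn G (Set.Ioc a (2 * a)) := hIntg.integrableOn
  have hIG : ∫ v in Set.Ioc a (2 * a), G v ≤ 88 * R ^ 2 * B ^ 2 * a :=
    (setIntegral_le_integral hIntg (ae_of_all _ hG0)).trans hmean
  have hci : IntegrableOn (fun _ : ℝ => (κ / 2 + C * R ^ 2) / a) (Set.Ioc a (2 * a)) := by
    simp [integrableOn_const_iff]
  have hGm : IntegrableOn (fun v => (Real.exp 4 / (2 * κ * a)) * G v) (Set.Ioc a (2 * a)) := hGi.const_mul _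
  have hGC : IntegrableOn (fun v => (Real.exp 4 / (2 * κ * a)) * G v + (κ / 2 + C * R ^ 2) / a) (Set.Ioc a (2 * a)) := hGm.add hci
  rw [II]
  calc _ ≤ ∫ v in Set.Ioc a (2 * a), ((Real.exp 4 / (2 * κ * a)) * G v + (κ / 2 + C * R ^ 2) / a) :=
        setIntegral_mono_on (II_int hh q lam hl a (2 * a)) hGC measurableSet_Ioc hpt
    _ = (Real.exp 4 / (2 * κ * a)) * (∫ v in Set.Ioc a (2 * a), G v) + a * ((κ / 2 + C * R ^ 2) / a) := by
        rw [integral_add hGm hci, integral_const_mul, setIntegral_const]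
        simp only [smul_eq_mul, Measure.real, Real.volume_Ioc]
        rw [ENNReal.toReal_ofReal (by linarith)]
        ring
    _ ≤ (Real.exp 4 / (2 * κ * a)) * (88 * R ^ 2 * B ^ 2 * a) + a * ((κ / 2 + C * R ^ 2) / a) := by gcongr
    _ = 44 * Real.exp 4 * (R * B) + R * B / 2 + C * R ^ 2 := by rw [hκ]; field_simp; ring
    _ ≤ _ := by
        have : 0 ≤ R * B := by positivity
        have h2 : 0 ≤ R ^ 2 := by positivity
        have h4 : 0 ≤ Real.exp 4 := (Real.exp_pos 4).le
        nlinarith [mul_nonneg h4 h2, mul_nonneg hC.le this]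

end S18

namespace S18

lemma II_triv {h : ℕ → ℝ} (hh : CM h) (R : ℝ) (hR : 1 ≤ R) (q : ℕ) [NeZero q] (hqR : (q : ℝ) ≤ Real.exp R)
    (lam : ℝ) (hl : 1 ≤ lam) (hlR : lam ≤ Real.exp R) (X : ℝ) (hX : 19 * R ≤ X) :
    II h q lam (19 * R) X ≤ 6 * X := by
  have hq : 1 ≤ q := NeZero.one_le
  have hq0 : (0 : ℝ) < q := by exact_mod_cast hq
  have hφ : (q.totient : ℝ) ≤ q := by exact_mod_cast Nat.totient_le q
  have hpt : ∀ v ∈ Set.Ioc (19 * R) X, ∑ b ∈ univ.filter (fun b : ZMod q => IsUnit b), |EE h q lam b (Real.exp v)| * Real.exp (-v) ≤ 6 := by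
    intro v hv
    have h1 : ∀ b ∈ univ.filter (fun b : ZMod q => IsUnit b), |EE h q lam b (Real.exp v)| * Real.exp (-v) ≤ 6 / q := by
      intro b _
      have h2 := EE_abs_le hh q lam (by linarith) b (Real.exp v)
      have h3 := card_cls q hq b (Real.exp v) (Real.exp_pos v).le
      have h4 := card_cls q hq b (Real.exp v / lam) (by positivity)
      have h5 : lam * (Real.exp v / lam / q + 2) = Real.exp v / q + 2 * lam := by field_simp
      have h6 : |EE h q lam b (Real.exp v)| ≤ 2 * (Real.exp v / q) + 2 + 2 * lam := by
        have := mul_le_mul_of_nonneg_left h4 (show 0 ≤ lam by linarith)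
        linarith
      have h7 : Real.exp R ≤ Real.exp v / q := by
        rw [le_div_iff₀ hq0]
        calc Real.exp R * q ≤ Real.exp R * Real.exp R := by gcongr
          _ = Real.exp (2 * R) := by rw [← Real.exp_add]; ring_nf
          _ ≤ _ := Real.exp_le_exp.mpr (by linarith [hv.1])
      have h8 : |EE h q lam b (Real.exp v)| ≤ 6 * (Real.exp v / q) := by linarith
      calc _ ≤ 6 * (Real.exp v / q) * Real.exp (-v) := by gcongr
        _ = 6 / q * (Real.exp v * Real.exp (-v)) := by ring
        _ = 6 / q := by rw [← Real.exp_add]; simp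
    refine (Finset.sum_le_sum h1).trans ?_
    rw [Finset.sum_const, nsmul_eq_mul, card_units_filter, mul_div_assoc', div_le_iff₀ hq0]
    linarith
  have hci : IntegrableOn (fun _ : ℝ => (6 : ℝ)) (Set.Ioc (19 * R) X) := by
    simp [integrableOn_const_iff]
  rw [II]
  refine (setIntegral_mono_on (II_int hh q lam hl _ _) hci measurableSet_Ioc hpt).trans ?_
  rw [setIntegral_const]
  simp only [smul_eq_mul, Measure.real, Real.volume_Ioc]
  rw [ENNReal.toReal_ofReal (by linarith)]
  linarith

lemma II_add {h : ℕ → ℝ} (hh : CM h) (q : ℕ) [NeZero q] (lam : ℝ) (hl : 1 ≤ lam) (r s t : ℝ) (hrs : r ≤ s) (hst : s ≤ t) :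
    II h q lam r t = II h q lam r s + II h q lam s t := by
  rw [II, II, II, ← Set.Ioc_union_Ioc_eq_Ioc hrs hst]
  refine setIntegral_union ?_ measurableSet_Ioc (II_int hh q lam hl _ _) (II_int hh q lam hl _ _)
  exact Set.Ioc_disjoint_Ioc_of_le le_rfl

lemma II_nonneg (h : ℕ → ℝ) (q : ℕ) [NeZero q] (lam : ℝ) (s t : ℝ) : 0 ≤ II h q lam s t :=
  integral_nonneg fun v => Finset.sum_nonneg fun b _ => by positivity

lemma II_bound : ∃ C : ℝ, 0 < C ∧ ∀ {h : ℕ → ℝ} (_ : CM h) (R : ℝ) (_ : 1 ≤ R) (q : ℕ) [NeZero q] (_ : (q : ℝ) ≤ Real.exp R)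
    (lam : ℝ) (_ : 1 ≤ lam) (_ : lam ≤ Real.exp R) (X L : ℝ) (_ : 19 * R ≤ X) (_ : X ≤ L) (_ : 2 * L ≤ Real.exp R) (B : ℝ) (_ : 1 ≤ B)
    (_ : ∀ a : ℝ, X ≤ a → a ≤ L → ∀ (χ : DirichletCharacter ℂ q) (t : ℝ), |t| ≤ Real.exp (7 * R) →
      ‖Dser h χ ((1 + 1 / a : ℝ) + t * Complex.I) * (1 - lam * Complex.exp (-((1 + 1 / a : ℝ) + t * Complex.I) * (Real.log lam : ℝ)))‖ ≤ B),
    II h q lam (19 * R) L ≤ C * (X + R * (R * B + R ^ 2)) := by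
  obtain ⟨C, hC, H⟩ := block
  refine ⟨6 + 4 * C, by positivity, fun {h} hh R hR q _ hqR lam hl hlR X L hX hXL hL B hB HB => ?_⟩
  have hX0 : 0 < X := by linarith
  set D := R * B + R ^ 2 with hD
  have hD0 : 0 ≤ D := by positivity
  have ind : ∀ n : ℕ, 2 ^ n * X ≤ 2 * L → II h q lam (19 * R) (2 ^ n * X) ≤ 6 * X + n * (C * D) := by
    intro n
    induction n with
    | zero => intro _; simpa using II_triv hh R hR q hqR lam hl hlR X hX
    | succ n ih =>
      intro hn
      have h1 : (2 : ℝ) ^ n * X ≤ L := by rw [pow_succ] at hn; linarith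
      have h0 : X ≤ (2 : ℝ) ^ n * X := le_mul_of_one_le_left hX0.le (one_le_pow₀ (by norm_num))
      have h2 := ih (by linarith)
      have h3 := H hh R hR q hqR lam hl hlR (2 ^ n * X) (by linarith) (by linarith) B hB (HB _ h0 h1)
      rw [show (2 : ℝ) ^ (n + 1) * X = 2 * (2 ^ n * X) by ring, II_add hh q lam hl (19 * R) (2 ^ n * X) _ (by linarith) (by linarith)]
      push_cast
      linarith
  obtain ⟨n, hn1, hn2⟩ := exists_nat_pow_near (show 1 ≤ L / X by rw [le_div_iff₀ hX0]; linarith) (show (1 : ℝ) < 2 by norm_num)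
  rw [le_div_iff₀ hX0] at hn1
  rw [div_lt_iff₀ hX0] at hn2
  have h4 := ind (n + 1) (by rw [pow_succ]; linarith)
  have h5 : II h q lam (19 * R) L ≤ II h q lam (19 * R) (2 ^ (n + 1) * X) := by
    rw [II_add hh q lam hl (19 * R) L _ (by linarith) hn2.le]
    linarith [II_nonneg h q lam L (2 ^ (n + 1) * X)]
  have h6 : (n : ℝ) ≤ 2 * R := by
    have h7 : (2 : ℝ) ^ n ≤ Real.exp R := by
      have : (2 : ℝ) ^ n * 1 ≤ 2 ^ n * X := by gcongr; linarith
      linarith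
    have h8 := Real.log_le_log (by positivity) h7
    rw [Real.log_exp, Real.log_pow] at h8
    have := Real.log_two_gt_d9
    nlinarith [Nat.cast_nonneg (α := ℝ) n]
  push_cast at h4
  have h9 : (n + 1 : ℝ) * (C * D) ≤ (4 * R) * (C * D) := by gcongr; linarith
  have h10 : 0 ≤ C * X := by positivity
  have h11 : 0 ≤ R * D := by positivity
  have h12 : 0 ≤ C * (R * D) := by positivity
  nlinarith

end S18

namespace S18

lemma sum_block (q : ℕ) [NeZero q] (g : ZMod q → ℂ) (n : ℕ) :
    ∑ k ∈ range q, g ((n + k : ℕ) : ZMod q) = ∑ b : ZMod q, g b := by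
  have h0 : ∑ b : ZMod q, g b = ∑ b : ZMod q, g ((n : ZMod q) + b) :=
    (Equiv.sum_comp (Equiv.addLeft (n : ZMod q)) g).symm
  rw [h0]
  refine Finset.sum_bij' (fun k _ => (k : ZMod q)) (fun b _ => b.val) ?_ ?_ ?_ ?_ ?_
  · intro a _; simp
  · intro a _; simpa using ZMod.val_lt a
  · intro a ha; exact ZMod.val_cast_of_lt (by simpa using ha)
  · intro a _; simp
  · intro a _; simp

lemma sum_periodic (q : ℕ) [NeZero q] (g : ZMod q → ℂ) (hg : ∀ b, ‖g b‖ ≤ 1) (n : ℕ) :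
    ‖∑ k ∈ range n, g ((k : ℕ) : ZMod q) - (n : ℂ) / q * ∑ b : ZMod q, g b‖ ≤ 2 * q := by
  have hq : (0 : ℝ) < q := by exact_mod_cast NeZero.pos q
  have hqc : (q : ℂ) ≠ 0 := by exact_mod_cast hq.ne'
  have hS : ‖∑ b : ZMod q, g b‖ ≤ q := by
    refine (norm_sum_le _ _).trans ((Finset.sum_le_sum fun b _ => hg b).trans ?_)
    simp [ZMod.card]
  induction n using Nat.strong_induction_on with
  | _ n ih =>
    by_cases hn : n < q
    · refine (norm_sub_le _ _).trans ?_
      have h1 : ‖∑ k ∈ range n, g ((k : ℕ) : ZMod q)‖ ≤ n := by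
        refine (norm_sum_le _ _).trans ((Finset.sum_le_sum fun b _ => hg _).trans ?_)
        simp
      have h2 : ‖(n : ℂ) / q * ∑ b : ZMod q, g b‖ ≤ 1 * q := by
        rw [norm_mul, norm_div, Complex.norm_natCast, Complex.norm_natCast]
        have : (n : ℝ) / q ≤ 1 := by
          rw [div_le_one hq]; exact_mod_cast hn.le
        gcongr
      have h3 : (n : ℝ) ≤ q := by exact_mod_cast hn.le
      linarith
    · have hq' := NeZero.pos q
      obtain ⟨m, rfl⟩ : ∃ m, n = m + q := ⟨n - q, by omega⟩
      have h1 := ih m (by omega)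
      rw [Finset.sum_range_add, sum_block]
      have : (∑ x ∈ range m, g (x : ZMod q) + ∑ b, g b - ((m + q : ℕ) : ℂ) / q * ∑ b, g b) = ∑ x ∈ range m, g (x : ZMod q) - (m : ℂ) / q * ∑ b, g b := by
        push_cast
        field_simp
        ring
      rw [this]; exact h1

lemma F_err (q : ℕ) [NeZero q] (χ : DirichletCharacter ℂ q) (N : ℕ) (u : ℝ) (hu : (N : ℝ) ≤ u) :
    ‖(∑ k ∈ Icc 1 ⌊u⌋₊, if N < k then χ (k : ZMod q) else 0)
      - (∑ b : ZMod q, χ b) / q * ((u : ℂ) - N)‖ ≤ 5 * q := by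
  have hq : (0 : ℝ) < q := by exact_mod_cast NeZero.pos q
  have hqc : (q : ℂ) ≠ 0 := by exact_mod_cast hq.ne'
  have hN : N ≤ ⌊u⌋₊ := Nat.le_floor hu
  have hu0 : 0 ≤ u := (Nat.cast_nonneg N).trans hu
  have hS : ‖∑ b : ZMod q, χ b‖ ≤ q := by
    refine (norm_sum_le _ _).trans ((Finset.sum_le_sum fun b _ => χ.norm_le_one b).trans ?_)
    simp [ZMod.card]
  have e1 : (∑ k ∈ Icc 1 ⌊u⌋₊, if N < k then χ (k : ZMod q) else 0)
      = ∑ k ∈ range (⌊u⌋₊ + 1), χ (k : ZMod q) - ∑ k ∈ range (N + 1), χ (k : ZMod q) := by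
    rw [← Finset.sum_filter, eq_sub_iff_add_eq, ← Finset.sum_union]
    · congr 1
      ext k; simp; omega
    · rw [Finset.disjoint_left]; intro k hk; simp at hk ⊢; omega
  have h1 := sum_periodic q (fun b => χ b) (fun b => χ.norm_le_one b) (⌊u⌋₊ + 1)
  have h2 := sum_periodic q (fun b => χ b) (fun b => χ.norm_le_one b) (N + 1)
  set S := ∑ b : ZMod q, χ b
  set A := ∑ k ∈ range (⌊u⌋₊ + 1), χ (k : ZMod q)
  set B := ∑ k ∈ range (N + 1), χ (k : ZMod q)
  rw [e1]
  have e2 : A - B - S / q * ((u : ℂ) - N) = (A - ((⌊u⌋₊ + 1 : ℕ) : ℂ) / q * S) - (B - ((N + 1 : ℕ) : ℂ) / q * S)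
      - S / q * ((u - ⌊u⌋₊ : ℝ) : ℂ) := by
    push_cast; field_simp; ring
  rw [e2]
  have h3 : ‖S / q * ((u - ⌊u⌋₊ : ℝ) : ℂ)‖ ≤ q := by
    rw [norm_mul, norm_div, Complex.norm_natCast, Complex.norm_real, Real.norm_of_nonneg (by linarith [Nat.floor_le hu0])]
    have h4 : u - ⌊u⌋₊ ≤ 1 := by linarith [Nat.lt_floor_add_one u]
    have h5 : ‖S‖ / q ≤ 1 := by rw [div_le_one hq]; exact hS
    have h6 : (1 : ℝ) ≤ q := by exact_mod_cast NeZero.pos q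
    have h7 : 0 ≤ u - ⌊u⌋₊ := by linarith [Nat.floor_le hu0]
    calc ‖S‖ / q * (u - ⌊u⌋₊) ≤ 1 * 1 := by gcongr
      _ ≤ q := by linarith
  refine (norm_sub_le _ _).trans ?_
  have := norm_sub_le (A - ((⌊u⌋₊ + 1 : ℕ) : ℂ) / q * S) (B - ((N + 1 : ℕ) : ℂ) / q * S)
  linarith

lemma main_int (N : ℝ) (hN : 0 < N) (s : ℂ) (hs : 1 < s.re) :
    IntegrableOn (fun u : ℝ => ((u : ℂ) - N) * (u : ℂ) ^ (-(s + 1))) (Set.Ioi N) ∧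
    s * ∫ u in Set.Ioi N, ((u : ℂ) - N) * (u : ℂ) ^ (-(s + 1)) = (N : ℂ) ^ (1 - s) / (s - 1) := by
  have i1 : IntegrableOn (fun u : ℝ => (u : ℂ) ^ (-s)) (Set.Ioi N) := integrableOn_Ioi_cpow_of_lt (by simpa using hs) hN
  have i2 : IntegrableOn (fun u : ℝ => (u : ℂ) ^ (-(s + 1))) (Set.Ioi N) := integrableOn_Ioi_cpow_of_lt (by simp; linarith) hN
  have hs0 : s ≠ 0 := by rintro rfl; simp at hs; linarith
  have hs1 : s - 1 ≠ 0 := by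
    intro h; have : s = 1 := by linear_combination h
    rw [this] at hs; simp at hs
  have hNc : (N : ℂ) ≠ 0 := by exact_mod_cast hN.ne'
  have e : Set.EqOn (fun u : ℝ => ((u : ℂ) - N) * (u : ℂ) ^ (-(s + 1))) (fun u : ℝ => (u : ℂ) ^ (-s) - N * (u : ℂ) ^ (-(s + 1))) (Set.Ioi N) := by
    intro u hu
    have hu0 : (u : ℂ) ≠ 0 := by exact_mod_cast (hN.trans hu).ne'
    simp only
    rw [show -s = -(s + 1) + 1 by ring, Complex.cpow_add _ _ hu0, Complex.cpow_one]; ring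
  refine ⟨(IntegrableOn.congr_fun (i1.sub (i2.const_mul (N : ℂ))) (fun u hu => (e hu).symm) measurableSet_Ioi), ?_⟩
  rw [setIntegral_congr_fun measurableSet_Ioi e, integral_sub i1 (i2.const_mul (N : ℂ)), integral_const_mul (N : ℂ),
    integral_Ioi_cpow_of_lt (by simpa using hs) hN, integral_Ioi_cpow_of_lt (by simp; linarith) hN]
  rw [show -s + 1 = 1 - s by ring, show -(s + 1) + 1 = -s by ring, show (1 - s) = -s + 1 by ring, Complex.cpow_add _ _ hNc, Complex.cpow_one]
  have hs2 : -s + 1 ≠ 0 := by intro h; apply hs1; linear_combination -h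
  field_simp
  ring

lemma tail_bd (q : ℕ) [NeZero q] (χ : DirichletCharacter ℂ q) (N : ℕ) (hN : 1 ≤ N) (s : ℂ) (hs : 1 < s.re) (ht : s.im ≠ 0) :
    ‖LSeries (fun n => if N < n then χ (n : ZMod q) else 0) s‖ ≤ 1 / |s.im| + ‖s‖ * (5 * q / N) := by
  have hq : (0 : ℝ) < q := by exact_mod_cast NeZero.pos q
  have hN0 : (0 : ℝ) < N := by exact_mod_cast hN
  have hO : (fun n : ℕ ↦ ∑ k ∈ Icc 1 n, ‖(if N < k then χ (k : ZMod q) else 0)‖) =O[atTop] fun n ↦ (n : ℝ) ^ (1 : ℝ) := by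
    refine Asymptotics.IsBigO.of_bound 1 (Eventually.of_forall fun n => ?_)
    rw [Real.norm_of_nonneg (Finset.sum_nonneg fun _ _ => norm_nonneg _), Real.rpow_one, Real.norm_of_nonneg (Nat.cast_nonneg _), one_mul]
    refine (Finset.sum_le_sum (g := fun _ => (1 : ℝ)) fun k _ => ?_).trans (by simp)
    split_ifs
    · exact χ.norm_le_one _
    · simp
  rw [LSeries_eq_mul_integral' _ zero_le_one hs hO]
  set F : ℝ → ℂ := fun u => ∑ k ∈ Icc 1 ⌊u⌋₊, if N < k then χ (k : ZMod q) else 0 with hF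
  set S := ∑ b : ZMod q, χ b with hSdef
  have hS : ‖S‖ ≤ q := by
    refine (norm_sum_le _ _).trans ((Finset.sum_le_sum fun b _ => χ.norm_le_one b).trans ?_)
    simp [ZMod.card]
  have e1 : ∫ u in Set.Ioi (1 : ℝ), F u * (u : ℂ) ^ (-(s + 1)) = ∫ u in Set.Ioi (N : ℝ), F u * (u : ℂ) ^ (-(s + 1)) := by
    symm
    refine (setIntegral_eq_of_subset_of_forall_diff_eq_zero measurableSet_Ioi ?_ ?_).symm
    · intro u hu
      have : (1 : ℝ) ≤ N := by exact_mod_cast hN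
      exact lt_of_le_of_lt this hu
    · intro u hu
      have h1 : u ≤ N := by simpa using hu.2
      have : F u = 0 := by
        rw [hF]
        refine Finset.sum_eq_zero fun k hk => ?_
        rw [if_neg]
        have h2 : ⌊u⌋₊ ≤ N := by
          have := Nat.floor_le_floor h1; simpa using this
        simp at hk; omega
      rw [this, zero_mul]
  obtain ⟨m1, m2⟩ := main_int N hN0 s hs
  set E : ℝ → ℂ := fun u => (F u - S / q * ((u : ℂ) - (N : ℝ))) * (u : ℂ) ^ (-(s + 1)) with hE
  have hFm : Measurable F := (measurable_from_nat (f := fun n : ℕ => ∑ k ∈ Icc 1 n, if N < k then χ (k : ZMod q) else 0)).comp Nat.measurable_floor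
  have hb : ∀ u ∈ Set.Ioi (N : ℝ), ‖E u‖ ≤ 5 * q * u ^ (-2 : ℝ) := by
    intro u hu
    have hu1 : (N : ℝ) < u := hu
    have hu0 : 0 < u := hN0.trans hu1
    have h1 : (1 : ℝ) ≤ u := by
      have : (1 : ℝ) ≤ N := by exact_mod_cast hN
      linarith
    rw [hE]
    simp only
    rw [norm_mul, Complex.norm_cpow_eq_rpow_re_of_pos hu0]
    have h2 := F_err q χ N u hu1.le
    have h3 : u ^ (-(s + 1)).re ≤ u ^ (-2 : ℝ) := by
      apply Real.rpow_le_rpow_of_exponent_le h1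
      simp; linarith
    have h4 : ‖F u - S / q * ((u : ℂ) - (N : ℝ))‖ ≤ 5 * q := by simpa using h2
    have h5 : 0 ≤ u ^ (-(s + 1)).re := by positivity
    gcongr
  have i0 : IntegrableOn (fun u : ℝ => 5 * q * u ^ (-2 : ℝ)) (Set.Ioi (N : ℝ)) :=
    (integrableOn_Ioi_rpow_of_lt (by norm_num) hN0).const_mul (5 * (q : ℝ))
  have hEm : Measurable E := by
    rw [hE]
    refine Measurable.mul (hFm.sub (by fun_prop)) ?_
    exact (Complex.measurable_ofReal).pow_const _
  have iE : IntegrableOn E (Set.Ioi (N : ℝ)) := by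
    refine Integrable.mono' i0 hEm.aestronglyMeasurable ?_
    filter_upwards [ae_restrict_mem measurableSet_Ioi] with u hu using hb u hu
  have e2 : ∫ u in Set.Ioi (N : ℝ), F u * (u : ℂ) ^ (-(s + 1)) = (∫ u in Set.Ioi (N : ℝ), E u) + S / q * ∫ u in Set.Ioi (N : ℝ), ((u : ℂ) - (N : ℝ)) * (u : ℂ) ^ (-(s + 1)) := by
    rw [← integral_const_mul (S / q), ← integral_add iE (m1.const_mul _)]
    refine integral_congr_ae (Eventually.of_forall fun u => ?_)
    simp only [hE]; ring
  have hEi : ‖∫ u in Set.Ioi (N : ℝ), E u‖ ≤ 5 * q / N := by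
    refine (norm_integral_le_of_norm_le i0 ?_).trans ?_
    · filter_upwards [ae_restrict_mem measurableSet_Ioi] with u hu using hb u hu
    · rw [integral_const_mul (5 * (q : ℝ)), integral_Ioi_rpow_of_lt (by norm_num) hN0]
      norm_num [Real.rpow_neg_one]
      rw [div_eq_mul_inv]
  rw [e1, e2, mul_add]
  have e3 : s * (S / q * ∫ u in Set.Ioi (N : ℝ), ((u : ℂ) - (N : ℝ)) * (u : ℂ) ^ (-(s + 1))) = S / q * (((N : ℝ) : ℂ) ^ (1 - s) / (s - 1)) := by
    rw [← m2]; ring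
  rw [e3, add_comm]
  refine (norm_add_le _ _).trans (add_le_add ?_ ?_)
  · rw [norm_mul, norm_div, norm_div, Complex.norm_natCast, Complex.norm_cpow_eq_rpow_re_of_pos hN0]
    have h1 : ‖S‖ / q ≤ 1 := by rw [div_le_one hq]; exact hS
    have h2 : (N : ℝ) ^ (1 - s).re ≤ 1 := by
      apply Real.rpow_le_one_of_one_le_of_nonpos (by exact_mod_cast hN)
      simp; linarith
    have h3 : |s.im| ≤ ‖s - 1‖ := by
      have := Complex.abs_im_le_norm (s - 1); simpa using this
    have h4 : 0 < |s.im| := abs_pos.mpr ht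
    calc ‖S‖ / q * ((N : ℝ) ^ (1 - s).re / ‖s - 1‖) ≤ 1 * (1 / |s.im|) := by gcongr
      _ = _ := by ring
  · rw [norm_mul]; gcongr

lemma L_bound (q : ℕ) [NeZero q] (χ : DirichletCharacter ℂ q) (σ t : ℝ) (hσ : 0 < σ) (hσ1 : σ ≤ 1) (ht : t ≠ 0) :
    ‖LSeries (fun n => χ (n : ZMod q)) ((1 + σ : ℝ) + t * Complex.I)‖ ≤ 1 / |t| + 7 + Real.log (q * (2 + |t|)) := by
  have hq1 : (1 : ℝ) ≤ q := by exact_mod_cast NeZero.pos q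
  set s : ℂ := (1 + σ : ℝ) + t * Complex.I with hs
  have hsr : s.re = 1 + σ := by simp [hs]
  have hsi : s.im = t := by simp [hs]
  set N := ⌈(q : ℝ) * (2 + |t|)⌉₊ with hNdef
  have hb : (2 : ℝ) ≤ (q : ℝ) * (2 + |t|) := by nlinarith [abs_nonneg t]
  have hN1 : (q : ℝ) * (2 + |t|) ≤ N := Nat.le_ceil _
  have hN2 : (N : ℝ) < (q : ℝ) * (2 + |t|) + 1 := Nat.ceil_lt_add_one (by linarith)
  have hN0 : 1 ≤ N := by
    have : (1 : ℝ) ≤ N := by linarith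
    exact_mod_cast this
  have hs1 : 1 < s.re := by rw [hsr]; linarith
  have hsum : LSeriesSummable (fun n : ℕ => χ (n : ZMod q)) s := by
    exact DirichletCharacter.LSeriesSummable_of_one_lt_re χ hs1
  set f1 : ℕ → ℂ := fun n => if n ≤ N then χ (n : ZMod q) else 0
  set f2 : ℕ → ℂ := fun n => if N < n then χ (n : ZMod q) else 0
  have s1 : LSeriesSummable f1 s := by
    refine summable_of_ne_finset_zero (s := Icc 1 N) fun n hn => ?_
    rcases Nat.eq_zero_or_pos n with rfl | h
    · simp
    · rw [LSeries.term_of_ne_zero h.ne']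
      have : ¬ n ≤ N := by simp at hn; omega
      simp [f1, this]
  have e0 : (fun n : ℕ => χ (n : ZMod q)) = f1 + f2 := by
    funext n; simp only [f1, f2, Pi.add_apply]; split_ifs <;> first | omega | simp
  have s2 : LSeriesSummable f2 s := by
    have : f2 = (fun n : ℕ => χ (n : ZMod q)) - f1 := by rw [e0]; simp
    rw [this]; exact hsum.sub s1
  rw [e0, LSeries_add s1 s2]
  have b2 := tail_bd q χ N hN0 s hs1 (by rw [hsi]; exact ht)
  rw [hsi] at b2
  have b1 : ‖LSeries f1 s‖ ≤ 1 + Real.log N := by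
    rw [LSeries, tsum_eq_sum (s := Icc 1 N)]
    · refine (norm_sum_le _ _).trans ((Finset.sum_le_sum fun n hn => ?_).trans (harm_le N))
      simp at hn
      rw [LSeries.term_of_ne_zero (by omega), norm_div]
      have hn0 : (0 : ℝ) < n := by exact_mod_cast hn.1
      have hn1 : (1 : ℝ) ≤ n := by exact_mod_cast hn.1
      have h1 : ‖f1 n‖ ≤ 1 := by simp only [f1, hn.2, if_true]; exact χ.norm_le_one _
      have h2 : (n : ℝ) ≤ ‖(n : ℂ) ^ s‖ := by
        rw [← Complex.ofReal_natCast, Complex.norm_cpow_eq_rpow_re_of_pos hn0]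
        calc (n : ℝ) = (n : ℝ) ^ (1 : ℝ) := by simp
          _ ≤ _ := Real.rpow_le_rpow_of_exponent_le hn1 hs1.le
      gcongr
    · intro n hn
      rcases Nat.eq_zero_or_pos n with rfl | h
      · simp
      · rw [LSeries.term_of_ne_zero h.ne']
        have : ¬ n ≤ N := by simp at hn; omega
        simp [f1, this]
  have b3 : Real.log N ≤ Real.log (q * (2 + |t|)) + 1 := by
    have h1 : (N : ℝ) ≤ Real.exp 1 * (q * (2 + |t|)) := by
      have := Real.add_one_le_exp (1 : ℝ)
      nlinarith
    have h2 := Real.log_le_log (by exact_mod_cast hN0) h1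
    rw [Real.log_mul (by positivity) (by positivity), Real.log_exp] at h2
    linarith
  have b4 : ‖s‖ * (5 * q / N) ≤ 5 := by
    have h1 : ‖s‖ ≤ 2 + |t| := by
      rw [hs]
      refine (norm_add_le _ _).trans ?_
      rw [norm_mul, Complex.norm_I, Complex.norm_real, Complex.norm_real, Real.norm_of_nonneg (by linarith), Real.norm_eq_abs]
      linarith
    rw [mul_div_assoc', div_le_iff₀ (by exact_mod_cast hN0)]
    nlinarith [norm_nonneg s]
  refine (norm_add_le _ _).trans ?_
  linarith

end S18

namespace S18

/-- constant for Euler products -/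
def c0 : ℝ := ∑' p : Nat.Primes, 1 / ((p : ℕ) : ℝ) ^ 2

lemma c0_summ : Summable fun p : Nat.Primes => 1 / ((p : ℕ) : ℝ) ^ 2 :=
  (Real.summable_one_div_nat_pow.mpr (by norm_num : 1 < 2)).subtype _

lemma c0_nonneg : 0 ≤ c0 := tsum_nonneg fun p => by positivity

lemma euler_bds (f : ℕ →*₀ ℂ) (hs : Summable (‖f ·‖)) (hf : ∀ p : Nat.Primes, ‖f p‖ ≤ 1 / ((p : ℕ) : ℝ)) :
    ‖∑' n, f n‖ ≤ Real.exp (∑' p : Nat.Primes, (f p).re + c0) ∧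
    Real.exp (∑' p : Nat.Primes, (f p).re - c0) ≤ ‖∑' n, f n‖ := by
  have hsp : Summable fun p : Nat.Primes => f p := hs.of_norm.subtype _
  have hsl : Summable fun p : Nat.Primes => -Complex.log (1 - f p) :=
    hs.of_norm.clog_one_sub.neg.subtype Nat.Prime
  have hb : ∀ p : Nat.Primes, ‖-Complex.log (1 - f p) - f p‖ ≤ 1 / ((p : ℕ) : ℝ) ^ 2 := by
    intro p
    have h2 : (2 : ℝ) ≤ ((p : ℕ) : ℝ) := by exact_mod_cast p.2.two_le
    have h1 : ‖f p‖ ≤ 1 / 2 := (hf p).trans (by gcongr)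
    have h3 := Complex.norm_log_one_add_sub_self_le (z := -f p) (by rw [norm_neg]; linarith)
    have e : -Complex.log (1 - f p) - f p = -(Complex.log (1 + -f p) - -f p) := by
      rw [← sub_eq_add_neg]; ring
    rw [e, norm_neg]
    refine h3.trans ?_
    rw [norm_neg]
    have h4 : (1 - ‖f p‖)⁻¹ ≤ 2 := by
      rw [inv_le_comm₀ (by linarith) (by norm_num)]; linarith
    have h5 : ‖f p‖ ^ 2 ≤ (1 / ((p : ℕ) : ℝ)) ^ 2 := by gcongr; exact hf p
    have h6 : 0 ≤ ‖f p‖ ^ 2 := by positivity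
    calc ‖f p‖ ^ 2 * (1 - ‖f p‖)⁻¹ / 2 ≤ ‖f p‖ ^ 2 * 2 / 2 := by gcongr
      _ = ‖f p‖ ^ 2 := by ring
      _ ≤ _ := by rw [one_div_pow] at h5; exact h5
  have hd : ‖∑' p : Nat.Primes, (-Complex.log (1 - f p) - f p)‖ ≤ c0 :=
    tsum_of_norm_bounded c0_summ.hasSum hb
  rw [hsl.tsum_sub hsp] at hd
  rw [← EulerProduct.exp_tsum_primes_log_eq_tsum hs, Complex.norm_exp]
  set A := ∑' p : Nat.Primes, -Complex.log (1 - f p)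
  have e : ∑' p : Nat.Primes, (f p).re = (∑' p : Nat.Primes, f p).re := by
    rw [Complex.re_tsum hsp]
  rw [e]
  have h1 := (Complex.abs_re_le_norm _).trans hd
  rw [Complex.sub_re, abs_le] at h1
  constructor <;> apply Real.exp_le_exp.mpr <;> linarith

/-- weights -/
def ww (σ : ℝ) (p : ℕ) : ℝ := Real.exp (-(1 + σ) * Real.log p)

/-- twisted value -/
def zz {q : ℕ} (χ : DirichletCharacter ℂ q) (t : ℝ) (p : ℕ) : ℂ := χ p * Complex.exp (-(t * Complex.I) * (Real.log p : ℝ))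

lemma ww_pos (σ : ℝ) (p : ℕ) : 0 < ww σ p := Real.exp_pos _

lemma ww_le (σ : ℝ) (hσ : 0 ≤ σ) (p : ℕ) (hp : 1 ≤ p) : ww σ p ≤ 1 / (p : ℝ) := by
  have h1 : (1 : ℝ) ≤ p := by exact_mod_cast hp
  have h2 : 0 ≤ Real.log p := Real.log_nonneg h1
  rw [one_div, ← Real.exp_log (by linarith : (0 : ℝ) < p), ← Real.exp_neg, ww]
  apply Real.exp_le_exp.mpr
  nlinarith

lemma ww_summ (σ : ℝ) (hσ : 0 < σ) : Summable fun p : Nat.Primes => ww σ p := by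
  have h := (dser_bd (fun n => if n = 0 then 0 else 1) (by simp) 1 0 σ hσ (by norm_num) (fun n hn => by simp; split_ifs <;> simp)).1
  have h2 := h.subtype (fun n => Nat.Prime n)
  refine h2.congr fun p => ?_
  have : (p : ℕ) ≠ 0 := p.2.ne_zero
  simp [ww, this, Function.comp]

lemma zz_norm {q : ℕ} (χ : DirichletCharacter ℂ q) (t : ℝ) (p : ℕ) : ‖zz χ t p‖ = 1 ∨ zz χ t p = 0 := by
  rw [zz]
  generalize Real.log (p : ℝ) = L
  by_cases h : IsUnit (p : ZMod q)
  · left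
    obtain ⟨u, hu⟩ := h
    rw [norm_mul, ← hu, χ.unit_norm_eq_one, Complex.norm_exp]
    simp
  · right
    rw [χ.map_nonunit h, zero_mul]

lemma zz_pow {q : ℕ} (χ : DirichletCharacter ℂ q) (t : ℝ) (p m : ℕ) (hm : m ≠ 0) : zz χ t p ^ m = zz (χ ^ m) (m * t) p := by
  rw [zz, zz, mul_pow, MulChar.pow_apply' χ hm, ← Complex.exp_nat_mul]
  generalize Real.log (p : ℝ) = L
  congr 2
  push_cast; ring

/-- the multiplicative homomorphism -/
def hom {h : ℕ → ℝ} (hh : CM h) {q : ℕ} (χ : DirichletCharacter ℂ q) (s : ℂ) : ℕ →*₀ ℂ where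
  toFun n := (χ n * h n) * Complex.exp (-s * (Real.log n : ℝ))
  map_zero' := by simp [hh.zero]
  map_one' := by simp [hh.one]
  map_mul' m n := by
    rcases Nat.eq_zero_or_pos m with rfl | hm
    · simp [hh.zero]
    rcases Nat.eq_zero_or_pos n with rfl | hn
    · simp [hh.zero]
    have : Real.log ((m * n : ℕ) : ℝ) = Real.log m + Real.log n := by
      push_cast
      exact Real.log_mul (by positivity) (by positivity)
    rw [this, hh.mul]
    generalize Real.log (m : ℝ) = L
    generalize Real.log (n : ℝ) = L'
    push_cast
    rw [map_mul, mul_add, Complex.exp_add]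
    ring

lemma euler_D {h : ℕ → ℝ} (hh : CM h) {q : ℕ} (χ : DirichletCharacter ℂ q) (σ t : ℝ) (hσ : 0 < σ) :
    ‖Dser h χ ((1 + σ : ℝ) + t * Complex.I)‖ ≤ Real.exp (∑' p : Nat.Primes, h p * (zz χ t p).re * ww σ p + c0) ∧
    Real.exp (∑' p : Nat.Primes, h p * (zz χ t p).re * ww σ p - c0) ≤ ‖Dser h χ ((1 + σ : ℝ) + t * Complex.I)‖ := by
  have hs := (h_summ hh (1 / σ) (by positivity)).1
  rw [one_div_one_div] at hs
  have hb : ∀ n : ℕ, ‖hom hh χ ((1 + σ : ℝ) + t * Complex.I) n‖ ≤ |h n| * Real.exp (-(1 + σ) * Real.log n) := fun n => norm_Dser_term h χ (1 + σ) t n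
  have hsum : Summable (fun n => ‖hom hh χ ((1 + σ : ℝ) + t * Complex.I) n‖) :=
    Summable.of_nonneg_of_le (fun _ => norm_nonneg _) hb hs
  have hre : ∀ p : Nat.Primes, (hom hh χ ((1 + σ : ℝ) + t * Complex.I) p).re = h p * (zz χ t p).re * ww σ p := by
    intro p
    change ((χ (p : ℕ) * h p) * Complex.exp (-((1 + σ : ℝ) + t * Complex.I) * (Real.log (p : ℕ) : ℝ))).re = _
    rw [zz, ww]
    generalize Real.log ((p : ℕ) : ℝ) = L
    have e : (χ (p : ℕ) * h p) * Complex.exp (-((1 + σ : ℝ) + t * Complex.I) * (L : ℝ)) = ((h p * Real.exp (-(1 + σ) * L) : ℝ) : ℂ) * (χ (p : ℕ) * Complex.exp (-(t * Complex.I) * (L : ℝ))) := by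
      rw [show -((1 + σ : ℝ) + t * Complex.I) * (L : ℝ) = ((-(1 + σ) * L : ℝ) : ℂ) + (-(t * Complex.I) * (L : ℝ)) by push_cast; ring, Complex.exp_add]
      push_cast; ring
    rw [e, Complex.re_ofReal_mul]; ring
  have hf : ∀ p : Nat.Primes, ‖hom hh χ ((1 + σ : ℝ) + t * Complex.I) p‖ ≤ 1 / ((p : ℕ) : ℝ) := by
    intro p
    refine (hb p).trans ?_
    have h1 := ww_le σ hσ.le p p.2.one_lt.le
    rw [ww] at h1
    have h2 : |h p| ≤ 1 := by rw [abs_of_nonneg (hh.nonneg _)]; exact hh.le_one _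
    calc |h p| * Real.exp (-(1 + σ) * Real.log (p : ℕ)) ≤ 1 * Real.exp (-(1 + σ) * Real.log (p : ℕ)) := by gcongr
      _ ≤ _ := by rw [one_mul]; exact h1
  have := euler_bds _ hsum hf
  simp only [hre] at this
  exact this

/-- constant one function as CM -/
def one1 (n : ℕ) : ℝ := if n = 0 then 0 else 1

lemma one1_CM : CM one1 := by
  refine ⟨by simp [one1], by simp [one1], fun m n => ?_, fun n => ?_⟩
  · simp only [one1, mul_eq_zero]; by_cases hm : m = 0 <;> by_cases hn : n = 0 <;> simp [hm, hn]
  · simp only [one1]; split_ifs <;> simp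

lemma one1_prime (p : Nat.Primes) : one1 p = 1 := by simp [one1, p.2.ne_zero]

lemma Dser_one1 {q : ℕ} (χ : DirichletCharacter ℂ q) (s : ℂ) : Dser one1 χ s = LSeries (fun n : ℕ => χ (n : ZMod q)) s := by
  rw [Dser, Dser_term_eq one1 (by simp [one1]), ← LSeries]
  refine LSeries_congr (fun {n} hn => ?_) s
  simp [one1, hn]

lemma prime_twist (q : ℕ) [NeZero q] (χ : DirichletCharacter ℂ q) (σ t : ℝ) (hσ : 0 < σ) (hσ1 : σ ≤ 1) (ht : t ≠ 0) :
    ∑' p : Nat.Primes, (zz χ t p).re * ww σ p ≤ Real.log (1 / |t| + 7 + Real.log (q * (2 + |t|))) + c0 := by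
  have h1 := (euler_D one1_CM χ σ t hσ).2
  rw [Dser_one1] at h1
  have h2 := h1.trans (L_bound q χ σ t hσ hσ1 ht)
  simp only [one1_prime, one_mul] at h2
  have h3 := Real.log_le_log (Real.exp_pos _) h2
  rw [Real.log_exp] at h3
  linarith

lemma zz_one (p : ℕ) : zz (1 : DirichletCharacter ℂ 1) 0 p = 1 := by
  have h2 : (1 : DirichletCharacter ℂ 1) (p : ZMod 1) = 1 := MulChar.one_apply (isUnit_of_subsingleton _)
  simp [zz, h2]

lemma W_upper (σ : ℝ) (hσ : 0 < σ) (hσ1 : σ ≤ 1) :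
    ∑' p : Nat.Primes, ww σ p ≤ Real.log (1 / σ) + (c0 + 1) := by
  have h1 := (euler_D one1_CM (1 : DirichletCharacter ℂ 1) σ 0 hσ).2
  have hs := h_summ one1_CM (1 / σ) (by positivity)
  rw [one_div_one_div] at hs
  have h2 := h1.trans ((Dser_norm_le one1 _ (1 + σ) 0 hs.1).trans hs.2)
  simp only [one1_prime, one_mul, zz_one, Complex.one_re] at h2
  have h3 := Real.log_le_log (Real.exp_pos _) h2
  rw [Real.log_exp] at h3
  have h4 : Real.log (1 + 1 / σ) ≤ Real.log (Real.exp 1 * (1 / σ)) := by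
    apply Real.log_le_log (by positivity)
    have h5 : (1 : ℝ) ≤ 1 / σ := by rw [le_div_iff₀ hσ]; linarith
    have := Real.add_one_le_exp (1 : ℝ)
    nlinarith
  rw [Real.log_mul (by positivity) (by positivity), Real.log_exp] at h4
  linarith

lemma zeta_lower (σ : ℝ) (hσ : 0 < σ) (N : ℕ) :
    (1 / σ) * (1 - Real.exp (-σ * Real.log (N + 1 : ℕ))) ≤ ∑ n ∈ Icc 1 N, Real.exp (-(1 + σ) * Real.log n) := by
  induction N with
  | zero => simp
  | succ n ih =>
    rw [Finset.sum_Icc_succ_top (by omega)]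
    set a : ℝ := ((n + 1 : ℕ) : ℝ) with ha
    have ha0 : 0 < a := by rw [ha]; positivity
    have hb : (((n + 1) + 1 : ℕ) : ℝ) = a + 1 := by rw [ha]; push_cast; ring
    rw [hb]
    have h1 : Real.log (a + 1) - Real.log a ≤ 1 / a := by
      have h2 := Real.log_le_sub_one_of_pos (show (0 : ℝ) < (a + 1) / a by positivity)
      rw [Real.log_div (by positivity) (by positivity)] at h2
      have h3 : (a + 1) / a - 1 = 1 / a := by field_simp; ring
      linarith
    have h4 : Real.exp (-(1 + σ) * Real.log a) = Real.exp (-σ * Real.log a) * (1 / a) := by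
      rw [show -(1 + σ) * Real.log a = -σ * Real.log a - Real.log a by ring, Real.exp_sub, Real.exp_log ha0]; ring
    have h5 : Real.exp (-σ * Real.log (a + 1)) = Real.exp (-σ * Real.log a) * Real.exp (-(σ * (Real.log (a + 1) - Real.log a))) := by
      rw [← Real.exp_add]; ring_nf
    have h6 : 1 - σ * (1 / a) ≤ Real.exp (-(σ * (Real.log (a + 1) - Real.log a))) := by
      have := Real.add_one_le_exp (-(σ * (Real.log (a + 1) - Real.log a)))
      have h7 : σ * (Real.log (a + 1) - Real.log a) ≤ σ * (1 / a) := by gcongr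
      linarith
    have h8 : Real.exp (-σ * Real.log a) * (1 - σ * (1 / a)) ≤ Real.exp (-σ * Real.log (a + 1)) := by
      rw [h5]; gcongr
    have h9 : (1 / σ) * (Real.exp (-σ * Real.log a) * (1 - σ * (1 / a))) ≤ (1 / σ) * Real.exp (-σ * Real.log (a + 1)) := by gcongr
    have h10 : (1 / σ) * (Real.exp (-σ * Real.log a) * (1 - σ * (1 / a))) = (1 / σ) * Real.exp (-σ * Real.log a) - Real.exp (-σ * Real.log a) * (1 / a) := by
      field_simp
    rw [h4]
    linarith

lemma W_lower (σ : ℝ) (hσ : 0 < σ) :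
    Real.log (1 / σ) - c0 ≤ ∑' p : Nat.Primes, ww σ p := by
  have h1 := (euler_D one1_CM (1 : DirichletCharacter ℂ 1) σ 0 hσ).1
  simp only [one1_prime, one_mul, zz_one, Complex.one_re] at h1
  have e : Dser one1 (1 : DirichletCharacter ℂ 1) ((1 + σ : ℝ) + (0 : ℝ) * Complex.I) = ((∑' n : ℕ, |one1 n| * Real.exp (-(1 + σ) * Real.log n) : ℝ) : ℂ) := by
    rw [Dser, Complex.ofReal_tsum]
    refine tsum_congr fun n => ?_
    have h2 : (1 : DirichletCharacter ℂ 1) (n : ZMod 1) = 1 := MulChar.one_apply (isUnit_of_subsingleton _)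
    rw [h2, abs_of_nonneg (one1_CM.nonneg n)]
    generalize Real.log (n : ℝ) = L
    push_cast
    simp
  have hs := h_summ one1_CM (1 / σ) (by positivity)
  rw [one_div_one_div] at hs
  have h3 : 1 / σ ≤ ∑' n : ℕ, |one1 n| * Real.exp (-(1 + σ) * Real.log n) := by
    have hlim : Tendsto (fun N : ℕ => (1 / σ) * (1 - Real.exp (-σ * Real.log (N + 1 : ℕ)))) atTop (nhds ((1 / σ) * (1 - 0))) := by
      refine Tendsto.const_mul _ (Tendsto.const_sub _ ?_)
      refine Real.tendsto_exp_atBot.comp ?_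
      refine Tendsto.const_mul_atTop_of_neg (by linarith) ?_
      exact Real.tendsto_log_atTop.comp ((tendsto_natCast_atTop_atTop).comp (tendsto_add_atTop_nat 1))
    rw [sub_zero, mul_one] at hlim
    refine le_of_tendsto hlim (Eventually.of_forall fun N => ?_)
    refine (zeta_lower σ hσ N).trans ?_
    refine le_trans (le_of_eq ?_) (hs.1.sum_le_tsum (Icc 1 N) fun n _ => by positivity)
    refine Finset.sum_congr rfl fun n hn => ?_
    have : n ≠ 0 := by simp at hn; omega
    simp [one1, this]
  rw [e, Complex.norm_real, Real.norm_of_nonneg (tsum_nonneg fun n => by positivity)] at h1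
  have h4 := Real.log_le_log (by positivity) (h3.trans h1)
  rw [Real.log_exp] at h4
  linarith

end S18

namespace S18

/-- Fejer kernel -/
def PP (k : ℕ) (z : ℂ) : ℝ := (1 / (k : ℝ) ^ 2) * ∑ j ∈ range k, ∑ l ∈ range k, (z ^ ((j - l) + (l - j))).re

lemma pow_gap (z : ℂ) (hz : ‖z‖ = 1 ∨ z = 0) (m : ℕ) : 1 - (z ^ m).re ≤ (m : ℝ) ^ 2 * (1 - z.re) := by
  rcases hz with hz | rfl
  · have key : ∀ w : ℂ, ‖w‖ = 1 → ‖1 - w‖ ^ 2 = 2 * (1 - w.re) := by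
      intro w hw
      rw [← Complex.normSq_eq_norm_sq, Complex.normSq_apply]
      have h1 : w.re * w.re + w.im * w.im = 1 := by
        rw [← Complex.normSq_apply, Complex.normSq_eq_norm_sq, hw]; norm_num
      simp
      linarith
    have h1 := key z hz
    have h2 := key (z ^ m) (by rw [norm_pow, hz, one_pow])
    have h3 : ‖1 - z ^ m‖ ≤ m * ‖1 - z‖ := by
      have : 1 - z ^ m = (1 - z) * ∑ i ∈ range m, z ^ i := by
        have := mul_neg_geom_sum z m; rw [this]
      rw [this, norm_mul, mul_comm]
      gcongr
      refine (norm_sum_le _ _).trans ?_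
      simp [norm_pow, hz]
    have h4 : ‖1 - z ^ m‖ ^ 2 ≤ (m * ‖1 - z‖) ^ 2 := by gcongr
    rw [mul_pow, h1, h2] at h4
    linarith
  · rcases Nat.eq_zero_or_pos m with rfl | hm
    · simp
    · have : (1 : ℝ) ≤ m := by exact_mod_cast hm
      simp [hm.ne']
      exact hm

lemma PP_nonneg (k : ℕ) (z : ℂ) (hz : ‖z‖ = 1 ∨ z = 0) : 0 ≤ PP k z := by
  rw [PP]
  refine mul_nonneg (by positivity) ?_
  rcases hz with hz | rfl
  · have hc : z * (starRingEnd ℂ) z = 1 := by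
      rw [Complex.mul_conj, Complex.normSq_eq_norm_sq, hz]; norm_num
    have e : ∀ j l : ℕ, (z ^ ((j - l) + (l - j))).re = (z ^ j * (starRingEnd ℂ) (z ^ l)).re := by
      intro j l
      rcases le_total l j with h | h
      · obtain ⟨d, rfl⟩ := Nat.exists_eq_add_of_le h
        have : z ^ (l + d) * (starRingEnd ℂ) (z ^ l) = z ^ d := by
          rw [map_pow, pow_add, mul_right_comm, ← mul_pow, hc]; simp
        rw [this]; congr 2; omega
      · obtain ⟨d, rfl⟩ := Nat.exists_eq_add_of_le h
        have : z ^ j * (starRingEnd ℂ) (z ^ (j + d)) = (starRingEnd ℂ) (z ^ d) := by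
          rw [map_pow, pow_add, ← mul_assoc, ← mul_pow, hc]; simp
        rw [this, Complex.conj_re]; congr 2; omega
    have e2 : ∑ j ∈ range k, ∑ l ∈ range k, (z ^ ((j - l) + (l - j))).re = ‖∑ j ∈ range k, z ^ j‖ ^ 2 := by
      simp only [e]
      simp only [← Complex.re_sum]
      rw [← Finset.sum_mul_sum, ← map_sum, Complex.mul_conj, Complex.normSq_eq_norm_sq, Complex.ofReal_re]
    rw [e2]; positivity
  · refine Finset.sum_nonneg fun j _ => Finset.sum_nonneg fun l _ => ?_
    rcases Nat.eq_zero_or_pos ((j - l) + (l - j)) with h | h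
    · rw [h]; simp
    · rw [zero_pow h.ne']; simp

lemma PP_gap (k : ℕ) (hk : 1 ≤ k) (z : ℂ) (hz : ‖z‖ = 1 ∨ z = 0) : 1 - PP k z ≤ (k : ℝ) ^ 2 * (1 - z.re) := by
  have hk0 : (0 : ℝ) < k := by exact_mod_cast hk
  have hre : z.re ≤ 1 := by
    rcases hz with hz | rfl
    · exact (Complex.re_le_norm z).trans hz.le
    · simp
  have h1 : ∑ j ∈ range k, ∑ l ∈ range k, (1 - (z ^ ((j - l) + (l - j))).re) ≤ ∑ j ∈ range k, ∑ l ∈ range k, (k : ℝ) ^ 2 * (1 - z.re) := by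
    refine Finset.sum_le_sum fun j hj => Finset.sum_le_sum fun l hl => ?_
    refine (pow_gap z hz _).trans ?_
    have h2 : ((j - l + (l - j) : ℕ) : ℝ) ≤ k := by
      simp at hj hl
      exact_mod_cast (by omega : j - l + (l - j) ≤ k)
    have : 0 ≤ 1 - z.re := by linarith
    gcongr
  simp only [Finset.sum_sub_distrib] at h1
  simp only [Finset.sum_const, card_range, nsmul_eq_mul, mul_one] at h1
  rw [PP]
  have h2 : 1 - (1 / (k : ℝ) ^ 2) * ∑ j ∈ range k, ∑ l ∈ range k, (z ^ ((j - l) + (l - j))).re = (1 / (k : ℝ) ^ 2) * ((k : ℝ) * k - ∑ j ∈ range k, ∑ l ∈ range k, (z ^ ((j - l) + (l - j))).re) := by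
    field_simp
  rw [h2]
  calc _ ≤ (1 / (k : ℝ) ^ 2) * ((k : ℝ) * (k * ((k : ℝ) ^ 2 * (1 - z.re)))) := by gcongr
    _ = _ := by field_simp

/-- weighted prime sum -/
def Asum (h : ℕ → ℝ) (σ : ℝ) : ℝ := ∑' p : Nat.Primes, h p * ww σ p

lemma summ_mul_ww (σ : ℝ) (hσ : 0 < σ) (g : Nat.Primes → ℝ) (C : ℝ) (hg : ∀ p, |g p| ≤ C) :
    Summable fun p : Nat.Primes => g p * ww σ p := by
  refine Summable.of_norm_bounded ((ww_summ σ hσ).mul_left C) fun p => ?_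
  rw [norm_mul, Real.norm_eq_abs, Real.norm_of_nonneg (ww_pos _ _).le]
  have := (ww_pos σ p).le
  gcongr
  exact hg p

lemma zz_le {q : ℕ} (χ : DirichletCharacter ℂ q) (t : ℝ) (p : ℕ) : ‖zz χ t p‖ ≤ 1 := by
  rcases zz_norm χ t p with h | h
  · exact h.le
  · rw [h]; simp

lemma CM_abs {h : ℕ → ℝ} (hh : CM h) (n : ℕ) : |h n| ≤ 1 := by
  rw [abs_of_nonneg (hh.nonneg n)]; exact hh.le_one n

lemma A_gap {h : ℕ → ℝ} (hh : CM h) {q : ℕ} (χ : DirichletCharacter ℂ q) (σ t : ℝ) (hσ : 0 < σ) (k : ℕ) (hk : 1 ≤ k)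
    (M : ℝ) (hM0 : 0 ≤ M)
    (hM : ∀ m : ℕ, 1 ≤ m → m < k → ∑' p : Nat.Primes, (zz (χ ^ m) (m * t) p).re * ww σ p ≤ M) :
    ∑' p : Nat.Primes, h p * (zz χ t p).re * ww σ p ≤
      Asum h σ - (Asum h σ - (∑' p : Nat.Primes, ww σ p) / k - M) / (k : ℝ) ^ 2 := by
  have hk0 : (0 : ℝ) < k := by exact_mod_cast hk
  have hb1 : ∀ p : Nat.Primes, ∀ m : ℕ, |(zz χ t p ^ m).re| ≤ 1 := fun p m =>
    (Complex.abs_re_le_norm _).trans (by rw [norm_pow]; exact pow_le_one₀ (norm_nonneg _) (zz_le χ t p))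
  have hb2 : ∀ p : Nat.Primes, |h p * (zz χ t p).re| ≤ 1 := fun p => by
    rw [abs_mul]
    have h1 := CM_abs hh p
    have h2 := hb1 p 1
    rw [pow_one] at h2
    exact mul_le_one₀ h1 (abs_nonneg _) h2
  have sA : Summable fun p : Nat.Primes => h p * ww σ p := summ_mul_ww σ hσ (fun p => h p) 1 fun p => CM_abs hh p
  have sR : Summable fun p : Nat.Primes => h p * (zz χ t p).re * ww σ p := summ_mul_ww σ hσ (fun p => h p * (zz χ t p).re) 1 hb2
  have sz : ∀ m, Summable fun p : Nat.Primes => (zz χ t p ^ m).re * ww σ p := fun m => summ_mul_ww σ hσ (fun p => (zz χ t p ^ m).re) 1 fun p => hb1 p m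
  have sW := ww_summ σ hσ
  -- the Fejer sum
  have sP : HasSum (fun p : Nat.Primes => PP k (zz χ t p) * ww σ p)
      ((1 / (k : ℝ) ^ 2) * ∑ j ∈ range k, ∑ l ∈ range k, ∑' p : Nat.Primes, (zz χ t p ^ ((j - l) + (l - j))).re * ww σ p) := by
    have h1 := (hasSum_sum (s := range k) fun j _ => hasSum_sum (s := range k) fun l _ => (sz ((j - l) + (l - j))).hasSum).mul_left (1 / (k : ℝ) ^ 2)
    suffices e : (fun p : Nat.Primes => PP k (zz χ t p) * ww σ p) = fun p : Nat.Primes => (1 / (k : ℝ) ^ 2) * ∑ j ∈ range k, ∑ l ∈ range k, (zz χ t p ^ ((j - l) + (l - j))).re * ww σ p by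
      rw [e]; exact h1
    funext p
    rw [PP, mul_assoc, Finset.sum_mul]
    congr 1
    exact Finset.sum_congr rfl fun j _ => by rw [Finset.sum_mul]
  have hPle : ∑' p : Nat.Primes, PP k (zz χ t p) * ww σ p ≤ (∑' p : Nat.Primes, ww σ p) / k + M := by
    rw [sP.tsum_eq]
    have h1 : ∀ j ∈ range k, ∑ l ∈ range k, ∑' p : Nat.Primes, (zz χ t p ^ ((j - l) + (l - j))).re * ww σ p ≤ (∑' p : Nat.Primes, ww σ p) + k * M := by
      intro j hj
      have h2 : ∀ l ∈ range k, ∑' p : Nat.Primes, (zz χ t p ^ ((j - l) + (l - j))).re * ww σ p ≤ (if l = j then ∑' p : Nat.Primes, ww σ p else 0) + M := by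
        intro l hl
        simp at hj hl
        split_ifs with h
        · subst h; simp; exact hM0
        · rw [zero_add]
          refine le_trans (le_of_eq ?_) (hM ((j - l) + (l - j)) (by omega) (by omega))
          refine tsum_congr fun p => ?_
          rw [zz_pow _ _ _ _ (by omega)]
      refine (Finset.sum_le_sum h2).trans ?_
      rw [Finset.sum_add_distrib, Finset.sum_ite_eq' _ j]
      simp at hj
      simp [hj]
    calc _ ≤ (1 / (k : ℝ) ^ 2) * (k * ((∑' p : Nat.Primes, ww σ p) + k * M)) := by
          gcongr
          refine (Finset.sum_le_sum h1).trans (le_of_eq ?_)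
          simp only [Finset.sum_const, card_range, nsmul_eq_mul]
      _ = _ := by field_simp
  have key : Asum h σ - ∑' p : Nat.Primes, PP k (zz χ t p) * ww σ p ≤ (k : ℝ) ^ 2 * (Asum h σ - ∑' p : Nat.Primes, h p * (zz χ t p).re * ww σ p) := by
    rw [Asum, ← sA.tsum_sub sP.summable, ← sA.tsum_sub sR, ← tsum_mul_left]
    refine Summable.tsum_le_tsum (fun p => ?_) (sA.sub sP.summable) ((sA.sub sR).mul_left _)
    have h1 := PP_gap k hk _ (zz_norm χ t p)
    have h2 := PP_nonneg k _ (zz_norm χ t p)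
    have hw := (ww_pos σ p).le
    rcases hh.val p with h | h
    · rw [h]; simp; positivity
    · rw [h]
      have := mul_le_mul_of_nonneg_right h1 hw
      nlinarith
  have : (Asum h σ - (∑' p : Nat.Primes, ww σ p) / k - M) / (k : ℝ) ^ 2 ≤ Asum h σ - ∑' p : Nat.Primes, h p * (zz χ t p).re * ww σ p := by
    rw [div_le_iff₀ (by positivity)]
    linarith
  linarith

lemma F_triv {h : ℕ → ℝ} (hh : CM h) {q : ℕ} (χ : DirichletCharacter ℂ q) (σ t : ℝ) (hσ : 0 < σ) :
    ‖Dser h χ ((1 + σ : ℝ) + t * Complex.I)‖ ≤ Real.exp (Asum h σ + c0) := by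
  refine (euler_D hh χ σ t hσ).1.trans (Real.exp_le_exp.mpr ?_)
  refine add_le_add ?_ le_rfl
  have sA : Summable fun p : Nat.Primes => h p * ww σ p := summ_mul_ww σ hσ (fun p => h p) 1 fun p => CM_abs hh p
  have hb : ∀ p : Nat.Primes, |(zz χ t p).re| ≤ 1 := fun p => (Complex.abs_re_le_norm _).trans (zz_le χ t p)
  have sR : Summable fun p : Nat.Primes => h p * (zz χ t p).re * ww σ p := summ_mul_ww σ hσ (fun p => h p * (zz χ t p).re) 1 fun p => by
    rw [abs_mul]
    exact mul_le_one₀ (CM_abs hh p) (abs_nonneg _) (hb p)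
  refine Summable.tsum_le_tsum (fun p => ?_) sR sA
  have hw := (ww_pos σ p).le
  have h1 := hh.nonneg p
  have h2 := (abs_le.mp (hb p)).2
  gcongr
  nlinarith

lemma Asum_mono {h : ℕ → ℝ} (hh : CM h) (σ τ : ℝ) (hσ : 0 < σ) (hst : σ ≤ τ) : Asum h τ ≤ Asum h σ := by
  have sA : ∀ σ, 0 < σ → Summable fun p : Nat.Primes => h p * ww σ p := fun σ hσ => summ_mul_ww σ hσ (fun p => h p) 1 fun p => CM_abs hh p
  refine Summable.tsum_le_tsum (fun p => ?_) (sA τ (hσ.trans_le hst)) (sA σ hσ)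
  have h1 := hh.nonneg p
  have h2 : 0 ≤ Real.log (p : ℕ) := Real.log_nonneg (by exact_mod_cast p.2.one_lt.le)
  refine mul_le_mul_of_nonneg_left ?_ h1
  rw [ww, ww]
  apply Real.exp_le_exp.mpr
  nlinarith

/-- tail of the prime sum -/
lemma prime_tail (L : ℝ) (hL : 2 ≤ L) :
    ∑' p : Nat.Primes, (if Real.exp L < ((p : ℕ) : ℝ) then ww (1 / L) p else 0) ≤ 2 * (2 * c0 + 2) := by
  have h1 := W_upper (1 / L) (by positivity) (by rw [div_le_one (by linarith)]; linarith)
  have h2 := W_lower (2 / L) (by positivity)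
  have s1 := ww_summ (1 / L) (by positivity)
  have s2 := ww_summ (2 / L) (by positivity)
  have e1 : Real.log (1 / (1 / L)) - Real.log (1 / (2 / L)) ≤ 1 := by
    rw [one_div_one_div, one_div_div, Real.log_div (by positivity) (by norm_num)]
    have := Real.log_two_lt_d9
    linarith
  have h3 : ∑' p : Nat.Primes, (ww (1 / L) p - ww (2 / L) p) ≤ 2 * c0 + 2 := by
    rw [s1.tsum_sub s2]; linarith
  have hd : ∀ p : Nat.Primes, 0 ≤ ww (1 / L) p - ww (2 / L) p := by
    intro p
    have h2 : 0 ≤ Real.log (p : ℕ) := Real.log_nonneg (by exact_mod_cast p.2.one_lt.le)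
    rw [sub_nonneg, ww, ww]
    apply Real.exp_le_exp.mpr
    have : 1 / L ≤ 2 / L := by gcongr; norm_num
    nlinarith
  have s3 : Summable fun p : Nat.Primes => (if Real.exp L < ((p : ℕ) : ℝ) then ww (1 / L) p else 0) := by
    refine Summable.of_nonneg_of_le (fun p => ?_) (fun p => ?_) s1
    · split_ifs; exacts [(ww_pos _ _).le, le_rfl]
    · split_ifs; exacts [le_rfl, (ww_pos _ _).le]
  refine le_trans ?_ (mul_le_mul_of_nonneg_left h3 (by norm_num : (0 : ℝ) ≤ 2))
  rw [← tsum_mul_left]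
  refine Summable.tsum_le_tsum (fun p => ?_) s3 ((s1.sub s2).mul_left 2)
  split_ifs with h
  · have hp0 : (0 : ℝ) < ((p : ℕ) : ℝ) := (Real.exp_pos _).trans h
    have h4 : L < Real.log (p : ℕ) := by rwa [Real.lt_log_iff_exp_lt hp0]
    have h5 : ww (2 / L) p = ww (1 / L) p * Real.exp (-(1 / L) * Real.log (p : ℕ)) := by
      rw [ww, ww, ← Real.exp_add]; ring_nf
    have h6 : Real.exp (-(1 / L) * Real.log (p : ℕ)) ≤ 1 / 2 := by
      have h7 : 1 ≤ (1 / L) * Real.log (p : ℕ) := by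
        rw [one_div, inv_mul_eq_div, le_div_iff₀ (by linarith)]; linarith
      have h8 : Real.exp (-(1 / L) * Real.log (p : ℕ)) ≤ Real.exp (-1) := by
        apply Real.exp_le_exp.mpr; linarith
      refine h8.trans ?_
      rw [Real.exp_neg, inv_le_comm₀ (Real.exp_pos _) (by norm_num)]
      have := Real.add_one_le_exp (1 : ℝ); linarith
    rw [h5]
    have := (ww_pos (1 / L) p)
    nlinarith
  · have := hd p; linarith

end S18

namespace S18

/-- primes up to `n` as a finset of `Nat.Primes` -/
def psub (n : ℕ) : Finset Nat.Primes := (Icc 1 n).subtype Nat.Prime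

lemma mem_psub (n : ℕ) (p : Nat.Primes) : p ∈ psub n ↔ (p : ℕ) ≤ n := by
  have h : p ∈ psub n ↔ (p : ℕ) ∈ Icc 1 n := Finset.mem_subtype
  rw [h, mem_Icc]
  exact ⟨fun h => h.2, fun h => ⟨p.2.one_lt.le, h⟩⟩

lemma psub_sum (n : ℕ) (g : ℕ → ℝ) : ∑ p ∈ (Icc 1 n).filter Nat.Prime, g p = ∑ p ∈ psub n, g p := by
  rw [psub]
  exact (Finset.sum_subtype_eq_sum_filter (f := g) (p := Nat.Prime) (s := Icc 1 n)).symm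

lemma Asum_fin {h : ℕ → ℝ} (hh : CM h) (σ : ℝ) (hσ : 0 < σ) (n : ℕ) :
    ∑ p ∈ (Icc 1 n).filter Nat.Prime, h p * ww σ p ≤ Asum h σ := by
  have sA : Summable fun p : Nat.Primes => h p * ww σ p := summ_mul_ww σ hσ (fun p => h p) 1 fun p => CM_abs hh p
  have e : ∑ p ∈ (Icc 1 n).filter Nat.Prime, h p * ww σ p = ∑ p ∈ psub n, h p * ww σ p := by
    exact psub_sum _ (fun p : ℕ => h p * ww σ p)
  rw [e]
  exact sA.sum_le_tsum (psub n) fun p _ => mul_nonneg (hh.nonneg _) (ww_pos _ _).le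

lemma Asum_le_sum {h : ℕ → ℝ} (hh : CM h) (L : ℝ) (hL : 2 ≤ L) :
    Asum h (1 / L) ≤ ∑ p ∈ (Icc 1 ⌊Real.exp L⌋₊).filter Nat.Prime, h p / p + 2 * (2 * c0 + 2) := by
  have hσ : (0 : ℝ) < 1 / L := by positivity
  have sA : Summable fun p : Nat.Primes => h p * ww (1 / L) p := summ_mul_ww _ hσ (fun p => h p) 1 fun p => CM_abs hh p
  have s1 := ww_summ (1 / L) hσ
  have s3 : Summable fun p : Nat.Primes => (if Real.exp L < ((p : ℕ) : ℝ) then ww (1 / L) p else 0) := by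
    refine Summable.of_nonneg_of_le (fun p => ?_) (fun p => ?_) s1
    · split_ifs; exacts [(ww_pos _ _).le, le_rfl]
    · split_ifs; exacts [le_rfl, (ww_pos _ _).le]
  have e : ∑ p ∈ (Icc 1 ⌊Real.exp L⌋₊).filter Nat.Prime, h p / p = ∑ p ∈ psub ⌊Real.exp L⌋₊, h p / p := by
    exact psub_sum _ (fun p : ℕ => h p / p)
  have hs : HasSum (fun p : Nat.Primes => if p ∈ psub ⌊Real.exp L⌋₊ then h p / (p : ℕ) else 0) (∑ p ∈ psub ⌊Real.exp L⌋₊, h p / p) := by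
    have h1 := hasSum_sum_of_ne_finset_zero (f := fun p : Nat.Primes => if p ∈ psub ⌊Real.exp L⌋₊ then h p / (p : ℕ) else 0) (s := psub ⌊Real.exp L⌋₊) (L := SummationFilter.unconditional _) (fun p hp => if_neg hp)
    rw [Finset.sum_congr rfl fun p hp => if_pos hp] at h1
    exact h1
  rw [e, ← hs.tsum_eq]
  refine le_trans ?_ (add_le_add le_rfl (prime_tail L hL))
  rw [← hs.summable.tsum_add s3]
  refine Summable.tsum_le_tsum (fun p => ?_) sA (hs.summable.add s3)
  have h0 := hh.nonneg p
  have h1 := hh.le_one p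
  have hw := ww_pos (1 / L) p
  have hp := p.2.one_lt.le
  have hw2 := ww_le (1 / L) hσ.le p hp
  by_cases hpL : Real.exp L < ((p : ℕ) : ℝ)
  · rw [if_pos hpL]
    have : (0 : ℝ) ≤ if p ∈ psub ⌊Real.exp L⌋₊ then h p / (p : ℕ) else 0 := by
      split_ifs
      · positivity
      · exact le_rfl
    nlinarith
  · rw [if_neg hpL, if_pos, add_zero]
    · calc h p * ww (1 / L) p ≤ h p * (1 / (p : ℕ)) := by gcongr
        _ = _ := by ring
    · rw [mem_psub]
      exact Nat.le_floor (not_lt.mp hpL)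

lemma Asum_le_prod {h : ℕ → ℝ} (hh : CM h) (L : ℝ) (hL : 2 ≤ L) :
    Real.exp (Asum h (1 / L)) ≤ Real.exp (5 * c0 + 4) * ∏ p ∈ (Icc 1 ⌊Real.exp L⌋₊).filter Nat.Prime, (1 + h p / p) := by
  set S := (Icc 1 ⌊Real.exp L⌋₊).filter Nat.Prime with hS
  have hpos : ∀ p ∈ S, 0 < 1 + h p / (p : ℝ) := fun p _ => by
    have := hh.nonneg p; positivity
  have hq : ∑ p ∈ S, 1 / (p : ℝ) ^ 2 ≤ c0 := by
    have e : ∑ p ∈ S, 1 / (p : ℝ) ^ 2 = ∑ p ∈ psub ⌊Real.exp L⌋₊, 1 / ((p : ℕ) : ℝ) ^ 2 := by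
      exact psub_sum _ (fun p : ℕ => 1 / (p : ℝ) ^ 2)
    rw [e]
    exact c0_summ.sum_le_tsum (psub ⌊Real.exp L⌋₊) fun p _ => by positivity
  have h1 : ∑ p ∈ S, h p / p ≤ ∑ p ∈ S, Real.log (1 + h p / p) + c0 := by
    refine le_trans ?_ (add_le_add le_rfl hq)
    rw [← Finset.sum_add_distrib]
    refine Finset.sum_le_sum fun p hp => ?_
    have hp1 : 1 ≤ p := by simp [hS] at hp; omega
    have hp0 : (0 : ℝ) < p := by exact_mod_cast hp1
    have h0 := hh.nonneg p
    have h2 := hh.le_one p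
    have h3 := Real.one_sub_inv_le_log_of_pos (hpos p hp)
    have h4 : h p / p - 1 / (p : ℝ) ^ 2 ≤ 1 - (1 + h p / p)⁻¹ := by
      set y := h p / (p : ℝ) with hy
      have hy0 : 0 ≤ y := by positivity
      have hy1 : y ≤ 1 / p := by rw [hy]; gcongr
      have h5 : y ^ 2 ≤ 1 / (p : ℝ) ^ 2 := by
        rw [← one_div_pow]; gcongr
      have h6 : 1 - (1 + y)⁻¹ = y / (1 + y) := by field_simp; ring
      rw [h6]
      have h7 : y - y ^ 2 ≤ y / (1 + y) := by
        rw [le_div_iff₀ (by linarith)]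
        nlinarith [pow_nonneg hy0 3]
      linarith
    linarith
  have h2 := Asum_le_sum hh L hL
  have h3 : Real.exp (∑ p ∈ S, Real.log (1 + h p / p)) = ∏ p ∈ S, (1 + h p / p) := by
    rw [Real.exp_sum]
    exact Finset.prod_congr rfl fun p hp => Real.exp_log (hpos p hp)
  rw [← h3, ← Real.exp_add]
  apply Real.exp_le_exp.mpr
  linarith

lemma prod_coprime {h : ℕ → ℝ} (hh : CM h) (q : ℕ) (hq : 1 ≤ q) (n : ℕ) :
    ∏ p ∈ (Icc 1 n).filter Nat.Prime, (1 + h p / p) ≤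
      ((q : ℝ) / (Nat.totient q : ℝ)) * ∏ p ∈ ((Icc 1 n).filter Nat.Prime).filter (fun p => ¬ p ∣ q), (1 + h p / p) := by
  have hpos : ∀ p : ℕ, 0 < 1 + h p / (p : ℝ) := fun p => by
    have := hh.nonneg p; positivity
  rw [← Finset.prod_filter_mul_prod_filter_not ((Icc 1 n).filter Nat.Prime) (fun p => p ∣ q)]
  refine mul_le_mul_of_nonneg_right ?_ (Finset.prod_nonneg fun p _ => (hpos p).le)
  have hq0 : (0 : ℝ) < q := by exact_mod_cast hq
  have htot : (Nat.totient q : ℝ) = q * ∏ p ∈ q.primeFactors, (1 - (p : ℝ)⁻¹) := by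
    have := Nat.totient_eq_mul_prod_factors q
    have h2 := congrArg (fun r : ℚ => (r : ℝ)) this
    push_cast at h2
    exact h2
  have hf : ∀ p ∈ q.primeFactors, 0 < 1 - (p : ℝ)⁻¹ := by
    intro p hp
    have h2 : (2 : ℝ) ≤ p := by exact_mod_cast (Nat.prime_of_mem_primeFactors hp).two_le
    have : (p : ℝ)⁻¹ ≤ 2⁻¹ := by gcongr
    linarith
  have hP : 0 < ∏ p ∈ q.primeFactors, (1 - (p : ℝ)⁻¹) := Finset.prod_pos hf
  have e : (q : ℝ) / (Nat.totient q : ℝ) = ∏ p ∈ q.primeFactors, (1 - (p : ℝ)⁻¹)⁻¹ := by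
    rw [htot, Finset.prod_inv_distrib]; field_simp
  rw [e]
  have hge : ∀ p ∈ q.primeFactors, 1 ≤ (1 - (p : ℝ)⁻¹)⁻¹ := fun p hp => by
    rw [one_le_inv₀ (hf p hp)]
    have : (0 : ℝ) ≤ (p : ℝ)⁻¹ := by positivity
    linarith
  have hsub : ((Icc 1 n).filter Nat.Prime).filter (fun p => p ∣ q) ⊆ q.primeFactors := by
    intro p hp
    simp at hp ⊢
    exact ⟨hp.1.2, hp.2, by omega⟩
  calc ∏ p ∈ ((Icc 1 n).filter Nat.Prime).filter (fun p => p ∣ q), (1 + h p / p)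
      ≤ ∏ p ∈ ((Icc 1 n).filter Nat.Prime).filter (fun p => p ∣ q), (1 - (p : ℝ)⁻¹)⁻¹ := by
        refine Finset.prod_le_prod (fun p _ => (hpos p).le) fun p hp => ?_
        have h1 := hf p (hsub hp)
        rw [le_inv_comm₀ (hpos p) h1, ← one_div (1 + h p / (p : ℝ)), le_div_iff₀ (hpos p)]
        have h2 := hh.le_one p
        have h0 := hh.nonneg p
        have h3 : h p / (p : ℝ) ≤ (p : ℝ)⁻¹ := by
          rw [div_eq_mul_inv]
          have : (0 : ℝ) ≤ (p : ℝ)⁻¹ := by positivity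
          nlinarith
        have : (0 : ℝ) ≤ (p : ℝ)⁻¹ := by positivity
        nlinarith
    _ ≤ _ := by
        exact Finset.prod_le_prod_of_subset_of_one_le hsub (fun p hp => (inv_pos.mpr (hf p (hsub hp))).le) fun p hp _ => hge p hp

lemma A_lower {h : ℕ → ℝ} (hh : CM h) (α x₀ : ℝ) (hα : 0 < α)
    (hIII : ∀ x : ℝ, x₀ ≤ x → α ≤ (1 / x) * ∑ p ∈ (Icc 1 ⌊x⌋₊).filter Nat.Prime, |h p| * Real.log p) :
    ∃ α' C' : ℝ, 0 < α' ∧ ∀ σ : ℝ, 0 < σ → σ ≤ 1 → α' * Real.log (1 / σ) - C' ≤ Asum h σ := by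
  obtain ⟨B, hB⟩ := exists_nat_gt (max 2 ((Real.log 4 + 1) / α))
  have hB2 : (2 : ℝ) < B := (le_max_left _ _).trans_lt hB
  have hB2' : 2 < B := by exact_mod_cast hB2
  have hBα : Real.log 4 + 1 < α * B := by
    have := (le_max_right _ _).trans_lt hB
    rw [div_lt_iff₀ hα] at this; linarith
  have hB0 : (0 : ℝ) < B := by linarith
  have hlB : 0 < Real.log B := Real.log_pos (by linarith)
  obtain ⟨j0, hj0⟩ := pow_unbounded_of_one_lt x₀ (by linarith : (1 : ℝ) < B)
  set c : ℝ := 1 / (B * Real.log B) with hc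
  have hc0 : 0 < c := by positivity
  set T : ℕ → ℝ := fun n => ∑ p ∈ (Icc 1 n).filter Nat.Prime, |h p| * Real.log p with hT
  set G : ℕ → ℝ := fun n => ∑ p ∈ (Icc 1 n).filter Nat.Prime, h p / p with hG
  have hTle : ∀ n : ℕ, T n ≤ Real.log 4 * n := by
    intro n
    have h1 := Chebyshev.theta_le_log4_mul_x (x := (n : ℝ)) (by positivity)
    refine le_trans ?_ h1
    rw [Chebyshev.theta_eq_sum_Icc, Nat.floor_natCast, hT]
    refine (Finset.sum_le_sum fun p hp => ?_).trans (Finset.sum_le_sum_of_subset_of_nonneg (f := fun p : ℕ => Real.log p) ?_ ?_)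
    · have hp1 : 1 ≤ p := by simp at hp; omega
      have : 0 ≤ Real.log p := Real.log_nonneg (by exact_mod_cast hp1)
      have := CM_abs hh p
      nlinarith
    · intro p hp; simp at hp ⊢; tauto
    · intro p hp _
      exact Real.log_natCast_nonneg p
  have hdiff : ∀ (g : ℕ → ℝ) (m n : ℕ), m ≤ n → ∑ p ∈ (Icc 1 n).filter Nat.Prime, g p = ∑ p ∈ (Icc 1 m).filter Nat.Prime, g p + ∑ p ∈ (Ioc m n).filter Nat.Prime, g p := by
    intro g m n hmn
    rw [← Finset.sum_union]
    · congr 1; ext p; simp; constructor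
      · rintro ⟨h1, h2⟩; by_cases h3 : p ≤ m
        · left; exact ⟨⟨h1.1, h3⟩, h2⟩
        · right; exact ⟨⟨by omega, h1.2⟩, h2⟩
      · rintro (⟨h1, h2⟩ | ⟨h1, h2⟩) <;> exact ⟨by omega, h2⟩
    · rw [Finset.disjoint_left]; intro p hp; simp at hp ⊢; omega
  have hstep : ∀ j : ℕ, G (B ^ j) + (if j0 ≤ j then c / (j + 1) else 0) ≤ G (B ^ (j + 1)) := by
    intro j
    have hle : B ^ j ≤ B ^ (j + 1) := Nat.pow_le_pow_right (by omega) (by omega)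
    have e := hdiff (fun p => h p / p) _ _ hle
    simp only [hG]
    rw [e]
    refine add_le_add le_rfl ?_
    split_ifs with hj
    · have h1 := hdiff (fun p => |h p| * Real.log p) _ _ hle
      have h2 := hIII ((B : ℝ) ^ (j + 1)) (hj0.le.trans (pow_le_pow_right₀ (by linarith) (by omega)))
      rw [show ((B : ℝ) ^ (j + 1)) = ((B ^ (j + 1) : ℕ) : ℝ) by push_cast; rfl, Nat.floor_natCast, one_div, inv_mul_eq_div, le_div_iff₀ (by positivity)] at h2
      have h3 := hTle (B ^ j)
      simp only [hT] at h3
      rw [h1] at h2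
      have h4 : ((B ^ j : ℕ) : ℝ) ≤ ∑ p ∈ (Ioc (B ^ j) (B ^ (j + 1))).filter Nat.Prime, |h p| * Real.log p := by
        have h5 : ((B ^ (j + 1) : ℕ) : ℝ) = B * ((B ^ j : ℕ) : ℝ) := by push_cast; ring
        have h6 : (0 : ℝ) < ((B ^ j : ℕ) : ℝ) := by positivity
        rw [h5] at h2
        nlinarith
      have h7 : ∑ p ∈ (Ioc (B ^ j) (B ^ (j + 1))).filter Nat.Prime, |h p| * Real.log p ≤ ∑ p ∈ (Ioc (B ^ j) (B ^ (j + 1))).filter Nat.Prime, (h p / p) * ((B : ℝ) ^ (j + 1) * ((j + 1) * Real.log B)) := by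
        refine Finset.sum_le_sum fun p hp => ?_
        simp at hp
        have hp0 : (0 : ℝ) < p := by exact_mod_cast (by omega : 0 < p)
        have hpB : (p : ℝ) ≤ (B : ℝ) ^ (j + 1) := by exact_mod_cast hp.1.2
        have hlp : Real.log p ≤ (j + 1) * Real.log B := by
          have := Real.log_le_log hp0 hpB
          rw [Real.log_pow] at this
          push_cast at this; exact this
        have hl0 : 0 ≤ Real.log p := Real.log_natCast_nonneg p
        rw [abs_of_nonneg (hh.nonneg p)]
        have h0 := hh.nonneg p
        calc h p * Real.log p = (h p / p) * (p * Real.log p) := by field_simp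
          _ ≤ (h p / p) * ((B : ℝ) ^ (j + 1) * ((j + 1) * Real.log B)) := by gcongr
      rw [← Finset.sum_mul] at h7
      have h8 := h4.trans h7
      have h9 : (0 : ℝ) < (B : ℝ) ^ (j + 1) * ((j + 1) * Real.log B) := by positivity
      rw [← div_le_iff₀ h9] at h8
      refine le_trans (le_of_eq ?_) h8
      rw [hc, Nat.cast_pow, pow_succ]
      field_simp
    · exact Finset.sum_nonneg fun p _ => by have := hh.nonneg p; positivity
  have hGJ : ∀ J : ℕ, c * Real.log (J + 1) - c * j0 ≤ G (B ^ J) := by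
    intro J
    have h1 : ∑ j ∈ range J, (if j0 ≤ j then c / ((j : ℝ) + 1) else 0) ≤ G (B ^ J) := by
      induction J with
      | zero =>
        simp only [range_zero, sum_empty, hG]
        exact Finset.sum_nonneg fun p _ => by have := hh.nonneg p; positivity
      | succ J ih => rw [Finset.sum_range_succ]; linarith [hstep J]
    refine le_trans ?_ h1
    have h2 : ∑ j ∈ range J, (c / ((j : ℝ) + 1) - c * (if j < j0 then 1 else 0)) ≤ ∑ j ∈ range J, (if j0 ≤ j then c / ((j : ℝ) + 1) else 0) := by
      refine Finset.sum_le_sum fun j _ => ?_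
      by_cases hj : j < j0
      · rw [if_pos hj, if_neg (by omega)]
        have : c / ((j : ℝ) + 1) ≤ c := div_le_self hc0.le (by linarith [(Nat.cast_nonneg j : (0 : ℝ) ≤ j)])
        linarith
      · rw [if_neg hj, if_pos (by omega)]; simp
    refine le_trans ?_ h2
    rw [Finset.sum_sub_distrib, ← Finset.mul_sum]
    have h3 : ∑ j ∈ range J, (if j < j0 then (1 : ℝ) else 0) ≤ j0 := by
      rw [← Finset.sum_filter]
      simp only [Finset.sum_const, nsmul_eq_mul, mul_one]
      have : ((range J).filter (fun j => j < j0)) ⊆ range j0 := by intro j hj; simp at hj ⊢; exact hj.2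
      have := Finset.card_le_card this
      rw [card_range] at this
      exact_mod_cast this
    have h4 : Real.log (J + 1) ≤ ∑ j ∈ range J, 1 / ((j : ℝ) + 1) := by
      have := log_add_one_le_harmonic J
      rw [harmonic] at this
      push_cast at this
      simpa [one_div] using this
    have h5 : ∑ j ∈ range J, c / ((j : ℝ) + 1) = c * ∑ j ∈ range J, 1 / ((j : ℝ) + 1) := by
      rw [Finset.mul_sum]; exact Finset.sum_congr rfl fun j _ => by ring
    rw [h5]
    have h6 := mul_le_mul_of_nonneg_left h4 hc0.le
    have h7 := mul_le_mul_of_nonneg_left h3 hc0.le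
    linarith
  refine ⟨Real.exp (-1) * c, Real.exp (-1) * (c * j0 + c * |Real.log (Real.log B)|), by positivity, fun σ hσ hσ1 => ?_⟩
  set J := ⌊1 / (σ * Real.log B)⌋₊ with hJ
  have hJ1 : (J : ℝ) ≤ 1 / (σ * Real.log B) := Nat.floor_le (by positivity)
  have hJ2 : 1 / (σ * Real.log B) < J + 1 := Nat.lt_floor_add_one _
  have h1 : Real.exp (-1) * G (B ^ J) ≤ Asum h σ := by
    refine le_trans ?_ (Asum_fin hh σ hσ (B ^ J))
    simp only [hG]
    rw [Finset.mul_sum]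
    refine Finset.sum_le_sum fun p hp => ?_
    simp at hp
    have hp0 : (0 : ℝ) < p := by exact_mod_cast (by omega : 0 < p)
    have hpB : (p : ℝ) ≤ (B : ℝ) ^ J := by exact_mod_cast hp.1.2
    have hlp : Real.log p ≤ J * Real.log B := by
      have := Real.log_le_log hp0 hpB
      rwa [Real.log_pow] at this
    have h2 : σ * Real.log p ≤ 1 := by
      have h3 : (J : ℝ) * (σ * Real.log B) ≤ 1 := by
        rwa [le_div_iff₀ (by positivity)] at hJ1
      nlinarith
    have h4 : Real.exp (-1) * (1 / p) ≤ ww σ p := by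
      rw [ww, show -(1 + σ) * Real.log p = -(σ * Real.log p) - Real.log p by ring, Real.exp_sub, Real.exp_log hp0, div_eq_mul_one_div (Real.exp _)]
      gcongr
    have h0 := hh.nonneg p
    calc Real.exp (-1) * (h p / p) = h p * (Real.exp (-1) * (1 / p)) := by ring
      _ ≤ _ := by gcongr
  refine le_trans ?_ h1
  have h2 : Real.log (1 / σ) - |Real.log (Real.log B)| ≤ Real.log (J + 1) := by
    have h3 := Real.log_le_log (by positivity) hJ2.le
    rw [← div_div, Real.log_div (by positivity) (by positivity)] at h3
    have := le_abs_self (Real.log (Real.log B))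
    linarith
  have h3 := hGJ J
  have h4 : c * (Real.log (1 / σ) - |Real.log (Real.log B)|) - c * j0 ≤ G (B ^ J) := by
    have := mul_le_mul_of_nonneg_left h2 hc0.le
    linarith
  have h5 := mul_le_mul_of_nonneg_left h4 (Real.exp_pos (-1)).le
  linarith

end S18

namespace S18

lemma one_sub_exp_le (w : ℂ) (hw : 0 ≤ w.re) : ‖1 - Complex.exp (-w)‖ ≤ 2 * ‖w‖ := by
  by_cases h : ‖w‖ ≤ 1
  · have h1 := Complex.norm_exp_sub_one_le (x := -w) (by rwa [norm_neg])
    rw [norm_neg] at h1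
    rwa [norm_sub_rev]
  · have h1 : ‖Complex.exp (-w)‖ ≤ 1 := by
      rw [Complex.norm_exp]; simp [hw]
    have h2 := norm_sub_le (1 : ℂ) (Complex.exp (-w))
    rw [norm_one] at h2
    linarith

lemma sup_small {h : ℕ → ℝ} (hh : CM h) (δ L R : ℝ) (hδ : 0 < δ) (hL : 2 ≤ L) (hR : R ≤ L ^ δ) {q : ℕ}
    (χ : DirichletCharacter ℂ q) (lam : ℝ) (hl : 1 ≤ lam) (hlR : lam ≤ Real.exp R) (a : ℝ)
    (ha : L ^ (2 * δ) ≤ a) (haL : a ≤ L) (t : ℝ) (ht : |t| ≤ L ^ (-(2 * δ))) :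
    ‖Dser h χ ((1 + 1 / a : ℝ) + t * Complex.I) * (1 - lam * Complex.exp (-((1 + 1 / a : ℝ) + t * Complex.I) * (Real.log lam : ℝ)))‖
      ≤ 4 * Real.exp c0 * Real.exp (Asum h (1 / L)) * L ^ (-δ) := by
  have hL0 : 0 < L := by linarith
  have ha0 : 0 < a := lt_of_lt_of_le (by positivity) ha
  have h1 := F_triv hh χ (1 / a) t (by positivity)
  have h2 := Asum_mono hh (1 / L) (1 / a) (by positivity) (by gcongr)
  have h3 : ‖Dser h χ ((1 + 1 / a : ℝ) + t * Complex.I)‖ ≤ Real.exp c0 * Real.exp (Asum h (1 / L)) := by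
    rw [← Real.exp_add]
    exact h1.trans (Real.exp_le_exp.mpr (by linarith))
  have hl0 : (0 : ℝ) < lam := by linarith
  have hll : 0 ≤ Real.log lam := Real.log_nonneg hl
  have hll2 : Real.log lam ≤ L ^ δ := by
    have := Real.log_le_log hl0 hlR
    rw [Real.log_exp] at this; linarith
  have e : (lam : ℂ) * Complex.exp (-((1 + 1 / a : ℝ) + t * Complex.I) * (Real.log lam : ℝ)) = Complex.exp (-(((1 / a : ℝ) + t * Complex.I) * (Real.log lam : ℝ))) := by
    have : (lam : ℂ) = Complex.exp (Real.log lam : ℝ) := by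
      rw [← Complex.ofReal_exp, Real.exp_log hl0]
    generalize Real.log lam = m at *
    rw [this, ← Complex.exp_add]
    congr 1
    push_cast; ring
  have h4 : ‖1 - (lam : ℂ) * Complex.exp (-((1 + 1 / a : ℝ) + t * Complex.I) * (Real.log lam : ℝ))‖ ≤ 4 * L ^ (-δ) := by
    rw [e]
    refine (one_sub_exp_le _ ?_).trans ?_
    · generalize Real.log lam = m at *
      simp
      positivity
    · rw [norm_mul, Complex.norm_real, Real.norm_of_nonneg hll]
      have h5 : ‖((1 / a : ℝ) : ℂ) + t * Complex.I‖ ≤ 2 * L ^ (-(2 * δ)) := by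
        refine (norm_add_le _ _).trans ?_
        rw [norm_mul, Complex.norm_I, Complex.norm_real, Complex.norm_real, Real.norm_of_nonneg (by positivity), Real.norm_eq_abs]
        have : 1 / a ≤ L ^ (-(2 * δ)) := by
          rw [Real.rpow_neg hL0.le, ← one_div]; gcongr
        linarith
      have h6 : L ^ (-(2 * δ)) * L ^ δ = L ^ (-δ) := by
        rw [← Real.rpow_add hL0]; congr 1; ring
      calc 2 * (‖((1 / a : ℝ) : ℂ) + t * Complex.I‖ * Real.log lam) ≤ 2 * ((2 * L ^ (-(2 * δ))) * L ^ δ) := by gcongr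
        _ = 4 * (L ^ (-(2 * δ)) * L ^ δ) := by ring
        _ = _ := by rw [h6]
  rw [norm_mul]
  calc _ ≤ (Real.exp c0 * Real.exp (Asum h (1 / L))) * (4 * L ^ (-δ)) := by gcongr
    _ = _ := by ring

lemma M_bound (δ L R : ℝ) (hδ : 0 < δ) (hL : 2 ≤ L) (hR1 : 1 ≤ R) (hR : R ≤ L ^ δ) (q : ℕ) [NeZero q]
    (hq : (q : ℝ) ≤ Real.exp R) (χ : DirichletCharacter ℂ q) (σ : ℝ) (hσ : 0 < σ) (hσ1 : σ ≤ 1) (t : ℝ)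
    (ht : L ^ (-(2 * δ)) ≤ |t|) (ht2 : |t| ≤ Real.exp (7 * R)) (k : ℕ) (m : ℕ) (hm1 : 1 ≤ m) (hmk : m < k) :
    ∑' p : Nat.Primes, (zz (χ ^ m) (m * t) p).re * ww σ p ≤ 2 * δ * Real.log L + (Real.log (17 + k) + c0) := by
  have hL0 : 0 < L := by linarith
  have hm : (1 : ℝ) ≤ m := by exact_mod_cast hm1
  have ht0 : 0 < |t| := lt_of_lt_of_le (by positivity) ht
  have hmt : (m : ℝ) * t ≠ 0 := mul_ne_zero (by linarith) (abs_pos.mp ht0)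
  have h1 := prime_twist q (χ ^ m) σ (m * t) hσ hσ1 hmt
  refine h1.trans ?_
  have hmt2 : |(m : ℝ) * t| = m * |t| := by rw [abs_mul, abs_of_nonneg (by linarith : (0 : ℝ) ≤ m)]
  have hmk' : (m : ℝ) ≤ k := by exact_mod_cast hmk.le
  have hq1 : (1 : ℝ) ≤ q := by exact_mod_cast NeZero.pos q
  have hRR : L ^ δ ≤ L ^ (2 * δ) := Real.rpow_le_rpow_of_exponent_le (by linarith) (by linarith)
  have b1 : 1 / |(m : ℝ) * t| ≤ L ^ (2 * δ) := by
    rw [hmt2, div_le_iff₀ (by positivity)]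
    have h2 : L ^ (2 * δ) * L ^ (-(2 * δ)) = 1 := by rw [← Real.rpow_add hL0]; simp
    have h3 : (0 : ℝ) < L ^ (2 * δ) := by positivity
    have h4 : L ^ (2 * δ) * L ^ (-(2 * δ)) ≤ L ^ (2 * δ) * |t| := by gcongr
    have h5 : 1 * |t| ≤ m * |t| := by gcongr
    nlinarith
  have b2 : Real.log (q * (2 + |(m : ℝ) * t|)) ≤ 8 * R + (k + 1) := by
    rw [hmt2]
    have h2 : (q : ℝ) * (2 + m * |t|) ≤ Real.exp R * ((k + 2) * Real.exp (7 * R)) := by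
      have h3 : 2 + m * |t| ≤ (k + 2) * Real.exp (7 * R) := by
        have h4 : (1 : ℝ) ≤ Real.exp (7 * R) := Real.one_le_exp (by linarith)
        have h5 : m * |t| ≤ k * Real.exp (7 * R) := by gcongr
        nlinarith
      gcongr
    have h3 := Real.log_le_log (by positivity) h2
    have e3 : Real.log (Real.exp R * (((k : ℝ) + 2) * Real.exp (7 * R))) = R + (Real.log ((k : ℝ) + 2) + 7 * R) := by
      rw [Real.log_mul (by positivity) (by positivity), Real.log_mul (by positivity) (by positivity), Real.log_exp, Real.log_exp]
    rw [e3] at h3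
    have h4 := Real.log_le_sub_one_of_pos (by positivity : (0 : ℝ) < (k : ℝ) + 2)
    linarith
  have b3 : 1 / |(m : ℝ) * t| + 7 + Real.log (q * (2 + |(m : ℝ) * t|)) ≤ (17 + k) * L ^ (2 * δ) := by
    have h1 : 1 ≤ L ^ (2 * δ) := hR1.trans (hR.trans hRR)
    have hk : (0 : ℝ) ≤ k := by positivity
    nlinarith
  have hpos : 0 < 1 / |(m : ℝ) * t| + 7 + Real.log (q * (2 + |(m : ℝ) * t|)) := by
    have : 0 ≤ Real.log (q * (2 + |(m : ℝ) * t|)) := Real.log_nonneg (by nlinarith [abs_nonneg ((m : ℝ) * t)])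
    positivity
  have h2 := Real.log_le_log hpos b3
  have e3 : Real.log ((17 + (k : ℝ)) * L ^ (2 * δ)) = Real.log (17 + k) + 2 * δ * Real.log L := by
    rw [Real.log_mul (by positivity) (by positivity), Real.log_rpow hL0]
  rw [e3] at h2
  linarith

lemma sup_bound {h : ℕ → ℝ} (hh : CM h) (α C' : ℝ) (hα : 0 < α)
    (hlow : ∀ σ : ℝ, 0 < σ → σ ≤ 1 → α * Real.log (1 / σ) - C' ≤ Asum h σ) (ν : ℝ) (hν : 0 < ν) :
    ∃ δ > (0 : ℝ), ∃ c > (0 : ℝ), ∃ K > (0 : ℝ), ∀ L R : ℝ, 2 ≤ L → 1 ≤ R → R ≤ L ^ δ → ∀ (q : ℕ) [NeZero q], (q : ℝ) ≤ Real.exp R →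
      ∀ lam : ℝ, 1 ≤ lam → lam ≤ Real.exp R → ∀ a : ℝ, L ^ ν ≤ a → a ≤ L → ∀ (χ : DirichletCharacter ℂ q) (t : ℝ), |t| ≤ Real.exp (7 * R) →
      ‖Dser h χ ((1 + 1 / a : ℝ) + t * Complex.I) * (1 - lam * Complex.exp (-((1 + 1 / a : ℝ) + t * Complex.I) * (Real.log lam : ℝ)))‖
      ≤ K * Real.exp (Asum h (1 / L)) * L ^ (-c) := by
  obtain ⟨k, hk⟩ := exists_nat_gt (4 / α)
  have hk0 : (0 : ℝ) < k := lt_trans (by positivity) hk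
  have hk1 : 1 ≤ k := by exact_mod_cast hk0
  have hk1' : (1 : ℝ) ≤ k := by exact_mod_cast hk1
  set δ := min (ν / 2) (α * ν / 8) with hδdef
  have hδ : 0 < δ := lt_min (by positivity) (by positivity)
  have hδ1 : 2 * δ ≤ ν := by have := min_le_left (ν / 2) (α * ν / 8); linarith
  have hδ2 : 8 * δ ≤ α * ν := by have := min_le_right (ν / 2) (α * ν / 8); linarith
  set e := α * ν / (2 * (k : ℝ) ^ 2) with he
  have he0 : 0 < e := by positivity
  set D := C' + (c0 + 1) + (Real.log (17 + k) + c0) with hD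
  refine ⟨δ, hδ, min δ e, lt_min hδ he0, 4 * Real.exp c0 + 2 * Real.exp (c0 + D / (k : ℝ) ^ 2), by positivity, ?_⟩
  intro L R hL hR1 hR q _ hq lam hl hlR a ha haL χ t ht
  have hL0 : 0 < L := by linarith
  have ha2 : L ^ (2 * δ) ≤ a := (Real.rpow_le_rpow_of_exponent_le (by linarith) hδ1).trans ha
  have ha1 : 1 ≤ a := by
    refine le_trans ?_ ha
    exact Real.one_le_rpow (by linarith) hν.le
  have hmin1 : L ^ (-δ) ≤ L ^ (-(min δ e)) := Real.rpow_le_rpow_of_exponent_le (by linarith) (neg_le_neg (min_le_left _ _))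
  have hmin2 : L ^ (-e) ≤ L ^ (-(min δ e)) := Real.rpow_le_rpow_of_exponent_le (by linarith) (neg_le_neg (min_le_right _ _))
  have hEp := Real.exp_pos (Asum h (1 / L))
  by_cases hts : |t| ≤ L ^ (-(2 * δ))
  · refine (sup_small hh δ L R hδ hL hR χ lam hl hlR a ha2 haL t hts).trans ?_
    have h1 : 0 < Real.exp (c0 + D / (k : ℝ) ^ 2) := Real.exp_pos _
    gcongr
    linarith
  · have hM := fun m hm1 hmk => M_bound δ L R hδ hL hR1 hR q hq χ (1 / a) (by positivity) (by rw [div_le_one (by linarith)]; exact ha1) t (not_le.mp hts).le ht k m hm1 hmk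
    have hlogk : 0 ≤ Real.log (17 + k) := Real.log_nonneg (by linarith)
    have hlL : 0 ≤ Real.log L := Real.log_nonneg (by linarith)
    have hc0 := c0_nonneg
    have hgap := A_gap hh χ (1 / a) t (by positivity) k hk1 _ (by positivity) hM
    have hW := W_upper (1 / a) (by positivity) (by rw [div_le_one (by linarith)]; exact ha1)
    have hA := hlow (1 / a) (by positivity) (by rw [div_le_one (by linarith)]; exact ha1)
    rw [one_div_one_div] at hW hA
    have hla : ν * Real.log L ≤ Real.log a := by
      have := Real.log_le_log (by positivity) ha
      rwa [Real.log_rpow hL0] at this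
    have hla0 : 0 ≤ Real.log a := Real.log_nonneg ha1
    have hWk : (∑' p : Nat.Primes, ww (1 / a) p) / k ≤ α / 4 * Real.log a + (c0 + 1) := by
      have h1 : 1 / (k : ℝ) ≤ α / 4 := by
        rw [div_lt_iff₀ hα] at hk
        rw [div_le_iff₀ hk0]; linarith
      have h2 : (∑' p : Nat.Primes, ww (1 / a) p) / k ≤ (Real.log a + (c0 + 1)) / k := by gcongr
      refine h2.trans ?_
      rw [add_div]
      have h3 : Real.log a / k = 1 / (k : ℝ) * Real.log a := by ring
      have h4 : (c0 + 1) / k ≤ c0 + 1 := div_le_self (by linarith) hk1'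
      rw [h3]
      have h5 := mul_le_mul_of_nonneg_right h1 hla0
      linarith
    have hM2 : 2 * δ * Real.log L ≤ α / 4 * Real.log a := by nlinarith
    have hfin : α * ν / 2 * Real.log L - D ≤ Asum h (1 / a) - (∑' p : Nat.Primes, ww (1 / a) p) / k - (2 * δ * Real.log L + (Real.log (17 + k) + c0)) := by
      have : α * ν / 2 * Real.log L ≤ α / 2 * Real.log a := by nlinarith
      rw [hD]
      linarith
    have h2 := Asum_mono hh (1 / L) (1 / a) (by positivity) (by gcongr)
    have hF := (euler_D hh χ (1 / a) t (by positivity)).1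
    have hF2 : ‖Dser h χ ((1 + 1 / a : ℝ) + t * Complex.I)‖ ≤ Real.exp (c0 + D / (k : ℝ) ^ 2) * Real.exp (Asum h (1 / L)) * L ^ (-e) := by
      rw [Real.rpow_def_of_pos hL0, ← Real.exp_add, ← Real.exp_add]
      refine hF.trans (Real.exp_le_exp.mpr ?_)
      have h3 : (α * ν / 2 * Real.log L - D) / (k : ℝ) ^ 2 ≤ (Asum h (1 / a) - (∑' p : Nat.Primes, ww (1 / a) p) / k - (2 * δ * Real.log L + (Real.log (17 + k) + c0))) / (k : ℝ) ^ 2 := by gcongr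
      have h4 : (α * ν / 2 * Real.log L - D) / (k : ℝ) ^ 2 = Real.log L * e - D / (k : ℝ) ^ 2 := by
        rw [he]; field_simp
      linarith
    have h5 := lam_factor lam hl (1 + 1 / a) t (by have : 0 < 1 / a := by positivity
                                                   linarith)
    rw [norm_mul]
    calc _ ≤ (Real.exp (c0 + D / (k : ℝ) ^ 2) * Real.exp (Asum h (1 / L)) * L ^ (-e)) * 2 := by gcongr
      _ = 2 * Real.exp (c0 + D / (k : ℝ) ^ 2) * Real.exp (Asum h (1 / L)) * L ^ (-e) := by ring
      _ ≤ _ := by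
        have h1 : 0 < Real.exp c0 := Real.exp_pos _
        gcongr
        linarith

end S18

namespace S18

set_option maxHeartbeats 1000000 in
lemma main_est {h : ℕ → ℝ} (hh : CM h) (α C' : ℝ) (hα : 0 < α)
    (hlow : ∀ σ : ℝ, 0 < σ → σ ≤ 1 → α * Real.log (1 / σ) - C' ≤ Asum h σ) :
    ∃ η > (0 : ℝ), ∃ ε > (0 : ℝ), ∃ K > (0 : ℝ), ∀ᶠ L : ℝ in atTop, ∀ (q : ℕ) [NeZero q], (q : ℝ) ≤ Real.exp (L ^ ε) →
      ∀ lam : ℝ, 1 ≤ lam → lam ≤ Real.exp (L ^ ε) → ∀ A : ZMod q, IsUnit A →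
      |EE h q lam A (Real.exp L)| * L ≤ K * (Real.exp L / q) * (L ^ (-η) * Real.exp (Asum h (1 / L))) := by
  set ν := min 1 α / 4 with hνd
  have hm0 : 0 < min 1 α := lt_min one_pos hα
  have hν : 0 < ν := by positivity
  have hν1 : ν ≤ 1 / 4 := by have := min_le_left 1 α; linarith
  have hνα : ν ≤ α / 4 := by have := min_le_right 1 α; linarith
  obtain ⟨δ, hδ, c, hc, K, hK, hsup⟩ := sup_bound hh α C' hα hlow ν hν
  obtain ⟨C1, hC1, hpw⟩ := pointwise_stage
  obtain ⟨C2, hC2, hII⟩ := II_bound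
  set ε := min (ν / 2) (min δ (c / 4)) with hεd
  have hε : 0 < ε := lt_min (by positivity) (lt_min hδ (by positivity))
  have hε1 : ε ≤ ν / 2 := min_le_left _ _
  have hε2 : ε ≤ δ := (min_le_right _ _).trans (min_le_left _ _)
  have hε3 : ε ≤ c / 4 := (min_le_right _ _).trans (min_le_right _ _)
  set η := min (c / 4) (α / 2) with hηd
  have hη : 0 < η := lt_min (by positivity) (by positivity)
  have hη1 : η ≤ c / 4 := min_le_left _ _
  have hη2 : η ≤ α / 2 := min_le_right _ _
  refine ⟨η, hη, ε, hε, C1 * (1 + C2) * (4 * Real.exp C' + K), by positivity, ?_⟩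
  have ev1 : ∀ᶠ L : ℝ in atTop, 20 ≤ L ^ (ν - ε) := (tendsto_rpow_atTop (by linarith)).eventually_ge_atTop 20
  have ev2 : ∀ᶠ L : ℝ in atTop, 2 ≤ L ^ ε := (tendsto_rpow_atTop hε).eventually_ge_atTop 2
  have ev3 := (isLittleO_log_rpow_atTop hε).bound (by norm_num : (0 : ℝ) < 1 / 2)
  filter_upwards [ev1, ev2, ev3, eventually_ge_atTop 2] with L h1 h2 h3 hL q _ hq lam hl hlR A hA
  have hL0 : 0 < L := by linarith
  have hL1 : 1 ≤ L := by linarith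
  set R := L ^ ε with hR
  set X := L ^ ν with hX
  have hR0 : 0 < R := by linarith
  have hRX : 20 * R ≤ X := by
    have : X = L ^ (ν - ε) * R := by rw [hX, hR, ← Real.rpow_add hL0]; ring_nf
    rw [this]; gcongr
  have hXL : X ≤ L := by
    have := Real.rpow_le_rpow_of_exponent_le hL1 (by linarith : ν ≤ 1)
    rwa [Real.rpow_one] at this
  have hlog : Real.log L ≤ R / 2 := by
    rw [Real.norm_eq_abs, Real.norm_eq_abs, abs_of_pos hR0] at h3
    linarith [le_abs_self (Real.log L)]
  have h2L : 2 * L ≤ Real.exp R := by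
    rw [← Real.log_le_iff_le_exp (by positivity), Real.log_mul (by norm_num) hL0.ne']
    have := Real.log_two_lt_d9
    linarith
  set E := Real.exp (Asum h (1 / L)) with hE
  have hE0 : 0 < E := Real.exp_pos _
  have hB := hII hh R (by linarith) q hq lam hl hlR X L (by linarith) hXL h2L (1 + K * E * L ^ (-c))
    (by have : 0 ≤ K * E * L ^ (-c) := by positivity
        linarith)
    (fun a ha haL χ t ht => (hsup L R hL (by linarith) (Real.rpow_le_rpow_of_exponent_le hL1 hε2) q hq lam hl hlR a ha haL χ t ht).trans (by linarith))
  have hP := hpw hh R (by linarith) q hq A hA lam hl hlR (Real.exp L) (Real.exp_le_exp.mpr (by linarith)) (by rw [Real.log_exp]; linarith)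
  rw [Real.log_exp] at hP
  refine hP.trans ?_
  have hElow : L ^ α ≤ Real.exp C' * E := by
    have := hlow (1 / L) (by positivity) (by rw [div_le_one hL0]; exact hL1)
    rw [one_div_one_div] at this
    rw [hE, ← Real.exp_add, Real.rpow_def_of_pos hL0]
    exact Real.exp_le_exp.mpr (by linarith)
  have key : ∀ s : ℝ, s ≤ α / 2 → L ^ s ≤ Real.exp C' * (L ^ (-η) * E) := by
    intro s hs
    calc L ^ s ≤ L ^ (-η + α) := Real.rpow_le_rpow_of_exponent_le hL1 (by linarith)
      _ = L ^ (-η) * L ^ α := Real.rpow_add hL0 _ _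
      _ ≤ L ^ (-η) * (Real.exp C' * E) := by gcongr
      _ = _ := by ring
  have k4 : R ^ 4 ≤ Real.exp C' * (L ^ (-η) * E) := by
    have : R ^ 4 = L ^ (ε * 4) := by rw [hR, ← Real.rpow_natCast, ← Real.rpow_mul hL0.le]; norm_num
    rw [this]; exact key _ (by linarith)
  have k1 : R * X ≤ Real.exp C' * (L ^ (-η) * E) := by
    rw [hR, hX, ← Real.rpow_add hL0]; exact key _ (by linarith)
  have k3 : R ^ 3 * (K * E * L ^ (-c)) ≤ K * (L ^ (-η) * E) := by
    have : R ^ 3 = L ^ (ε * 3) := by rw [hR, ← Real.rpow_natCast, ← Real.rpow_mul hL0.le]; norm_num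
    rw [this]
    have h5 : L ^ (ε * 3) * L ^ (-c) ≤ L ^ (-η) := by
      rw [← Real.rpow_add hL0]; exact Real.rpow_le_rpow_of_exponent_le hL1 (by linarith)
    calc _ = K * E * (L ^ (ε * 3) * L ^ (-c)) := by ring
      _ ≤ K * E * L ^ (-η) := by gcongr
      _ = _ := by ring
  set Y := L ^ (-η) * E with hY
  have r2 : R ^ 2 ≤ R ^ 4 := by
    have := pow_le_pow_right₀ (by linarith : 1 ≤ R) (by norm_num : 2 ≤ 4); exact this
  have r3 : R ^ 3 ≤ R ^ 4 := by
    have := pow_le_pow_right₀ (by linarith : 1 ≤ R) (by norm_num : 3 ≤ 4); exact this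
  have hexp0 : 0 < Real.exp C' := Real.exp_pos _
  have hY0 : 0 < Y := by positivity
  have hfin : R ^ 2 + R * II h q lam (19 * R) L ≤ (1 + C2) * (4 * Real.exp C' + K) * Y := by
    have i1 : R * II h q lam (19 * R) L ≤ R * (C2 * (X + R * (R * (1 + K * E * L ^ (-c)) + R ^ 2))) := by gcongr
    have i2 : R * (C2 * (X + R * (R * (1 + K * E * L ^ (-c)) + R ^ 2))) = C2 * (R * X + R ^ 3 + R ^ 3 * (K * E * L ^ (-c)) + R ^ 4) := by ring
    have i3 : R * X + R ^ 3 + R ^ 3 * (K * E * L ^ (-c)) + R ^ 4 ≤ (4 * Real.exp C' + K) * Y := by linarith [mul_pos hexp0 hY0, mul_pos hK hY0]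
    have i4 : R ^ 2 ≤ (4 * Real.exp C' + K) * Y := by linarith [mul_pos hexp0 hY0, mul_pos hK hY0]
    have i5 := mul_le_mul_of_nonneg_left i3 hC2.le
    linarith
  calc _ ≤ C1 * (Real.exp L / q) * ((1 + C2) * (4 * Real.exp C' + K) * Y) := by gcongr
    _ = _ := by ring

end S18

namespace S18

lemma condIV_of {h : ℕ → ℝ} (hh : CM h) (α : ℝ) (hIII : CondIII h α) : CondIV h := by
  obtain ⟨hα, x₀, hx₀⟩ := hIII
  obtain ⟨α', C', hα', hlow⟩ := A_lower hh α x₀ hα (fun x hx => hx₀ x hx)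
  obtain ⟨η, hη, ε, hε, K, hK, hev⟩ := main_est hh α' C' hα' hlow
  intro C hC
  refine ⟨fun x => (Real.log x) ^ (-η), (tendsto_rpow_neg_atTop hη).comp Real.tendsto_log_atTop, K * Real.exp (5 * c0 + 4), by positivity, ?_⟩
  have ev3 := (isLittleO_log_rpow_atTop hε).bound (by positivity : (0 : ℝ) < 1 / C)
  obtain ⟨x1, hx1⟩ := eventually_atTop.mp (Real.tendsto_log_atTop.eventually ((hev.and ev3).and (eventually_ge_atTop 2)))
  refine ⟨max x1 2, fun x hx x' q A hx' hxx hq hqC hgcd => ?_⟩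
  obtain ⟨⟨hE, hlg⟩, hL⟩ := hx1 x ((le_max_left _ _).trans hx)
  have hx0 : 0 < x := by have := (le_max_right x1 2).trans hx; linarith
  set L := Real.log x with hLd
  have hexpL : Real.exp L = x := Real.exp_log hx0
  have hL0 : 0 < L := by linarith
  haveI : NeZero q := ⟨by omega⟩
  have hq0 : (0 : ℝ) < q := by exact_mod_cast hq
  have hx'0 : 0 < x' := lt_trans (by positivity) hx'
  have hLC : L ^ C ≤ Real.exp (L ^ ε) := by
    rw [Real.rpow_def_of_pos hL0]
    refine Real.exp_le_exp.mpr ?_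
    rw [Real.norm_eq_abs, Real.norm_eq_abs, abs_of_pos (by positivity : 0 < L ^ ε)] at hlg
    have := (le_abs_self _).trans hlg
    calc Real.log L * C ≤ (1 / C * L ^ ε) * C := by gcongr
      _ = L ^ ε := by field_simp
  have hunit : IsUnit ((A : ℤ) : ZMod q) := by
    rw [ZMod.coe_int_isUnit_iff_isCoprime, Int.isCoprime_iff_gcd_eq_one]
    exact hgcd
  have hlam : x / x' ≤ L ^ C := by
    rw [div_le_iff₀ hx'0]
    have h1 : L ^ C * (x * L ^ (-C)) = x := by
      have : L ^ C * L ^ (-C) = 1 := by rw [← Real.rpow_add hL0]; simp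
      calc _ = x * (L ^ C * L ^ (-C)) := by ring
        _ = x := by rw [this, mul_one]
    have h2 : L ^ C * (x * L ^ (-C)) ≤ L ^ C * x' := by gcongr
    linarith
  have hb := hE q (hqC.le.trans hLC) (x / x') (by rw [le_div_iff₀ hx'0]; linarith) (hlam.trans hLC) A hunit
  rw [hexpL] at hb
  have hSM : ∀ y : ℝ, SmAP h y q A = (q / y) * MM h q (A : ZMod q) y := by
    intro y
    rw [SmAP, MM, cls, Finset.sum_filter]
    simp only [Int.cast_natCast]
  have hid : SmAP h x' q A - SmAP h x q A = -(q / x * EE h q (x / x') (A : ZMod q) x) := by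
    rw [hSM, hSM, EE]
    have : x / (x / x') = x' := by field_simp
    rw [this]
    field_simp
    ring
  rw [hid, abs_neg, abs_mul, abs_of_pos (by positivity : 0 < (q : ℝ) / x)]
  have hpp : ppProd h x q = ∏ p ∈ ((Icc 1 ⌊Real.exp L⌋₊).filter Nat.Prime).filter (fun p => ¬ p ∣ q), (1 + h p / p) := by
    rw [ppProd, primesUpTo, hexpL]
    refine Finset.prod_congr rfl fun p _ => ?_
    rw [abs_of_nonneg (hh.nonneg p)]
  have hA := (Asum_le_prod hh L hL).trans (mul_le_mul_of_nonneg_left (prod_coprime hh q hq ⌊Real.exp L⌋₊) (Real.exp_pos _).le)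
  rw [← hpp] at hA
  have hb2 : |EE h q (x / x') (A : ZMod q) x| ≤ K * (x / q) * (L ^ (-η) * (Real.exp (5 * c0 + 4) * ((q : ℝ) / (Nat.totient q : ℝ) * ppProd h x q))) / L := by
    rw [le_div_iff₀ hL0]
    refine hb.trans ?_
    gcongr
  calc _ ≤ (q : ℝ) / x * (K * (x / q) * (L ^ (-η) * (Real.exp (5 * c0 + 4) * ((q : ℝ) / (Nat.totient q : ℝ) * ppProd h x q))) / L) := by gcongr
    _ = ((q : ℝ) / x * (x / q)) * (K * (L ^ (-η) * (Real.exp (5 * c0 + 4) * ((q : ℝ) / (Nat.totient q : ℝ) * ppProd h x q))) / L) := by ring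
    _ = (K * (L ^ (-η) * (Real.exp (5 * c0 + 4) * ((q : ℝ) / (Nat.totient q : ℝ) * ppProd h x q))) / L) := by
      rw [show (q : ℝ) / x * (x / q) = 1 by field_simp, one_mul]
    _ = _ := by ring

end S18

namespace S18
section B1
open NumberField
variable (K : Type*) [Field K] [NumberField K]

def hs {K : Type*} [Field K] [NumberField K] (a : 𝓞 K) : ℝ := house (a : K)

lemma hs_nonneg {K : Type*} [Field K] [NumberField K] (a : 𝓞 K) : 0 ≤ hs a := house_nonneg _
lemma hs_zero {K : Type*} [Field K] [NumberField K] : hs (0 : 𝓞 K) = 0 := by simp [hs, house]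
lemma hs_add {K : Type*} [Field K] [NumberField K] (a b : 𝓞 K) : hs (a + b) ≤ hs a + hs b := by
  simpa [hs] using house_add_le (a : K) b
lemma hs_neg {K : Type*} [Field K] [NumberField K] (a : 𝓞 K) : hs (-a) = hs a := by
  simp [hs, house]
lemma hs_sub {K : Type*} [Field K] [NumberField K] (a b : 𝓞 K) : hs (a - b) ≤ hs a + hs b := by
  rw [sub_eq_add_neg, ← hs_neg b]; exact hs_add _ _
lemma hs_natCast {K : Type*} [Field K] [NumberField K] (k : ℕ) : hs (k : 𝓞 K) = k := by
  have := house_intCast (K := K) (k : ℤ)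
  simpa [hs] using this

lemma coord_bound : ∃ c : ℝ, 0 < c ∧ ∀ (a : 𝓞 K) (i : Module.Free.ChooseBasisIndex ℤ (𝓞 K)),
    |(((RingOfIntegers.basis K).repr a i : ℤ) : ℝ)| ≤ c * hs a := by
  obtain ⟨c, hc⟩ : ∃ c : ℝ, ∀ (α : 𝓞 K) (i : K →+* ℂ),
      ‖(((integralBasis K).reindex (equivReindex K).symm).repr α i : ℂ)‖ ≤ c * house (algebraMap (𝓞 K) K α) :=
    ⟨_, house.basis_repr_norm_le_const_mul_house K⟩
  refine ⟨max c 1, by positivity, fun a i => ?_⟩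
  have h := hc a ((equivReindex K).symm i)
  rw [Module.Basis.repr_reindex_apply, Equiv.symm_symm, Equiv.apply_symm_apply, integralBasis_repr_apply] at h
  simp only [algebraMap_int_eq, eq_intCast, Rat.cast_intCast, Complex.norm_intCast] at h
  refine h.trans ?_
  have := hs_nonneg a
  unfold hs at *
  gcongr
  exact le_max_left _ _

lemma house_lin : ∃ c : ℝ, 1 ≤ c ∧ ∀ (v : Module.Free.ChooseBasisIndex ℤ (𝓞 K) → ℚ) (M : ℝ), 0 ≤ M → (∀ i, |(v i : ℝ)| ≤ M) →
    house (∑ i, v i • ((RingOfIntegers.basis K i : 𝓞 K) : K)) ≤ c * M := by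
  refine ⟨1 + ∑ i, house ((RingOfIntegers.basis K i : 𝓞 K) : K), ?_, fun v M hM hv => ?_⟩
  · have : 0 ≤ ∑ i, house ((RingOfIntegers.basis K i : 𝓞 K) : K) := Finset.sum_nonneg fun i _ => house_nonneg _
    linarith
  refine (house_sum_le_sum_house _ _).trans ?_
  have : ∀ i, house (v i • ((RingOfIntegers.basis K i : 𝓞 K) : K)) ≤ house ((RingOfIntegers.basis K i : 𝓞 K) : K) * M := by
    intro i
    rw [Algebra.smul_def]
    refine (house_mul_le _ _).trans ?_
    have e : house (algebraMap ℚ K (v i)) = |(v i : ℝ)| := by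
      have : canonicalEmbedding K (algebraMap ℚ K (v i)) = fun _ => ((v i : ℚ) : ℂ) := by
        ext φ; simp [canonicalEmbedding.apply_at]
      rw [house, this, pi_norm_const, Complex.norm_ratCast]
    rw [e, mul_comm]
    exact mul_le_mul_of_nonneg_left (hv i) (house_nonneg _)
  refine (Finset.sum_le_sum fun i _ => this i).trans ?_
  rw [← Finset.sum_mul]
  nlinarith

lemma round_ex : ∃ c : ℝ, 1 ≤ c ∧ ∀ x : K, ∃ z : 𝓞 K, house (x - z) ≤ c := by
  obtain ⟨c, hc, H⟩ := house_lin K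
  refine ⟨c, hc, fun x => ⟨∑ i, round ((integralBasis K).repr x i) • RingOfIntegers.basis K i, ?_⟩⟩
  have h := H (fun i => (integralBasis K).repr x i - round ((integralBasis K).repr x i)) 1 (by norm_num) (fun i => by
    have := abs_sub_round ((integralBasis K).repr x i)
    have h2 : |(((integralBasis K).repr x i - round ((integralBasis K).repr x i) : ℚ) : ℝ)| ≤ ((1 / 2 : ℚ) : ℝ) := by exact_mod_cast this
    refine h2.trans (by norm_num))
  rw [mul_one] at h
  convert h using 2
  simp only [sub_smul, Finset.sum_sub_distrib]
  congr 1
  · have := (integralBasis K).sum_repr x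
    conv_lhs => rw [← this]
    simp only [integralBasis_apply]
  · simp [Algebra.smul_def]

lemma card_idx : Fintype.card (Module.Free.ChooseBasisIndex ℤ (𝓞 K)) = Module.finrank ℚ K := by
  rw [← RingOfIntegers.rank, Module.finrank_eq_card_chooseBasisIndex]

lemma upper_count : ∃ c : ℝ, 1 ≤ c ∧ ∀ T : ℝ, 0 ≤ T → ∀ s : Finset (𝓞 K), (∀ a ∈ s, hs a ≤ T) → (s.card : ℝ) ≤ (c * (T + 1)) ^ Module.finrank ℚ K := by
  obtain ⟨c, hc, H⟩ := coord_bound K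
  refine ⟨2 * c + 3, by linarith, fun T hT s hsT => ?_⟩
  set M : ℕ := ⌈c * T⌉₊ with hM
  have hle : s.card ≤ (Fintype.piFinset (fun _ : Module.Free.ChooseBasisIndex ℤ (𝓞 K) => Finset.Icc (-(M : ℤ)) M)).card := by
    refine Finset.card_le_card_of_injOn (fun a i => (RingOfIntegers.basis K).repr a i) ?_ ?_
    · intro a ha
      simp only [Finset.mem_coe, Fintype.mem_piFinset, Finset.mem_Icc]
      intro i
      have h1 := (H a i).trans (mul_le_mul_of_nonneg_left (hsT a ha) hc.le)
      have h2 := h1.trans (Nat.le_ceil (c * T))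
      rw [← abs_le]
      exact_mod_cast h2
    · intro a _ b _ hab
      apply (RingOfIntegers.basis K).repr.injective
      ext i
      exact congrFun hab i
  rw [Fintype.card_piFinset, Finset.prod_const, Finset.card_univ, card_idx, Int.card_Icc] at hle
  have h3 : (s.card : ℝ) ≤ (((M : ℤ) + 1 - (-(M : ℤ))).toNat : ℝ) ^ Module.finrank ℚ K := by exact_mod_cast hle
  refine h3.trans ?_
  have h4 : (((M : ℤ) + 1 - (-(M : ℤ))).toNat : ℝ) = 2 * M + 1 := by
    have : ((M : ℤ) + 1 - (-(M : ℤ))).toNat = 2 * M + 1 := by omega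
    rw [this]; push_cast; ring
  rw [h4]
  have h5 : (M : ℝ) ≤ c * T + 1 := (Nat.ceil_lt_add_one (by positivity)).le
  gcongr
  nlinarith

lemma fin_set (T : ℝ) : {a : 𝓞 K | hs a ≤ T}.Finite := by
  obtain ⟨c, hc, H⟩ := upper_count K
  by_contra hinf
  obtain ⟨N, hN⟩ := exists_nat_gt ((c * (max T 0 + 1)) ^ Module.finrank ℚ K)
  obtain ⟨s, hs1, hs2⟩ := (Set.not_finite.mp hinf).exists_subset_card_eq N
  have := H (max T 0) (le_max_right _ _) s (fun a ha => (hs1 ha : hs a ≤ T).trans (le_max_left _ _))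
  rw [hs2] at this
  linarith

def FF (T : ℝ) : Finset (𝓞 K) := (fin_set K T).toFinset

variable {K} in
lemma mem_FF {T : ℝ} {a : 𝓞 K} : a ∈ FF K T ↔ hs a ≤ T := by simp [FF]

lemma FF_upper : ∃ c : ℝ, 1 ≤ c ∧ ∀ T : ℝ, 0 ≤ T → ((FF K T).card : ℝ) ≤ (c * (T + 1)) ^ Module.finrank ℚ K := by
  obtain ⟨c, hc, H⟩ := upper_count K
  exact ⟨c, hc, fun T hT => H T hT _ (fun a ha => mem_FF.mp ha)⟩

lemma FF_lower : ∃ c : ℝ, 0 < c ∧ ∀ T : ℝ, 0 ≤ T → (c * T) ^ Module.finrank ℚ K ≤ ((FF K T).card : ℝ) := by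
  obtain ⟨c, hc, H⟩ := house_lin K
  refine ⟨1 / c, by positivity, fun T hT => ?_⟩
  set M : ℕ := ⌊T / c⌋₊ with hM
  have hle : (Fintype.piFinset (fun _ : Module.Free.ChooseBasisIndex ℤ (𝓞 K) => Finset.range (M + 1))).card ≤ (FF K T).card := by
    refine Finset.card_le_card_of_injOn (fun v => ∑ i, (v i : ℤ) • RingOfIntegers.basis K i) ?_ ?_
    · intro v hv
      simp only [Finset.mem_coe, Fintype.mem_piFinset, Finset.mem_range] at hv
      rw [Finset.mem_coe, mem_FF]
      have h := H (fun i => (v i : ℚ)) M (by positivity) (fun i => by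
        have := hv i
        simp only [Rat.cast_natCast, Nat.abs_cast]
        exact_mod_cast Nat.lt_succ_iff.mp this)
      have h2 : c * (M : ℝ) ≤ T := by
        have := Nat.floor_le (by positivity : 0 ≤ T / c)
        calc c * (M : ℝ) ≤ c * (T / c) := by gcongr
          _ = T := by field_simp
      refine le_trans (le_of_eq ?_) (h.trans h2)
      unfold hs
      congr 1
      simp [Algebra.smul_def]
    · intro v _ w _ hvw
      have hvw' : ∑ i, (v i : ℤ) • RingOfIntegers.basis K i = ∑ i, (w i : ℤ) • RingOfIntegers.basis K i := hvw
      ext i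
      have h := congrArg (fun a => (RingOfIntegers.basis K).repr a i) hvw'
      simp only [Module.Basis.repr_sum_self] at h
      exact_mod_cast h
  rw [Fintype.card_piFinset, Finset.prod_const, Finset.card_univ, card_idx, Finset.card_range] at hle
  have h3 : ((M : ℝ) + 1) ^ Module.finrank ℚ K ≤ ((FF K T).card : ℝ) := by exact_mod_cast hle
  refine le_trans ?_ h3
  have := Nat.lt_floor_add_one (T / c)
  have e : 1 / c * T = T / c := by ring
  rw [e]
  gcongr

end B1
end S18

namespace S18
section B2
open NumberField
variable (K : Type*) [Field K] [NumberField K]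

/-- the real number `(absNorm I)^(1/n)` -/
def rho {K : Type*} [Field K] [NumberField K] (I : Ideal (𝓞 K)) : ℝ := (Ideal.absNorm I : ℝ) ^ (1 / (Module.finrank ℚ K : ℝ))

variable {K} in
lemma NN_eq (a : 𝓞 K) : ((Ideal.absNorm (Ideal.span {a}) : ℕ) : ℝ) = ∏ φ : K →ₐ[ℚ] ℂ, ‖φ (a : K)‖ := by
  rw [Ideal.absNorm_span_singleton, Nat.cast_natAbs, ← norm_prod, ← Algebra.norm_eq_prod_embeddings ℚ ℂ (a : K), ← Algebra.coe_norm_int]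
  simp

variable {K} in
lemma emb_le (a : 𝓞 K) (φ : K →ₐ[ℚ] ℂ) : ‖φ (a : K)‖ ≤ hs a := norm_embedding_le_house (a : K) (φ : K →+* ℂ)

variable {K} in
lemma NN_le (a : 𝓞 K) : ((Ideal.absNorm (Ideal.span {a}) : ℕ) : ℝ) ≤ hs a ^ Module.finrank ℚ K := by
  rw [NN_eq]
  refine (Finset.prod_le_prod (fun _ _ => norm_nonneg _) (fun φ _ => emb_le a φ)).trans ?_
  rw [Finset.prod_const, Finset.card_univ, AlgHom.card]

variable {K} in
lemma norm_le_of_mem {I : Ideal (𝓞 K)} {a : 𝓞 K} (ha : a ∈ I) (h0 : a ≠ 0) :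
    (Ideal.absNorm I : ℝ) ≤ hs a ^ Module.finrank ℚ K := by
  refine le_trans ?_ (NN_le a)
  have h1 : Ideal.absNorm I ∣ Ideal.absNorm (Ideal.span {a}) :=
    Ideal.absNorm_dvd_absNorm_of_le ((Ideal.span_singleton_le_iff_mem I).mpr ha)
  have h2 : Ideal.absNorm (Ideal.span {a}) ≠ 0 := by
    rw [Ne, Ideal.absNorm_eq_zero_iff, Ideal.span_singleton_eq_bot]; exact h0
  exact_mod_cast Nat.le_of_dvd (Nat.pos_of_ne_zero h2) h1

lemma fr_pos : 0 < Module.finrank ℚ K := Module.finrank_pos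

variable {K} in
lemma aN_one_le {I : Ideal (𝓞 K)} (hI : I ≠ ⊥) : (1 : ℝ) ≤ Ideal.absNorm I := by
  have : Ideal.absNorm I ≠ 0 := by rw [Ne, Ideal.absNorm_eq_zero_iff]; exact hI
  exact_mod_cast Nat.pos_of_ne_zero this

variable {K} in
lemma rho_pow (I : Ideal (𝓞 K)) : rho I ^ Module.finrank ℚ K = Ideal.absNorm I := by
  have := fr_pos K
  rw [rho, ← Real.rpow_natCast, ← Real.rpow_mul (by positivity), one_div, inv_mul_cancel₀ (by positivity), Real.rpow_one]

variable {K} in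
lemma rho_one_le {I : Ideal (𝓞 K)} (hI : I ≠ ⊥) : 1 ≤ rho I := Real.one_le_rpow (aN_one_le hI) (by positivity)

lemma reps : ∃ c : ℝ, 1 ≤ c ∧ ∀ I : Ideal (𝓞 K), I ≠ ⊥ → ∀ r : 𝓞 K, ∃ r' : 𝓞 K, r' - r ∈ I ∧ hs r' ≤ c * rho I := by
  obtain ⟨cl, hcl, Hl⟩ := FF_lower K
  obtain ⟨c, hc, Hc⟩ := round_ex K
  refine ⟨max 1 (c * (4 / cl)), le_max_left _ _, fun I hI r => ?_⟩
  have hρ := rho_one_le hI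
  set T := 2 * rho I / cl with hT
  have hT0 : 0 ≤ T := by positivity
  have h1 := Hl T hT0
  have h2 : (Ideal.absNorm I : ℝ) < (FF K T).card := by
    refine lt_of_lt_of_le ?_ h1
    have : cl * T = 2 * rho I := by rw [hT]; field_simp
    rw [this, mul_pow, rho_pow]
    have h3 : (1 : ℝ) < 2 ^ Module.finrank ℚ K := one_lt_pow₀ (by norm_num) (fr_pos K).ne'
    nlinarith [aN_one_le hI]
  haveI : Finite (𝓞 K ⧸ I) := Ideal.finiteQuotientOfFreeOfNeBot I hI
  haveI : Fintype (𝓞 K ⧸ I) := Fintype.ofFinite _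
  have h3 : (Finset.univ : Finset (𝓞 K ⧸ I)).card < (FF K T).card := by
    rw [Finset.card_univ, ← Nat.card_eq_fintype_card]
    have : Ideal.absNorm I < (FF K T).card := by exact_mod_cast h2
    exact this
  obtain ⟨a, ha, b, hb, hab, heq⟩ := Finset.exists_ne_map_eq_of_card_lt_of_maps_to h3 (f := fun a => Ideal.Quotient.mk I a) (fun a _ => Finset.mem_coe.mpr (Finset.mem_univ _))
  have hmem : a - b ∈ I := Ideal.Quotient.eq.mp heq
  have hne : a - b ≠ 0 := sub_ne_zero.mpr hab
  have hh : hs (a - b) ≤ 2 * T := by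
    have := hs_sub a b
    have h4 := mem_FF.mp ha
    have h5 := mem_FF.mp hb
    linarith
  obtain ⟨z, hz⟩ := Hc ((r : K) / ((a - b : 𝓞 K) : K))
  refine ⟨r - (a - b) * z, ?_, ?_⟩
  · have : r - (a - b) * z - r = (a - b) * (-z) := by ring
    rw [this]; exact I.mul_mem_right _ hmem
  · have hne' : ((a - b : 𝓞 K) : K) ≠ 0 := by
      intro h0; exact hne (by exact_mod_cast h0)
    have e : ((r - (a - b) * z : 𝓞 K) : K) = ((a - b : 𝓞 K) : K) * ((r : K) / ((a - b : 𝓞 K) : K) - z) := by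
      rw [mul_sub, mul_div_cancel₀ _ hne']; simp
    unfold hs
    rw [e]
    refine (house_mul_le _ _).trans ?_
    have : house ((a - b : 𝓞 K) : K) * house ((r : K) / ((a - b : 𝓞 K) : K) - z) ≤ (2 * T) * c :=
      mul_le_mul hh hz (house_nonneg _) (by positivity)
    refine this.trans ?_
    have e2 : 2 * T * c = c * (4 / cl) * rho I := by rw [hT]; ring
    rw [e2]
    gcongr
    exact le_max_right _ _

variable {K} in
def CL (T : ℝ) (I : Ideal (𝓞 K)) (r : 𝓞 K) : Finset (𝓞 K) := (FF K T).filter (fun b => b - r ∈ I)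

lemma packing : ∃ C : ℝ, 1 ≤ C ∧ ∀ I : Ideal (𝓞 K), I ≠ ⊥ → ∀ r : 𝓞 K, ∀ T : ℝ, 0 ≤ T →
    ((CL T I r).card : ℝ) ≤ (C * (T / rho I + 1)) ^ Module.finrank ℚ K := by
  obtain ⟨cl, hcl, Hl⟩ := FF_lower K
  obtain ⟨cu, hcu, Hu⟩ := FF_upper K
  refine ⟨max 1 (4 * cu * 3 / cl), le_max_left _ _, fun I hI r T hT => ?_⟩
  have hρ := rho_one_le hI
  set s := rho I / 3 with hs'
  have hs0 : 0 < s := by positivity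
  have hcard : (CL T I r ×ˢ FF K s).card ≤ (FF K (T + s)).card := by
    refine Finset.card_le_card_of_injOn (fun x => x.1 + x.2) ?_ ?_
    · rintro ⟨b, g⟩ hx
      simp only [Finset.coe_product, Set.mem_prod, Finset.mem_coe, CL, Finset.mem_filter, mem_FF] at hx ⊢
      exact (hs_add _ _).trans (by linarith)
    · rintro ⟨b, g⟩ hx ⟨b', g'⟩ hx' hxx
      simp only [Finset.coe_product, Set.mem_prod, Finset.mem_coe, CL, Finset.mem_filter, mem_FF] at hx hx'
      have hxx' : b + g = b' + g' := hxx
      have h1 : b - b' ∈ I := by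
        have := I.sub_mem hx.1.2 hx'.1.2
        simpa using this
      have h2 : b - b' = g' - g := by linear_combination hxx'
      have h3 : b - b' = 0 := by
        by_contra h0
        have h4 := norm_le_of_mem h1 h0
        have h5 : hs (b - b') ≤ 2 * s := by
          rw [h2]; exact (hs_sub _ _).trans (by linarith)
        have h6 : hs (b - b') ^ Module.finrank ℚ K < rho I ^ Module.finrank ℚ K :=
          pow_lt_pow_left₀ (by rw [hs'] at h5; linarith) (hs_nonneg _) (fr_pos K).ne'
        rw [rho_pow] at h6
        linarith
      have h7 : b = b' := sub_eq_zero.mp h3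
      have h8 : g = g' := by rw [h7] at hxx'; exact add_left_cancel hxx'
      rw [h7, h8]
  rw [Finset.card_product] at hcard
  have h1 := Hl s hs0.le
  have h2 := Hu (T + s) (by positivity)
  have h3 : ((CL T I r).card : ℝ) * (FF K s).card ≤ (FF K (T + s)).card := by exact_mod_cast hcard
  have h4 : ((CL T I r).card : ℝ) * (cl * s) ^ Module.finrank ℚ K ≤ (cu * (T + s + 1)) ^ Module.finrank ℚ K :=
    (mul_le_mul_of_nonneg_left h1 (by positivity)).trans (h3.trans h2)
  rw [← le_div_iff₀ (by positivity), ← div_pow] at h4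
  refine h4.trans ?_
  gcongr
  have h5 : cu * (T + s + 1) / (cl * s) ≤ (4 * cu * 3 / cl) * (T / rho I + 1) := by
    have e : s = rho I / 3 := rfl
    have e1 : (4 * cu * 3 / cl) * (T / rho I + 1) = cu * (4 * (T + 3 * s)) / (cl * s) := by
      rw [e]; field_simp
    rw [e1]
    gcongr
    linarith
  refine h5.trans ?_
  gcongr
  exact le_max_right _ _

variable {K} in
def wt (t : ℝ) (a : 𝓞 K) : ℝ := max 0 (1 - hs a / t)

variable {K} in
def SS (t : ℝ) (I : Ideal (𝓞 K)) (r : 𝓞 K) : ℝ := ∑ b ∈ CL t I r, wt t b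

variable {K} in
lemma wt_nonneg (t : ℝ) (a : 𝓞 K) : 0 ≤ wt t a := le_max_left _ _

variable {K} in
lemma shift (t σ : ℝ) (ht : 0 < t) (hσ : 0 ≤ σ) (I : Ideal (𝓞 K)) (r r' : 𝓞 K) (hd : hs (r - r') ≤ σ) :
    SS t I r ≤ SS t I r' + (σ / t) * (CL (t + σ) I r').card := by
  have h1 : ∀ b : 𝓞 K, wt t b ≤ wt t (b - (r - r')) + σ / t := by
    intro b
    have h2 : hs (b - (r - r')) ≤ hs b + σ := (hs_sub _ _).trans (by linarith)
    have h3 : hs (b - (r - r')) / t ≤ hs b / t + σ / t := by rw [← add_div]; gcongr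
    have h3' : hs b / t ≥ 0 := div_nonneg (hs_nonneg _) ht.le
    unfold wt
    refine max_le (by positivity) ?_
    have := le_max_right 0 (1 - hs (b - (r - r')) / t)
    have h5 : hs (b - (r - r')) ≤ hs b + hs (r - r') := hs_sub _ _
    have h6 : hs b ≥ hs (b - (r - r')) - σ := by linarith
    have h7 : hs (b - (r - r')) / t - σ / t ≤ hs b / t := by rw [← sub_div]; gcongr
    linarith
  have h2 : SS t I r ≤ ∑ b ∈ CL t I r, (wt t (b - (r - r')) + σ / t) := Finset.sum_le_sum fun b _ => h1 b
  have h3 : ∑ b ∈ CL t I r, (wt t (b - (r - r')) + σ / t) = ∑ b ∈ (CL t I r).image (fun b => b - (r - r')), (wt t b + σ / t) := by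
    rw [Finset.sum_image]
    intro a _ b _ hab
    exact sub_left_injective hab
  have h4 : (CL t I r).image (fun b => b - (r - r')) ⊆ CL (t + σ) I r' := by
    intro b hb
    obtain ⟨b, hb', rfl⟩ := Finset.mem_image.mp hb
    clear hb
    have hb := hb'
    simp only [CL, Finset.mem_filter, mem_FF] at hb ⊢
    refine ⟨(hs_sub _ _).trans (by linarith), ?_⟩
    have : b - (r - r') - r' = b - r := by ring
    rw [this]; exact hb.2
  have h5 : ∑ b ∈ (CL t I r).image (fun b => b - (r - r')), (wt t b + σ / t) ≤ ∑ b ∈ CL (t + σ) I r', (wt t b + σ / t) :=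
    Finset.sum_le_sum_of_subset_of_nonneg h4 (fun b _ _ => add_nonneg (wt_nonneg _ _) (by positivity))
  have h6 : ∑ b ∈ CL (t + σ) I r', wt t b = SS t I r' := by
    symm
    refine Finset.sum_subset ?_ ?_
    · intro b hb
      simp only [CL, Finset.mem_filter, mem_FF] at hb ⊢
      exact ⟨by linarith, hb.2⟩
    · intro b hb hb'
      simp only [CL, Finset.mem_filter, mem_FF, not_and] at hb hb'
      have : ¬ hs b ≤ t := fun h => hb' h hb.2
      unfold wt
      rw [max_eq_left]
      rw [sub_nonpos, le_div_iff₀ ht]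
      linarith
  have h7 : ∑ b ∈ CL (t + σ) I r', (wt t b + σ / t) = SS t I r' + (σ / t) * (CL (t + σ) I r').card := by
    rw [Finset.sum_add_distrib, h6, Finset.sum_const, nsmul_eq_mul]; ring
  rw [h3] at h2
  linarith

lemma SS_est : ∃ C : ℝ, 1 ≤ C ∧ ∀ I : Ideal (𝓞 K), I ≠ ⊥ → ∀ t : ℝ, rho I ≤ t →
    |SS t I 0 - SS t (⊤ : Ideal (𝓞 K)) 0 / Ideal.absNorm I| ≤ C * (t / rho I) ^ (Module.finrank ℚ K - 1) := by
  obtain ⟨c, hc, Hc⟩ := reps K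
  obtain ⟨C, hC, HC⟩ := packing K
  refine ⟨max 1 (c * (C * (c + 2)) ^ Module.finrank ℚ K), le_max_left _ _, fun I hI t ht => ?_⟩
  have hρ := rho_one_le hI
  have ht0 : 0 < t := by linarith
  haveI : Finite (𝓞 K ⧸ I) := Ideal.finiteQuotientOfFreeOfNeBot I hI
  haveI : Fintype (𝓞 K ⧸ I) := Fintype.ofFinite _
  set σ := c * rho I with hσ
  have hσ0 : 0 ≤ σ := by positivity
  set n := Module.finrank ℚ K with hn
  have hn0 : 0 < n := fr_pos K
  set E := c * (C * (c + 2)) ^ n * (t / rho I) ^ (n - 1) with hE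
  have hu : 1 ≤ t / rho I := by rw [one_le_div (by linarith)]; exact ht
  have hcnt : ∀ r : 𝓞 K, σ / t * (CL (t + σ) I r).card ≤ E := by
    intro r
    have h1 := HC I hI r (t + σ) (by positivity)
    have h2 : C * ((t + σ) / rho I + 1) ≤ C * (c + 2) * (t / rho I) := by
      have : (t + σ) / rho I + 1 = t / rho I + c + 1 := by rw [hσ]; field_simp
      rw [this, mul_assoc]
      gcongr
      nlinarith
    have h3 : ((CL (t + σ) I r).card : ℝ) ≤ (C * (c + 2) * (t / rho I)) ^ n := h1.trans (by gcongr)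
    calc σ / t * (CL (t + σ) I r).card ≤ σ / t * (C * (c + 2) * (t / rho I)) ^ n := by gcongr
      _ = E := by
        rw [hE, mul_pow, hσ]
        obtain ⟨m, hm⟩ : ∃ m, n = m + 1 := ⟨n - 1, by omega⟩
        rw [hm, Nat.add_sub_cancel, pow_succ (t / rho I)]
        field_simp
  choose rep hrep1 hrep2 using Hc I hI
  have hdiff : ∀ r : 𝓞 K, |SS t I r - SS t I 0| ≤ E := by
    intro r
    have e : SS t I r = SS t I (rep r) := by
      unfold SS
      congr 1
      ext b
      simp only [CL, Finset.mem_filter, and_congr_right_iff]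
      intro _
      constructor
      · intro h
        have := I.sub_mem h (hrep1 r)
        have e : b - r - (rep r - r) = b - rep r := by ring
        rwa [e] at this
      · intro h
        have := I.add_mem h (hrep1 r)
        have e : b - rep r + (rep r - r) = b - r := by ring
        rwa [e] at this
    rw [e, abs_le]
    have h1 := shift t σ ht0 hσ0 I (rep r) 0 (by rw [sub_zero]; exact hrep2 r)
    have h2 := shift t σ ht0 hσ0 I 0 (rep r) (by rw [zero_sub, hs_neg]; exact hrep2 r)
    have h3 := hcnt 0
    have h4 := hcnt (rep r)
    constructor <;> linarith
  have hsum : SS t (⊤ : Ideal (𝓞 K)) 0 = ∑ x : 𝓞 K ⧸ I, SS t I (Quotient.out x) := by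
    have h1 : SS t (⊤ : Ideal (𝓞 K)) 0 = ∑ b ∈ FF K t, wt t b := by
      unfold SS
      congr 1
      ext b; simp [CL]
    rw [h1, ← Finset.sum_fiberwise (FF K t) (fun b => Ideal.Quotient.mk I b)]
    refine Finset.sum_congr rfl fun x _ => ?_
    unfold SS
    congr 1
    ext b
    simp only [CL, Finset.mem_filter, and_congr_right_iff]
    intro _
    have h2 : Ideal.Quotient.mk I (Quotient.out x) = x := Ideal.Quotient.mk_out x
    rw [← Ideal.Quotient.eq, h2]
  have hcard : (Fintype.card (𝓞 K ⧸ I) : ℝ) = Ideal.absNorm I := by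
    rw [← Nat.card_eq_fintype_card]; rfl
  have hN := aN_one_le hI
  have hN0 : (0 : ℝ) < Ideal.absNorm I := by linarith
  have h5 : |SS t (⊤ : Ideal (𝓞 K)) 0 - Ideal.absNorm I * SS t I 0| ≤ Ideal.absNorm I * E := by
    have : SS t (⊤ : Ideal (𝓞 K)) 0 - Ideal.absNorm I * SS t I 0 = ∑ x : 𝓞 K ⧸ I, (SS t I (Quotient.out x) - SS t I 0) := by
      rw [Finset.sum_sub_distrib, ← hsum, Finset.sum_const, Finset.card_univ, nsmul_eq_mul, hcard]
    rw [this]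
    refine (Finset.abs_sum_le_sum_abs _ _).trans ?_
    refine (Finset.sum_le_sum fun x _ => hdiff _).trans ?_
    rw [Finset.sum_const, Finset.card_univ, nsmul_eq_mul, hcard]
  have h6 : SS t I 0 - SS t (⊤ : Ideal (𝓞 K)) 0 / Ideal.absNorm I = -((SS t (⊤ : Ideal (𝓞 K)) 0 - Ideal.absNorm I * SS t I 0) / Ideal.absNorm I) := by
    field_simp; ring
  rw [h6, abs_neg, abs_div, abs_of_pos hN0, div_le_iff₀ hN0]
  refine h5.trans ?_
  rw [mul_comm]
  gcongr
  rw [hE]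
  gcongr
  exact le_max_right _ _

end B2
end S18

namespace S18
section B3
open NumberField

lemma sqrt_sum (N : ℕ) : ∑ j ∈ Icc 1 N, 1 / √(j : ℝ) ≤ 2 * √(N : ℝ) := by
  induction N with
  | zero => simp
  | succ N ih =>
    rw [Finset.sum_Icc_succ_top (by omega)]
    have h1 : 0 < √((N + 1 : ℕ) : ℝ) := Real.sqrt_pos.mpr (by positivity)
    have h2 : √((N + 1 : ℕ) : ℝ) ^ 2 = N + 1 := by rw [Real.sq_sqrt (by positivity)]; push_cast; ring
    have h3 : √(N : ℝ) ^ 2 = N := Real.sq_sqrt (by positivity)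
    have h4 : 0 ≤ √(N : ℝ) := Real.sqrt_nonneg _
    have h5 : 1 / √((N + 1 : ℕ) : ℝ) ≤ 2 * √((N + 1 : ℕ) : ℝ) - 2 * √(N : ℝ) := by
      rw [div_le_iff₀ h1]
      nlinarith [sq_nonneg (√((N + 1 : ℕ) : ℝ) - √(N : ℝ))]
    linarith

lemma line_half (t : ℝ) (ht : 1 ≤ t) (A : Finset ℕ) (v : ℕ → ℝ) (g : ℕ → ℕ) (hg : Set.InjOn g A)
    (h1 : ∀ k ∈ A, 1 ≤ g k) (hv : ∀ k ∈ A, (g k : ℝ) ≤ v k) (hvt : ∀ k ∈ A, v k ≤ t) :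
    ∑ k ∈ A, Real.log (t / v k) ≤ 4 * t := by
  have hterm : ∀ k ∈ A, Real.log (t / v k) ≤ 2 * √t * (1 / √(g k : ℝ)) := by
    intro k hk
    have hg0 : (1 : ℝ) ≤ g k := by exact_mod_cast h1 k hk
    have hvk := hv k hk
    have h2 : Real.log (t / v k) ≤ Real.log (t / g k) := by
      have : 0 < v k := by linarith
      apply Real.log_le_log (by positivity); gcongr
    have h3 : Real.log (t / g k) = 2 * Real.log (√(t / g k)) := by
      rw [Real.log_sqrt (by positivity)]; ring
    have h4 := Real.log_le_sub_one_of_pos (Real.sqrt_pos.mpr (by positivity : 0 < t / (g k : ℝ)))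
    rw [Real.sqrt_div (by linarith)] at h4 h3
    have h5 : 2 * √t * (1 / √(g k : ℝ)) = 2 * (√t / √(g k : ℝ)) := by ring
    rw [h5]; linarith
  refine (Finset.sum_le_sum hterm).trans ?_
  rw [← Finset.sum_image (f := fun j : ℕ => 2 * √t * (1 / √(j : ℝ))) (g := g) hg]
  have hsub : A.image g ⊆ Icc 1 ⌊t⌋₊ := by
    intro j hj
    obtain ⟨k, hk, rfl⟩ := Finset.mem_image.mp hj
    rw [Finset.mem_Icc]
    exact ⟨h1 k hk, Nat.le_floor ((hv k hk).trans (hvt k hk))⟩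
  refine (Finset.sum_le_sum_of_subset_of_nonneg hsub (fun j _ _ => by positivity)).trans ?_
  rw [← Finset.mul_sum]
  have h6 := sqrt_sum ⌊t⌋₊
  have h7 : √(⌊t⌋₊ : ℝ) ≤ √t := Real.sqrt_le_sqrt (Nat.floor_le (by linarith))
  have h8 : √t * √t = t := Real.mul_self_sqrt (by linarith)
  have h9 : 0 ≤ √t := Real.sqrt_nonneg _
  nlinarith

lemma line_sum (n : ℕ) (t : ℝ) (ht : 1 ≤ t) (z : ℂ) (A : Finset ℕ)
    (hlo : ∀ k ∈ A, Real.log (t / ‖z + k‖) ≤ n * t) (hvt : ∀ k ∈ A, ‖z + k‖ ≤ t) :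
    ∑ k ∈ A, Real.log (t / ‖z + k‖) ≤ (2 * n + 8) * t := by
  set m0 := ⌊z.re⌋ with hm0
  have hre : ∀ k : ℕ, |z.re + k| ≤ ‖z + k‖ := by
    intro k
    have := Complex.abs_re_le_norm (z + k)
    simpa using this
  have f1 := Int.floor_le z.re
  have f2 := Int.lt_floor_add_one z.re
  set A1 := A.filter (fun k : ℕ => 1 ≤ m0 + k)
  set A2 := A.filter (fun k : ℕ => ¬ 1 ≤ m0 + k)
  have hA : ∑ k ∈ A, Real.log (t / ‖z + k‖) = ∑ k ∈ A1, Real.log (t / ‖z + k‖) + ∑ k ∈ A2, Real.log (t / ‖z + k‖) :=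
    (Finset.sum_filter_add_sum_filter_not _ _ _).symm
  have hA2 : ∑ k ∈ A2, Real.log (t / ‖z + k‖) = ∑ k ∈ A2.filter (fun k : ℕ => m0 + k ≤ -2), Real.log (t / ‖z + k‖) + ∑ k ∈ A2.filter (fun k : ℕ => ¬ m0 + k ≤ -2), Real.log (t / ‖z + k‖) :=
    (Finset.sum_filter_add_sum_filter_not _ _ _).symm
  have b1 : ∑ k ∈ A1, Real.log (t / ‖z + k‖) ≤ 4 * t := by
    refine line_half t ht A1 (fun k => ‖z + k‖) (fun k => (m0 + k).toNat) ?_ ?_ ?_ ?_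
    · intro a ha b hb hab
      simp only [A1, Finset.mem_coe, Finset.mem_filter] at ha hb hab
      omega
    · intro k hk
      simp only [A1, Finset.mem_filter] at hk
      omega
    · intro k hk
      simp only [A1, Finset.mem_filter] at hk
      refine le_trans ?_ ((le_abs_self _).trans (hre k))
      have : (((m0 + k).toNat : ℤ) : ℝ) = ((m0 + k : ℤ) : ℝ) := by
        rw [Int.toNat_of_nonneg (by omega)]
      have h2 : ((m0 + k).toNat : ℝ) = m0 + k := by exact_mod_cast this
      rw [h2]; linarith
    · intro k hk
      exact hvt k (Finset.mem_filter.mp hk).1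
  have b2 : ∑ k ∈ A2.filter (fun k : ℕ => m0 + k ≤ -2), Real.log (t / ‖z + k‖) ≤ 4 * t := by
    refine line_half t ht _ (fun k => ‖z + k‖) (fun k => (-(m0 + k) - 1).toNat) ?_ ?_ ?_ ?_
    · intro a ha b hb hab
      simp only [Finset.mem_coe, Finset.mem_filter] at ha hb hab
      omega
    · intro k hk
      simp only [Finset.mem_filter] at hk
      omega
    · intro k hk
      simp only [Finset.mem_filter] at hk
      refine le_trans ?_ ((neg_le_abs _).trans (hre k))
      have : (((-(m0 + k) - 1).toNat : ℤ) : ℝ) = ((-(m0 + k) - 1 : ℤ) : ℝ) := by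
        rw [Int.toNat_of_nonneg (by omega)]
      have h2 : ((-(m0 + k) - 1).toNat : ℝ) = -(m0 + k) - 1 := by exact_mod_cast this
      rw [h2]; linarith
    · intro k hk
      exact hvt k (Finset.mem_filter.mp (Finset.mem_filter.mp hk).1).1
  have b3 : ∑ k ∈ A2.filter (fun k : ℕ => ¬ m0 + k ≤ -2), Real.log (t / ‖z + k‖) ≤ 2 * (n * t) := by
    refine (Finset.sum_le_card_nsmul _ _ (n * t) (fun k hk => hlo k (Finset.mem_filter.mp (Finset.mem_filter.mp hk).1).1)).trans ?_
    rw [nsmul_eq_mul]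
    gcongr
    have : (A2.filter (fun k : ℕ => ¬ m0 + k ≤ -2)).card ≤ (Finset.Icc (-1 : ℤ) 0).card := by
      refine Finset.card_le_card_of_injOn (fun k : ℕ => m0 + k) ?_ ?_
      · intro k hk
        simp only [A2, Finset.mem_coe, Finset.mem_filter, Finset.mem_Icc] at hk ⊢
        omega
      · intro a _ b _ hab
        simpa using hab
    exact_mod_cast this
  linarith

variable (K : Type*) [Field K] [NumberField K]

lemma emb_sum : ∃ C : ℝ, 0 < C ∧ ∀ t : ℝ, 1 ≤ t → ∀ φ : K →ₐ[ℚ] ℂ,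
    ∑ a ∈ (FF K t).erase 0, Real.log (t / ‖φ (a : K)‖) ≤ C * t ^ Module.finrank ℚ K := by
  obtain ⟨cu, hcu, Hu⟩ := FF_upper K
  set n := Module.finrank ℚ K with hn
  refine ⟨(2 * n + 8) * (cu * 3) ^ n, by positivity, fun t ht φ => ?_⟩
  set M : ℕ := ⌊t⌋₊ with hM
  have hMt : t ≤ M + 1 := (Nat.lt_floor_add_one t).le
  have hMt2 : (M : ℝ) ≤ t := Nat.floor_le (by linarith)
  set g : 𝓞 K → ℝ := fun a => Real.log (t / ‖φ (a : K)‖) with hg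
  have hφ0 : ∀ a : 𝓞 K, a ≠ 0 → 0 < ‖φ (a : K)‖ := by
    intro a ha
    rw [norm_pos_iff]
    intro h0
    have : (a : K) = 0 := (map_eq_zero φ).mp h0
    exact ha (by exact_mod_cast this)
  have hg0 : ∀ a ∈ (FF K t).erase 0, 0 ≤ g a := by
    intro a ha
    rw [Finset.mem_erase, mem_FF] at ha
    have h1 := hφ0 a ha.1
    refine Real.log_nonneg ?_
    rw [one_le_div h1]
    exact (emb_le a φ).trans ha.2
  have hglo : ∀ a ∈ (FF K t).erase 0, g a ≤ n * t := by
    intro a ha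
    rw [Finset.mem_erase, mem_FF] at ha
    have h1 := hφ0 a ha.1
    have h2 : (1 : ℝ) ≤ Ideal.absNorm (Ideal.span {a}) := aN_one_le (by rw [Ne, Ideal.span_singleton_eq_bot]; exact ha.1)
    rw [NN_eq, ← Finset.mul_prod_erase _ _ (Finset.mem_univ φ)] at h2
    have h3 : ∏ x ∈ Finset.univ.erase φ, ‖x (a : K)‖ ≤ t ^ (n - 1) := by
      refine (Finset.prod_le_prod (fun _ _ => norm_nonneg _) (fun x _ => (emb_le a x).trans ha.2)).trans ?_
      rw [Finset.prod_const, Finset.card_erase_of_mem (Finset.mem_univ _), Finset.card_univ, AlgHom.card]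
    have h4 : t / ‖φ (a : K)‖ ≤ t ^ n := by
      rw [div_le_iff₀ h1]
      have h5 : 1 ≤ ‖φ (a : K)‖ * t ^ (n - 1) := h2.trans (by gcongr)
      have h6 : t ^ n = t * t ^ (n - 1) := by
        rw [← pow_succ', Nat.sub_add_cancel (fr_pos K)]
      rw [h6]
      nlinarith
    have h7 := Real.log_le_log (by positivity) h4
    rw [Real.log_pow] at h7
    refine h7.trans ?_
    gcongr
    have := Real.log_le_sub_one_of_pos (by linarith : 0 < t)
    linarith
  have h1 : ((M : ℝ) + 1) * ∑ a ∈ (FF K t).erase 0, g a = ∑ k ∈ Finset.range (M + 1), ∑ a ∈ (FF K t).erase 0, g a := by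
    rw [Finset.sum_const, Finset.card_range, nsmul_eq_mul]; push_cast; ring
  have h2 : ∑ k ∈ Finset.range (M + 1), ∑ a ∈ (FF K t).erase 0, g a ≤
      ∑ k ∈ Finset.range (M + 1), ∑ b ∈ (FF K (2 * t)).filter (fun b => b + (k : 𝓞 K) ∈ (FF K t).erase 0), g (b + (k : 𝓞 K)) := by
    refine Finset.sum_le_sum fun k hk => ?_
    rw [Finset.mem_range] at hk
    have hkM : (k : ℝ) ≤ M := by exact_mod_cast Nat.lt_succ_iff.mp hk
    refine le_of_eq ?_
    refine Finset.sum_nbij' (fun a => a - (k : 𝓞 K)) (fun b => b + (k : 𝓞 K)) ?_ ?_ ?_ ?_ ?_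
    · intro a ha
      rw [Finset.mem_filter, mem_FF]
      refine ⟨?_, by simpa using ha⟩
      have h3 := mem_FF.mp (Finset.mem_erase.mp ha).2
      refine (hs_sub _ _).trans ?_
      rw [hs_natCast]; linarith
    · intro b hb
      exact (Finset.mem_filter.mp hb).2
    · intro a _; simp
    · intro b _; simp
    · intro a _; simp
  have h3 : ∑ k ∈ Finset.range (M + 1), ∑ b ∈ (FF K (2 * t)).filter (fun b => b + (k : 𝓞 K) ∈ (FF K t).erase 0), g (b + (k : 𝓞 K)) =
      ∑ b ∈ FF K (2 * t), ∑ k ∈ (Finset.range (M + 1)).filter (fun k : ℕ => b + (k : 𝓞 K) ∈ (FF K t).erase 0), g (b + (k : 𝓞 K)) := by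
    simp_rw [Finset.sum_filter]
    exact Finset.sum_comm
  have h4 : ∀ b ∈ FF K (2 * t), ∑ k ∈ (Finset.range (M + 1)).filter (fun k : ℕ => b + (k : 𝓞 K) ∈ (FF K t).erase 0), g (b + (k : 𝓞 K)) ≤ (2 * n + 8) * t := by
    intro b _
    have e : ∀ k : ℕ, φ ((b + (k : 𝓞 K) : 𝓞 K) : K) = φ (b : K) + k := by
      intro k; simp
    have := line_sum n t ht (φ (b : K)) ((Finset.range (M + 1)).filter (fun k : ℕ => b + (k : 𝓞 K) ∈ (FF K t).erase 0)) ?_ ?_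
    · simpa only [hg, e] using this
    · intro k hk
      rw [← e]
      exact hglo _ (Finset.mem_filter.mp hk).2
    · intro k hk
      rw [← e]
      exact (emb_le _ φ).trans (mem_FF.mp (Finset.mem_erase.mp (Finset.mem_filter.mp hk).2).2)
  have h5 := Finset.sum_le_card_nsmul _ _ _ h4
  rw [nsmul_eq_mul] at h5
  have h6 := Hu (2 * t) (by linarith)
  have h7 : (cu * (2 * t + 1)) ^ n ≤ (cu * 3) ^ n * t ^ n := by
    rw [← mul_pow]
    refine pow_le_pow_left₀ (by positivity) ?_ n
    nlinarith
  have h8 : t * ∑ a ∈ (FF K t).erase 0, g a ≤ ((cu * 3) ^ n * t ^ n) * ((2 * n + 8) * t) := by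
    calc t * ∑ a ∈ (FF K t).erase 0, g a ≤ ((M : ℝ) + 1) * ∑ a ∈ (FF K t).erase 0, g a :=
          mul_le_mul_of_nonneg_right hMt (Finset.sum_nonneg hg0)
      _ ≤ ((FF K (2 * t)).card : ℝ) * ((2 * n + 8) * t) := by rw [h1]; exact h2.trans (h3.le.trans h5)
      _ ≤ _ := by
        refine mul_le_mul_of_nonneg_right (h6.trans h7) (by positivity)
  have h9 : t * ∑ a ∈ (FF K t).erase 0, g a ≤ t * ((2 * n + 8) * (cu * 3) ^ n * t ^ n) := by
    refine h8.trans (le_of_eq ?_); ring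
  exact le_of_mul_le_mul_left h9 (by linarith)

/-- total log-norm sum -/
lemma log_lower : ∃ C : ℝ, 0 < C ∧ ∀ t : ℝ, 1 ≤ t →
    |∑ a ∈ (FF K t).erase 0, wt t a * Real.log (Ideal.absNorm (Ideal.span {a})) - Module.finrank ℚ K * Real.log t * ∑ a ∈ (FF K t).erase 0, wt t a|
      ≤ C * t ^ Module.finrank ℚ K := by
  obtain ⟨C, hC, H⟩ := emb_sum K
  set n := Module.finrank ℚ K with hn
  have hn0 : 0 < n := fr_pos K
  refine ⟨n * C, by positivity, fun t ht => ?_⟩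
  have hφ0 : ∀ a : 𝓞 K, a ≠ 0 → ∀ φ : K →ₐ[ℚ] ℂ, 0 < ‖φ (a : K)‖ := by
    intro a ha φ
    rw [norm_pos_iff]
    intro h0
    have : (a : K) = 0 := (map_eq_zero φ).mp h0
    exact ha (by exact_mod_cast this)
  have hid : ∀ a ∈ (FF K t).erase 0, n * Real.log t - Real.log (Ideal.absNorm (Ideal.span {a})) = ∑ φ : K →ₐ[ℚ] ℂ, Real.log (t / ‖φ (a : K)‖) := by
    intro a ha
    have h0 := (Finset.mem_erase.mp ha).1
    rw [NN_eq, Real.log_prod (fun φ _ => (hφ0 a h0 φ).ne')]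
    have : ∀ φ : K →ₐ[ℚ] ℂ, Real.log (t / ‖φ (a : K)‖) = Real.log t - Real.log ‖φ (a : K)‖ := fun φ =>
      Real.log_div (by linarith) (hφ0 a h0 φ).ne'
    simp_rw [this]
    rw [Finset.sum_sub_distrib, Finset.sum_const, Finset.card_univ, AlgHom.card, nsmul_eq_mul]
  have hnn : ∀ a ∈ (FF K t).erase 0, ∀ φ : K →ₐ[ℚ] ℂ, 0 ≤ Real.log (t / ‖φ (a : K)‖) := by
    intro a ha φ
    rw [Finset.mem_erase, mem_FF] at ha
    refine Real.log_nonneg ?_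
    rw [one_le_div (hφ0 a ha.1 φ)]
    exact (emb_le a φ).trans ha.2
  have e : ∑ a ∈ (FF K t).erase 0, wt t a * Real.log (Ideal.absNorm (Ideal.span {a})) - n * Real.log t * ∑ a ∈ (FF K t).erase 0, wt t a
      = -∑ a ∈ (FF K t).erase 0, wt t a * ∑ φ : K →ₐ[ℚ] ℂ, Real.log (t / ‖φ (a : K)‖) := by
    rw [Finset.mul_sum, ← Finset.sum_sub_distrib, ← Finset.sum_neg_distrib]
    refine Finset.sum_congr rfl fun a ha => ?_
    rw [← hid a ha]; ring
  rw [e, abs_neg, abs_of_nonneg (Finset.sum_nonneg fun a ha => mul_nonneg (wt_nonneg _ _) (Finset.sum_nonneg fun φ _ => hnn a ha φ))]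
  have h1 : ∑ a ∈ (FF K t).erase 0, wt t a * ∑ φ : K →ₐ[ℚ] ℂ, Real.log (t / ‖φ (a : K)‖) ≤ ∑ a ∈ (FF K t).erase 0, ∑ φ : K →ₐ[ℚ] ℂ, Real.log (t / ‖φ (a : K)‖) := by
    refine Finset.sum_le_sum fun a ha => ?_
    refine mul_le_of_le_one_left (Finset.sum_nonneg fun φ _ => hnn a ha φ) ?_
    unfold wt
    refine max_le zero_le_one ?_
    have := div_nonneg (hs_nonneg a) (by linarith : 0 ≤ t)
    linarith
  refine h1.trans ?_
  rw [Finset.sum_comm]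
  refine (Finset.sum_le_sum fun φ _ => H t ht φ).trans ?_
  rw [Finset.sum_const, Finset.card_univ, AlgHom.card, nsmul_eq_mul, mul_assoc]

lemma SS_top : ∃ c : ℝ, 0 < c ∧ ∃ C : ℝ, 0 < C ∧ ∀ t : ℝ, 1 ≤ t →
    c * t ^ Module.finrank ℚ K ≤ SS t (⊤ : Ideal (𝓞 K)) 0 ∧ SS t (⊤ : Ideal (𝓞 K)) 0 ≤ C * t ^ Module.finrank ℚ K := by
  obtain ⟨cu, hcu, Hu⟩ := FF_upper K
  obtain ⟨cl, hcl, Hl⟩ := FF_lower K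
  set n := Module.finrank ℚ K with hn
  refine ⟨(cl / 2) ^ n / 2, by positivity, (cu * 2) ^ n, by positivity, fun t ht => ?_⟩
  have h1 : SS t (⊤ : Ideal (𝓞 K)) 0 = ∑ b ∈ FF K t, wt t b := by
    unfold SS
    congr 1
    ext b; simp [CL]
  rw [h1]
  constructor
  · have h2 : ∑ b ∈ FF K (t / 2), (1 / 2 : ℝ) ≤ ∑ b ∈ FF K t, wt t b := by
      refine (Finset.sum_le_sum fun b hb => ?_).trans (Finset.sum_le_sum_of_subset_of_nonneg (s := FF K (t / 2)) ?_ (fun b _ _ => wt_nonneg t b))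
      · rw [mem_FF] at hb
        refine le_trans ?_ (le_max_right _ _)
        have : hs b / t ≤ 1 / 2 := by rw [div_le_iff₀ (by linarith)]; linarith
        linarith
      · intro b hb
        rw [mem_FF] at hb ⊢
        linarith
    rw [Finset.sum_const, nsmul_eq_mul] at h2
    have h3 := Hl (t / 2) (by linarith)
    have h4 : (cl * (t / 2)) ^ n = (cl / 2) ^ n * t ^ n := by rw [← mul_pow]; ring
    rw [h4] at h3
    linarith
  · have h2 : ∑ b ∈ FF K t, wt t b ≤ ∑ b ∈ FF K t, 1 := by
      refine Finset.sum_le_sum fun b _ => ?_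
      unfold wt
      refine max_le zero_le_one ?_
      have := div_nonneg (hs_nonneg b) (by linarith : 0 ≤ t)
      linarith
    rw [Finset.sum_const, nsmul_eq_mul, mul_one] at h2
    refine h2.trans ((Hu t (by linarith)).trans ?_)
    rw [← mul_pow]
    refine pow_le_pow_left₀ (by positivity) ?_ n
    nlinarith

end B3
end S18

namespace S18
section B4
open NumberField
variable (K : Type*) [Field K] [NumberField K]

/-- prime powers `(P, k)` with `N(P)^k ≤ y` -/
def PPK (y : ℝ) : Finset (Ideal (𝓞 K) × ℕ) :=
  ((Ideal.finite_setOfPred_absNorm_le (S := 𝓞 K) ⌊y⌋₊).toFinset ×ˢ Icc 1 ⌊y⌋₊).filter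
    (fun x => x.1.IsPrime ∧ x.1 ≠ ⊥ ∧ (Ideal.absNorm x.1 : ℝ) ^ x.2 ≤ y)

variable {K} in
lemma two_le_aN {P : Ideal (𝓞 K)} (hP : P.IsPrime) (h0 : P ≠ ⊥) : 2 ≤ Ideal.absNorm P := by
  have h1 : Ideal.absNorm P ≠ 0 := fun h => h0 (Ideal.absNorm_eq_zero_iff.mp h)
  have h2 : Ideal.absNorm P ≠ 1 := fun h => hP.ne_top (Ideal.absNorm_eq_one_iff.mp h)
  omega

variable {K} in
lemma mem_PPK {y : ℝ} {x : Ideal (𝓞 K) × ℕ} : x ∈ PPK K y ↔ x.1.IsPrime ∧ x.1 ≠ ⊥ ∧ 1 ≤ x.2 ∧ (Ideal.absNorm x.1 : ℝ) ^ x.2 ≤ y := by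
  unfold PPK
  rw [Finset.mem_filter, Finset.mem_product, Set.Finite.mem_toFinset, Finset.mem_Icc]
  constructor
  · rintro ⟨⟨_, h1, _⟩, h2, h3, h4⟩
    exact ⟨h2, h3, h1, h4⟩
  · rintro ⟨h1, h2, h3, h4⟩
    have h5 := two_le_aN h1 h2
    have h6 : Ideal.absNorm x.1 ^ x.2 ≤ ⌊y⌋₊ := Nat.le_floor (by exact_mod_cast h4)
    refine ⟨⟨?_, h3, ?_⟩, h1, h2, h4⟩
    · exact (Nat.le_self_pow (by omega) _).trans h6
    · exact ((Nat.lt_pow_self (by omega : 1 < Ideal.absNorm x.1)).le).trans h6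

variable {K} in
lemma log_decomp (J : Ideal (𝓞 K)) (hJ : J ≠ ⊥) (y : ℝ) (hy : (Ideal.absNorm J : ℝ) ≤ y) :
    Real.log (Ideal.absNorm J) = ∑ x ∈ PPK K y, if J ≤ x.1 ^ x.2 then Real.log (Ideal.absNorm x.1) else 0 := by
  set s := UniqueFactorizationMonoid.normalizedFactors J with hs
  have hprod : J = s.prod := (Ideal.prod_normalizedFactors_eq_self hJ).symm
  have hmem : ∀ P ∈ s, P.IsPrime ∧ P ≠ ⊥ := by
    intro P hP
    have h := UniqueFactorizationMonoid.prime_of_normalized_factor P hP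
    exact ⟨Ideal.isPrime_of_prime h, h.ne_zero⟩
  have hcnt : ∀ P : Ideal (𝓞 K), P.IsPrime → P ≠ ⊥ → ∀ k : ℕ, J ≤ P ^ k ↔ k ≤ s.count P := by
    intro P hP h0 k
    have hpr : Irreducible P := (Ideal.prime_of_isPrime h0 hP).irreducible
    rw [← Ideal.dvd_iff_le, pow_dvd_iff_le_emultiplicity, UniqueFactorizationMonoid.emultiplicity_eq_count_normalizedFactors hpr hJ, normalize_eq]
    simp [hs]
  rw [← Finset.sum_filter]
  have hset : (PPK K y).filter (fun x => J ≤ x.1 ^ x.2) = (s.toFinset ×ˢ Icc 1 ⌊y⌋₊).filter (fun x => x.2 ≤ s.count x.1) := by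
    ext x
    rw [Finset.mem_filter, Finset.mem_filter, Finset.mem_product, Finset.mem_Icc, Multiset.mem_toFinset]
    constructor
    · rintro ⟨hx, hx2⟩
      have hx' := hx
      rw [mem_PPK] at hx
      rw [hcnt _ hx.1 hx.2.1] at hx2
      refine ⟨⟨?_, hx.2.2.1, ?_⟩, hx2⟩
      · rw [← Multiset.one_le_count_iff_mem]
        exact hx.2.2.1.trans hx2
      · unfold PPK at hx'
        rw [Finset.mem_filter, Finset.mem_product, Finset.mem_Icc] at hx'
        exact hx'.1.2.2
    · rintro ⟨⟨h1, h2, h3⟩, h4⟩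
      obtain ⟨h5, h6⟩ := hmem _ h1
      have h7 := (hcnt _ h5 h6 _).mpr h4
      refine ⟨mem_PPK.mpr ⟨h5, h6, h2, ?_⟩, h7⟩
      have h8 := Nat.le_of_dvd (Nat.pos_of_ne_zero fun h => hJ (Ideal.absNorm_eq_zero_iff.mp h)) (Ideal.absNorm_dvd_absNorm_of_le h7)
      rw [map_pow] at h8
      refine le_trans ?_ hy
      exact_mod_cast h8
  rw [hset, Finset.sum_filter, Finset.sum_product]
  have hN : Ideal.absNorm J = ∏ P ∈ s.toFinset, Ideal.absNorm P ^ s.count P := by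
    conv_lhs => rw [hprod, Finset.prod_multiset_count, map_prod]
    simp
  rw [hN, Nat.cast_prod, Real.log_prod]
  · refine Finset.sum_congr rfl fun P hP => ?_
    rw [Multiset.mem_toFinset] at hP
    obtain ⟨h5, h6⟩ := hmem _ hP
    have hle : s.count P ≤ ⌊y⌋₊ := by
      have h8 := Nat.le_of_dvd (Nat.pos_of_ne_zero fun h => hJ (Ideal.absNorm_eq_zero_iff.mp h)) (Ideal.absNorm_dvd_absNorm_of_le ((hcnt P h5 h6 _).mpr le_rfl))
      rw [map_pow] at h8
      refine ((Nat.lt_pow_self (by have := two_le_aN h5 h6; omega : 1 < Ideal.absNorm P)).le).trans (h8.trans (Nat.le_floor hy))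
    rw [← Finset.sum_filter]
    have : (Icc 1 ⌊y⌋₊).filter (fun k => k ≤ s.count P) = Icc 1 (s.count P) := by
      ext k; simp; omega
    simp [this]
  · intro P hP
    rw [Multiset.mem_toFinset] at hP
    obtain ⟨h5, h6⟩ := hmem _ hP
    have := two_le_aN h5 h6
    positivity

lemma wt_zero {K : Type*} [Field K] [NumberField K] (t : ℝ) : wt t (0 : 𝓞 K) = 1 := by
  simp [wt, hs_zero]

variable {K} in
lemma SS_zero (t : ℝ) (ht : 0 ≤ t) (I : Ideal (𝓞 K)) :
    SS t I 0 = 1 + ∑ a ∈ (FF K t).erase 0, if a ∈ I then wt t a else 0 := by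
  unfold SS CL
  rw [Finset.sum_filter, ← Finset.add_sum_erase (FF K t) _ (mem_FF.mpr (by rw [hs_zero]; exact ht) : (0 : 𝓞 K) ∈ FF K t)]
  simp [wt_zero]

/-- swapping sums -/
lemma log_swap (t : ℝ) (ht : 1 ≤ t) :
    ∑ a ∈ (FF K t).erase 0, wt t a * Real.log (Ideal.absNorm (Ideal.span {a})) =
      ∑ x ∈ PPK K (t ^ Module.finrank ℚ K), Real.log (Ideal.absNorm x.1) * (SS t (x.1 ^ x.2) 0 - 1) := by
  have h1 : ∀ a ∈ (FF K t).erase 0, wt t a * Real.log (Ideal.absNorm (Ideal.span {a})) =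
      ∑ x ∈ PPK K (t ^ Module.finrank ℚ K), Real.log (Ideal.absNorm x.1) * (if a ∈ x.1 ^ x.2 then wt t a else 0) := by
    intro a ha
    rw [Finset.mem_erase, mem_FF] at ha
    have h2 : (Ideal.absNorm (Ideal.span {a}) : ℝ) ≤ t ^ Module.finrank ℚ K :=
      (norm_le_of_mem (Ideal.mem_span_singleton_self a) ha.1).trans (pow_le_pow_left₀ (hs_nonneg a) ha.2 _)
    rw [log_decomp _ (by simpa using ha.1) _ h2, Finset.mul_sum]
    refine Finset.sum_congr rfl fun x _ => ?_
    rw [Ideal.span_singleton_le_iff_mem]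
    split_ifs <;> ring
  rw [Finset.sum_congr rfl h1, Finset.sum_comm]
  refine Finset.sum_congr rfl fun x _ => ?_
  rw [SS_zero t (by linarith), ← Finset.mul_sum]
  ring

end B4
end S18

namespace S18
section B5
open NumberField
variable (K : Type*) [Field K] [NumberField K]

lemma frZ : Module.finrank ℤ (𝓞 K) = Module.finrank ℚ K := RingOfIntegers.rank K

variable {K} in
lemma prime_data {P : Ideal (𝓞 K)} (hP : P.IsPrime) (h0 : P ≠ ⊥) :
    ∃ p f : ℕ, 0 < f ∧ f ≤ Module.finrank ℚ K ∧ (p : 𝓞 K) ∈ P ∧ p.Prime ∧ Ideal.absNorm P = p ^ f := by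
  have := hP.isMaximal h0
  obtain ⟨p, f, hf, hp, hpp, hN⟩ := Ideal.exists_prime_and_absNorm_eq_pow P
  refine ⟨p, f, hf, ?_, hp, hpp, hN⟩
  have h1 := Ideal.absNorm_dvd_absNorm_of_le ((Ideal.span_singleton_le_iff_mem P).mpr hp)
  rw [Ideal.absNorm_span_natCast, frZ, hN] at h1
  exact (Nat.pow_dvd_pow_iff_le_right hpp.one_lt).mp h1

variable {K} in
lemma card_over (p : ℕ) (hp : p.Prime) (A : Finset (Ideal (𝓞 K)))
    (hA : ∀ P ∈ A, P.IsPrime ∧ P ≠ ⊥ ∧ (p : 𝓞 K) ∈ P) : A.card ≤ Module.finrank ℚ K := by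
  have h1 : ∏ P ∈ A, P ∣ Ideal.span {(p : 𝓞 K)} := by
    refine Finset.prod_primes_dvd _ (fun P hP => Ideal.prime_of_isPrime (hA P hP).2.1 (hA P hP).1) (fun P hP => ?_)
    rw [Ideal.dvd_iff_le, Ideal.span_singleton_le_iff_mem]
    exact (hA P hP).2.2
  have h2 := map_dvd Ideal.absNorm h1
  rw [Ideal.absNorm_span_natCast, frZ, map_prod] at h2
  have h3 : p ^ A.card ≤ ∏ P ∈ A, Ideal.absNorm P := by
    rw [← Finset.prod_const]
    refine Finset.prod_le_prod' fun P hP => ?_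
    obtain ⟨h4, h5, h6⟩ := hA P hP
    obtain ⟨q, f, hf, hfn, hq, hqp, hN⟩ := prime_data h4 h5
    have h7 := Ideal.absNorm_dvd_absNorm_of_le ((Ideal.span_singleton_le_iff_mem P).mpr h6)
    rw [Ideal.absNorm_span_natCast, frZ, hN] at h7
    have h8 : q ∣ p := hqp.dvd_of_dvd_pow ((dvd_pow_self q hf.ne').trans h7)
    rw [Nat.prime_dvd_prime_iff_eq hqp hp] at h8
    rw [hN, h8]
    exact Nat.le_self_pow hf.ne' p
  exact (Nat.pow_le_pow_iff_right hp.one_lt).mp (h3.trans (Nat.le_of_dvd (pow_pos hp.pos _) h2))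

variable {K} in
lemma transfer (A : Finset (Ideal (𝓞 K) × ℕ)) (hA : ∀ x ∈ A, x.1.IsPrime ∧ x.1 ≠ ⊥ ∧ 1 ≤ x.2) (F : ℕ → ℝ) (hF : ∀ m, 0 ≤ F m) :
    ∑ x ∈ A, Real.log (Ideal.absNorm x.1) * F (Ideal.absNorm x.1 ^ x.2) ≤
      (Module.finrank ℚ K : ℝ) ^ 2 * ∑ m ∈ A.image (fun x => Ideal.absNorm x.1 ^ x.2), ArithmeticFunction.vonMangoldt m * F m := by
  set n := Module.finrank ℚ K with hn
  have hL : ∀ m, 0 ≤ ArithmeticFunction.vonMangoldt m := fun m => ArithmeticFunction.vonMangoldt_nonneg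
  have h1 : ∀ x ∈ A, Real.log (Ideal.absNorm x.1) * F (Ideal.absNorm x.1 ^ x.2) ≤
      (fun m : ℕ => (n : ℝ) * (ArithmeticFunction.vonMangoldt m * F m)) (Ideal.absNorm x.1 ^ x.2) := by
    intro x hx
    obtain ⟨h2, h3, h4⟩ := hA x hx
    obtain ⟨p, f, hf, hfn, hp, hpp, hN⟩ := prime_data h2 h3
    have h5 : ArithmeticFunction.vonMangoldt (Ideal.absNorm x.1 ^ x.2) = Real.log p := by
      rw [ArithmeticFunction.vonMangoldt_apply_pow (by omega), hN, ArithmeticFunction.vonMangoldt_apply_pow hf.ne', ArithmeticFunction.vonMangoldt_apply_prime hpp]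
    simp only [h5]
    rw [← mul_assoc]
    refine mul_le_mul_of_nonneg_right ?_ (hF _)
    rw [hN, Nat.cast_pow, Real.log_pow]
    refine mul_le_mul_of_nonneg_right (by exact_mod_cast hfn) (Real.log_natCast_nonneg p)
  refine (Finset.sum_le_sum h1).trans ?_
  rw [Finset.sum_comp (fun m : ℕ => (n : ℝ) * (ArithmeticFunction.vonMangoldt m * F m)) (fun x : Ideal (𝓞 K) × ℕ => Ideal.absNorm x.1 ^ x.2), Finset.mul_sum]
  refine Finset.sum_le_sum fun m hm => ?_
  rw [nsmul_eq_mul, pow_two, mul_assoc]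
  refine mul_le_mul_of_nonneg_right ?_ (mul_nonneg (Nat.cast_nonneg _) (mul_nonneg (hL m) (hF m)))
  rw [Nat.cast_le]
  obtain ⟨x0, hx0, rfl⟩ := Finset.mem_image.mp hm
  obtain ⟨h2, h3, h4⟩ := hA x0 hx0
  obtain ⟨p, f, hf, hfn, hp, hpp, hN⟩ := prime_data h2 h3
  set B := A.filter (fun x => Ideal.absNorm x.1 ^ x.2 = Ideal.absNorm x0.1 ^ x0.2) with hB
  have hinj : Set.InjOn Prod.fst (B : Set (Ideal (𝓞 K) × ℕ)) := by
    intro x hx y hy hxy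
    simp only [hB, Finset.coe_filter, Set.mem_ofPred_eq] at hx hy
    obtain ⟨h6, h7, h8⟩ := hA x hx.1
    have h9 := two_le_aN h6 h7
    have h10 := hx.2.trans hy.2.symm
    rw [← hxy] at h10
    exact Prod.ext hxy (Nat.pow_right_injective h9 h10)
  rw [← Finset.card_image_of_injOn hinj]
  refine card_over p hpp _ ?_
  intro P hP
  obtain ⟨x, hx, rfl⟩ := Finset.mem_image.mp hP
  rw [hB, Finset.mem_filter] at hx
  obtain ⟨h6, h7, h8⟩ := hA x hx.1
  refine ⟨h6, h7, ?_⟩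
  have h9 : ((Ideal.absNorm x.1 : ℕ) : 𝓞 K) ^ x.2 ∈ x.1 := Ideal.pow_mem_of_mem _ (Ideal.absNorm_mem _) _ h8
  have h10 : ((p : ℕ) : 𝓞 K) ^ (f * x0.2) ∈ x.1 := by
    rw [← Nat.cast_pow, hx.2, hN, ← pow_mul, Nat.cast_pow] at h9
    exact h9
  exact h6.mem_of_pow_mem _ h10

lemma cheb_weight (δ : ℝ) (hδ : 0 < δ) (hδ1 : δ ≤ 1) : ∃ D : ℝ, 0 < D ∧ ∀ N : ℕ,
    ∑ m ∈ Icc 1 N, ArithmeticFunction.vonMangoldt m * (m : ℝ) ^ (δ - 1) ≤ D * (N : ℝ) ^ δ := by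
  set c : ℝ := Real.log 4 + 4 with hc
  have hc0 : 0 < c := by have := Real.log_pos (by norm_num : (1:ℝ) < 4); linarith
  have h2 : (1 / 2 : ℝ) ^ δ < 1 := Real.rpow_lt_one (by norm_num) (by norm_num) hδ
  set e := (1 / 2 : ℝ) ^ δ with he
  refine ⟨2 * c / (1 - e), by have : 0 < 1 - e := by linarith
                              positivity, ?_⟩
  intro N
  induction N using Nat.strong_induction_on with
  | _ N ih =>
    rcases Nat.eq_zero_or_pos N with rfl | hN
    · simp [Real.zero_rpow hδ.ne']
    have h3 := ih (N / 2) (by omega)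
    have hN0 : (0 : ℝ) < N := by exact_mod_cast hN
    have h4 : Icc 1 N = Icc 1 (N / 2) ∪ Ioc (N / 2) N := by ext m; simp; omega
    have hdj : Disjoint (Icc 1 (N / 2)) (Ioc (N / 2) N) := by
      rw [Finset.disjoint_left]; intro m; simp; omega
    rw [h4, Finset.sum_union hdj]
    have h5 : ∑ m ∈ Ioc (N / 2) N, ArithmeticFunction.vonMangoldt m * (m : ℝ) ^ (δ - 1) ≤ 2 * c * (N : ℝ) ^ δ := by
      have h6 : ∀ m ∈ Ioc (N / 2) N, ArithmeticFunction.vonMangoldt m * (m : ℝ) ^ (δ - 1) ≤ ArithmeticFunction.vonMangoldt m * ((N : ℝ) / 2) ^ (δ - 1) := by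
        intro m hm
        rw [Finset.mem_Ioc] at hm
        refine mul_le_mul_of_nonneg_left ?_ ArithmeticFunction.vonMangoldt_nonneg
        refine Real.rpow_le_rpow_of_nonpos (by positivity) ?_ (by linarith)
        have : N ≤ 2 * m := by omega
        have : (N : ℝ) ≤ 2 * m := by exact_mod_cast this
        linarith
      refine (Finset.sum_le_sum h6).trans ?_
      rw [← Finset.sum_mul]
      have h7 : ∑ m ∈ Ioc (N / 2) N, ArithmeticFunction.vonMangoldt m ≤ c * N := by
        refine le_trans ?_ (Chebyshev.psi_le_const_mul_self (Nat.cast_nonneg N))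
        unfold Chebyshev.psi
        rw [Nat.floor_natCast]
        exact Finset.sum_le_sum_of_subset_of_nonneg (Finset.Ioc_subset_Ioc_left (Nat.zero_le _)) (fun _ _ _ => ArithmeticFunction.vonMangoldt_nonneg)
      have h8 : ((N : ℝ) / 2) ^ (δ - 1) ≤ 2 * (N : ℝ) ^ (δ - 1) := by
        rw [div_eq_mul_inv, Real.mul_rpow hN0.le (by norm_num), mul_comm]
        refine mul_le_mul_of_nonneg_right ?_ (by positivity)
        rw [Real.inv_rpow (by norm_num), ← Real.rpow_neg (by norm_num)]
        calc (2 : ℝ) ^ (-(δ - 1)) ≤ 2 ^ (1 : ℝ) := Real.rpow_le_rpow_of_exponent_le (by norm_num) (by linarith)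
          _ = 2 := Real.rpow_one 2
      have h9 : (N : ℝ) ^ (δ - 1) * N = (N : ℝ) ^ δ := by
        rw [Real.rpow_sub_one hN0.ne']; field_simp
      calc _ ≤ (c * N) * (2 * (N : ℝ) ^ (δ - 1)) := mul_le_mul h7 h8 (by positivity) (by positivity)
        _ = 2 * c * ((N : ℝ) ^ (δ - 1) * N) := by ring
        _ = _ := by rw [h9]
    have h10 : ((N / 2 : ℕ) : ℝ) ^ δ ≤ e * (N : ℝ) ^ δ := by
      rw [he, ← Real.mul_rpow (by norm_num) hN0.le]
      refine Real.rpow_le_rpow (Nat.cast_nonneg _) ?_ hδ.le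
      have := @Nat.cast_div_le ℝ _ _ _ N 2
      push_cast at this; linarith
    have hee : 0 < 1 - e := by linarith
    calc _ ≤ 2 * c / (1 - e) * (e * (N : ℝ) ^ δ) + 2 * c * (N : ℝ) ^ δ :=
          add_le_add (h3.trans (mul_le_mul_of_nonneg_left h10 (by positivity))) h5
      _ = _ := by field_simp; ring

/-- the Mertens sum for `K` -/
def GK (y : ℝ) : ℝ := ∑ x ∈ PPK K y, Real.log (Ideal.absNorm x.1) / (Ideal.absNorm x.1 : ℝ) ^ x.2

variable {K} in
lemma PPK_props {y : ℝ} : ∀ x ∈ PPK K y, x.1.IsPrime ∧ x.1 ≠ ⊥ ∧ 1 ≤ x.2 := by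
  intro x hx
  rw [mem_PPK] at hx
  exact ⟨hx.1, hx.2.1, hx.2.2.1⟩

lemma err_sum : ∃ D : ℝ, 0 < D ∧ ∀ t : ℝ, 1 ≤ t →
    ∑ x ∈ PPK K (t ^ Module.finrank ℚ K), Real.log (Ideal.absNorm x.1) * (t / rho (x.1 ^ x.2)) ^ (Module.finrank ℚ K - 1) ≤ D * t ^ Module.finrank ℚ K := by
  set n := Module.finrank ℚ K with hn
  have hn0 : 0 < n := fr_pos K
  have hnR : (1 : ℝ) ≤ n := by exact_mod_cast hn0
  obtain ⟨D, hD, HD⟩ := cheb_weight (1 / (n : ℝ)) (by positivity) (by rw [div_le_iff₀ (by linarith)]; linarith)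
  refine ⟨(n : ℝ) ^ 2 * D, by positivity, fun t ht => ?_⟩
  have h1 : ∀ x ∈ PPK K (t ^ n), Real.log (Ideal.absNorm x.1) * (t / rho (x.1 ^ x.2)) ^ (n - 1) =
      Real.log (Ideal.absNorm x.1) * (fun m : ℕ => t ^ (n - 1) * (m : ℝ) ^ (1 / (n : ℝ) - 1)) (Ideal.absNorm x.1 ^ x.2) := by
    intro x hx
    congr 1
    obtain ⟨h2, h3, h4⟩ := PPK_props x hx
    have h5 := two_le_aN h2 h3
    have h6 : (0 : ℝ) < (Ideal.absNorm x.1 : ℝ) ^ x.2 := by positivity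
    simp only [rho, map_pow, Nat.cast_pow, ← hn]
    rw [div_pow, div_eq_mul_inv]
    congr 1
    rw [← Real.rpow_natCast (((Ideal.absNorm x.1 : ℝ) ^ x.2) ^ (1 / (n : ℝ))) (n - 1), ← Real.rpow_mul h6.le, ← Real.rpow_neg h6.le]
    congr 1
    rw [Nat.cast_sub hn0]
    push_cast
    field_simp
    ring
  rw [Finset.sum_congr rfl h1]
  refine (transfer (PPK K (t ^ n)) PPK_props (fun m : ℕ => t ^ (n - 1) * (m : ℝ) ^ (1 / (n : ℝ) - 1)) (fun m => by positivity)).trans ?_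
  rw [mul_assoc]
  refine mul_le_mul_of_nonneg_left ?_ (by positivity)
  have h2 : (PPK K (t ^ n)).image (fun x => Ideal.absNorm x.1 ^ x.2) ⊆ Icc 1 ⌊t ^ n⌋₊ := by
    intro m hm
    obtain ⟨x, hx, rfl⟩ := Finset.mem_image.mp hm
    rw [mem_PPK] at hx
    have h5 := two_le_aN hx.1 hx.2.1
    rw [Finset.mem_Icc]
    exact ⟨Nat.one_le_pow _ _ (by omega), Nat.le_floor (by exact_mod_cast hx.2.2.2)⟩
  refine (Finset.sum_le_sum_of_subset_of_nonneg h2 (fun m _ _ => mul_nonneg ArithmeticFunction.vonMangoldt_nonneg (by positivity))).trans ?_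
  have h3 : ∀ m : ℕ, ArithmeticFunction.vonMangoldt m * (t ^ (n - 1) * (m : ℝ) ^ (1 / (n : ℝ) - 1)) = t ^ (n - 1) * (ArithmeticFunction.vonMangoldt m * (m : ℝ) ^ (1 / (n : ℝ) - 1)) := fun m => by ring
  simp only [h3]
  rw [← Finset.mul_sum]
  have h4 := HD ⌊t ^ n⌋₊
  have h5 : ((⌊t ^ n⌋₊ : ℕ) : ℝ) ^ (1 / (n : ℝ)) ≤ t := by
    calc ((⌊t ^ n⌋₊ : ℕ) : ℝ) ^ (1 / (n : ℝ)) ≤ (t ^ n) ^ (1 / (n : ℝ)) :=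
          Real.rpow_le_rpow (Nat.cast_nonneg _) (Nat.floor_le (by positivity)) (by positivity)
      _ = t := by rw [one_div]; exact Real.pow_rpow_inv_natCast (by linarith) hn0.ne'
  calc _ ≤ t ^ (n - 1) * (D * t) := by
        refine mul_le_mul_of_nonneg_left (h4.trans ?_) (by positivity)
        exact mul_le_mul_of_nonneg_left h5 hD.le
    _ = D * (t ^ (n - 1) * t) := by ring
    _ = D * t ^ n := by rw [← pow_succ, Nat.sub_add_cancel hn0]

lemma mertens_t : ∃ C : ℝ, 0 < C ∧ ∀ t : ℝ, 1 ≤ t → |GK K (t ^ Module.finrank ℚ K) - Module.finrank ℚ K * Real.log t| ≤ C := by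
  set n := Module.finrank ℚ K with hn
  have hn0 : 0 < n := fr_pos K
  obtain ⟨C1, hC1, H1⟩ := SS_est K
  obtain ⟨C2, hC2, H2⟩ := log_lower K
  obtain ⟨c, hc, C3, hC3, H3⟩ := SS_top K
  obtain ⟨D, hD, HD⟩ := err_sum K
  rw [← hn] at H1 H2 H3 HD
  refine ⟨(C2 + n + (1 + C1) * D) / c, by positivity, fun t ht => ?_⟩
  obtain ⟨h3, h3'⟩ := H3 t ht
  set S := SS t (⊤ : Ideal (𝓞 K)) 0 with hS
  have htn : 1 ≤ t ^ n := one_le_pow₀ ht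
  have hS0 : 0 < S := lt_of_lt_of_le (by positivity) h3
  have h2 := H2 t ht
  rw [log_swap K t ht, ← hn] at h2
  have h4 : ∑ a ∈ (FF K t).erase 0, wt t a = S - 1 := by
    rw [hS, SS_zero t (by linarith)]; simp
  rw [h4] at h2
  have h5 : |∑ x ∈ PPK K (t ^ n), Real.log (Ideal.absNorm x.1) * (SS t (x.1 ^ x.2) 0 - 1) - S * GK K (t ^ n)| ≤ (1 + C1) * D * t ^ n := by
    unfold GK
    rw [Finset.mul_sum, ← Finset.sum_sub_distrib]
    refine (Finset.abs_sum_le_sum_abs _ _).trans ?_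
    rw [mul_assoc]
    refine le_trans ?_ (mul_le_mul_of_nonneg_left (HD t ht) (by positivity))
    rw [Finset.mul_sum]
    refine Finset.sum_le_sum fun x hx => ?_
    rw [mem_PPK] at hx
    obtain ⟨hx1, hx2, hx3, hx4⟩ := hx
    have hne : x.1 ^ x.2 ≠ ⊥ := pow_ne_zero _ hx2
    have hrho : rho (x.1 ^ x.2) ≤ t := by
      have h6 := rho_pow (x.1 ^ x.2)
      rw [← hn] at h6
      refine le_of_pow_le_pow_left₀ hn0.ne' (by linarith) ?_
      rw [h6, map_pow]; push_cast; exact hx4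
    have h7 := H1 _ hne t hrho
    have h8 : 1 ≤ (t / rho (x.1 ^ x.2)) ^ (n - 1) := by
      refine one_le_pow₀ ?_
      rw [le_div_iff₀ (by have := rho_one_le hne; linarith)]; linarith
    set E := (t / rho (x.1 ^ x.2)) ^ (n - 1) with hE
    have hl : 0 ≤ Real.log (Ideal.absNorm x.1) := Real.log_natCast_nonneg _
    have e : Real.log (Ideal.absNorm x.1) * (SS t (x.1 ^ x.2) 0 - 1) - S * (Real.log (Ideal.absNorm x.1) / (Ideal.absNorm x.1 : ℝ) ^ x.2) =
        Real.log (Ideal.absNorm x.1) * ((SS t (x.1 ^ x.2) 0 - S / (Ideal.absNorm (x.1 ^ x.2) : ℕ)) - 1) := by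
      rw [map_pow]; push_cast; ring
    rw [e, abs_mul, abs_of_nonneg hl]
    calc _ ≤ Real.log (Ideal.absNorm x.1) * (C1 * E + 1) := by
          refine mul_le_mul_of_nonneg_left ((abs_sub _ _).trans ?_) hl
          rw [abs_one]; linarith
      _ ≤ Real.log (Ideal.absNorm x.1) * ((1 + C1) * E) := by
          refine mul_le_mul_of_nonneg_left ?_ hl
          linarith
      _ = _ := by ring
  have h6 : (n : ℝ) * Real.log t ≤ n * t ^ n := by
    refine mul_le_mul_of_nonneg_left ?_ (Nat.cast_nonneg _)
    have := Real.log_le_sub_one_of_pos (by linarith : 0 < t)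
    have : t ≤ t ^ n := le_self_pow₀ ht hn0.ne'
    linarith
  have h7 : 0 ≤ (n : ℝ) * Real.log t := mul_nonneg (Nat.cast_nonneg _) (Real.log_nonneg ht)
  have h8 : S * |GK K (t ^ n) - n * Real.log t| ≤ (C2 + n + (1 + C1) * D) * t ^ n := by
    rw [← abs_of_pos hS0, ← abs_mul]
    rw [abs_le] at h2 h5 ⊢
    constructor <;> nlinarith
  rw [le_div_iff₀ hc]
  have h9 : c * t ^ n * |GK K (t ^ n) - n * Real.log t| ≤ (C2 + n + (1 + C1) * D) * t ^ n :=
    (mul_le_mul_of_nonneg_right h3 (abs_nonneg _)).trans h8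
  have : t ^ n * (|GK K (t ^ n) - n * Real.log t| * c) ≤ t ^ n * (C2 + n + (1 + C1) * D) := by linarith
  exact le_of_mul_le_mul_left this (by linarith)

lemma mertens_K : ∃ C : ℝ, 0 < C ∧ ∀ y : ℝ, 1 ≤ y → |GK K y - Real.log y| ≤ C := by
  obtain ⟨C, hC, H⟩ := mertens_t K
  have hn0 : 0 < Module.finrank ℚ K := fr_pos K
  refine ⟨C, hC, fun y hy => ?_⟩
  have h1 := H (y ^ ((Module.finrank ℚ K : ℝ)⁻¹)) (Real.one_le_rpow hy (by positivity))
  rw [Real.rpow_inv_natCast_pow (by linarith) hn0.ne', Real.log_rpow (by linarith)] at h1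
  have : (Module.finrank ℚ K : ℝ) ≠ 0 := by positivity
  rwa [mul_inv_cancel_left₀ this] at h1

end B5
end S18

namespace S18
section B6
open NumberField
variable (K : Type*) [Field K] [NumberField K]

variable {K} in
lemma splits_of [IsGalois ℚ K] {p : ℕ} (hp : p.Prime) (hd : ¬ (p : ℤ) ∣ discr K)
    (P : Ideal (𝓞 K)) (hN : Ideal.absNorm P = p) : SplitsCompletely K p := by
  have hpZ : Prime (p : ℤ) := Nat.prime_iff_prime_int.mp hp
  have hPpr : P.IsPrime := Ideal.isPrime_of_irreducible_absNorm (by rw [hN]; exact hp)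
  have hP0 : P ≠ ⊥ := by
    intro h; rw [h, Ideal.absNorm_bot] at hN; exact hp.ne_zero hN.symm
  set q : Ideal ℤ := Ideal.span {(p : ℤ)} with hq
  have hqpr : q.IsPrime := (Ideal.span_singleton_prime hpZ.ne_zero).mpr hpZ
  have hq0 : q ≠ ⊥ := by simpa [hq] using hp.ne_zero
  have hqm : q.IsMaximal := hqpr.isMaximal hq0
  have hover : ∀ Q : Ideal (𝓞 K), Q.IsPrime → (p : 𝓞 K) ∈ Q → Q.LiesOver q := by
    intro Q hQ hpQ
    refine ⟨hqm.eq_of_le (Ideal.IsPrime.under ℤ Q).ne_top ?_⟩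
    rw [hq, Ideal.span_singleton_le_iff_mem, Ideal.mem_under]
    simpa using hpQ
  have hpP : (p : 𝓞 K) ∈ P := by rw [← hN]; exact Ideal.absNorm_mem P
  have hPo := hover P hPpr hpP
  have hPm : P.IsMaximal := hPpr.isMaximal hP0
  have hun : Algebra.IsUnramifiedAt ℤ P := (not_dvd_discr_iff_forall_mem K (𝓞 K) hpZ).mp hd P hPpr (by simpa using hpP)
  have he : Ideal.ramificationIdxIn q (𝓞 K) = 1 := by
    rw [Ideal.ramificationIdxIn_eq_ramificationIdx q P (K ≃ₐ[ℚ] K)]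
    exact Ideal.ramificationIdx_eq_one_of_isUnramifiedAt
  have hnorm : ∀ Q : Ideal (𝓞 K), Q.IsPrime → Q ≠ ⊥ → Q.LiesOver q → Ideal.absNorm Q = p ^ Q.inertiaDeg ℤ := by
    intro Q hQ hQ0 hQo
    have hQm : Q.IsMaximal := hQ.isMaximal hQ0
    rw [← Ideal.inertiaDeg'_eq_inertiaDeg q Q]
    exact Ideal.absNorm_eq_pow_inertiaDeg' Q hp
  have hfP : P.inertiaDeg ℤ = 1 := by
    have h1 := hnorm P hPpr hP0 hPo
    rw [hN] at h1
    exact (Nat.pow_right_injective hp.two_le (by simpa using h1)).symm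
  have hf : Ideal.inertiaDegIn q (𝓞 K) = 1 := by
    rw [Ideal.inertiaDegIn_eq_inertiaDeg q P (K ≃ₐ[ℚ] K), hfP]
  have hcard := Ideal.ncard_primesOver_mul_ramificationIdxIn_mul_inertiaDegIn q (𝓞 K) (K ≃ₐ[ℚ] K)
  rw [he, hf, mul_one, mul_one, IsGaloisGroup.card_eq_finrank (K ≃ₐ[ℚ] K) ℚ K] at hcard
  have hfin : (q.primesOver (𝓞 K)).Finite := Set.finite_of_ncard_pos (by rw [hcard]; exact fr_pos K)
  have hmem : ∀ Q ∈ hfin.toFinset, Q.IsPrime ∧ Q ≠ ⊥ ∧ Ideal.absNorm Q = p ∧ (p : 𝓞 K) ∈ Q := by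
    intro Q hQ
    rw [Set.Finite.mem_toFinset] at hQ
    obtain ⟨hQ1, hQ2⟩ := hQ
    have hpQ : (p : 𝓞 K) ∈ Q := by
      have h1 : (p : ℤ) ∈ Q.under ℤ := by rw [← hQ2.over]; exact Ideal.mem_span_singleton_self _
      rw [Ideal.mem_under] at h1
      simpa using h1
    have hQ0 : Q ≠ ⊥ := by
      rintro rfl
      rw [Ideal.mem_bot] at hpQ
      exact hp.ne_zero (by exact_mod_cast hpQ)
    refine ⟨hQ1, hQ0, ?_, hpQ⟩
    rw [hnorm Q hQ1 hQ0 hQ2, ← Ideal.inertiaDegIn_eq_inertiaDeg q Q (K ≃ₐ[ℚ] K), hf, pow_one]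
  have hc : hfin.toFinset.card = Module.finrank ℚ K := by
    rw [← hcard, Set.ncard_eq_toFinset_card _ hfin]
  refine ⟨hfin.toFinset, hc, fun Q hQ => ⟨(hmem Q hQ).1, (hmem Q hQ).2.1⟩, ?_⟩
  have h1 : ∏ Q ∈ hfin.toFinset, Q ∣ Ideal.span {(p : 𝓞 K)} := by
    refine Finset.prod_primes_dvd _ (fun Q hQ => Ideal.prime_of_isPrime (hmem Q hQ).2.1 (hmem Q hQ).1) (fun Q hQ => ?_)
    rw [Ideal.dvd_iff_le, Ideal.span_singleton_le_iff_mem]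
    exact (hmem Q hQ).2.2.2
  obtain ⟨J, hJ⟩ := h1
  have h2 := congrArg Ideal.absNorm hJ
  rw [Ideal.absNorm_span_natCast, frZ, map_mul, map_prod, Finset.prod_congr rfl (fun Q hQ => (hmem Q hQ).2.2.1), Finset.prod_const, hc] at h2
  have h3 : Ideal.absNorm J = 1 := by
    have : 0 < p ^ Module.finrank ℚ K := pow_pos hp.pos _
    nlinarith
  rw [Ideal.absNorm_eq_one_iff] at h3
  rw [hJ, h3, Ideal.mul_top]

/-- the indicator function -/
def hK (n : ℕ) : ℝ := if 0 < n ∧ ∀ p : ℕ, p.Prime → p ∣ n → SplitsCompletely K p then 1 else 0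

lemma hK_CM : CM (hK K) := by
  constructor
  · simp [hK]
  · unfold hK
    rw [if_pos]
    refine ⟨one_pos, fun p hp h => ?_⟩
    exact absurd (Nat.dvd_one.mp h) hp.one_lt.ne'
  · intro m n
    unfold hK
    by_cases h1 : 0 < m ∧ ∀ p : ℕ, p.Prime → p ∣ m → SplitsCompletely K p
    · by_cases h2 : 0 < n ∧ ∀ p : ℕ, p.Prime → p ∣ n → SplitsCompletely K p
      · rw [if_pos h1, if_pos h2, if_pos, mul_one]
        refine ⟨Nat.mul_pos h1.1 h2.1, fun p hp h => ?_⟩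
        rcases hp.dvd_mul.mp h with h | h
        · exact h1.2 p hp h
        · exact h2.2 p hp h
      · rw [if_neg h2, if_neg, mul_zero]
        rintro ⟨h3, h4⟩
        exact h2 ⟨Nat.pos_of_mul_pos_left h3, fun p hp h => h4 p hp (h.mul_left m)⟩
    · rw [if_neg h1, if_neg, zero_mul]
      rintro ⟨h3, h4⟩
      exact h1 ⟨Nat.pos_of_mul_pos_right h3, fun p hp h => h4 p hp (h.mul_right n)⟩
  · intro n
    unfold hK
    split_ifs <;> simp

lemma hK_prime {p : ℕ} (hp : p.Prime) (h : SplitsCompletely K p) : hK K p = 1 := by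
  unfold hK
  rw [if_pos]
  refine ⟨hp.pos, fun q hq hqp => ?_⟩
  rw [(Nat.prime_dvd_prime_iff_eq hq hp).mp hqp]; exact h

/-- large primes that are norms of prime powers split -/
lemma hK_of_norm [IsGalois ℚ K] {m : ℕ} (hm : m.Prime) (hd : (discr K).natAbs < m)
    (x : Ideal (𝓞 K) × ℕ) (hx : Ideal.absNorm x.1 ^ x.2 = m) : hK K m = 1 := by
  refine hK_prime K hm (splits_of hm ?_ (x.1 ^ x.2) (by rw [map_pow, hx]))
  intro h
  have h1 : m ∣ (discr K).natAbs := Int.natCast_dvd.mp h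
  exact absurd (Nat.le_of_dvd (Int.natAbs_pos.mpr (discr_ne_zero K)) h1) (by omega)

end B6
end S18

namespace S18
section B7
open NumberField
variable (K : Type*) [Field K] [NumberField K]

lemma GK_diff [IsGalois ℚ K] (x y : ℝ) (hy : 1 ≤ y) (hyx : y ≤ x) (hd : ((discr K).natAbs : ℝ) ≤ y) :
    y * (GK K x - GK K y) ≤ (Module.finrank ℚ K : ℝ) ^ 2 *
      (∑ p ∈ primesUpTo x, |hK K p| * Real.log p + (Chebyshev.psi x - Chebyshev.theta x)) := by
  set A := PPK K x \ PPK K y with hA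
  have hsub : PPK K y ⊆ PPK K x := by
    intro z hz
    rw [mem_PPK] at hz ⊢
    exact ⟨hz.1, hz.2.1, hz.2.2.1, hz.2.2.2.trans hyx⟩
  have h1 : GK K x - GK K y = ∑ z ∈ A, Real.log (Ideal.absNorm z.1) / (Ideal.absNorm z.1 : ℝ) ^ z.2 := by
    unfold GK
    rw [hA, ← Finset.sum_sdiff hsub]; ring
  have hAp : ∀ z ∈ A, z.1.IsPrime ∧ z.1 ≠ ⊥ ∧ 1 ≤ z.2 := by
    intro z hz
    exact PPK_props z (Finset.mem_sdiff.mp hz).1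
  have hAy : ∀ z ∈ A, y < (Ideal.absNorm z.1 : ℝ) ^ z.2 ∧ (Ideal.absNorm z.1 : ℝ) ^ z.2 ≤ x := by
    intro z hz
    rw [hA, Finset.mem_sdiff, mem_PPK, mem_PPK] at hz
    obtain ⟨⟨h2, h3, h4, h5⟩, h6⟩ := hz
    refine ⟨?_, h5⟩
    by_contra hcon
    exact h6 ⟨h2, h3, h4, not_lt.mp hcon⟩
  have h2 : y * (GK K x - GK K y) ≤ ∑ z ∈ A, Real.log (Ideal.absNorm z.1) * (fun _ : ℕ => (1 : ℝ)) (Ideal.absNorm z.1 ^ z.2) := by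
    rw [h1, Finset.mul_sum]
    refine Finset.sum_le_sum fun z hz => ?_
    have h3 := (hAy z hz).1
    have hl : 0 ≤ Real.log (Ideal.absNorm z.1) := Real.log_natCast_nonneg _
    rw [mul_one, ← mul_div_assoc, div_le_iff₀ (by linarith), mul_comm]
    exact mul_le_mul_of_nonneg_left h3.le hl
  refine h2.trans ((transfer A hAp (fun _ : ℕ => (1 : ℝ)) (fun _ => zero_le_one)).trans ?_)
  refine mul_le_mul_of_nonneg_left ?_ (by positivity)
  simp only [mul_one]
  set I := A.image (fun z => Ideal.absNorm z.1 ^ z.2) with hI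
  rw [← Finset.sum_filter_add_sum_filter_not I Nat.Prime]
  have hIm : ∀ m ∈ I, 1 ≤ m ∧ m ≤ ⌊x⌋₊ ∧ (discr K).natAbs < m ∧ ∃ z : Ideal (𝓞 K) × ℕ, Ideal.absNorm z.1 ^ z.2 = m := by
    intro m hm
    obtain ⟨z, hz, rfl⟩ := Finset.mem_image.mp hm
    obtain ⟨h3, h4⟩ := hAy z hz
    have h5 : (discr K).natAbs < Ideal.absNorm z.1 ^ z.2 := by
      have : ((discr K).natAbs : ℝ) < (Ideal.absNorm z.1 : ℝ) ^ z.2 := by linarith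
      exact_mod_cast this
    exact ⟨by omega, Nat.le_floor (by exact_mod_cast h4), h5, z, rfl⟩
  refine add_le_add ?_ ?_
  · have h3 : ∀ m ∈ I.filter Nat.Prime, ArithmeticFunction.vonMangoldt m = |hK K m| * Real.log m := by
      intro m hm
      rw [Finset.mem_filter] at hm
      obtain ⟨_, _, h4, z, hz⟩ := hIm m hm.1
      rw [hK_of_norm K hm.2 h4 z hz, abs_one, one_mul, ArithmeticFunction.vonMangoldt_apply_prime hm.2]
    rw [Finset.sum_congr rfl h3]
    refine Finset.sum_le_sum_of_subset_of_nonneg ?_ (fun m _ _ => mul_nonneg (abs_nonneg _) (Real.log_natCast_nonneg _))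
    intro m hm
    rw [Finset.mem_filter] at hm
    obtain ⟨h4, h5, _⟩ := hIm m hm.1
    unfold primesUpTo
    rw [Finset.mem_filter, Finset.mem_Icc]
    exact ⟨⟨h4, h5⟩, hm.2⟩
  · rw [Chebyshev.psi_sub_theta_eq_sum_not_prime]
    refine Finset.sum_le_sum_of_subset_of_nonneg ?_ (fun m _ _ => ArithmeticFunction.vonMangoldt_nonneg)
    intro m hm
    rw [Finset.mem_filter] at hm ⊢
    obtain ⟨h4, h5, _⟩ := hIm m hm.1
    rw [Finset.mem_Ioc]
    exact ⟨⟨by omega, h5⟩, hm.2⟩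

lemma hK_III [IsGalois ℚ K] : ∃ α : ℝ, CondIII (hK K) α := by
  obtain ⟨C, hC, H⟩ := mertens_K K
  obtain ⟨C4, H4⟩ := Chebyshev.psi_sub_theta_le_mul_sqrt
  set n : ℝ := (Module.finrank ℚ K : ℝ) with hn
  have hn0 : 0 < n := by rw [hn]; exact_mod_cast fr_pos K
  set B := Real.exp (2 * C + 1) with hB
  have hB0 : 0 < B := Real.exp_pos _
  have hB1 : 1 ≤ B := Real.one_le_exp (by linarith)
  refine ⟨1 / (2 * B * n ^ 2), by positivity, max (B * ((discr K).natAbs + 1)) ((2 * |C4| * B * n ^ 2) ^ 2), fun x hx => ?_⟩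
  have hx1 := (le_max_left _ _).trans hx
  have hx2 := (le_max_right _ _).trans hx
  set y := x / B with hy
  have hdn : (0 : ℝ) ≤ ((discr K).natAbs : ℝ) := Nat.cast_nonneg _
  have hyd : ((discr K).natAbs : ℝ) + 1 ≤ y := by
    rw [hy, le_div_iff₀ hB0]; linarith
  have hxy : x = B * y := by rw [hy]; field_simp
  have hx0 : 1 ≤ x := by rw [hxy]; nlinarith
  have hyx : y ≤ x := by rw [hxy]; nlinarith
  have h1 := GK_diff K x y (by linarith) hyx (by linarith)
  have h2 := abs_le.mp (H x hx0)
  have h3 := abs_le.mp (H y (by linarith))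
  have h4 : Real.log x = 2 * C + 1 + Real.log y := by
    rw [hxy, Real.log_mul hB0.ne' (by linarith), hB, Real.log_exp]
  have h5 : 1 ≤ GK K x - GK K y := by linarith [h2.1, h3.2]
  have h6 := H4 x
  have h7 : C4 * √x ≤ |C4| * √x := mul_le_mul_of_nonneg_right (le_abs_self _) (Real.sqrt_nonneg _)
  have h8 : 2 * |C4| * B * n ^ 2 ≤ √x := Real.le_sqrt_of_sq_le hx2
  have h9 : √x * √x = x := Real.mul_self_sqrt (by linarith)
  set T := ∑ p ∈ primesUpTo x, |hK K p| * Real.log p with hT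
  have h10 : y ≤ n ^ 2 * (T + |C4| * √x) := by
    refine le_trans ?_ (h1.trans ?_)
    · nlinarith
    · refine mul_le_mul_of_nonneg_left ?_ (by positivity)
      linarith
  have h11 : x ≤ B * n ^ 2 * T + x / 2 := by
    have h12 : 2 * |C4| * B * n ^ 2 * √x ≤ √x * √x := mul_le_mul_of_nonneg_right h8 (Real.sqrt_nonneg _)
    have h13 : B * y ≤ B * (n ^ 2 * (T + |C4| * √x)) := mul_le_mul_of_nonneg_left h10 hB0.le
    rw [← hxy] at h13
    nlinarith
  rw [div_mul_eq_mul_div, one_mul, div_le_div_iff₀ (by positivity) (by linarith)]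
  linarith

lemma final [IsGalois ℚ K] : MemM (hK K) := by
  have hh := hK_CM K
  have hv : ∀ n, |hK K n| ≤ 1 := by
    intro n
    rcases hh.val n with h | h <;> rw [h] <;> simp
  obtain ⟨α, hα⟩ := hK_III K
  refine ⟨⟨hh.one, fun m n _ => hh.mul m n⟩, ⟨1, ?_⟩, ?_, ⟨α, hα⟩, condIV_of hh α hα⟩
  · refine ⟨le_rfl, fun p k _ _ => ?_⟩
    rw [one_pow]; exact hv _
  · intro ε hε
    refine ⟨1, one_pos, fun n hn => ?_⟩
    rw [one_mul]
    exact (hv n).trans (Real.one_le_rpow (by exact_mod_cast hn) hε.le)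

end B7
end S18

/-- For a finite Galois extension `K/ℚ`, the characteristic function of the set
of positive integers all of whose prime factors split completely in `K` belongs
to the class `𝓜`. -/
theorem stmt_18 (K : Type*) [Field K] [NumberField K] [IsGalois ℚ K] :
    MemM (fun n =>
      if 0 < n ∧ ∀ p : ℕ, p.Prime → p ∣ n → SplitsCompletely K p then 1 else 0) := by
  exact S18.final K

end
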